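/- Let d ≥ 2, Ω = (−1,1)^d, p > 1, α, β ∈ ℝ, ϰ ≥ 0, and α + β > p + ϰ. Then there exist a nonnegative weight a on Ω̄ with modulus of continuity C (log(e + ρ^{−1}))^{−ϰ} and a function u ∈ W^{1,1}(Ω) with ∇u ∈ L^p(Ω) such that u is a local minimizer of the borderline double phase functional F(w) = ∫_Ω |∇w|^p ( (log(e+|∇w|))^{−β} + a(x)(log(e+|∇w|))^{α} ) dx, and ∇u ∉ L^s(Ω) for every s > p. If moreover 1 < p < d, then there exists a closed set Σ ⊂ Ω consisting of non-Lebesgue points of u whose Hausdorff dimension equals d − p. -/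

import Mathlib

open MeasureTheory Real Set Metric Filter Topology NNReal ENNReal

noncomputable section

abbrev Euc (n : ℕ) := EuclideanSpace ℝ (Fin n)

def Box (n : ℕ) : Set (Euc n) := {x | ∀ i, |x i| < 1}

def lastC {n : ℕ} (x : Euc (n + 1)) : ℝ := x (Fin.last n)

def frontC {n : ℕ} (x : Euc (n + 1)) : Euc n := WithLp.toLp 2 fun i => x i.castSucc

def snocC {n : ℕ} (xb : Euc n) (t : ℝ) : Euc (n + 1) :=
  WithLp.toLp 2 (Fin.snoc (α := fun _ => ℝ) (WithLp.ofLp xb) t)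

def barPart {m k : ℕ} (x : Euc (m + k)) : Euc m := WithLp.toLp 2 fun i => x (Fin.castAdd k i)

def hatPart {m k : ℕ} (x : Euc (m + k)) : Euc k := WithLp.toLp 2 fun i => x (Fin.natAdd m i)

def IsCantorLengths (lam gam : ℝ) (l : ℕ → ℝ) : Prop :=
  l 0 = 1 ∧ (∀ j, 0 < l j) ∧ (∀ j, 2 * l (j + 1) < l j) ∧
    (∀ j, l (j + 1) - 2 * l (j + 2) < l j - 2 * l (j + 1)) ∧
    ∃ C : ℝ, 1 ≤ C ∧ ∀ j : ℕ, 1 ≤ j →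
      C⁻¹ * lam ^ j * (j : ℝ) ^ gam ≤ l j ∧ l j ≤ C * lam ^ j * (j : ℝ) ^ gam

def gCantorPoint (l : ℕ → ℝ) (ε : ℕ → Bool) : ℝ :=
  -(1 / 2 : ℝ) + ∑' j : ℕ, if ε j then l j - l (j + 1) else 0

def gCantorSet (l : ℕ → ℝ) : Set ℝ := Set.range (gCantorPoint l)

def gCantorSetPi (l : ℕ → ℝ) (m : ℕ) : Set (Euc m) := {x | ∀ i, x i ∈ gCantorSet l}

def binDigit (t : ℝ) (j : ℕ) : Bool := ⌊t * 2 ^ (j + 1)⌋ % 2 = 1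

def gCantorMeasure (l : ℕ → ℝ) : Measure ℝ :=
  Measure.map (fun t => gCantorPoint l (binDigit t)) (volume.restrict (Set.Ico (0 : ℝ) 1))

def gCantorMeasurePi (l : ℕ → ℝ) (m : ℕ) : Measure (Euc m) :=
  Measure.map (⇑(MeasurableEquiv.toLp 2 (Fin m → ℝ)))
    (Measure.pi fun _ : Fin m => gCantorMeasure l)

def frD (m : ℕ) (lam : ℝ) : ℝ := m * Real.log 2 / Real.log lam⁻¹

def HasWeakFDerivOn {n : ℕ} (Ω : Set (Euc n)) (u : Euc n → ℝ)
    (G : Euc n → Euc n →L[ℝ] ℝ) : Prop :=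
  ∀ φ : Euc n → ℝ, ContDiff ℝ (⊤ : ℕ∞) φ → HasCompactSupport φ → tsupport φ ⊆ Ω →
    ∫ x in Ω, u x • fderiv ℝ φ x = -∫ x in Ω, φ x • G x

def W11On {n : ℕ} (Ω : Set (Euc n)) (u : Euc n → ℝ) (G : Euc n → Euc n →L[ℝ] ℝ) : Prop :=
  IntegrableOn u Ω ∧ IntegrableOn G Ω ∧ HasWeakFDerivOn Ω u G

def ZeroBoundary {n : ℕ} (Ω : Set (Euc n)) (w : Euc n → ℝ)
    (G : Euc n → Euc n →L[ℝ] ℝ) : Prop :=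
  Integrable (Set.indicator Ω w) ∧ Integrable (Set.indicator Ω G) ∧
    HasWeakFDerivOn Set.univ (Set.indicator Ω w) (Set.indicator Ω G)

def energyOf {n : ℕ} (Ω : Set (Euc n)) (φ : Euc n → ℝ → ℝ) (g : Euc n → ℝ) : ℝ≥0∞ :=
  ∫⁻ x in Ω, ENNReal.ofReal (φ x (g x))

def conjOrlicz (φ : ℝ → ℝ) (s : ℝ) : ℝ≥0∞ :=
  ⨆ t : ℝ≥0, ENNReal.ofReal (s * t - φ t)

def energyConj {n : ℕ} (Ω : Set (Euc n)) (φ : Euc n → ℝ → ℝ) (g : Euc n → ℝ) : ℝ≥0∞ :=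
  ∫⁻ x in Ω, conjOrlicz (φ x) (g x)

def IsLocalMinimizer {n : ℕ} (Ω : Set (Euc n)) (φ : Euc n → ℝ → ℝ) (u : Euc n → ℝ)
    (G : Euc n → Euc n →L[ℝ] ℝ) : Prop :=
  W11On Ω u G ∧ energyOf Ω φ (fun x => ‖G x‖) < ⊤ ∧
    ∀ v Gv, W11On Ω v Gv →
      (∃ K : Set (Euc n), IsCompact K ∧ K ⊆ Ω ∧ ∀ᵐ x ∂(volume.restrict Ω), x ∉ K → v x = u x) →
      energyOf Ω φ (fun x => ‖G x‖) ≤ energyOf Ω φ (fun x => ‖Gv x‖)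

def IsNonLebesguePoint {n : ℕ} (u : Euc n → ℝ) (x : Euc n) : Prop :=
  ¬ ∃ c : ℝ, Tendsto (fun r : ℝ => ⨍ y in Metric.ball x r, |u y - c| ∂volume)
      (𝓝[>] (0 : ℝ)) (𝓝 0)

def InHolderCls {n : ℕ} (α : ℝ) (s : Set (Euc n)) (a : Euc n → ℝ) : Prop :=
  ContDiffOn ℝ (⌊α⌋₊ : ℕ) a s ∧
    ∃ C : ℝ≥0, HolderOnWith C (Real.toNNReal (α - ⌊α⌋₊))
      (fun x => iteratedFDerivWithin ℝ ⌊α⌋₊ a s x) s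

def rieszBow {n : ℕ} (f : Euc (n + 1) → ℝ) (xb : Euc n) : ℝ≥0∞ :=
  ∫⁻ y : Euc (n + 1),
    ENNReal.ofReal ((if dist (frontC y) xb ≤ |lastC y| / 2 then (1 : ℝ) else 0) *
      |f y| * Real.sqrt (dist (frontC y) xb ^ 2 + lastC y ^ 2) ^ (-(n : ℝ)))

def avgPlus {n : ℕ} (ω : Euc (n + 1) → ℝ) (f : Euc (n + 1) → ℝ) (xb : Euc n) (r : ℝ) : ℝ :=
  ∫ y in Metric.ball (0 : Euc (n + 1)) 1,
    ω y * f (snocC (xb + |r| • frontC y) (|r| * lastC y + |r|))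

def avgMinus {n : ℕ} (ω : Euc (n + 1) → ℝ) (f : Euc (n + 1) → ℝ) (xb : Euc n) (r : ℝ) : ℝ :=
  ∫ y in Metric.ball (0 : Euc (n + 1)) 1,
    ω y * f (snocC (xb + |r| • frontC y) (|r| * lastC y - |r|))

open Classical in
def uD {n : ℕ} (θ : ℝ → ℝ) (x : Euc (n + 1)) : ℝ :=
  if frontC x = 0 then (1 / 2) * Real.sign (lastC x)
  else (1 / 2) * Real.sign (lastC x) * θ (|lastC x| / ‖frontC x‖)

def IsProfile (θ : ℝ → ℝ) : Prop :=
  ContDiffOn ℝ (⊤ : ℕ∞) θ (Set.Ioi 0) ∧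
    (∀ t : ℝ, 0 < t → (if 1 / 2 < t then (1 : ℝ) else 0) ≤ θ t) ∧
    (∀ t : ℝ, 0 < t → θ t ≤ if 1 / 4 < t then 1 else 0) ∧
    (∀ t : ℝ, 0 < t → |deriv θ t| ≤ 6)

end
namespace BDP
noncomputable section
notation "bL" => (by linarith)
notation "bP" => (by positivity)
notation "bN" => (by norm_num)
notation "bS" => (by simp)
notation "bO" => (by omega)
notation:max "rS" x:max => (x + 1 : ℝ)
notation:max "sc" x:max => (x + 1)
notation:max "pd" x:max => (x - 1)
notation:max "cm" x:max => (1 - x)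
notation "hlf" => (1 / 2)
notation:max "BX" x:max => Box (x + 2)
notation:max "VX" x:max => volume.restrict (Box (x + 2))
notation:max "nI" x:max => (1 + 1 / x : ℝ)
notation "oR" => ENNReal.ofReal
notation "lgg" => Real.log
notation "tI" => (⊤ : ℕ∞)
notation "fD" => fderiv ℝ
notation "esg" => EuclideanSpace.single
notation "rz" => (0 : ℝ)
notation "ro" => (1 : ℝ)
set_option hygiene false
section
variable (H Hier rr tt x j p α β s t T0 Q Par γ μ ν bs A c0 m i τ n Lκ : ℕ)
notation "HR" => Hier.R H
notation "Hi" => Hier.i H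
notation "Hmm" => Hier.mm H
notation "HEE" => Hier.EE H
notation "Hc" => Hier.c H
notation "Hy" => Hier.y H
notation "HP" => Hier.P H
notation "HG" => Hier.G H
notation "Hσ" => Hier.σ H
notation "HN" => Hier.N H
notation "Hss" => Hier.ss H
notation "Hu" => Hier.u H
notation "Hcell" => Hier.cell H
notation "Hε" => Hier.ε H
notation "Hcs" => Hier.cs H
notation "Hm0" => Hier.m0 H
notation "HV" => Hier.V H
notation "HgL" => Hier.gL H
notation "HSg" => Hier.Sg H
notation "HD" => Hier.D H
notation "HuL" => Hier.uL H
notation "HσL" => Hier.σL H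
notation "Hgl" => Hier.gl H
notation "Hgu" => Hier.gu H
notation "Hsu" => Hier.su H
notation "Haw" => Hier.aw H
notation "Hs0" => Hier.s0 H
notation "Hsl" => Hier.sl H
notation "rX" => (rr x)
notation "tX" => (tt x)
notation "Hij" => (Hi j)
notation "PA" => Par H p γ μ ν bs A c0
notation "GD" => Hier.Good H p α β T0 Q
notation "mP" => ((m : ℝ) + 2 - p)
notation "ij1" => ((1 - (i j).τ) / (i j).b)
notation "sL" => (1 + s * (cm t / τ) ^ n / Lκ τ n)
notation "jR" => (((j + 1 : ℕ) + 1 : ℝ) / sc j)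
notation "awx" => (Haw p α β x)
end
alias coe_toNNReal := Real.coe_toNNReal
alias dist_eq := Real.dist_eq
alias div_rpow := Real.div_rpow
alias exp_log := Real.exp_log
alias inv_rpow := Real.inv_rpow
alias log_inv := Real.log_inv
alias log_le_log := Real.log_le_log
alias log_one := Real.log_one
alias log_pow := Real.log_pow
alias log_rpow := Real.log_rpow
alias mul_rpow := Real.mul_rpow
alias one_le_rpow := Real.one_le_rpow
alias one_rpow := Real.one_rpow
alias rpow_add := Real.rpow_add
alias rpow_add_one := Real.rpow_add_one
alias rpow_le_one := Real.rpow_le_one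
alias rpow_le_one_of_one_le_of_nonpos := Real.rpow_le_one_of_one_le_of_nonpos
alias rpow_le_rpow := Real.rpow_le_rpow
alias rpow_le_rpow_of_exponent_ge := Real.rpow_le_rpow_of_exponent_ge
alias rpow_le_rpow_of_exponent_le := Real.rpow_le_rpow_of_exponent_le
alias rpow_le_rpow_of_nonpos := Real.rpow_le_rpow_of_nonpos
alias rpow_mul := Real.rpow_mul
alias rpow_natCast := Real.rpow_natCast
alias rpow_neg := Real.rpow_neg
alias rpow_one := Real.rpow_one
alias rpow_sub_one := Real.rpow_sub_one
alias rpow_two := Real.rpow_two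
alias rpow_zero := Real.rpow_zero
alias sq_sqrt := Real.sq_sqrt
alias sqrt_pos := Real.sqrt_pos
alias sqrt_sq := Real.sqrt_sq
alias toNNReal_pos := Real.toNNReal_pos
alias zero_rpow := Real.zero_rpow
def D2 (F : ℝ → ℝ → ℝ) (s t a b : ℝ) : Prop :=
  HasFDerivAt (fun z : ℝ × ℝ ↦ F z.1 z.2)
    (a • ContinuousLinearMap.fst ℝ ℝ ℝ + b • ContinuousLinearMap.snd ℝ ℝ ℝ) (s, t)
theorem D2.comp {V : Type*} [NormedAddCommGroup V] [NormedSpace ℝ V] {F : ℝ → ℝ → ℝ}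
    {S T : V → ℝ} {S' T' : V →L[ℝ] ℝ} {x : V} {a b : ℝ} (h : D2 F (S x) (T x) a b)
    (hS : HasFDerivAt S S' x) (hT : HasFDerivAt T T' x) :
    HasFDerivAt (fun y ↦ F (S y) (T y)) (a • S' + b • T') x := by
  have h2 : HasFDerivAt (fun z : ℝ × ℝ ↦ F z.1 z.2)
    (a • ContinuousLinearMap.fst ℝ ℝ ℝ + b • ContinuousLinearMap.snd ℝ ℝ ℝ) (S x, T x) := h
  have := HasFDerivAt.comp x h2 (hS.prodMk hT)
  refine this.congr_fderiv ?_
  ext v; simp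
theorem D2.congr {F : ℝ → ℝ → ℝ} {s t a b a' b' : ℝ} (h : D2 F s t a b) (ha : a = a') (hb : b = b') :
    D2 F s t a' b' := by subst ha hb; exact h
theorem glue {V : Type*} [NormedAddCommGroup V] [NormedSpace ℝ V] {F f g : V → ℝ} {L : V →L[ℝ] ℝ}
    {x : V} (hf : HasFDerivAt f L x) (hg : HasFDerivAt g L x) (h1 : F x = f x) (h2 : F x = g x)
    (h : ∀ᶠ y in 𝓝 x, F y = f y ∨ F y = g y) : HasFDerivAt F L x := by
  rw [hasFDerivAt_iff_isLittleO, Asymptotics.isLittleO_iff] at *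
  intro c hc
  filter_upwards [hf hc, hg hc, h] with y a1 a2 a3
  rcases a3 with a3 | a3
  · rw [a3, h1]; exact a1
  · rw [a3, h2]; exact a2
theorem D2.glue {F f g : ℝ → ℝ → ℝ} {s t a b : ℝ} (hf : D2 f s t a b) (hg : D2 g s t a b)
    (h1 : F s t = f s t) (h2 : F s t = g s t)
    (h : ∀ᶠ y : ℝ × ℝ in 𝓝 (s, t), F y.1 y.2 = f y.1 y.2 ∨ F y.1 y.2 = g y.1 y.2) : D2 F s t a b :=
  BDP.glue (F := fun z : ℝ × ℝ ↦ F z.1 z.2) hf hg h1 h2 h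
theorem D2.fst (s t : ℝ) : D2 (fun s _ ↦ s) s t 1 0 := by
  refine (hasFDerivAt_fst (𝕜 := ℝ) (p := (s, t))).congr_fderiv ?_
  ext <;> simp
theorem D2.snd (s t : ℝ) : D2 (fun _ t ↦ t) s t 0 1 := by
  refine (hasFDerivAt_snd (𝕜 := ℝ) (p := (s, t))).congr_fderiv ?_
  ext <;> simp
theorem D2.const (k s t : ℝ) : D2 (fun _ _ ↦ k) s t 0 0 := by
  refine (hasFDerivAt_const (𝕜 := ℝ) k (s, t)).congr_fderiv ?_
  ext <;> simp
theorem D2.add {f g : ℝ → ℝ → ℝ} {s t a b a' b' : ℝ} (hf : D2 f s t a b) (hg : D2 g s t a' b') :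
    D2 (fun s t ↦ f s t + g s t) s t (a + a') (b + b') := by
  refine (HasFDerivAt.fun_add hf hg).congr_fderiv ?_
  ext <;> simp
theorem D2.mul {f g : ℝ → ℝ → ℝ} {s t a b a' b' : ℝ} (hf : D2 f s t a b) (hg : D2 g s t a' b') :
    D2 (fun s t ↦ f s t * g s t) s t (a * g s t + f s t * a') (b * g s t + f s t * b') := by
  refine (HasFDerivAt.fun_mul hf hg).congr_fderiv ?_
  ext <;> simp <;> ring
theorem D2.scomp {f : ℝ → ℝ → ℝ} {φ : ℝ → ℝ} {s t a b φ' : ℝ} (hf : D2 f s t a b)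
    (hφ : HasDerivAt φ φ' (f s t)) : D2 (fun s t ↦ φ (f s t)) s t (φ' * a) (φ' * b) := by
  refine (HasDerivAt.comp_hasFDerivAt (s, t) (h₂ := φ) (f := fun z : ℝ × ℝ ↦ f z.1 z.2) hφ hf).congr_fderiv ?_
  ext <;> simp
theorem D2.ofFun {F G : ℝ → ℝ → ℝ} {s t a b : ℝ} (h : D2 F s t a b)
    (he : ∀ᶠ y : ℝ × ℝ in 𝓝 (s, t), G y.1 y.2 = F y.1 y.2) : D2 G s t a b :=
  HasFDerivAt.congr_of_eventuallyEq h he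
def PN (s c : ℝ) : ℝ := 4 * c + s * (1 - c ^ 2)
def PD (c : ℝ) : ℝ := 1 - c ^ 2
def PR (s c : ℝ) : ℝ := √(4 * PD c ^ 2 + PN s c ^ 2)
def Pf (s c : ℝ) : ℝ := PN s c / (2 * PD c + PR s c)
def cl (c : ℝ) : ℝ := max (-1) (min 1 c)
def Pd (s c : ℝ) : ℝ := if |c| ≤ 1 then Pf s c - c else 0
def PX (c : ℝ) : ℝ := PD (cl c) ^ 2 / (4 * (1 + cl c ^ 2))
def PJ (s c : ℝ) : ℝ := 8 * (1 + cl c ^ 2) / (PR s (cl c) * (2 * PD (cl c) + PR s (cl c)))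
theorem PR_pos' (s c : ℝ) : 0 < 4 * PD c ^ 2 + PN s c ^ 2 := by
  unfold PD PN
  by_cases h : 1 - c ^ 2 = 0
  · rw [h]; nlinarith
  · have := sq_pos_of_ne_zero h
    nlinarith [sq_nonneg (4 * c + s * (1 - c ^ 2))]
theorem PR_pos (s c : ℝ) : 0 < PR s c := sqrt_pos.2 (PR_pos' s c)
theorem PR_sq (s c : ℝ) : PR s c ^ 2 = 4 * PD c ^ 2 + PN s c ^ 2 :=
  sq_sqrt (PR_pos' s c).le
theorem Pf_D2 (s c : ℝ) (h : 0 < 2 * PD c + PR s c) :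
    D2 Pf s c (2 * PD c ^ 2 / (PR s c * (2 * PD c + PR s c)))
      (8 * (1 + c ^ 2) / (PR s c * (2 * PD c + PR s c))) := by
  have h1 := PR_pos s c
  have h2 := PR_sq s c
  have hD : D2 (fun _ c ↦ PD c) s c 0 (-2 * c) :=
    ((D2.snd s c).scomp (((hasDerivAt_pow 2 c).const_sub 1))).congr bS bS
  have hN : D2 PN s c (PD c) (4 + s * (-2 * c)) :=
    (((D2.const 4 s c).mul (D2.snd s c)).add ((D2.fst s c).mul hD)).congr bS bS
  have hR : D2 PR s c (PN s c * PD c / PR s c)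
      ((4 * PD c * (-2 * c) + PN s c * (4 + s * (-2 * c))) / PR s c) :=
    ((((D2.const 4 s c).mul (hD.scomp (hasDerivAt_pow 2 _))).add
      (hN.scomp (hasDerivAt_pow 2 _))).scomp (hasDerivAt_sqrt (PR_pos' s c).ne')).congr
      (by
        change 1 / (2 * PR s c) * _ = _
        norm_num; field_simp) (by
        change 1 / (2 * PR s c) * _ = _
        norm_num; field_simp)
  have hq := hN.mul ((((D2.const 2 s c).mul hD).add hR).scomp (hasDerivAt_inv h.ne'))
  refine D2.congr (F := Pf) hq ?_ ?_
  · set K := 2 * PD c + PR s c with hK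
    field_simp
    rw [hK]
    linear_combination PD c * h2
  · have e : PN s c = 4 * c + s * PD c := rfl
    have e2 : PD c = 1 - c ^ 2 := rfl
    set K := 2 * PD c + PR s c with hK
    field_simp
    rw [hK]
    linear_combination (4 - 2 * s * c) * h2 + (8 * c * PD c + 4 * c * PR s c) * e + (16 * PD c + 8 * PR s c) * e2
theorem Pden_pos (s c : ℝ) (h : |c| ≤ 1) : 0 < 2 * PD c + PR s c := by
  have : c ^ 2 ≤ 1 := by rw [← sq_abs]; nlinarith [abs_nonneg c]
  have := PR_pos s c
  unfold PD; linarith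
theorem cl_eq {c : ℝ} (h : |c| ≤ 1) : cl c = c := by
  rw [abs_le] at h; simp [cl, h.1, h.2]
theorem cl_abs (c : ℝ) : |cl c| ≤ 1 := by
  unfold cl; rw [abs_le]; constructor
  · exact le_max_left _ _
  · exact max_le bN (min_le_left _ _)
theorem PJ_end (s c : ℝ) (h : 1 ≤ |c|) : PJ s c = 1 ∧ PX c = 0 := by
  have : cl c = 1 ∨ cl c = -1 := by
    rcases le_abs.1 h with h | h
    · left; simp [cl, h]
    · right; simp only [cl]; rw [min_eq_right bL, max_eq_left bL]
  have h4 : √(16 : ℝ) = 4 := by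
    rw [show (16 : ℝ) = 4 ^ 2 by norm_num]; exact sqrt_sq bN
  rcases this with h | h <;> simp [PJ, PX, h, PD, PR, PN] <;> norm_num [h4]
theorem Pf_id (s c : ℝ) (h : |c| = 1) : Pf s c = c := by
  have h1 : c ^ 2 = 1 := by rw [← sq_abs, h]; norm_num
  have h4 : √(16 : ℝ) = 4 := by
    rw [show (16 : ℝ) = 4 ^ 2 by norm_num]; exact sqrt_sq bN
  have : (4 * c) ^ 2 = 16 := by nlinarith
  simp [Pf, PN, PD, PR, h1, this, h4]
theorem Pd_D2 (s c : ℝ) : D2 Pd s c (PX c * PJ s c) (PJ s c - 1) := by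
  have key : |c| ≤ 1 → D2 (fun s c ↦ Pf s c + (-1) * c) s c (PX c * PJ s c) (PJ s c - 1) := by
    intro h
    refine ((Pf_D2 s c (Pden_pos s c h)).add ((D2.const (-1) s c).mul (D2.snd s c))).congr ?_ ?_
    · have := Pden_pos s c h
      have := PR_pos s c
      simp only [PX, PJ, cl_eq h]; field_simp; ring
    · simp only [PJ, cl_eq h]; ring
  have ca : Continuous fun y : ℝ × ℝ ↦ |y.2| := continuous_snd.abs
  rcases lt_trichotomy |c| 1 with h | h | h
  · refine (key h.le).ofFun ?_
    filter_upwards [ca.continuousAt.eventually_lt continuousAt_const h] with y hy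
    simp [Pd, hy.le]; ring
  · refine D2.glue (key h.le) (g := fun _ _ ↦ 0) ((D2.const 0 s c).congr ?_ ?_) ?_ ?_ ?_
    · simp [PJ_end s c h.ge]
    · simp [PJ_end s c h.ge]
    · simp [Pd, h.le]; ring
    · simp [Pd, h.le, Pf_id s c h]
    · refine .of_forall fun y ↦ ?_
      by_cases hy : |y.2| ≤ 1
      · left; simp [Pd, hy]; ring
      · right; simp [Pd, hy]
  · refine ((D2.const 0 s c).congr ?_ ?_).ofFun ?_
    · simp [PJ_end s c h.le]
    · simp [PJ_end s c h.le]
    filter_upwards [continuousAt_const.eventually_lt ca.continuousAt h] with y hy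
    simp [Pd, hy]
def Lz (τ t : ℝ) : ℝ := max 0 (min 1 (cm t / τ))
def Lκ (τ : ℝ) (n : ℕ) : ℝ := τ / (cm τ * n)
def LX (τ : ℝ) (n : ℕ) (t : ℝ) : ℝ := min t cm τ * Lz τ t ^ sc n
def L1 (s t : ℝ) : ℝ := t * exp s
def L2 (τ : ℝ) (n : ℕ) (s t : ℝ) : ℝ :=
  1 - τ * (1 + (s + lgg (t / cm τ)) / Lκ τ n) ^ (-(1 / n : ℝ))
def L3 (τ : ℝ) (n : ℕ) (s t : ℝ) : ℝ :=
  1 - τ * (cm t / τ * sL ^ (-(1 / n : ℝ)))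
def Lf (τ : ℝ) (n : ℕ) (s t : ℝ) : ℝ :=
  if 1 ≤ t then t else if 1 - τ ≤ t then L3 τ n s t else
    if t * exp s ≤ 1 - τ then t * exp s else L2 τ n s t
def Lmm (τ b s t : ℝ) : ℝ := min s (lgg (cm τ / max b (min t cm τ)))
def LJ (τ b : ℝ) (n : ℕ) (s t : ℝ) : ℝ :=
  exp (Lmm τ b s t) * (1 + Lz τ t ^ n * (s - Lmm τ b s t) / Lκ τ n) ^ (-nI n)
structure LH (τ b : ℝ) (n : ℕ) : Prop where
  τ0 : 0 < τ
  τ1 : τ ≤ 1 / 2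
  b0 : 0 < b
  b1 : b ≤ 1 - τ
  n0 : 1 ≤ n
theorem LH.κ0 {τ b : ℝ} {n : ℕ} (h : LH τ b n) : 0 < Lκ τ n := by
  have := h.τ0; have := h.τ1
  have : rz < n := by exact_mod_cast h.n0
  have : 0 < 1 - τ := by linarith
  unfold Lκ; positivity
theorem L1_D2 (s t : ℝ) : D2 L1 s t (t * exp s) (exp s) :=
  ((D2.snd s t).mul ((D2.fst s t).scomp (Real.hasDerivAt_exp s))).congr bS bS
theorem L2_D2 {τ b : ℝ} {n : ℕ} (h : LH τ b n) {s t : ℝ} (ht : 0 < t)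
    (hA : 0 < 1 + (s + lgg (t / cm τ)) / Lκ τ n) :
    D2 (L2 τ n) s t
      (cm τ * (1 + (s + lgg (t / cm τ)) / Lκ τ n) ^ (-nI n))
      (cm τ / t * (1 + (s + lgg (t / cm τ)) / Lκ τ n) ^ (-nI n)) := by
  have h1 := h.τ0; have h2 := h.τ1
  have hn : rz < n := by exact_mod_cast h.n0
  have h3 : 0 < 1 - τ := by linarith
  have hl : D2 (fun _ t ↦ lgg (t / cm τ)) s t 0 (1 / t) :=
    (((D2.snd s t).mul (D2.const (1 - τ)⁻¹ s t)).scomp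
      (hasDerivAt_log bP)).congr bS (by field_simp; simp)
  have hv := (D2.const 1 s t).add (((D2.fst s t).add hl).mul (D2.const (Lκ τ n)⁻¹ s t))
  have hp := hv.scomp (hasDerivAt_rpow_const (p := -(1 / n : ℝ)) (.inl hA.ne'))
  have := (D2.const 1 s t).add ((D2.const (-τ) s t).mul hp)
  refine (D2.ofFun (G := L2 τ n) this (.of_forall fun y ↦ ?_)).congr ?_ ?_
  · simp only [L2, div_eq_mul_inv]; ring
  · rw [show -(1 / n : ℝ) - 1 = -(1 + 1 / n) by ring, ← div_eq_mul_inv]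
    generalize (1 + (s + lgg (t / cm τ)) / Lκ τ n) ^ (-nI n) = Q
    simp only [Lκ]; field_simp; ring
  · rw [show -(1 / n : ℝ) - 1 = -(1 + 1 / n) by ring, ← div_eq_mul_inv]
    generalize (1 + (s + lgg (t / cm τ)) / Lκ τ n) ^ (-nI n) = Q
    simp only [Lκ]; field_simp; ring
theorem L3_D2 {τ b : ℝ} {n : ℕ} (h : LH τ b n) {s t : ℝ}
    (hA : 0 < 1 + s * (cm t / τ) ^ n / Lκ τ n) :
    D2 (L3 τ n) s t
      (cm τ * (cm t / τ) ^ sc n * sL ^ (-nI n))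
      (sL ^ (-nI n)) := by
  have h1 := h.τ0; have h2 := h.τ1
  obtain ⟨k, rfl⟩ : ∃ k, n = k + 1 := ⟨n - 1, by have := h.n0; omega⟩
  have hn : rz < ((k + 1 : ℕ) : ℝ) := by positivity
  have h3 : 0 < 1 - τ := by linarith
  set n : ℕ := k + 1 with hnn
  have hz : D2 (fun _ t ↦ cm t / τ) s t 0 (-(1 / τ)) :=
    ((D2.snd s t).scomp (((hasDerivAt_id t).const_sub 1).div_const τ)).congr bS (by simp; ring)
  have hv := (D2.const 1 s t).add (((D2.fst s t).mul (hz.scomp (hasDerivAt_pow n _))).mul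
    (D2.const (Lκ τ n)⁻¹ s t))
  have hp := hv.scomp (hasDerivAt_rpow_const (p := -(1 / n : ℝ)) (.inl hA.ne'))
  have := (D2.const 1 s t).add ((D2.const (-τ) s t).mul (hz.mul hp))
  have e1 : sL ^ (-(1 / n : ℝ)) =
     sL * sL ^ (-nI n) := by
    rw [show -(1 / n : ℝ) = 1 + -(1 + 1 / n) by ring, rpow_add hA, rpow_one]
  refine (D2.ofFun (G := L3 τ n) this (.of_forall fun y ↦ ?_)).congr ?_ ?_
  · simp only [L3, div_eq_mul_inv]; ring
  · rw [show -(1 / n : ℝ) - 1 = -(1 + 1 / n) by ring, ← div_eq_mul_inv]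
    set Q := sL ^ (-nI n)
    have : Lκ τ n * (cm τ * n) = τ := by simp only [Lκ]; field_simp
    have h9 := h.κ0
    have h8 : cm τ = τ * (1 / n) * (Lκ τ n)⁻¹ := by field_simp; linear_combination this
    generalize cm t / τ = z
    linear_combination (-(z ^ sc n * Q)) * h8
  · rw [show -(1 / n : ℝ) - 1 = -(1 + 1 / n) by ring, ← div_eq_mul_inv, e1]
    set Q := sL ^ (-nI n)
    have e2 : (cm t / τ) ^ n = (cm t / τ) * (cm t / τ) ^ pd n := by
      rw [hnn, pow_succ']; simp
    rw [e2]
    generalize (cm t / τ) ^ pd n = w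
    have : Lκ τ n * (cm τ * n) = τ := by simp only [Lκ]; field_simp
    have := h.κ0
    field_simp; ring
theorem Lf_D2 {τ b : ℝ} {n : ℕ} (h : LH τ b n) {s t : ℝ} (hs : 0 ≤ s)
    (hs2 : s ≤ lgg (cm τ / b)) : D2 (Lf τ n) s t (LX τ n t * LJ τ b n s t) (LJ τ b n s t) := by
  have h1 := h.τ0
  have h2 := h.τ1
  have h3 : 0 < 1 - τ := by linarith
  have hb := h.b0
  have hκ := h.κ0
  have hn0 : n ≠ 0 := by have := h.n0; omega
  have cf : Continuous fun y : ℝ × ℝ ↦ y.1 := continuous_fst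
  have ct : Continuous fun y : ℝ × ℝ ↦ y.2 := continuous_snd
  have ce : Continuous fun y : ℝ × ℝ ↦ y.2 * exp y.1 := by fun_prop
  have R1 : t * exp s ≤ 1 - τ → t ≤ 1 - τ →
      LX τ n t = t ∧ LJ τ b n s t = exp s := by
    intro ha htt
    have hz : Lz τ t = 1 := by
      have : 1 ≤ cm t / τ := by rw [le_div_iff₀ h1]; linarith
      simp [Lz, this]
    have hm : Lmm τ b s t = s := by
      unfold Lmm
      rw [min_eq_left htt]
      apply min_eq_left
      rcases le_total b t with hbt | hbt
      · rw [max_eq_right hbt, le_log_iff_exp_le (by apply div_pos h3; linarith),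
          le_div_iff₀ bL]; linarith
      · rw [max_eq_left hbt]; exact hs2
    simp [LX, LJ, hz, hm, min_eq_left htt]
  have R2 : 1 - τ ≤ t * exp s → t ≤ 1 - τ → 0 < t ∧ LX τ n t = t ∧
      LJ τ b n s t = cm τ / t * (1 + (s + lgg (t / cm τ)) / Lκ τ n) ^ (-nI n)
      ∧ 0 < 1 + (s + lgg (t / cm τ)) / Lκ τ n := by
    intro ha htt
    have hz : Lz τ t = 1 := by
      have : 1 ≤ cm t / τ := by rw [le_div_iff₀ h1]; linarith
      simp [Lz, this]
    have ht : 0 < t := by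
      by_contra hc
      push Not at hc
      nlinarith [mul_nonneg (neg_nonneg.2 hc) (exp_pos s).le]
    have hbt : b ≤ t := by
      have e1 := exp_le_exp.2 hs2
      rw [exp_log bP, le_div_iff₀ hb] at e1
      nlinarith [exp_pos s]
    have hl : lgg (cm τ / t) ≤ s := by
      rw [log_le_iff_le_exp bP, div_le_iff₀ ht]; linarith
    have hm : Lmm τ b s t = lgg (cm τ / t) := by
      unfold Lmm
      rw [min_eq_left htt, max_eq_right hbt, min_eq_right hl]
    have hl2 : lgg (cm τ / t) = - lgg (t / cm τ) := by
      rw [← log_inv, inv_div]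
    refine ⟨ht, by simp [LX, hz, min_eq_left htt], ?_, ?_⟩
    · rw [LJ, hz, hm, exp_log bP, hl2]; simp
    · have : 0 ≤ (s + lgg (t / cm τ)) / Lκ τ n := div_nonneg bL hκ.le
      linarith
  have R3 : 1 - τ ≤ t → t ≤ 1 → LX τ n t = cm τ * (cm t / τ) ^ sc n ∧
      LJ τ b n s t = sL ^ (-nI n) ∧
      0 < 1 + s * (cm t / τ) ^ n / Lκ τ n := by
    intro ha htt
    have z0 : 0 ≤ cm t / τ := div_nonneg bL h1.le
    have hz : Lz τ t = cm t / τ := by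
      have : cm t / τ ≤ 1 := by rw [div_le_iff₀ h1]; linarith
      simp [Lz, this, z0]
    have hm : Lmm τ b s t = 0 := by
      unfold Lmm
      rw [min_eq_right ha, max_eq_right h.b1, div_self h3.ne', log_one, min_eq_right hs]
    refine ⟨by simp [LX, hz, min_eq_right ha], ?_, by positivity⟩
    rw [LJ, hz, hm]; simp [mul_comm]
  have r4 : D2 (fun _ t : ℝ ↦ t) s t 0 1 := D2.snd s t
  have r1 : t * exp s ≤ 1 - τ → t ≤ 1 - τ → D2 L1 s t (LX τ n t * LJ τ b n s t) (LJ τ b n s t) := by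
    intro a1 a2
    rw [(R1 a1 a2).1, (R1 a1 a2).2]; exact L1_D2 s t
  have r2 : 1 - τ ≤ t * exp s → t ≤ 1 - τ →
      D2 (L2 τ n) s t (LX τ n t * LJ τ b n s t) (LJ τ b n s t) := by
    intro a1 a2
    obtain ⟨q1, q2, q3, q4⟩ := R2 a1 a2
    refine (L2_D2 h q1 q4).congr ?_ q3.symm
    rw [q2, q3]; field_simp
  have r3 : 1 - τ ≤ t → t ≤ 1 → D2 (L3 τ n) s t (LX τ n t * LJ τ b n s t) (LJ τ b n s t) := by
    intro a1 a2
    obtain ⟨q2, q3, q4⟩ := R3 a1 a2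
    refine (L3_D2 h q4).congr ?_ q3.symm
    rw [q2, q3]
  have v12 : t * exp s = 1 - τ → L2 τ n s t = L1 s t := by
    intro e
    have : t = cm τ * exp (-s) := by rw [← e, mul_assoc, ← exp_add]; simp
    have e2 : lgg (t / cm τ) = - s := by
      rw [this, mul_div_assoc, mul_comm, div_mul_cancel₀ _ h3.ne', log_exp]
    rw [L2, L1, e2, e]; simp
  have v23 : t = 1 - τ → L3 τ n s t = L2 τ n s t := by
    intro e
    rw [L2, L3, e, div_self h3.ne', log_one]
    simp [h1.ne']
  have v34 : t = 1 → L3 τ n s t = t := by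
    intro e; simp [L3, e]
  rcases lt_trichotomy t 1 with c1 | c1 | c1
  rotate_left
  · refine D2.glue (r3 bL c1.le) (g := fun _ t ↦ t) (r4.congr ?_ ?_) ?_ ?_ ?_
    · rw [(R3 bL c1.le).1]; simp [c1]
    · rw [(R3 bL c1.le).2.1]; simp [c1, hn0]
    · rw [v34 c1]; simp [Lf, c1]
    · simp [Lf, c1]
    · filter_upwards [continuousAt_const.eventually_lt ct.continuousAt
        (show 1 - τ < t by linarith)] with y hy
      by_cases hy2 : 1 ≤ y.2
      · right; simp [Lf, hy2]
      · left; simp [Lf, hy2, hy.le]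
  · have hz : Lz τ t = 0 := by
      have : cm t / τ ≤ 0 := by rw [div_le_iff₀ h1]; linarith
      simp [Lz, this]
    have hm : Lmm τ b s t = 0 := by
      unfold Lmm
      rw [min_eq_right (show 1 - τ ≤ t by linarith), max_eq_right h.b1, div_self h3.ne', log_one, min_eq_right hs]
    refine (r4.congr ?_ ?_).ofFun ?_
    · simp [LX, hz]
    · simp [LJ, hz, hm, hn0]
    · filter_upwards [continuousAt_const.eventually_lt ct.continuousAt c1] with y hy
      simp [Lf, hy.le]
  have e1 : ∀ᶠ y : ℝ × ℝ in 𝓝 (s, t), y.2 < 1 := ct.continuousAt.eventually_lt continuousAt_const c1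
  rcases lt_trichotomy t cm τ with c2 | c2 | c2
  · have e2 : ∀ᶠ y : ℝ × ℝ in 𝓝 (s, t), y.2 < 1 - τ :=
      ct.continuousAt.eventually_lt continuousAt_const c2
    rcases lt_trichotomy (t * exp s) cm τ with c3 | c3 | c3
    · refine (r1 c3.le c2.le).ofFun ?_
      filter_upwards [e1, e2, ce.continuousAt.eventually_lt continuousAt_const c3] with y y1 y2 y3
      simp [Lf, not_le.2 y1, not_le.2 y2, y3.le, L1]
    · refine D2.glue (r1 c3.le c2.le) (r2 c3.ge c2.le) ?_ ?_ ?_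
      · simp [Lf, not_le.2 c1, not_le.2 c2, c3.le, L1]
      · rw [v12 c3]; simp [Lf, not_le.2 c1, not_le.2 c2, c3.le, L1]
      · filter_upwards [e1, e2] with y y1 y2
        by_cases y3 : y.2 * exp y.1 ≤ 1 - τ
        · left; simp [Lf, not_le.2 y1, not_le.2 y2, y3, L1]
        · right; simp [Lf, not_le.2 y1, not_le.2 y2, y3]
    · refine (r2 c3.le c2.le).ofFun ?_
      filter_upwards [e1, e2, continuousAt_const.eventually_lt ce.continuousAt c3] with y y1 y2 y3
      simp [Lf, not_le.2 y1, not_le.2 y2, not_le.2 y3]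
  · have vF : Lf τ n s t = L3 τ n s t := by simp [Lf, not_le.2 c1, c2.ge]
    rcases hs.eq_or_lt with s0 | s0
    · have g1 : D2 (fun s t ↦ if t * exp s ≤ 1 - τ then L1 s t else L2 τ n s t) s t
          (LX τ n t * LJ τ b n s t) (LJ τ b n s t) := by
        have hes : t * exp s = 1 - τ := by rw [← s0, c2]; simp
        refine D2.glue (r1 hes.le c2.le) (r2 hes.ge c2.le) (by simp [hes]) ?_ ?_
        · simp [hes, v12 hes]
        · refine .of_forall fun y ↦ ?_
          by_cases y3 : y.2 * exp y.1 ≤ 1 - τ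
          · left; simp [y3]
          · right; simp [y3]
      refine D2.glue (r3 c2.ge c1.le) g1 vF ?_ ?_
      · rw [vF, v23 c2]
        have hes : t * exp s = 1 - τ := by rw [← s0, c2]; simp
        simp [hes, v12 hes]
      · filter_upwards [e1] with y y1
        by_cases y2 : 1 - τ ≤ y.2
        · left; simp [Lf, not_le.2 y1, y2]
        · right; simp [Lf, not_le.2 y1, y2, L1]
    · have c3 : 1 - τ < t * exp s := by
        rw [c2]; nlinarith [add_one_lt_exp s0.ne']
      refine D2.glue (r3 c2.ge c1.le) (r2 c3.le c2.le) vF (by rw [vF, v23 c2]) ?_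
      filter_upwards [e1, continuousAt_const.eventually_lt ce.continuousAt c3] with y y1 y3
      by_cases y2 : 1 - τ ≤ y.2
      · left; simp [Lf, not_le.2 y1, y2]
      · right; simp [Lf, not_le.2 y1, y2, not_le.2 y3]
  · refine (r3 c2.le c1.le).ofFun ?_
    filter_upwards [e1, continuousAt_const.eventually_lt ct.continuousAt c2] with y y1 y2
    simp [Lf, not_le.2 y1, y2.le]
end
noncomputable section
section tame
variable {ι X : Type*}
def Pb (N : ι → ℝ) (f : ι → X → ℝ) : Prop := ∃ M : ℕ, ∀ i x, |f i x| ≤ N i ^ M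
def TLip [PseudoMetricSpace X] (N : ι → ℝ) (f : ι → X → ℝ) : Prop :=
  ∃ M : ℕ, ∀ i x y, |f i x - f i y| ≤ N i ^ M * dist x y
def Tame [PseudoMetricSpace X] (N : ι → ℝ) (f : ι → X → ℝ) : Prop := Pb N f ∧ TLip N f
variable {N : ι → ℝ} {f g : ι → X → ℝ}
theorem Nmono (hN : ∀ i, 2 ≤ N i) (i : ι) {a b : ℕ} (h : a ≤ b) : N i ^ a ≤ N i ^ b :=
  pow_le_pow_right₀ (by linarith [hN i]) h
theorem Nadd (hN : ∀ i, 2 ≤ N i) (i : ι) (a b : ℕ) : N i ^ a + N i ^ b ≤ N i ^ (a + b + 1) := by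
  have h := hN i
  have h1 := Nmono hN i (Nat.zero_le a)
  have h2 := Nmono hN i (Nat.zero_le b)
  simp only [pow_zero] at h1 h2
  rw [pow_succ, pow_add]
  nlinarith [mul_nonneg (sub_nonneg.2 h1) (sub_nonneg.2 h2), mul_nonneg (mul_nonneg (zero_le_one.trans h1) (zero_le_one.trans h2)) (sub_nonneg.2 h)]
theorem Npos (hN : ∀ i, 2 ≤ N i) (i : ι) (a : ℕ) : 0 < N i ^ a := pow_pos (by linarith [hN i]) a
theorem Pb.const (hN : ∀ i, 2 ≤ N i) (k : ℝ) : Pb N (fun _ (_ : X) ↦ k) := by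
  obtain ⟨M, hM⟩ := pow_unbounded_of_one_lt |k| (one_lt_two)
  exact ⟨M, fun i x ↦ hM.le.trans (pow_le_pow_left₀ bN (hN i) M)⟩
theorem Pb.add (hN : ∀ i, 2 ≤ N i) (hf : Pb N f) (hg : Pb N g) : Pb N (fun i x ↦ f i x + g i x) := by
  obtain ⟨a, ha⟩ := hf
  obtain ⟨b, hb⟩ := hg
  exact ⟨a + b + 1, fun i x ↦ (abs_add_le _ _).trans ((add_le_add (ha i x) (hb i x)).trans (Nadd hN i a b))⟩
theorem Pb.mul (hN : ∀ i, 2 ≤ N i) (hf : Pb N f) (hg : Pb N g) : Pb N (fun i x ↦ f i x * g i x) := by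
  obtain ⟨a, ha⟩ := hf
  obtain ⟨b, hb⟩ := hg
  refine ⟨a + b, fun i x ↦ ?_⟩
  rw [abs_mul, pow_add]
  exact mul_le_mul (ha i x) (hb i x) (abs_nonneg _) (Npos hN i a).le
theorem Pb.mono (hf : Pb N f) (h : ∀ i x, |g i x| ≤ |f i x|) : Pb N g := by
  obtain ⟨a, ha⟩ := hf
  exact ⟨a, fun i x ↦ (h i x).trans (ha i x)⟩
theorem Pb.neg (hf : Pb N f) : Pb N (fun i x ↦ - f i x) := hf.mono bS
theorem Pb.pow (hN : ∀ i, 2 ≤ N i) (hf : Pb N f) (k : ℕ) : Pb N (fun i x ↦ f i x ^ k) := by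
  induction k with
  | zero => simpa using Pb.const hN 1
  | succ k ih => simpa [pow_succ] using ih.mul hN hf
variable [PseudoMetricSpace X]
theorem TLip.add (hN : ∀ i, 2 ≤ N i) (hf : TLip N f) (hg : TLip N g) : TLip N (fun i x ↦ f i x + g i x) := by
  obtain ⟨a, ha⟩ := hf
  obtain ⟨b, hb⟩ := hg
  refine ⟨a + b + 1, fun i x y ↦ ?_⟩
  have := mul_le_mul_of_nonneg_right (Nadd hN i a b) (dist_nonneg (x := x) (y := y))
  calc |f i x + g i x - (f i y + g i y)| = |(f i x - f i y) + (g i x - g i y)| := by ring_nf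
    _ ≤ _ := (abs_add_le _ _).trans (by linarith [ha i x y, hb i x y])
theorem TLip.neg (hf : TLip N f) : TLip N (fun i x ↦ - f i x) := by
  obtain ⟨a, ha⟩ := hf
  refine ⟨a, fun i x y ↦ ?_⟩
  rw [show -f i x - -f i y = -(f i x - f i y) by ring, abs_neg]; exact ha i x y
theorem TLip.const (k : ι → ℝ) : TLip N (fun i (_ : X) ↦ k i) :=
  ⟨0, fun i x y ↦ by simp [dist_nonneg]⟩
theorem TLip.scale (hN : ∀ i, 2 ≤ N i) {k : ι → ℝ} (hk : Pb N (fun i (_ : Unit) ↦ k i)) (hf : TLip N f) :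
    TLip N (fun i x ↦ k i * f i x) := by
  obtain ⟨a, ha⟩ := hf
  obtain ⟨b, hb⟩ := hk
  refine ⟨b + a, fun i x y ↦ ?_⟩
  rw [← mul_sub, abs_mul, pow_add, mul_assoc]
  exact mul_le_mul (hb i ()) (ha i x y) (abs_nonneg _) (Npos hN i b).le
theorem Tame.param {k : ι → ℝ} (hk : Pb N (fun i (_ : Unit) ↦ k i)) : Tame N (fun i (_ : X) ↦ k i) := by
  obtain ⟨b, hb⟩ := hk
  exact ⟨⟨b, fun i _ ↦ hb i ()⟩, TLip.const k⟩
theorem Tame.const (hN : ∀ i, 2 ≤ N i) (k : ℝ) : Tame N (fun _ (_ : X) ↦ k) := Tame.param (Pb.const hN k)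
theorem Tame.add (hN : ∀ i, 2 ≤ N i) (hf : Tame N f) (hg : Tame N g) : Tame N (fun i x ↦ f i x + g i x) :=
  ⟨hf.1.add hN hg.1, hf.2.add hN hg.2⟩
theorem Tame.neg (hf : Tame N f) : Tame N (fun i x ↦ - f i x) := ⟨hf.1.neg, hf.2.neg⟩
theorem Tame.sub (hN : ∀ i, 2 ≤ N i) (hf : Tame N f) (hg : Tame N g) : Tame N (fun i x ↦ f i x - g i x) := by
  simpa only [sub_eq_add_neg] using hf.add hN hg.neg
theorem Tame.mul (hN : ∀ i, 2 ≤ N i) (hf : Tame N f) (hg : Tame N g) : Tame N (fun i x ↦ f i x * g i x) := by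
  refine ⟨hf.1.mul hN hg.1, ?_⟩
  obtain ⟨⟨a, ha⟩, ⟨b, hb⟩⟩ := hf
  obtain ⟨⟨c, hc⟩, ⟨d, hd⟩⟩ := hg
  refine ⟨a + d + (c + b) + 1, fun i x y ↦ ?_⟩
  have := mul_le_mul_of_nonneg_right (Nadd hN i (a + d) (c + b)) (dist_nonneg (x := x) (y := y))
  calc |f i x * g i x - f i y * g i y| = |f i x * (g i x - g i y) + g i y * (f i x - f i y)| := by ring_nf
    _ ≤ |f i x| * |g i x - g i y| + |g i y| * |f i x - f i y| := by
        rw [← abs_mul, ← abs_mul]; exact abs_add_le _ _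
    _ ≤ N i ^ a * (N i ^ d * dist x y) + N i ^ c * (N i ^ b * dist x y) :=
        add_le_add (mul_le_mul (ha i x) (hd i x y) (abs_nonneg _) (Npos hN i a).le)
          (mul_le_mul (hc i y) (hb i x y) (abs_nonneg _) (Npos hN i c).le)
    _ ≤ _ := by rw [pow_add, pow_add] at this; linarith
theorem Tame.pow (hN : ∀ i, 2 ≤ N i) (hf : Tame N f) (k : ℕ) : Tame N (fun i x ↦ f i x ^ k) := by
  induction k with
  | zero => simpa using Tame.const hN 1
  | succ k ih => simpa [pow_succ] using ih.mul hN hf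
theorem TLip.max (hN : ∀ i, 2 ≤ N i) (hf : TLip N f) (hg : TLip N g) : TLip N (fun i x ↦ max (f i x) (g i x)) := by
  obtain ⟨a, ha⟩ := hf
  obtain ⟨b, hb⟩ := hg
  refine ⟨a + b, fun i x y ↦ ?_⟩
  have h1 := mul_le_mul_of_nonneg_right (Nmono hN i (Nat.le_add_right a b)) (dist_nonneg (x := x) (y := y))
  have h2 := mul_le_mul_of_nonneg_right (Nmono hN i (Nat.le_add_left b a)) (dist_nonneg (x := x) (y := y))
  exact (abs_max_sub_max_le_max _ _ _ _).trans (max_le ((ha i x y).trans h1) ((hb i x y).trans h2))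
theorem TLip.min (hN : ∀ i, 2 ≤ N i) (hf : TLip N f) (hg : TLip N g) : TLip N (fun i x ↦ min (f i x) (g i x)) := by
  have := (hf.neg.max hN hg.neg).neg
  simpa [max_neg_neg] using this
theorem TLip.abs (hf : TLip N f) : TLip N (fun i x ↦ |f i x|) := by
  obtain ⟨a, ha⟩ := hf
  exact ⟨a, fun i x y ↦ (abs_abs_sub_abs_le_abs_sub _ _).trans (ha i x y)⟩
theorem Tame.max (hN : ∀ i, 2 ≤ N i) (hf : Tame N f) (hg : Tame N g) : Tame N (fun i x ↦ max (f i x) (g i x)) := by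
  refine ⟨?_, hf.2.max hN hg.2⟩
  obtain ⟨⟨a, ha⟩, -⟩ := hf
  obtain ⟨⟨b, hb⟩, -⟩ := hg
  refine ⟨a + b, fun i x ↦ abs_max_le_max_abs_abs.trans (max_le ((ha i x).trans (Nmono hN i ?_)) ((hb i x).trans (Nmono hN i ?_)))⟩ <;> omega
theorem Tame.min (hN : ∀ i, 2 ≤ N i) (hf : Tame N f) (hg : Tame N g) : Tame N (fun i x ↦ min (f i x) (g i x)) := by
  have := (hf.neg.max hN hg.neg).neg
  simpa [max_neg_neg] using this
theorem TLip.scomp (hN : ∀ i, 2 ≤ N i) {F : ι → ℝ → ℝ} (S : ι → Set ℝ) (hf : TLip N f) (hS : ∀ i x, f i x ∈ S i)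
    (hF : ∃ K : ℕ, ∀ i, ∀ a ∈ S i, |F i a| ≤ N i ^ K ∧ ∀ b ∈ S i, |F i a - F i b| ≤ N i ^ K * |a - b|) :
    Tame N (fun i x ↦ F i (f i x)) := by
  obtain ⟨K, hK⟩ := hF
  obtain ⟨a, ha⟩ := hf
  refine ⟨⟨K, fun i x ↦ (hK i _ (hS i x)).1⟩, K + a, fun i x y ↦ ?_⟩
  rw [pow_add, mul_assoc]
  exact ((hK i _ (hS i x)).2 _ (hS i y)).trans (mul_le_mul_of_nonneg_left (ha i x y) (Npos hN i K).le)
theorem Tame.inv (hN : ∀ i, 2 ≤ N i) (hf : TLip N f) (h : ∃ K : ℕ, ∀ i x, 1 ≤ N i ^ K * f i x) :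
    Tame N (fun i x ↦ (f i x)⁻¹) := by
  obtain ⟨K, hK⟩ := h
  refine hf.scomp hN (fun i ↦ {a | 1 ≤ N i ^ K * a}) hK ⟨K + K, fun i a ha ↦ ?_⟩
  simp only [mem_ofPred_eq] at ha ⊢
  have hp := Npos hN i K
  have pos : ∀ a, 1 ≤ N i ^ K * a → 0 < a := fun a ha ↦ by
    by_contra hc; push Not at hc; nlinarith
  have inv : ∀ a, 1 ≤ N i ^ K * a → a⁻¹ ≤ N i ^ K := fun a ha ↦ by
    rw [inv_le_iff_one_le_mul₀ (pos a ha)]; exact ha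
  constructor
  · rw [abs_of_pos (inv_pos.2 (pos a ha))]
    exact (inv a ha).trans (Nmono hN i bO)
  · intro b hb
    have e : a⁻¹ - b⁻¹ = a⁻¹ * b⁻¹ * (b - a) := by
      have := pos a ha; have := pos b hb; field_simp
    rw [e, abs_mul, abs_mul, abs_of_pos (inv_pos.2 (pos a ha)), abs_of_pos (inv_pos.2 (pos b hb)), abs_sub_comm, pow_add]
    exact mul_le_mul_of_nonneg_right (mul_le_mul (inv a ha) (inv b hb) (inv_pos.2 (pos b hb)).le hp.le) (abs_nonneg _)
theorem lip_of_deriv {F F' : ℝ → ℝ} {S : Set ℝ} (hS : Convex ℝ S) {C : ℝ}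
    (h : ∀ a ∈ S, HasDerivAt F (F' a) a) (hC : ∀ a ∈ S, |F' a| ≤ C) {a b : ℝ} (ha : a ∈ S) (hb : b ∈ S) :
    |F a - F b| ≤ C * |a - b| := by
  have := hS.norm_image_sub_le_of_norm_hasDerivWithin_le (fun x hx ↦ (h x hx).hasDerivWithinAt) hC hb ha
  simpa using this
end tame
end
noncomputable section
theorem Lz_mem (τ t : ℝ) : 0 ≤ Lz τ t ∧ Lz τ t ≤ 1 :=
  ⟨le_max_left _ _, max_le bN (min_le_left _ _)⟩
theorem Lmm_mem {τ b s t : ℝ} {n : ℕ} (h : LH τ b n) (hs : 0 ≤ s) : 0 ≤ Lmm τ b s t ∧ Lmm τ b s t ≤ s := by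
  refine ⟨le_min hs (log_nonneg ?_), min_le_left _ _⟩
  have := h.b0
  rw [le_div_iff₀ (lt_of_lt_of_le h.b0 (le_max_left _ _)), one_mul]
  exact max_le h.b1 (min_le_right _ _)
theorem LJ_bounds {τ b s t : ℝ} {n : ℕ} (h : LH τ b n) (hs : 0 ≤ s) (hs2 : s ≤ lgg (cm τ / b)) :
    0 < LJ τ b n s t ∧ LJ τ b n s t ≤ b⁻¹ ∧ τ ^ nI n ≤ (1 + n * b⁻¹) ^ 2 * LJ τ b n s t := by
  have h1 := h.τ0
  have h2 := h.τ1
  have hb := h.b0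
  have hκ := h.κ0
  have hn : ro ≤ n := by exact_mod_cast h.n0
  have hz := Lz_mem τ t
  have hm := Lmm_mem (t := t) h hs
  have e0 : 0 ≤ Lz τ t ^ n * (s - Lmm τ b s t) / Lκ τ n :=
    div_nonneg (mul_nonneg (pow_nonneg hz.1 _) bL) hκ.le
  have hsb : s ≤ b⁻¹ := by
    have h6 : 0 < cm τ / b := div_pos bL hb
    refine hs2.trans ((log_le_self h6.le).trans ?_)
    rw [div_eq_mul_inv]; have := inv_pos.2 hb; nlinarith
  have e1 : Lz τ t ^ n * (s - Lmm τ b s t) / Lκ τ n ≤ n * b⁻¹ / τ := by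
    rw [Lκ, div_div_eq_mul_div]
    apply div_le_div_of_nonneg_right _ h1.le
    have : Lz τ t ^ n * (s - Lmm τ b s t) ≤ b⁻¹ := by
      have := mul_le_mul (pow_le_one₀ hz.1 hz.2 (n := n)) (show s - Lmm τ b s t ≤ b⁻¹ by linarith) bL zero_le_one
      linarith
    have h5 : 0 ≤ Lz τ t ^ n * (s - Lmm τ b s t) := mul_nonneg (pow_nonneg hz.1 _) bL
    nlinarith [mul_nonneg h5 (by linarith : rz ≤ n), mul_nonneg (by linarith : rz ≤ n) (sub_nonneg.2 this)]
  set A := 1 + Lz τ t ^ n * (s - Lmm τ b s t) / Lκ τ n with hA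
  have A1 : 1 ≤ A := by linarith
  have hx : exp (Lmm τ b s t) ≤ b⁻¹ := by
    have h6 : 0 < cm τ / b := div_pos bL hb
    have := exp_le_exp.2 (hm.2.trans hs2)
    rw [exp_log h6, div_eq_mul_inv] at this
    have := inv_pos.2 hb; nlinarith
  have hA0 : 0 < A ^ (-nI n) := rpow_pos_of_pos bL _
  have hA2 : A ^ (-nI n) ≤ 1 := rpow_le_one_of_one_le_of_nonpos A1 (by
    have : 0 ≤ 1 / (n : ℝ) := by positivity
    linarith)
  have hx1 : 1 ≤ exp (Lmm τ b s t) := one_le_exp hm.1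
  have hJ : LJ τ b n s t = exp (Lmm τ b s t) * A ^ (-nI n) := rfl
  refine ⟨by rw [hJ]; positivity, by rw [hJ]; nlinarith, ?_⟩
  have hD : 1 ≤ 1 + n * b⁻¹ := by have := inv_pos.2 hb; nlinarith
  have k1 : τ * A ≤ 1 + n * b⁻¹ := by
    rw [le_div_iff₀ h1] at e1; rw [hA]; nlinarith
  have hexp : nI n ≤ 2 := by
    have : 1 / (n : ℝ) ≤ 1 := by rw [div_le_one bL]; exact hn
    linarith
  have k2 : τ ^ nI n * A ^ nI n ≤ (1 + n * b⁻¹) ^ 2 := by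
    rw [← mul_rpow h1.le bL]
    calc (τ * A) ^ nI n ≤ (1 + n * b⁻¹) ^ nI n :=
          rpow_le_rpow bP k1 bP
      _ ≤ (1 + n * b⁻¹) ^ (2 : ℝ) := rpow_le_rpow_of_exponent_le hD hexp
      _ = _ := by norm_cast
  have k3 : A ^ nI n * A ^ (-nI n) = 1 := by
    rw [← rpow_add bL]; simp
  calc τ ^ nI n = τ ^ nI n * A ^ nI n * A ^ (-nI n) := by
        rw [mul_assoc, k3, mul_one]
    _ ≤ (1 + n * b⁻¹) ^ 2 * A ^ (-nI n) := mul_le_mul_of_nonneg_right k2 hA0.le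
    _ ≤ _ := by rw [hJ]; exact mul_le_mul_of_nonneg_left (by nlinarith) bP
section
variable {ι X : Type*} [PseudoMetricSpace X] {N : ι → ℝ}
theorem TLip.of_lip {f : ι → X → ℝ} {C : ℝ} (hN : ∀ i, 2 ≤ N i) (h : ∀ i x y, |f i x - f i y| ≤ C * dist x y) : TLip N f := by
  obtain ⟨M, hM⟩ := Pb.const (X := Unit) hN C
  exact ⟨M, fun i x y ↦ (h i x y).trans (mul_le_mul_of_nonneg_right ((le_abs_self C).trans (hM i ())) dist_nonneg)⟩
theorem tame_Lz (hN : ∀ i, 2 ≤ N i) {τ : ι → ℝ} (hτ : ∀ i, 0 < τ i) (hτN : ∀ i, (τ i)⁻¹ ≤ N i)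
    {T : ι → X → ℝ} (hT : TLip N T) : Tame N (fun i x ↦ Lz (τ i) (T i x)) := by
  refine ⟨⟨0, fun i x ↦ ?_⟩, ?_⟩
  · have := Lz_mem (τ i) (T i x)
    rw [abs_of_nonneg this.1]; simpa using this.2
  · have hk : Pb N (fun i (_ : Unit) ↦ (τ i)⁻¹) :=
      ⟨1, fun i _ ↦ by rw [abs_of_pos (inv_pos.2 (hτ i)), pow_one]; exact hτN i⟩
    have := (TLip.const (fun _ ↦ 0)).max hN ((TLip.const (fun _ ↦ 1)).min hN (((TLip.const (fun _ ↦ 1)).add hN hT.neg).scale hN hk))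
    refine (by simpa only [BDP.Lz, div_eq_inv_mul, sub_eq_add_neg] using this)
theorem tame_LJ (hN : ∀ i, 2 ≤ N i) {n : ℕ} {τ b : ι → ℝ} (h : ∀ i, LH (τ i) (b i) n) (hτN : ∀ i, (τ i)⁻¹ ≤ N i)
    (hbN : ∀ i, (b i)⁻¹ ≤ N i) {S T : ι → X → ℝ} (hS : TLip N S) (hT : TLip N T) (hS0 : ∀ i x, 0 ≤ S i x)
    (hS1 : ∀ i x, S i x ≤ lgg ((1 - τ i) / b i)) : Tame N (fun i x ↦ LJ (τ i) (b i) n (S i x) (T i x)) := by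
  have hz := tame_Lz hN (fun i ↦ (h i).τ0) hτN hT
  have h3 : ∀ i, 0 < 1 - τ i := fun i ↦ by linarith [(h i).τ1]
  have hv : TLip N (fun i x ↦ max (b i) (min (T i x) (1 - τ i))) :=
    (TLip.const b).max hN (hT.min hN (TLip.const _))
  have hSb : ∀ i x, |S i x| ≤ N i ^ 1 := fun i x ↦ by
    rw [abs_of_nonneg (hS0 i x), pow_one]
    refine (hS1 i x).trans ((log_le_self (div_pos (h3 i) (h i).b0).le).trans ?_)
    refine le_trans ?_ (hbN i)
    rw [div_eq_mul_inv]; have := inv_pos.2 (h i).b0; nlinarith [(h i).τ0]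
  have hl : Tame N (fun i x ↦ lgg ((1 - τ i) / max (b i) (min (T i x) (1 - τ i)))) := by
    refine hv.scomp (F := fun i v ↦ lgg ((1 - τ i) / v)) hN (fun i ↦ Icc (b i) (1 - τ i)) (fun i x ↦ ⟨le_max_left _ _, max_le (h i).b1 (min_le_right _ _)⟩) ⟨1, fun i a ha ↦ ?_⟩
    have ha0 : 0 < a := lt_of_lt_of_le (h i).b0 ha.1
    refine ⟨?_, fun c hc ↦ ?_⟩
    · have h1 : 1 ≤ (1 - τ i) / a := by rw [le_div_iff₀ ha0]; linarith [ha.2]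
      rw [abs_of_nonneg (log_nonneg h1), pow_one]
      refine (log_le_self bL).trans (le_trans ?_ (hbN i))
      rw [div_le_iff₀ ha0]
      have := (h i).τ0
      have : 1 ≤ (b i)⁻¹ * a := by rw [inv_mul_eq_div, le_div_iff₀ (h i).b0]; linarith [ha.1]
      linarith
    · refine lip_of_deriv (F := fun v ↦ lgg ((1 - τ i) / v)) (F' := fun v ↦ - v⁻¹) (convex_Icc (b i) (1 - τ i)) (fun v hv ↦ ?_) (fun v hv ↦ ?_) ha hc
      · have hv0 : 0 < v := lt_of_lt_of_le (h i).b0 hv.1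
        have := ((hasDerivAt_log hv0.ne').const_sub (lgg (1 - τ i)))
        refine this.congr_of_eventuallyEq ?_
        filter_upwards [eventually_gt_nhds hv0] with w hw
        rw [log_div (h3 i).ne' hw.ne']
      · have hv0 : 0 < v := lt_of_lt_of_le (h i).b0 hv.1
        rw [abs_neg, abs_of_pos (inv_pos.2 hv0), pow_one]
        exact (inv_anti₀ (h i).b0 hv.1).trans (hbN i)
  have hS' : Tame N S := ⟨⟨1, hSb⟩, hS⟩
  have hmm : Tame N (fun i x ↦ Lmm (τ i) (b i) (S i x) (T i x)) := hS'.min hN hl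
  have hE : Tame N (fun i x ↦ exp (Lmm (τ i) (b i) (S i x) (T i x))) := by
    refine hmm.2.scomp (F := fun _ v ↦ exp v) hN (fun i ↦ Iic (lgg ((1 - τ i) / b i))) (fun i x ↦ ?_) ⟨1, fun i a ha ↦ ?_⟩
    · exact (Lmm_mem (h i) (hS0 i x)).2.trans (hS1 i x)
    · have key : ∀ a ∈ Iic (lgg ((1 - τ i) / b i)), |exp a| ≤ N i ^ 1 := fun a ha ↦ by
        rw [abs_exp, pow_one]
        refine (exp_le_exp.2 ha).trans ?_
        rw [exp_log (div_pos (h3 i) (h i).b0)]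
        refine le_trans ?_ (hbN i)
        rw [div_eq_mul_inv]; have := inv_pos.2 (h i).b0; nlinarith [(h i).τ0]
      exact ⟨key a ha, fun c hc ↦ lip_of_deriv (convex_Iic _) (fun v _ ↦ Real.hasDerivAt_exp v) key ha hc⟩
  have hk : Pb N (fun i (_ : Unit) ↦ (Lκ (τ i) n)⁻¹) := by
    have hP : Pb N (fun i (_ : Unit) ↦ (τ i)⁻¹ * n) :=
      Pb.mul hN ⟨1, fun i _ ↦ by rw [abs_of_pos (inv_pos.2 (h i).τ0), pow_one]; exact hτN i⟩ (Pb.const hN n)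
    refine hP.mono fun i _ ↦ ?_
    have := (h i).κ0
    have := (h i).τ0
    have := h3 i
    rw [abs_of_pos bP, abs_of_nonneg bP, Lκ, inv_div, inv_mul_eq_div]
    apply div_le_div_of_nonneg_right _ bL
    nlinarith [(Nat.cast_nonneg n : rz ≤ n)]
  have hA : Tame N (fun i x ↦ 1 + BDP.Lz (τ i) (T i x) ^ n * (S i x - Lmm (τ i) (b i) (S i x) (T i x)) / Lκ (τ i) n) := by
    have := (Tame.const hN 1).add hN (((hz.pow hN n).mul hN (hS'.sub hN hmm)).mul hN (Tame.param hk))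
    simpa only [div_eq_mul_inv] using this
  refine hE.mul hN (hA.2.scomp (F := fun _ a ↦ a ^ (-nI n)) hN (fun _ ↦ Ici 1) (fun i x ↦ ?_) ⟨1, fun i a ha ↦ ?_⟩)
  · have hm := Lmm_mem (t := T i x) (h i) (hS0 i x)
    have := div_nonneg (mul_nonneg (pow_nonneg (Lz_mem (τ i) (T i x)).1 n) (sub_nonneg.2 hm.2)) (h i).κ0.le
    simp only [mem_Ici]; linarith
  · have hn : ro ≤ n := by exact_mod_cast (h i).n0
    have hn1 : 0 ≤ 1 / (n : ℝ) := by positivity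
    have hn2 : 1 / (n : ℝ) ≤ 1 := by rw [div_le_one bL]; exact hn
    have key : ∀ a ∈ Ici ro, ∀ e : ℝ, e ≤ 0 → |a ^ e| ≤ 1 := fun a ha e he ↦ by
      rw [abs_of_nonneg (rpow_nonneg (zero_le_one.trans ha) _)]
      exact rpow_le_one_of_one_le_of_nonpos ha he
    refine ⟨(key a ha _ bL).trans (by rw [pow_one]; linarith [hN i]), fun c hc ↦ ?_⟩
    refine lip_of_deriv (F := fun a ↦ a ^ (-nI n)) (convex_Ici 1) (fun v hv ↦ hasDerivAt_rpow_const (.inl (by simp at hv; linarith))) (fun v hv ↦ ?_) ha hc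
    rw [abs_mul, pow_one, abs_of_nonpos bL]
    have := key v hv (-(1 + 1 / (n : ℝ)) - 1) bL
    nlinarith [hN i, abs_nonneg (v ^ (-(1 + 1 / (n : ℝ)) - 1))]
theorem PR_lower {s c K : ℝ} (hK : |s| ≤ K) (hc : |c| ≤ 1) : 1 ≤ sc K ^ 2 * PR s c ^ 2 := by
  rw [PR_sq]
  have hD0 : 0 ≤ PD c := by unfold PD; nlinarith [abs_nonneg c, sq_abs c]
  have hK0 := (abs_nonneg s).trans hK
  by_cases h : 1 / (2 * sc K) ≤ PD c
  · have : 1 ≤ PD c * (2 * sc K) := (div_le_iff₀ bP).1 h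
    have h5 : 1 ≤ (PD c * (2 * sc K)) ^ 2 := one_le_pow₀ this
    nlinarith [mul_nonneg (sq_nonneg sc K) (sq_nonneg (PN s c))]
  · push Not at h
    have h1 : PD c * (2 * sc K) < 1 := (lt_div_iff₀ bP).1 h
    have h2 : |s * PD c| ≤ 1 / 2 := by
      rw [abs_mul, abs_of_nonneg hD0]; nlinarith
    have h3 : PD c < 1 / 2 := by nlinarith
    have h4 : 1 / 2 < c ^ 2 := by unfold PD at h3; linarith
    have h5 : 1 ≤ PN s c ^ 2 := by
      rw [abs_le] at h2
      have : PN s c = 4 * c + s * PD c := rfl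
      rcases le_total 0 c with h0 | h0
      · have : 1 ≤ PN s c := by nlinarith
        nlinarith
      · have : 1 ≤ - PN s c := by nlinarith
        nlinarith
    nlinarith [mul_nonneg (sq_nonneg sc K) (sq_nonneg (PD c)), mul_nonneg (by positivity : 0 ≤ K ^ 2 + 2 * K) (sq_nonneg (PN s c))]
theorem PD_mem {c : ℝ} (hc : |c| ≤ 1) : 0 ≤ PD c ∧ PD c ≤ 1 := by
  unfold PD; constructor <;> nlinarith [abs_nonneg c, sq_abs c]
theorem PJ_bounds {s c K : ℝ} (hK : |s| ≤ K) : 0 < PJ s c ∧ PJ s c ≤ 16 * sc K ^ 2 ∧ 1 ≤ (K + 8) ^ 2 * PJ s c := by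
  have hc := cl_abs c
  set w := cl c
  have hD := PD_mem hc
  have hR := PR_pos s w
  have hL := PR_lower hK hc
  have hK0 := (abs_nonneg s).trans hK
  have hden : 0 < PR s w * (2 * PD w + PR s w) := mul_pos hR bL
  have hw : w ^ 2 ≤ 1 := by rw [← sq_abs]; nlinarith [abs_nonneg w]
  have hJ : PJ s c = 8 * (1 + w ^ 2) / (PR s w * (2 * PD w + PR s w)) := rfl
  refine ⟨by rw [hJ]; positivity, ?_, ?_⟩
  · rw [hJ, div_le_iff₀ hden]
    nlinarith [mul_nonneg (sq_nonneg sc K) (mul_nonneg hR.le hD.1)]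
  · rw [hJ, ← mul_div_assoc, le_div_iff₀ hden, one_mul]
    have hN : |PN s w| ≤ 4 + K := by
      have : PN s w = 4 * w + s * PD w := rfl
      rw [this]
      refine (abs_add_le _ _).trans ?_
      rw [abs_mul, abs_mul, abs_of_nonneg hD.1]
      have : |(4 : ℝ)| = 4 := by norm_num
      nlinarith [abs_nonneg s]
    have hR2 : PR s w ^ 2 ≤ (K + 6) ^ 2 := by
      rw [PR_sq]; have := sq_abs (PN s w); nlinarith [abs_nonneg (PN s w)]
    have hR3 : PR s w ≤ K + 6 := by nlinarith
    nlinarith [mul_nonneg hR.le hD.1, mul_le_mul_of_nonneg_left hD.2 hR.le, sq_nonneg w, mul_nonneg (sq_nonneg (K + 8)) (sq_nonneg w)]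
theorem cl_lip (a b : ℝ) : |cl a - cl b| ≤ |a - b| := by
  unfold cl
  rw [max_comm, max_comm (-1)]
  refine (abs_max_sub_max_le_abs _ _ _).trans ?_
  rw [min_comm, min_comm 1]
  exact abs_min_sub_min_le_max _ _ _ _ |>.trans bS
theorem tame_cl (hN : ∀ i, 2 ≤ N i) {C : ι → X → ℝ} (hC : TLip N C) : Tame N (fun i x ↦ cl (C i x)) :=
  hC.scomp (F := fun _ a ↦ BDP.cl a) hN (fun _ ↦ univ) (fun _ _ ↦ mem_univ _) ⟨0, fun i a _ ↦ ⟨by simpa using cl_abs a, fun b _ ↦ by simpa using cl_lip a b⟩⟩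
theorem tame_PX (hN : ∀ i, 2 ≤ N i) {C : ι → X → ℝ} (hC : TLip N C) : Tame N (fun i x ↦ PX (C i x)) := by
  have h1 := tame_cl hN hC
  have hD : Tame N (fun i x ↦ PD (BDP.cl (C i x))) := (Tame.const hN 1).sub hN (h1.pow hN 2)
  have hden : Tame N (fun i x ↦ 4 * (1 + BDP.cl (C i x) ^ 2)) := (Tame.const hN 4).mul hN ((Tame.const hN 1).add hN (h1.pow hN 2))
  have := (hD.pow hN 2).mul hN (Tame.inv hN hden.2 ⟨0, fun i x ↦ by nlinarith [sq_nonneg (BDP.cl (C i x))]⟩)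
  simpa only [BDP.PX, div_eq_mul_inv] using this
theorem tame_PJ (hN : ∀ i, 2 ≤ N i) {S C : ι → X → ℝ} (hS : Tame N S) (hC : TLip N C) :
    Tame N (fun i x ↦ PJ (S i x) (C i x)) := by
  have h1 := tame_cl hN hC
  have hD : Tame N (fun i x ↦ PD (BDP.cl (C i x))) := (Tame.const hN 1).sub hN (h1.pow hN 2)
  have hNn : Tame N (fun i x ↦ PN (S i x) (BDP.cl (C i x))) := ((Tame.const hN 4).mul hN h1).add hN (hS.mul hN hD)
  obtain ⟨K, hK⟩ := hS.1
  have hlow : ∀ i x, 1 ≤ N i ^ sc K * PR (S i x) (BDP.cl (C i x)) := fun i x ↦ by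
    have h2 := PR_lower (hK i x) (cl_abs (C i x))
    have h3 := PR_pos (S i x) (BDP.cl (C i x))
    have h4 := Npos hN i K
    have h6 : 1 ≤ N i ^ K := one_le_pow₀ (by linarith [hN i])
    have h5 : 1 ≤ (N i ^ K + 1) * PR (S i x) (BDP.cl (C i x)) := by
      rw [← mul_pow] at h2
      by_contra hc
      push Not at hc
      have := pow_lt_one₀ bP hc (two_ne_zero)
      linarith
    refine h5.trans (mul_le_mul_of_nonneg_right ?_ h3.le)
    rw [pow_succ]; nlinarith [hN i]
  have hR : Tame N (fun i x ↦ PR (S i x) (BDP.cl (C i x))) := by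
    have hr2 : Tame N (fun i x ↦ 4 * PD (BDP.cl (C i x)) ^ 2 + PN (S i x) (BDP.cl (C i x)) ^ 2) :=
      ((Tame.const hN 4).mul hN (hD.pow hN 2)).add hN (hNn.pow hN 2)
    obtain ⟨⟨a, ha⟩, hr2L⟩ := hr2
    refine (hr2L.scomp (F := fun _ v ↦ √v) hN (fun i ↦ {v | 0 ≤ v ∧ v ≤ N i ^ a ∧ 1 ≤ N i ^ sc K * √v}) (fun i x ↦ ?_) ⟨a + sc K, fun i v hv ↦ ?_⟩)
    · exact ⟨(PR_pos' _ _).le, (le_abs_self _).trans (ha i x), hlow i x⟩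
    · have hp := Npos hN i sc K
      have h1N : 1 ≤ N i ^ a := one_le_pow₀ (by linarith [hN i])
      have h1M : 1 ≤ N i ^ sc K := one_le_pow₀ (by linarith [hN i])
      constructor
      · rw [abs_of_nonneg (sqrt_nonneg _), sqrt_le_iff, pow_add]
        refine ⟨by positivity, hv.2.1.trans ?_⟩
        nlinarith [mul_le_mul h1N h1M zero_le_one bL]
      · intro w hw
        have e : (√v - √w) * (√v + √w) = v - w := by
          nlinarith [sq_sqrt hv.1, sq_sqrt hw.1]
        rw [← e, abs_mul, abs_of_nonneg (add_nonneg (sqrt_nonneg v) (sqrt_nonneg w)), pow_add]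
        have h7 : 1 ≤ N i ^ a * N i ^ sc K * (√v + √w) := by
          have := hv.2.2; have := hw.2.2
          have h8 := mul_nonneg (sub_nonneg.2 h1N) (mul_nonneg hp.le (add_nonneg (sqrt_nonneg v) (sqrt_nonneg w)))
          nlinarith
        nlinarith [abs_nonneg (√v - √w)]
  have hden := (hD.add hN hD).add hN hR
  have hi1 := Tame.inv hN hR.2 ⟨K + 1, hlow⟩
  have hi2 := Tame.inv hN hden.2 ⟨K + 1, fun i x ↦ (hlow i x).trans (mul_le_mul_of_nonneg_left (by
    linarith [(PD_mem (cl_abs (C i x))).1]) (Npos hN i _).le)⟩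
  have := ((Tame.const hN 8).mul hN ((Tame.const hN 1).add hN (h1.pow hN 2))).mul hN (hi1.mul hN hi2)
  simpa only [BDP.PJ, div_eq_mul_inv, mul_inv, two_mul] using this
end
end
noncomputable section
theorem PX_cont : Continuous PX := by
  unfold PX PD cl
  refine Continuous.div (by fun_prop) (by fun_prop) fun x ↦ ?_
  positivity
theorem PX_mem (c : ℝ) : 0 ≤ PX c ∧ PX c ≤ 1 := by
  have h := PD_mem (cl_abs c)
  have h2 := sq_nonneg (cl c)
  unfold PX
  refine ⟨by positivity, ?_⟩
  rw [div_le_one bP]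
  nlinarith
theorem LX_cont (τ : ℝ) (n : ℕ) : Continuous (LX τ n) := by unfold LX Lz; fun_prop
theorem LX_ge1 {τ t : ℝ} (n : ℕ) (hτ : 0 < τ) (ht : 1 ≤ t) : Lz τ t = 0 ∧ LX τ n t = 0 := by
  have : Lz τ t = 0 := by
    unfold Lz
    refine max_eq_left ((min_le_right _ _).trans (div_nonpos_of_nonpos_of_nonneg bL hτ.le))
  simp [LX, this]
theorem Lz_one {τ t : ℝ} (hτ : 0 < τ) (ht : t ≤ 1 - τ) : Lz τ t = 1 := by
  unfold Lz
  rw [min_eq_left (by rw [le_div_iff₀ hτ]; linarith)]; simp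
theorem LX_low {τ t : ℝ} (n : ℕ) (hτ : 0 < τ) (ht : t ≤ 1 - τ) : LX τ n t = t := by
  simp [LX, Lz_one hτ ht, ht]
theorem LX_mem {τ t : ℝ} (n : ℕ) (h1 : τ ≤ 1 / 2) (hτ : 0 < τ) (ht : 0 ≤ t) : 0 ≤ LX τ n t ∧ LX τ n t ≤ 1 := by
  have hz := Lz_mem τ t
  have hp := pow_le_one₀ hz.1 hz.2 (n := n + 1)
  have hp0 := pow_nonneg hz.1 sc n
  have hm : 0 ≤ min t cm τ := le_min ht bL
  have hm1 : min t cm τ ≤ 1 := (min_le_right _ _).trans bL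
  exact ⟨mul_nonneg hm hp0, by unfold LX; nlinarith⟩
def PW (c : ℝ) : ℝ := ∫ x in (-1)..c, PX x
def κP : ℝ := PW 1
def WL (τ : ℝ) (n : ℕ) (c : ℝ) : ℝ := ∫ x in (0)..c, LX τ n x
theorem prim_deriv {f : ℝ → ℝ} (hf : Continuous f) (a c : ℝ) : HasDerivAt (fun c ↦ ∫ x in a..c, f x) (f c) c :=
  (hf.integral_hasStrictDerivAt a c).hasDerivAt
theorem prim_const {f : ℝ → ℝ} (hf : Continuous f) (a b c : ℝ) (h : ∀ x ∈ uIcc b c, f x = 0) :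
    (∫ x in a..c, f x) = ∫ x in a..b, f x := by
  rw [← intervalIntegral.integral_add_adjacent_intervals (hf.intervalIntegrable a b) (hf.intervalIntegrable b c),
    intervalIntegral.integral_congr (g := fun _ ↦ 0) (fun x hx ↦ h x hx)]
  simp
theorem PW_deriv (c : ℝ) : HasDerivAt PW (PX c) c := prim_deriv PX_cont _ _
theorem PW_low {c : ℝ} (h : c ≤ -1) : PW c = 0 := by
  unfold PW
  rw [prim_const PX_cont (-1) (-1) c (fun x hx ↦ ?_)]; · simp
  rw [uIcc_of_ge h] at hx
  exact (PJ_end 0 x (le_abs.2 (.inr (by linarith [hx.2])))).2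
theorem PW_high {c : ℝ} (h : 1 ≤ c) : PW c = κP := by
  unfold κP PW
  rw [prim_const PX_cont (-1) 1 c (fun x hx ↦ ?_)]
  rw [uIcc_of_le h] at hx
  exact (PJ_end 0 x (le_abs.2 (.inl (by linarith [hx.1])))).2
theorem PW_mono : Monotone PW := monotone_of_deriv_nonneg (fun c ↦ (PW_deriv c).differentiableAt)
  (fun c ↦ by rw [(PW_deriv c).deriv]; exact (PX_mem c).1)
theorem PW_mem (c : ℝ) : 0 ≤ PW c ∧ PW c ≤ κP := by
  constructor
  · rcases le_total c (-1) with h | h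
    · rw [PW_low h]
    · rw [← PW_low le_rfl]; exact PW_mono h
  · rcases le_total 1 c with h | h
    · rw [PW_high h]
    · exact PW_mono h
theorem κP_pos : 0 < κP := by
  refine intervalIntegral.intervalIntegral_pos_of_pos_on (PX_cont.intervalIntegrable _ _) (fun x hx ↦ ?_) bN
  have : |x| ≤ 1 := abs_le.2 ⟨hx.1.le, hx.2.le⟩
  unfold PX
  rw [cl_eq this]
  have : 0 < PD x := by unfold PD; nlinarith [hx.1, hx.2]
  positivity
theorem WL_deriv (τ : ℝ) (n : ℕ) (c : ℝ) : HasDerivAt (WL τ n) (LX τ n c) c := prim_deriv (LX_cont τ n) _ _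
theorem WL_high {τ c : ℝ} (n : ℕ) (hτ : 0 < τ) (h : 1 ≤ c) : WL τ n c = WL τ n 1 := by
  unfold WL
  rw [prim_const (LX_cont τ n) 0 1 c (fun x hx ↦ ?_)]
  rw [uIcc_of_le h] at hx
  exact (LX_ge1 n hτ hx.1).2
theorem Pf_zero (c : ℝ) : PR 0 c = 2 * (1 + c ^ 2) := by
  unfold PR PD PN
  rw [show 4 * (1 - c ^ 2) ^ 2 + (4 * c + 0 * (1 - c ^ 2)) ^ 2 = (2 * (1 + c ^ 2)) ^ 2 by ring, sqrt_sq bP]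
theorem Pd_zero (c : ℝ) : Pd 0 c = 0 := by
  unfold Pd
  split_ifs
  · unfold Pf; rw [Pf_zero]; unfold PN PD
    rw [sub_eq_zero, div_eq_iff] <;> nlinarith
  · rfl
theorem PJ_zero (c : ℝ) : PJ 0 c = 1 := by
  unfold PJ; rw [Pf_zero]; unfold PD
  rw [div_eq_one_iff_eq] <;> nlinarith [sq_nonneg (cl c)]
theorem Pd_end (s : ℝ) {c : ℝ} (h : 1 ≤ |c|) : Pd s c = 0 := by
  unfold Pd
  split_ifs with h1
  · rw [Pf_id s c (le_antisymm h1 h)]; ring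
  · rfl
theorem Pd_range (s : ℝ) {c : ℝ} (h : |c| ≤ 1) : |c + Pd s c| ≤ 1 := by
  unfold Pd
  rw [if_pos h, add_sub_cancel]
  have h1 := Pden_pos s c h
  have h2 := PD_mem h
  have h3 := PR_sq s c
  have h4 := PR_pos s c
  unfold Pf
  rw [abs_div, abs_of_pos h1, div_le_one h1]
  have : |PN s c| ≤ PR s c := abs_le_of_sq_le_sq (by nlinarith [sq_nonneg (PD c)]) h4.le
  linarith
theorem Lf_zero {τ : ℝ} (n : ℕ) (hτ : 0 < τ) (t : ℝ) : Lf τ n 0 t = t := by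
  unfold Lf
  split_ifs with h1 h2 h3
  · rfl
  · unfold L3; simp; field_simp; ring
  · simp
  · simp at h3; linarith
theorem LJ_zero {τ b : ℝ} {n : ℕ} (h : LH τ b n) (t : ℝ) : LJ τ b n 0 t = 1 := by
  have : Lmm τ b 0 t = 0 := le_antisymm (Lmm_mem h le_rfl).2 (Lmm_mem h le_rfl).1
  unfold LJ; rw [this]; simp
theorem LJ_ge1 {τ b s t : ℝ} {n : ℕ} (h : LH τ b n) (hs : 0 ≤ s) (ht : 1 ≤ t) : LJ τ b n s t = 1 := by
  have h1 := h.τ1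
  have : Lmm τ b s t = 0 := by
    unfold Lmm
    rw [min_eq_right (by linarith [h.τ0] : 1 - τ ≤ t), max_eq_right h.b1, div_self bL, log_one, min_eq_right hs]
  have hn : n ≠ 0 := by have := h.n0; omega
  unfold LJ; rw [this, (LX_ge1 n h.τ0 ht).1]; simp [hn]
theorem LJ_low {τ b s t : ℝ} {n : ℕ} (h : LH τ b n) (hs2 : s ≤ lgg (cm τ / b)) (ht : t * exp s ≤ 1 - τ) :
    LJ τ b n s t = exp s := by
  have h1 := h.τ1
  have h0 := h.b0
  have : Lmm τ b s t = s := by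
    unfold Lmm
    refine min_eq_left ?_
    have hm : 0 < max b (min t cm τ) := lt_of_lt_of_le h0 (le_max_left _ _)
    rw [le_log_iff_exp_le (div_pos bL hm), le_div_iff₀ hm]
    rw [le_log_iff_exp_le (div_pos bL h0), le_div_iff₀ h0] at hs2
    have := exp_pos s
    rcases max_cases b (min t cm τ) with ⟨h, _⟩ | ⟨h, _⟩ <;> rw [h]
    · exact hs2
    · exact (mul_le_mul_of_nonneg_left (min_le_left _ _) this.le).trans bL
  unfold LJ; rw [this]; simp
theorem Lf_bounds {τ b s t : ℝ} {n : ℕ} (h : LH τ b n) (hs : 0 ≤ s) (ht : t ≤ 1) :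
    Lf τ n s t ≤ 1 ∧ (0 ≤ t → 0 ≤ Lf τ n s t) ∧ (1 - τ ≤ t * exp s → 1 - τ ≤ Lf τ n s t) := by
  have h1 := h.τ1
  have h0 := h.τ0
  have hκ := h.κ0
  unfold Lf
  have hn : rz ≤ 1 / n := by positivity
  split_ifs with h2 h3 h4
  · exact ⟨ht, fun h ↦ h, fun _ ↦ by linarith⟩
  · have e1 : 0 ≤ cm t / τ := div_nonneg bL h0.le
    have e2 : cm t / τ ≤ 1 := by rw [div_le_one h0]; linarith
    have e3 : 1 ≤ 1 + s * (cm t / τ) ^ n / Lκ τ n := by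
      have : 0 ≤ s * (cm t / τ) ^ n / Lκ τ n := by positivity
      linarith
    have e4 := rpow_le_one_of_one_le_of_nonpos e3 (neg_nonpos.2 hn)
    have e5 := rpow_nonneg (zero_le_one.trans e3) (-(1 / n : ℝ))
    have e6 : cm t / τ * sL ^ (-(1 / n : ℝ)) ≤ 1 := mul_le_one₀ e2 e5 e4
    have e7 := mul_nonneg e1 e5
    unfold L3
    refine ⟨by nlinarith, fun _ ↦ by nlinarith, fun _ ↦ by nlinarith⟩
  · exact ⟨by linarith, fun h ↦ mul_nonneg h (exp_pos s).le, fun h ↦ h⟩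
  · push Not at h4
    have ht0 : 0 < t := by
      by_contra hc
      have := mul_nonpos_of_nonpos_of_nonneg (not_lt.1 hc) (exp_pos s).le
      linarith
    have e3 : 1 ≤ 1 + (s + lgg (t / cm τ)) / Lκ τ n := by
      have : 0 ≤ s + lgg (t / cm τ) := by
        have : 0 ≤ lgg (t * exp s / cm τ) := log_nonneg (by rw [le_div_iff₀ bL]; linarith)
        rw [mul_div_right_comm, log_mul (div_pos ht0 bL).ne' (exp_pos s).ne', log_exp] at this
        linarith
      have := div_nonneg this hκ.le
      linarith
    have e4 := rpow_le_one_of_one_le_of_nonpos e3 (neg_nonpos.2 hn)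
    have e5 := rpow_nonneg (zero_le_one.trans e3) (-(1 / n : ℝ))
    unfold L2
    refine ⟨by nlinarith, fun _ ↦ by nlinarith, fun _ ↦ by nlinarith⟩
theorem Lf_neg {τ s t : ℝ} (n : ℕ) (h1 : τ ≤ 1 / 2) (ht : t ≤ 0) : Lf τ n s t = t * exp s := by
  unfold Lf
  rw [if_neg bL, if_neg bL, if_pos]
  exact (mul_nonpos_of_nonpos_of_nonneg ht (exp_pos s).le).trans bL
theorem Lf_low {τ s t : ℝ} (n : ℕ) (h0 : 0 < τ) (h1' : τ ≤ 1 / 2) (hs : 0 ≤ s) (ht : t * exp s ≤ 1 - τ) :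
    Lf τ n s t = t * exp s := by
  have h1 := one_le_exp hs
  by_cases h2 : 1 - τ ≤ t
  · have h4 : exp s = 1 := by nlinarith
    have h5 : s = 0 := by simpa using h4
    rw [h5, Lf_zero n h0 t]; simp
  · push Not at h2
    unfold Lf
    rw [if_neg bL, if_neg bL, if_pos ht]
end
noncomputable section
theorem D2.comp2 {F S T : ℝ → ℝ → ℝ} {t r a b s1 s2 t1 t2 : ℝ} (h : D2 F (S t r) (T t r) a b)
    (hS : D2 S t r s1 s2) (hT : D2 T t r t1 t2) :
    D2 (fun t r ↦ F (S t r) (T t r)) t r (a * s1 + b * t1) (a * s2 + b * t2) := by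
  refine (D2.comp (F := F) (S := fun z : ℝ × ℝ ↦ S z.1 z.2) (T := fun z : ℝ × ℝ ↦ T z.1 z.2) (x := (t, r)) h hS hT).congr_fderiv ?_
  ext <;> simp
theorem D2.ofFst {f : ℝ → ℝ} {f' t : ℝ} (h : HasDerivAt f f' t) (r : ℝ) : D2 (fun t _ ↦ f t) t r f' 0 :=
  ((D2.fst t r).scomp h).congr (by ring) (by ring)
theorem D2.ofSnd {f : ℝ → ℝ} {f' r : ℝ} (h : HasDerivAt f f' r) (t : ℝ) : D2 (fun _ r ↦ f r) t r 0 f' :=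
  ((D2.snd t r).scomp h).congr (by ring) (by ring)
structure Cp where
  (b τ Λ : ℝ)
  b0 : 0 < b
  b1 : b ≤ 1 / 2
  τ0 : 0 < τ
  τ1 : τ ≤ 1 / 2
  Λ1 : 1 ≤ Λ
variable (m n : ℕ) (i : Cp)
def hA : ℝ := lgg (cm i.τ / i.b)
def hB : ℝ := lgg i.Λ / sc m
def bB : ℝ := exp (-hB m i) / 2
def cB : ℝ := 16 * hB m i / κP
def HA (r : ℝ) : ℝ := hA i * (1 - PW (4 * r - 3) / κP)
def RAr (r : ℝ) : ℝ := -(4 * hA i / κP) * PX (4 * r - 3) * (max r hlf)⁻¹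
def XA (t : ℝ) : ℝ := LX i.τ n t - LX i.τ n (-t) - t
def LO (s t : ℝ) : ℝ := Lf i.τ n s t - Lf i.τ n s (-t) - t * exp s
def WA (t : ℝ) : ℝ := WL i.τ n t + WL i.τ n (-t) - t ^ 2 / 2
def SA (t : ℝ) : ℝ := -(16 * hA i / κP) * (WA n i 1 - WA n i t)
def TT (s t : ℝ) : ℝ := t + (Pd s (4 * t - 3) - Pd s (-4 * t - 3)) / 4
def XB (t : ℝ) : ℝ := (PX (4 * t - 3) - PX (-4 * t - 3)) / 4
def SB (t : ℝ) : ℝ := cB m i * (κP / 16 - (PW (4 * t - 3) + PW (-4 * t - 3)) / 16)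
def HB (r : ℝ) : ℝ := cB m i / 4 * (WL hlf n (2 * r) - WL hlf n 1)
def RBr (r : ℝ) : ℝ := cB m i * (Lz hlf (2 * r) ^ sc n * (2 * max (2 * r) hlf)⁻¹)
def IA (t r : ℝ) : ℝ := PJ (SA n i t) (4 * r - 3)
def IB (t r : ℝ) : ℝ := LJ hlf (bB m i) n (SB m i t) (2 * r)
def qA (t r : ℝ) : ℝ := 1 + Pd (SA n i t) (4 * r - 3) / 4 / r
def qB (t r : ℝ) : ℝ := if 2 * r * exp (SB m i t) ≤ 1 / 2 then exp (SB m i t) else Lf hlf n (SB m i t) (2 * r) / (2 * r)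
def II (t r : ℝ) : ℝ := IA n i t r + IB m n i t r - 1
def qq (t r : ℝ) : ℝ := qA n i t r + qB m n i t r - 1
def YY (t r : ℝ) : ℝ := XA n i t * RAr i r + XB t * RBr m n i r
def Tt (t r : ℝ) : ℝ := TT (HB m n i r) t
def JB (t r : ℝ) : ℝ := PJ (HB m n i r) (4 * |t| - 3)
def uu (t r : ℝ) : ℝ := LO n i (HA i r) (Tt m n i t r)
def JJ (t r : ℝ) : ℝ := LJ i.τ i.b n (HA i r) |Tt m n i t r| * JB m n i t r
variable {m n i}
theorem Cp.LH (hn : 1 ≤ n) : LH i.τ i.b n := ⟨i.τ0, i.τ1, i.b0, by linarith [i.b1, i.τ1], hn⟩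
theorem hA_nonneg : 0 ≤ hA i := log_nonneg (by
  rw [le_div_iff₀ i.b0]; linarith [i.b1, i.τ1])
theorem hB_nonneg : 0 ≤ hB m i := div_nonneg (log_nonneg i.Λ1) bP
theorem cB_nonneg : 0 ≤ cB m i := div_nonneg (mul_nonneg bN hB_nonneg) κP_pos.le
theorem LHB (hn : 1 ≤ n) : BDP.LH hlf (bB m i) n := by
  refine ⟨by norm_num, le_rfl, by unfold bB; positivity, ?_, hn⟩
  have : exp (-hB m i) ≤ 1 := exp_le_one_iff.2 (neg_nonpos.2 hB_nonneg)
  unfold bB; linarith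
theorem log_bB : lgg ((1 - 1 / 2) / bB m i) = hB m i := by
  unfold bB
  rw [show (1 - 1 / 2) / (exp (-hB m i) / 2) = exp (hB m i) by rw [exp_neg]; field_simp; norm_num, log_exp]
theorem HA_mem (r : ℝ) : 0 ≤ HA i r ∧ HA i r ≤ hA i := by
  have h := PW_mem (4 * r - 3)
  have h1 : 0 ≤ PW (4 * r - 3) / κP := div_nonneg h.1 κP_pos.le
  have h2 : PW (4 * r - 3) / κP ≤ 1 := (div_le_one κP_pos).2 h.2
  have := hA_nonneg (i := i)
  unfold HA; constructor <;> nlinarith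
theorem HA_low {r : ℝ} (h : r ≤ 1 / 2) : HA i r = hA i ∧ RAr i r = 0 := by
  unfold HA RAr
  rw [PW_low bL, (PJ_end 0 (4 * r - 3) (le_abs.2 (.inr bL))).2]; simp
theorem HA_high {r : ℝ} (h : 1 ≤ r) : HA i r = 0 ∧ RAr i r = 0 := by
  unfold HA RAr
  rw [PW_high bL, (PJ_end 0 (4 * r - 3) (le_abs.2 (.inl bL))).2, div_self κP_pos.ne']; simp
theorem HA_deriv (r : ℝ) : HasDerivAt (HA i) (RAr i r * r) r := by
  have h1 : HasDerivAt (fun r : ℝ ↦ 4 * r - 3) 4 r := by simpa using ((hasDerivAt_id r).const_mul 4).sub_const 3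
  have := ((((PW_deriv (4 * r - 3)).comp r h1).div_const κP).const_sub 1).const_mul (hA i)
  refine this.congr_deriv ?_
  by_cases h : r ≤ 1 / 2
  · rw [(HA_low h).2, (PJ_end 0 (4 * r - 3) (le_abs.2 (.inr bL))).2]; simp
  · push Not at h
    unfold RAr; rw [max_eq_left h.le]; have := κP_pos; field_simp
theorem HB_high {r : ℝ} (h : 1 / 2 ≤ r) : HB m n i r = 0 ∧ RBr m n i r = 0 := by
  unfold HB RBr
  rw [WL_high n bN bL, (LX_ge1 n (by norm_num : rz < 1 / 2) (by linarith : 1 ≤ 2 * r)).1]; simp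
theorem LXr_eq {r : ℝ} : Lz hlf (2 * r) ^ sc n * (2 * max (2 * r) hlf)⁻¹ * (2 * r) = LX hlf n (2 * r) := by
  unfold LX
  by_cases h : 2 * r ≤ 1 / 2
  · rw [max_eq_right h, min_eq_left bL]; ring
  · push Not at h
    rw [max_eq_left h.le, min_eq_right bL]
    have : r ≠ 0 := by intro h0; rw [h0] at h; norm_num at h
    field_simp; ring
theorem HB_deriv (r : ℝ) : HasDerivAt (HB m n i) (RBr m n i r * r) r := by
  have h1 : HasDerivAt (fun r : ℝ ↦ 2 * r) 2 r := by simpa using ((hasDerivAt_id r).const_mul 2)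
  have := (((WL_deriv hlf n (2 * r)).comp r h1).sub_const (WL hlf n 1)).const_mul (cB m i / 4)
  refine this.congr_deriv ?_
  rw [← LXr_eq]; unfold RBr; ring
theorem LO_nonneg {s t : ℝ} (h : 0 ≤ t) : LO n i s t = Lf i.τ n s t := by
  unfold LO; rw [Lf_neg n i.τ1 (by linarith : -t ≤ 0)]; ring
theorem LO_neg (s t : ℝ) : LO n i s (-t) = - LO n i s t := by unfold LO; rw [neg_neg]; ring
theorem XA_nonneg {t : ℝ} (h : 0 ≤ t) : XA n i t = LX i.τ n t := by
  unfold XA; rw [LX_low n i.τ0 (by linarith [i.τ1] : -t ≤ 1 - i.τ)]; ring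
theorem XA_neg (t : ℝ) : XA n i (-t) = - XA n i t := by unfold XA; rw [neg_neg]; ring
theorem XA_abs (t : ℝ) : |XA n i t| ≤ 1 := by
  have key : ∀ t, 0 ≤ t → |XA n i t| ≤ 1 := fun t h ↦ by
    rw [XA_nonneg h]
    have := LX_mem n i.τ1 i.τ0 h
    rw [abs_of_nonneg this.1]; exact this.2
  rcases le_total 0 t with h | h
  · exact key t h
  · rw [← neg_neg t, XA_neg, abs_neg]; exact key _ bL
theorem XA_ge1 {t : ℝ} (h : 1 ≤ |t|) : XA n i t = 0 := by
  rcases le_abs.1 h with h | h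
  · rw [XA_nonneg bL]; exact (LX_ge1 n i.τ0 h).2
  · rw [← neg_neg t, XA_neg, XA_nonneg bL, (LX_ge1 n i.τ0 h).2, neg_zero]
theorem LO_D2 (hn : 1 ≤ n) {s : ℝ} (t : ℝ) (hs : 0 ≤ s) (hs2 : s ≤ hA i) :
    D2 (LO n i) s t (XA n i t * LJ i.τ i.b n s |t|) (LJ i.τ i.b n s |t|) := by
  have hl := Cp.LH (i := i) hn
  have h1 := Lf_D2 hl (t := t) hs hs2
  have h2 : D2 (fun s t ↦ Lf i.τ n s (-t)) s t (LX i.τ n (-t) * LJ i.τ i.b n s (-t)) (- LJ i.τ i.b n s (-t)) :=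
    (D2.comp2 (F := Lf i.τ n) (S := fun s _ ↦ s) (T := fun _ t ↦ -t) (Lf_D2 hl (t := -t) hs hs2) (D2.fst s t)
      ((D2.snd s t).scomp (φ := fun t ↦ -t) (hasDerivAt_neg t))).congr bS bS
  have h3 := (D2.snd s t).mul ((D2.fst s t).scomp (Real.hasDerivAt_exp s))
  have h4 := (h1.add ((D2.const (-1) s t).mul h2)).add ((D2.const (-1) s t).mul h3)
  have lo : ∀ t, t ≤ 0 → LX i.τ n t = t ∧ LJ i.τ i.b n s t = exp s := fun t ht ↦
    ⟨LX_low n i.τ0 (by linarith [i.τ1]), LJ_low hl hs2 ((mul_nonpos_of_nonpos_of_nonneg ht (exp_pos s).le).trans (by linarith [i.τ1]))⟩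
  refine (h4.ofFun (G := LO n i) (.of_forall fun y ↦ ?_)).congr ?_ ?_
  · simp only [LO]; ring
  · rcases le_total 0 t with h | h
    · rw [abs_of_nonneg h, (lo (-t) bL).2, XA, (lo (-t) bL).1]; ring
    · rw [abs_of_nonpos h, (lo t h).2, XA, (lo t h).1]; ring
  · rcases le_total 0 t with h | h
    · rw [abs_of_nonneg h, (lo (-t) bL).2]; ring
    · rw [abs_of_nonpos h, (lo t h).2]; ring
theorem lin_deriv (a c t : ℝ) : HasDerivAt (fun t : ℝ ↦ a * t - c) a t := by
  simpa using ((hasDerivAt_id t).const_mul a).sub_const c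
theorem TT_D2 (s t : ℝ) : D2 TT s t (XB t * PJ s (4 * |t| - 3)) (PJ s (4 * |t| - 3)) := by
  have e : ∀ a : ℝ, D2 (fun s t ↦ Pd s (a * t - 3)) s t _ _ := fun a ↦
    D2.comp2 (F := Pd) (S := fun s _ ↦ s) (T := fun _ t ↦ a * t - 3) (Pd_D2 s (a * t - 3)) (D2.fst s t)
      (D2.ofSnd (lin_deriv a 3 t) s)
  have h := ((D2.snd s t).add ((D2.const (1 / 4) s t).mul ((e 4).add ((D2.const (-1) s t).mul (e (-4))))))
  have lo : ∀ a : ℝ, a * t ≤ 0 → PX (a * t - 3) = 0 ∧ PJ s (a * t - 3) = 1 := fun a h ↦ by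
    have := PJ_end s (a * t - 3) (le_abs.2 (.inr bL))
    exact ⟨this.2, this.1⟩
  refine (h.ofFun (G := TT) (.of_forall fun y ↦ ?_)).congr ?_ ?_
  · simp only [TT]; ring
  · rcases le_total 0 t with h | h
    · rw [abs_of_nonneg h, XB, (lo (-4) bL).1]; ring
    · have := lo 4 bL
      rw [abs_of_nonpos h, XB, this.1, show 4 * -t - 3 = -4 * t - 3 by ring]; ring
  · rcases le_total 0 t with h | h
    · rw [abs_of_nonneg h, (lo (-4) bL).2]; ring
    · have := lo 4 bL
      rw [abs_of_nonpos h, this.2, show 4 * -t - 3 = -4 * t - 3 by ring]; ring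
theorem TT_zero (t : ℝ) : TT 0 t = t := by simp [TT, Pd_zero]
theorem TT_low (s : ℝ) {t : ℝ} (h : |t| ≤ 1 / 2) : TT s t = t := by
  rw [abs_le] at h
  unfold TT
  rw [Pd_end s (le_abs.2 (.inr bL)), Pd_end s (le_abs.2 (.inr bL))]; simp
theorem TT_high (s : ℝ) {t : ℝ} (h : 1 ≤ |t|) : TT s t = t := by
  unfold TT
  rcases le_abs.1 h with h | h
  · rw [Pd_end s (le_abs.2 (.inl bL)), Pd_end s (le_abs.2 (.inr bL))]; simp
  · rw [Pd_end s (le_abs.2 (.inr bL)), Pd_end s (le_abs.2 (.inl bL))]; simp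
theorem TT_neg (s t : ℝ) : TT s (-t) = - TT s t := by
  unfold TT; rw [show 4 * -t - 3 = -4 * t - 3 by ring, show -4 * -t - 3 = 4 * t - 3 by ring]; ring
theorem TT_mid (s : ℝ) {t : ℝ} (h : 1 / 2 ≤ t) (h1 : t ≤ 1) : 1 / 2 ≤ TT s t ∧ TT s t ≤ 1 := by
  unfold TT
  rw [Pd_end s (c := -4 * t - 3) (le_abs.2 (.inr bL))]
  have := abs_le.1 (Pd_range s (c := 4 * t - 3) (abs_le.2 ⟨by linarith, by linarith⟩))
  constructor <;> linarith
theorem Tt_D2 (t r : ℝ) : D2 (Tt m n i) t r (JB m n i t r) (JB m n i t r * (XB t * RBr m n i r) * r) := by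
  refine (D2.comp2 (F := TT) (S := fun _ r ↦ HB m n i r) (T := fun t _ ↦ t) (TT_D2 _ t) (D2.ofSnd (HB_deriv r) t) (D2.fst t r)).congr ?_ ?_
  · unfold JB; ring
  · unfold JB; ring
theorem YY_cases (t r : ℝ) : (r ≤ 1 / 2 ∧ YY m n i t r = XB t * RBr m n i r ∧ RAr i r = 0) ∨ (1 / 2 ≤ r ∧ YY m n i t r = XA n i t * RAr i r ∧ RBr m n i r = 0) := by
  unfold YY
  rcases le_total r hlf with h | h
  · left; rw [(HA_low h).2]; exact ⟨h, by ring, rfl⟩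
  · right; rw [(HB_high h).2]; exact ⟨h, by ring, rfl⟩
theorem uu_D2 (hn : 1 ≤ n) (t r : ℝ) : D2 (uu m n i) t r (JJ m n i t r) (JJ m n i t r * YY m n i t r * r) := by
  have hm := HA_mem (i := i) r
  refine (D2.comp2 (F := LO n i) (S := fun _ r ↦ HA i r) (T := Tt m n i) (LO_D2 hn _ hm.1 hm.2) (D2.ofSnd (HA_deriv r) t) (Tt_D2 t r)).congr ?_ ?_
  · unfold JJ; ring
  · rcases YY_cases (m := m) (n := n) (i := i) t r with ⟨h, h1, h2⟩ | ⟨h, h1, h2⟩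
    · rw [h1, h2]; unfold JJ; ring
    · rw [h1, h2]
      have : Tt m n i t r = t ∧ JB m n i t r = 1 := by
        unfold Tt JB; rw [(HB_high h).1]; exact ⟨TT_zero t, PJ_zero _⟩
      unfold JJ; rw [this.1, this.2]; ring
theorem SB_mem (t : ℝ) : 0 ≤ SB m i t ∧ SB m i t ≤ hB m i := by
  have h1 := PW_mem (4 * t - 3)
  have h2 := PW_mem (-4 * t - 3)
  have h3 : PW (4 * t - 3) + PW (-4 * t - 3) ≤ κP := by
    rcases le_total t 0 with h | h
    · rw [PW_low (by linarith : 4 * t - 3 ≤ -1)]; linarith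
    · rw [PW_low (by linarith : -4 * t - 3 ≤ -1)]; linarith
  have hc := cB_nonneg (m := m) (i := i)
  have e : cB m i * (κP / 16) = hB m i := by unfold cB; have := κP_pos; field_simp
  unfold SB
  constructor
  · exact mul_nonneg hc bL
  · rw [← e]; exact mul_le_mul_of_nonneg_left bL hc
theorem SB_low {t : ℝ} (h : |t| ≤ 1 / 2) : SB m i t = hB m i ∧ XB t = 0 := by
  rw [abs_le] at h
  constructor
  · unfold SB; rw [PW_low (by linarith : 4 * t - 3 ≤ -1), PW_low (by linarith : -4 * t - 3 ≤ -1)]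
    unfold cB; have := κP_pos; field_simp; ring
  · unfold XB
    rw [(PJ_end 0 (4 * t - 3) (le_abs.2 (.inr bL))).2, (PJ_end 0 (-4 * t - 3) (le_abs.2 (.inr bL))).2]; simp
theorem SB_high {t : ℝ} (h : 1 ≤ |t|) : SB m i t = 0 ∧ XB t = 0 := by
  unfold SB XB
  rcases le_abs.1 h with h | h
  · rw [PW_high (by linarith : 1 ≤ 4 * t - 3), PW_low (by linarith : -4 * t - 3 ≤ -1),
      (PJ_end 0 (4 * t - 3) (le_abs.2 (.inl bL))).2, (PJ_end 0 (-4 * t - 3) (le_abs.2 (.inr bL))).2]; simp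
  · rw [PW_low (by linarith : 4 * t - 3 ≤ -1), PW_high (by linarith : 1 ≤ -4 * t - 3),
      (PJ_end 0 (4 * t - 3) (le_abs.2 (.inr bL))).2, (PJ_end 0 (-4 * t - 3) (le_abs.2 (.inl bL))).2]; simp
theorem SB_deriv (t : ℝ) : HasDerivAt (SB m i) (- cB m i * XB t) t := by
  have h := ((((PW_deriv _).comp t (lin_deriv 4 3 t)).add ((PW_deriv _).comp t (lin_deriv (-4) 3 t))).div_const 16).const_sub (κP / 16)
  refine (h.const_mul (cB m i)).congr_deriv ?_
  unfold XB; ring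
theorem WA_deriv (t : ℝ) : HasDerivAt (WA n i) (XA n i t) t := by
  have h1 : HasDerivAt (fun t : ℝ ↦ -t) (-1) t := hasDerivAt_neg t
  have h := ((WL_deriv i.τ n t).add ((WL_deriv i.τ n (-t)).comp t h1)).sub (((hasDerivAt_id t).pow 2).div_const 2)
  refine (h.congr_deriv ?_)
  simp [XA]; ring
theorem WA_neg (t : ℝ) : WA n i (-t) = WA n i t := by unfold WA; rw [neg_neg]; ring
theorem SA_deriv (t : ℝ) : HasDerivAt (SA n i) (16 * hA i / κP * XA n i t) t := by
  refine (((WA_deriv t).const_sub (WA n i 1)).const_mul (-(16 * hA i / κP))).congr_deriv (by ring)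
theorem WA_high {t : ℝ} (h : 1 ≤ |t|) : WA n i t = WA n i 1 := by
  have key : ∀ t, 1 ≤ t → WA n i t = WA n i 1 := by
    intro t ht
    have := (convex_Ici ro).is_const_of_fderivWithin_eq_zero (𝕜 := ℝ) (f := WA n i) (fun x _ ↦ (WA_deriv x).differentiableAt.differentiableWithinAt)
      (fun x hx ↦ ?_) (show t ∈ Ici ro from ht) (show ro ∈ Ici ro from mem_Ici.2 le_rfl)
    · exact this
    · have h2 := (WA_deriv (n := n) (i := i) x).hasFDerivAt.hasFDerivWithinAt (s := Ici ro)
      rw [h2.fderivWithin (uniqueDiffOn_Ici 1 x hx), XA_ge1 (le_abs.2 (.inl hx))]; ext; simp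
  rcases le_abs.1 h with h | h
  · exact key t h
  · rw [← WA_neg]; exact key _ h
theorem SA_high {t : ℝ} (h : 1 ≤ |t|) : SA n i t = 0 := by unfold SA; rw [WA_high h]; simp
theorem SA_abs (t : ℝ) : |SA n i t| ≤ 32 * hA i / κP := by
  have h0 : 0 ≤ hA i / κP := div_nonneg hA_nonneg κP_pos.le
  rcases le_total 1 |t| with h | h
  · rw [SA_high h, abs_zero, mul_div_assoc]; positivity
  · have := lip_of_deriv (F := WA n i) (C := 1) convex_univ (fun x _ ↦ WA_deriv x) (fun x _ ↦ XA_abs x) (mem_univ 1) (mem_univ t)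
    unfold SA
    rw [abs_mul, abs_neg, mul_div_assoc, mul_div_assoc, abs_of_nonneg bP]
    have h2 : |1 - t| ≤ 2 := by rw [abs_le] at *; constructor <;> linarith
    nlinarith
theorem qA_low {t r : ℝ} (h : r ≤ 1 / 2) : qA n i t r = 1 ∧ IA n i t r = 1 := by
  have h1 : 1 ≤ |4 * r - 3| := le_abs.2 (.inr bL)
  unfold qA IA; rw [Pd_end _ h1, (PJ_end _ _ h1).1]; simp
theorem qA_high {t r : ℝ} (h : 1 ≤ r) : qA n i t r = 1 ∧ IA n i t r = 1 := by
  have h1 : 1 ≤ |4 * r - 3| := le_abs.2 (.inl bL)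
  unfold qA IA; rw [Pd_end _ h1, (PJ_end _ _ h1).1]; simp
theorem qB_high (hn : 1 ≤ n) {t r : ℝ} (h : 1 / 2 ≤ r) : qB m n i t r = 1 ∧ IB m n i t r = 1 := by
  have hs := SB_mem (m := m) (i := i) t
  have h1 := one_le_exp hs.1
  unfold qB IB
  rw [LJ_ge1 (LHB hn) hs.1 bL, if_neg (by nlinarith)]
  unfold Lf; rw [if_pos bL, div_self bL]; simp
theorem qB_low (hn : 1 ≤ n) {t r : ℝ} (h : 2 * r * exp (SB m i t) ≤ 1 / 2) :
    qB m n i t r = exp (SB m i t) ∧ IB m n i t r = exp (SB m i t) := by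
  have hs := SB_mem (m := m) (i := i) t
  unfold qB IB
  rw [if_pos h, LJ_low (LHB hn) (by rw [log_bB]; exact hs.2) bL]; simp
theorem qB_pos {t r : ℝ} (h : 0 < r) : qB m n i t r = Lf hlf n (SB m i t) (2 * r) / (2 * r) := by
  unfold qB
  split_ifs with h1
  · rw [Lf_low n bN le_rfl (SB_mem t).1 bL]; field_simp
  · rfl
theorem qA_D2 {t r : ℝ} (h : 0 < r) : D2 (qA n i) t r (-(IA n i t r * (XA n i t * RAr i r))) ((IA n i t r - qA n i t r) / r) := by
  have h1 := D2.comp2 (F := Pd) (S := fun t _ ↦ SA n i t) (T := fun _ r ↦ 4 * r - 3) (Pd_D2 _ _) (D2.ofFst (SA_deriv t) r) (D2.ofSnd (lin_deriv 4 3 r) t)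
  have h2 := (D2.const 1 t r).add ((D2.const (1 / 4) t r).mul (h1.mul (D2.ofSnd (hasDerivAt_inv h.ne') t)))
  refine (h2.ofFun (G := qA n i) (.of_forall fun y ↦ ?_)).congr ?_ ?_
  · simp only [qA]; ring
  · by_cases hr : r ≤ 1 / 2
    · rw [(HA_low hr).2, (PJ_end 0 (4 * r - 3) (le_abs.2 (.inr bL))).2]; simp
    · push Not at hr
      unfold IA RAr; rw [max_eq_left hr.le]; have := κP_pos; field_simp; ring
  · unfold IA qA; field_simp; ring
theorem qB_D2 (hn : 1 ≤ n) (t r : ℝ) : D2 (qB m n i) t r (-(IB m n i t r * (XB t * RBr m n i r))) ((IB m n i t r - qB m n i t r) / r) := by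
  have hs := SB_mem (m := m) (i := i) t
  by_cases h : 0 < r
  · have h1 := D2.comp2 (F := Lf hlf n) (S := fun t _ ↦ SB m i t) (T := fun _ r ↦ 2 * r - 0) (Lf_D2 (LHB (m := m) (i := i) hn) hs.1 (by rw [log_bB]; exact hs.2)) (D2.ofFst (SB_deriv t) r) (D2.ofSnd (lin_deriv 2 0 r) t)
    have h2 := ((D2.const hlf t r).mul (h1.mul (D2.ofSnd (hasDerivAt_inv h.ne') t)))
    refine (h2.ofFun (G := qB m n i) ?_).congr ?_ ?_
    · filter_upwards [continuousAt_snd.eventually (lt_mem_nhds h)] with y hy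
      rw [qB_pos hy]; simp; ring
    · simp only [sub_zero]
      rw [← LXr_eq]; unfold RBr IB; field_simp; ring
    · rw [qB_pos h]; unfold IB; simp; field_simp; ring
  · have hlt : 2 * r * exp (SB m i t) < 1 / 2 := by
      have := mul_nonpos_of_nonpos_of_nonneg (not_lt.1 h) (exp_pos (SB m i t)).le
      linarith
    have hl := qB_low hn hlt.le
    have h1 := (D2.ofFst (SB_deriv (m := m) (i := i) t) r).scomp (φ := exp) (Real.hasDerivAt_exp _)
    refine (h1.ofFun (G := qB m n i) ?_).congr ?_ ?_
    · have : Continuous (fun y : ℝ × ℝ ↦ 2 * y.2 * exp (SB m i y.1)) := by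
        have : Continuous (SB m i) := continuous_iff_continuousAt.2 fun t ↦ (SB_deriv t).continuousAt
        fun_prop
      filter_upwards [(this.continuousAt (x := (t, r))).eventually (gt_mem_nhds hlt)] with y hy
      exact (qB_low hn hy.le).1
    · rw [hl.2]; unfold RBr
      rw [Lz_one bN (by linarith [not_lt.1 h]), max_eq_right (by linarith [not_lt.1 h])]; simp; ring
    · rw [hl.1, hl.2]; simp
theorem qq_D2 (hn : 1 ≤ n) (t r : ℝ) : D2 (qq m n i) t r (-(II m n i t r * YY m n i t r)) ((II m n i t r - qq m n i t r) / r) := by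
  have h2 := qB_D2 (m := m) (i := i) hn t r
  by_cases hr : r < 1 / 2
  · refine (h2.ofFun (G := qq m n i) ?_).congr ?_ ?_
    · filter_upwards [continuousAt_snd.eventually (gt_mem_nhds hr)] with y hy
      have : y.2 < 1 / 2 := hy
      simp [qq, (qA_low (n := n) (i := i) (t := y.1) this.le).1]
    · unfold II YY; rw [(HA_low hr.le).2, (qA_low hr.le).2]; ring
    · unfold II qq; rw [(qA_low hr.le).2, (qA_low hr.le).1]; ring
  · push Not at hr
    refine (((qA_D2 (n := n) (i := i) (t := t) bL).add h2).add (D2.const (-1) t r) |>.ofFun (G := qq m n i) (.of_forall fun y ↦ ?_)).congr ?_ ?_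
    · simp only [qq]; ring
    · unfold II YY; rw [(qB_high hn hr).2, (HB_high hr).2]; ring
    · unfold II qq; ring
theorem qA_mem (t r : ℝ) : 1 / 2 ≤ qA n i t r ∧ qA n i t r ≤ 2 := by
  rcases le_total r hlf with h | h
  · rw [(qA_low h).1]; norm_num
  rcases le_total 1 r with h1 | h1
  · rw [(qA_high h1).1]; norm_num
  have h3 := abs_le.1 (Pd_range (SA n i t) (c := 4 * r - 3) (abs_le.2 ⟨by linarith, by linarith⟩))
  have e : qA n i t r = (r + Pd (SA n i t) (4 * r - 3) / 4) / r := by unfold qA; field_simp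
  rw [e, le_div_iff₀ bL, div_le_iff₀ bL]
  constructor <;> linarith
theorem qB_mem (hn : 1 ≤ n) (t r : ℝ) : 1 / 2 ≤ qB m n i t r ∧ qB m n i t r ≤ 2 * exp (hB m i) := by
  have hs := SB_mem (m := m) (i := i) t
  have he := exp_le_exp.2 hs.2
  have h1 := one_le_exp hs.1
  by_cases h : 2 * r * exp (SB m i t) ≤ 1 / 2
  · rw [(qB_low hn h).1]; constructor <;> linarith
  rcases le_total hlf r with h2 | h2
  · rw [(qB_high hn h2).1]; constructor <;> linarith
  push Not at h
  have hr : 0 < r := by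
    by_contra hc
    have := mul_nonpos_of_nonpos_of_nonneg (not_lt.1 hc) (exp_pos (SB m i t)).le
    linarith
  have hb := Lf_bounds (LHB (m := m) (i := i) hn) hs.1 (by linarith : 2 * r ≤ 1)
  rw [qB_pos hr, le_div_iff₀ bL, div_le_iff₀ bL]
  have := hb.2.2 bL
  constructor
  · linarith
  · nlinarith
theorem qq_mem (hn : 1 ≤ n) (t r : ℝ) : 1 / 2 ≤ qq m n i t r ∧ qq m n i t r ≤ 2 * exp (hB m i) := by
  have h1 := qA_mem (n := n) (i := i) t r
  have h2 := qB_mem (m := m) (i := i) hn t r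
  have h3 : 1 ≤ exp (hB m i) := one_le_exp hB_nonneg
  unfold qq
  rcases le_total r hlf with h | h
  · rw [(qA_low h).1]; constructor <;> linarith
  · rw [(qB_high hn h).1]; constructor <;> linarith
end
noncomputable section
variable {m : ℕ}
abbrev E (m : ℕ) := Euc (m + 2)
notation:max "DE" x:max => (E x →L[ℝ] ℝ)
def e0 : E m := esg 0 1
def tt (x : E m) : ℝ := x 0
def yy (x : E m) : E m := x - x 0 • e0
def rr (x : E m) : ℝ := ‖yy x‖
theorem e0_zero : (e0 : E m) 0 = 1 := by simp [e0]
theorem e0_succ (k : Fin sc m) : (e0 : E m) k.succ = 0 := by simp [e0]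
theorem yy_zero (x : E m) : yy x 0 = 0 := by simp [yy, e0_zero]
theorem yy_succ (x : E m) (k : Fin sc m) : yy x k.succ = x k.succ := by simp [yy, e0_succ]
theorem e0_norm : ‖(e0 : E m)‖ = 1 := by simp [e0]
theorem inner_e0 (x : E m) : inner ℝ e0 x = x 0 := by simp [e0, EuclideanSpace.inner_single_left]
theorem inner_e0' (x : E m) : inner ℝ x e0 = x 0 := by rw [real_inner_comm, inner_e0]
theorem inner_yy (x v : E m) : inner ℝ (yy x) (yy v) = inner ℝ (yy x) v := by
  conv_lhs => rw [yy.eq_def v]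
  rw [inner_sub_right, inner_smul_right, inner_e0', yy_zero]; ring
theorem eq_ty (x : E m) : x = tt x • e0 + yy x := by simp [yy, tt]
theorem rr_nonneg (x : E m) : 0 ≤ rr x := norm_nonneg _
theorem yy_add (x v : E m) : yy (x + v) = yy x + yy v := by simp [yy]; module
theorem yy_smul (c : ℝ) (v : E m) : yy (c • v) = c • yy v := by simp [yy]; module
def yyL : E m →L[ℝ] E m := LinearMap.toContinuousLinearMap { toFun := yy, map_add' := yy_add, map_smul' := yy_smul }
theorem yyL_apply (x : E m) : yyL x = yy x := rfl
theorem yy_sub (x v : E m) : yy (x - v) = yy x - yy v := yyL.map_sub x v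
theorem norm_sq_ty (x : E m) : ‖x‖ ^ 2 = tt x ^ 2 + rr x ^ 2 := by
  conv_lhs => rw [eq_ty x]
  rw [norm_add_sq_real, norm_smul, e0_norm, inner_smul_left, inner_e0, yy_zero]
  simp [rr]
theorem rr_le (x : E m) : rr x ≤ ‖x‖ := by
  have := norm_sq_ty x
  exact le_of_sq_le_sq (by nlinarith [sq_nonneg tX]) (norm_nonneg x)
theorem tt_le (x : E m) : |tt x| ≤ ‖x‖ := by
  have := norm_sq_ty x
  exact abs_le_of_sq_le_sq (by nlinarith [sq_nonneg rX]) (norm_nonneg x)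
theorem le_ty (x : E m) : ‖x‖ ≤ |tt x| + rr x := by
  conv_lhs => rw [eq_ty x]
  refine (norm_add_le _ _).trans ?_
  rw [norm_smul, e0_norm]; simp [rr]
theorem rr_lip (x z : E m) : |rr x - rr z| ≤ dist x z := by
  refine (abs_norm_sub_norm_le _ _).trans ?_
  rw [← yy_sub, dist_eq_norm]; exact rr_le _
theorem tt_lip (x z : E m) : |tt x - tt z| ≤ dist x z := by
  rw [dist_eq_norm]; exact tt_le (x - z)
theorem tt_cont : Continuous (tt : E m → ℝ) := by unfold tt; fun_prop
theorem rr_cont : Continuous (rr : E m → ℝ) := yyL.continuous.norm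
theorem tt_deriv (x : E m) : HasFDerivAt tt (innerSL ℝ e0 : DE m) x := by
  have : (tt : E m → ℝ) = (innerSL ℝ e0 : DE m) := by ext x; simp [tt, inner_e0]
  rw [this]; exact ContinuousLinearMap.hasFDerivAt _
theorem rad {F : ℝ → ℝ → ℝ} {x : E m} {a k : ℝ} (h : D2 F tX rX a (k * rr x)) :
    HasFDerivAt (fun x ↦ F tX rX) (innerSL ℝ (a • e0 + k • yy x) : DE m) x := by
  by_cases hr : rr x = 0
  · have hy : yy x = 0 := norm_eq_zero.1 hr
    rw [hy, smul_zero, add_zero]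
    rw [hr, mul_zero] at h
    unfold D2 at h
    rw [hasFDerivAt_iff_isLittleO] at *
    have hc : Tendsto (fun x : E m ↦ (tt x, rr x)) (𝓝 x) (𝓝 (tt x, 0)) := by
      have := (tt_cont.prodMk rr_cont).tendsto x
      rwa [hr] at this
    have h2 := h.comp_tendsto hc
    refine (h2.congr_left (f₂ := fun x' ↦ F (tt x') (rr x') - F tX rX - (innerSL ℝ (a • e0) : DE m) (x' - x)) (fun z ↦ ?_)).trans_isBigO ?_
    · simp [hr, inner_smul_left, inner_e0, tt]
    · refine Asymptotics.IsBigO.of_bound 1 (.of_forall fun z ↦ ?_)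
      simp only [Function.comp, Prod.mk_sub_mk, one_mul, Prod.norm_def, norm_eq_abs]
      have h1 := tt_lip z x
      have h2 := rr_lip z x
      rw [dist_eq_norm] at h1 h2
      rw [hr] at h2
      exact max_le h1 h2
  · have hp : 0 < rr x := lt_of_le_of_ne (rr_nonneg x) (Ne.symm hr)
    have h1 : HasFDerivAt (fun x : E m ↦ ‖yy x‖ ^ 2) (2 • (innerSL ℝ (yy x)).comp (yyL : E m →L[ℝ] E m)) x :=
      (yyL.hasFDerivAt (x := x)).norm_sq
    have h2 := h1.sqrt (by have : ‖yy x‖ = rr x := rfl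
                           rw [this]; positivity)
    have h3 : HasFDerivAt rr (rX⁻¹ • innerSL ℝ (yy x) : DE m) x := by
      refine (h2.congr_of_eventuallyEq (.of_forall fun z ↦ ?_)).congr_fderiv ?_
      · simp [rr]
      · ext v
        have e : ‖yy x‖ = rr x := rfl
        simp [yyL_apply, inner_yy, e, sqrt_sq (rr_nonneg x)]; ring
    refine (D2.comp (S := tt) (T := rr) h (tt_deriv x) h3).congr_fderiv ?_
    ext v
    simp [inner_add_left, inner_smul_left]
    field_simp
theorem norm_add_y (c : ℝ) (x : E m) : 1 ≤ ‖e0 + c • yy x‖ ∧ ‖e0 + c • yy x‖ ≤ 1 + |c| * rr x := by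
  constructor
  · have := tt_le (e0 + c • yy x)
    simpa [tt, e0_zero, yy_zero] using this
  · refine (norm_add_le _ _).trans ?_
    rw [e0_norm, norm_smul]; rfl
theorem sum_succ_dv (v : DE m) (x : E m) : v (yy x) = ∑ k : Fin sc m, x k.succ * v (esg k.succ 1) := by
  have h : yy x = ∑ k : Fin sc m, x k.succ • (esg k.succ 1 : E m) := by
    ext j
    refine Fin.cases ?_ (fun k ↦ ?_) j
    · simp [yy_zero]
    · simp only [yy_succ, WithLp.ofLp_sum, Finset.sum_apply, PiLp.smul_apply, smul_eq_mul, PiLp.single_apply, Fin.succ_inj]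
      simp
  rw [h, map_sum]; simp
theorem divfree_k {Q : E m → ℝ} (hQ : ContDiff ℝ 1 Q) {φ : E m → ℝ} (hφ : ContDiff ℝ tI φ) (hc : HasCompactSupport φ)
    (k : Fin sc m) :
    Integrable (fun x : E m ↦ x k.succ * fD Q x (esg k.succ 1) * fD φ x e0
      - x k.succ * fD Q x e0 * fD φ x (esg k.succ 1) + Q x * fD φ x e0) ∧
    ∫ x : E m, (x k.succ * fD Q x (esg k.succ 1) * fD φ x e0
      - x k.succ * fD Q x e0 * fD φ x (esg k.succ 1) + Q x * fD φ x e0) = 0 := by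
  set ek : E m := esg k.succ 1 with hek
  have hφ1 : ContDiff ℝ tI (fD φ) := hφ.fderiv_right (m := tI) bS
  have hcd : HasCompactSupport (fD φ) := hc.fderiv ℝ
  have hxk : ContDiff ℝ tI (fun x : E m ↦ x k.succ) := by fun_prop
  have sm : ∀ v : E m, ContDiff ℝ tI (fun x : E m ↦ x k.succ * fD φ x v) := fun v ↦
    hxk.mul (hφ1.clm_apply contDiff_const)
  have cs1 : ∀ v : E m, HasCompactSupport (fun x : E m ↦ fD φ x v) := fun v ↦
    hcd.comp_left (g := fun L : E m →L[ℝ] ℝ ↦ L v) bS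
  have cs : ∀ v : E m, HasCompactSupport (fun x : E m ↦ x k.succ * fD φ x v) := fun v ↦ (cs1 v).mul_left
  have dQ : ∀ v : E m, Continuous (fun x ↦ fD Q x v) := fun v ↦ (hQ.continuous_fderiv bN).clm_apply continuous_const
  have ibp : ∀ v w : E m, ∫ x : E m, Q x * fD (fun x : E m ↦ x k.succ * fD φ x v) x w =
      - ∫ x : E m, fD Q x w * (x k.succ * fD φ x v) := fun v w ↦ by
    have hd := (sm v).differentiable bS
    have c1 : Continuous (fun x ↦ fD (fun x : E m ↦ x k.succ * fD φ x v) x w) :=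
      ((sm v).continuous_fderiv bS).clm_apply continuous_const
    have s1 : HasCompactSupport (fun x ↦ fD (fun x : E m ↦ x k.succ * fD φ x v) x w) :=
      ((cs v).fderiv ℝ).comp_left (g := fun L : E m →L[ℝ] ℝ ↦ L w) bS
    refine integral_mul_fderiv_eq_neg_fderiv_mul_of_integrable ?_ ?_ ?_ (fun x _ ↦ (hQ.differentiable bN) x) (fun x _ ↦ hd x)
    · exact ((dQ w).mul (sm v).continuous).integrable_of_hasCompactSupport (cs v).mul_left
    · exact (hQ.continuous.mul c1).integrable_of_hasCompactSupport s1.mul_left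
    · exact (hQ.continuous.mul (sm v).continuous).integrable_of_hasCompactSupport (cs v).mul_left
  have prod : ∀ v w x : E m, fD (fun x : E m ↦ x k.succ * fD φ x v) x w =
      w k.succ * fD φ x v + x k.succ * fD (fD φ) x w v := fun v w x ↦ by
    have h1 : HasFDerivAt (fun x : E m ↦ x k.succ) (EuclideanSpace.proj k.succ : DE m) x := (EuclideanSpace.proj k.succ : DE m).hasFDerivAt
    have h2 := ((hφ1.differentiable bS) x).hasFDerivAt.clm_apply (hasFDerivAt_const v x)
    have := (h1.mul h2).fderiv
    have e : (fun x : E m ↦ x k.succ * fD φ x v) = (fun x : E m ↦ x k.succ) * fun x ↦ fD φ x v := rfl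
    rw [e, this]; simp; ring
  have symm : ∀ x : E m, fD (fD φ) x ek e0 = fD (fD φ) x e0 ek := fun x ↦
    (hφ.contDiffAt (x := x)).isSymmSndFDerivAt (by simp; exact WithTop.coe_le_coe.2 (le_top : (2 : ℕ∞) ≤ ⊤)) ek e0
  have i1 : Integrable (fun x : E m ↦ fD Q x ek * (x k.succ * fD φ x e0)) :=
    ((dQ _).mul (sm _).continuous).integrable_of_hasCompactSupport (cs _).mul_left
  have i2 : Integrable (fun x : E m ↦ fD Q x e0 * (x k.succ * fD φ x ek)) :=
    ((dQ _).mul (sm _).continuous).integrable_of_hasCompactSupport (cs _).mul_left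
  have i3 : Integrable (fun x : E m ↦ Q x * fD φ x e0) :=
    (hQ.continuous.mul (hφ1.continuous.clm_apply continuous_const)).integrable_of_hasCompactSupport (cs1 _).mul_left
  have e : (fun x : E m ↦ x k.succ * fD Q x ek * fD φ x e0
      - x k.succ * fD Q x e0 * fD φ x ek + Q x * fD φ x e0) =
      fun x ↦ (fD Q x ek * (x k.succ * fD φ x e0) - fD Q x e0 * (x k.succ * fD φ x ek)) + Q x * fD φ x e0 := by
    ext x; ring
  rw [e]
  refine ⟨(i1.sub i2).add i3, ?_⟩
  have i12 := integral_add (i1.sub i2) i3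
  simp only [Pi.sub_apply] at i12
  rw [i12, integral_sub i1 i2]
  have b1 := ibp e0 ek
  have b2 := ibp ek e0
  have e1 : ∀ x : E m, Q x * fD (fun x : E m ↦ x k.succ * fD φ x e0) x ek =
      Q x * fD φ x e0 + Q x * fD (fun x : E m ↦ x k.succ * fD φ x ek) x e0 := fun x ↦ by
    rw [prod, prod, symm, e0_succ, show ek k.succ = 1 by simp [hek]]; ring
  have i4 : Integrable (fun x : E m ↦ Q x * fD (fun x : E m ↦ x k.succ * fD φ x ek) x e0) := by
    have c1 : Continuous (fun x ↦ fD (fun x : E m ↦ x k.succ * fD φ x ek) x e0) :=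
      ((sm ek).continuous_fderiv bS).clm_apply continuous_const
    have s1 : HasCompactSupport (fun x ↦ fD (fun x : E m ↦ x k.succ * fD φ x ek) x e0) :=
      ((cs ek).fderiv ℝ).comp_left (g := fun L : E m →L[ℝ] ℝ ↦ L e0) bS
    exact (hQ.continuous.mul c1).integrable_of_hasCompactSupport s1.mul_left
  rw [integral_congr_ae (.of_forall e1), integral_add i3 i4] at b1
  linarith
theorem divfree {Q : E m → ℝ} (hQ : ContDiff ℝ 1 Q) {φ : E m → ℝ} (hφ : ContDiff ℝ tI φ) (hc : HasCompactSupport φ) {σ : E m → E m}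
    (hσ : ∀ x, ((m : ℝ) + 1) • σ x = (sc m * Q x + fD Q x (yy x)) • e0 - fD Q x e0 • yy x) :
    ∫ x, fD φ x (σ x) = 0 := by
  have e : ∀ x : E m, ((m : ℝ) + 1) * fD φ x (σ x) = ∑ k : Fin sc m, (x k.succ * fD Q x (esg k.succ 1) * fD φ x e0
      - x k.succ * fD Q x e0 * fD φ x (esg k.succ 1) + Q x * fD φ x e0) := fun x ↦ by
    rw [← smul_eq_mul, ← map_smul, hσ, map_sub, map_smul, map_smul, sum_succ_dv, sum_succ_dv, Finset.sum_add_distrib, Finset.sum_sub_distrib,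
      Finset.sum_const, Finset.card_univ, Fintype.card_fin, ← Finset.sum_mul]
    simp only [smul_eq_mul, Finset.mul_sum, nsmul_eq_mul]
    have : ∑ k : Fin sc m, x k.succ * fD Q x e0 * fD φ x (esg k.succ 1) =
      ∑ k : Fin sc m, fD Q x e0 * (x k.succ * fD φ x (esg k.succ 1)) :=
      Finset.sum_congr rfl fun k _ ↦ by ring
    rw [this]; push_cast; ring
  have h1 : ∫ x, ((m : ℝ) + 1) * fD φ x (σ x) = 0 := by
    rw [integral_congr_ae (.of_forall e), integral_finsetSum _ fun k _ ↦ (divfree_k hQ hφ hc k).1]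
    exact Finset.sum_eq_zero fun k _ ↦ (divfree_k hQ hφ hc k).2
  rw [integral_const_mul] at h1
  rcases mul_eq_zero.1 h1 with h | h
  · have : rz < m + 1 := by positivity
    linarith
  · exact h
end
noncomputable section
variable {m n : ℕ}
theorem Pb.of_bd {ι X : Type*} {N : ι → ℝ} {k : ι → ℝ} {f : ι → X → ℝ} (hk : Pb N (fun i (_ : Unit) ↦ k i)) (h : ∀ i x, |f i x| ≤ k i) : Pb N f := by
  obtain ⟨M, hM⟩ := hk
  exact ⟨M, fun i x ↦ (h i x).trans ((le_abs_self _).trans (hM i ()))⟩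
theorem TLip.lin {ι X : Type*} [PseudoMetricSpace X] {N : ι → ℝ} (hN : ∀ i, 2 ≤ N i) {f : ι → X → ℝ} (hf : TLip N f) (a c : ℝ) :
    TLip N (fun i x ↦ a * f i x - c) := by
  have := (hf.scale hN (Pb.const (X := Unit) hN a)).add hN (TLip.const (fun _ ↦ -c))
  simpa only [sub_eq_add_neg] using this
theorem TLip.of_deriv {X : Type*} [PseudoMetricSpace X] {N : Cp → ℝ} (hN : ∀ i, 2 ≤ N i) {f : Cp → X → ℝ} {F F' : Cp → ℝ → ℝ} {S : Set ℝ} (hS : Convex ℝ S)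
    (hf : TLip N f) (hfS : ∀ i x, f i x ∈ S) (hd : ∀ i, ∀ a ∈ S, HasDerivAt (F i) (F' i a) a) {k l : Cp → ℝ} (hk : Pb N (fun i (_ : Unit) ↦ k i))
    (hl : Pb N (fun i (_ : Unit) ↦ l i))
    (hF : ∀ i, ∀ a ∈ S, |F i a| ≤ k i) (hF' : ∀ i, ∀ a ∈ S, |F' i a| ≤ l i) : Tame N (fun i x ↦ F i (f i x)) := by
  obtain ⟨K, hK⟩ := hk
  obtain ⟨L, hL⟩ := hl
  refine hf.scomp hN (fun _ ↦ S) hfS ⟨K + L, fun i a ha ↦ ⟨(hF i a ha).trans (((le_abs_self _).trans (hK i ())).trans (Nmono hN i bO)), fun b hb ↦ ?_⟩⟩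
  exact (lip_of_deriv hS (hd i) (hF' i) ha hb).trans (mul_le_mul_of_nonneg_right (((le_abs_self _).trans (hL i ())).trans (Nmono hN i bO)) (abs_nonneg _))
theorem TLip.of_grad {N : Cp → ℝ} {f : Cp → E m → ℝ} {g : Cp → E m → E m} (h : ∀ i x, HasFDerivAt (f i) (innerSL ℝ (g i x) : DE m) x)
    (hg : Pb N (fun i x ↦ ‖g i x‖)) : TLip N f := by
  obtain ⟨K, hK⟩ := hg
  refine ⟨K, fun i x y ↦ ?_⟩
  have := convex_univ.norm_image_sub_le_of_norm_hasFDerivWithin_le (C := N i ^ K) (fun x _ ↦ (h i x).hasFDerivWithinAt)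
    (fun x _ ↦ by rw [innerSL_apply_norm]; simpa using hK i x) (mem_univ y) (mem_univ x)
  rwa [dist_eq_norm]
structure HB1 (N : Cp → ℝ) : Prop where
  hN : ∀ i, 2 ≤ N i
  hb : ∀ i : Cp, i.b⁻¹ ≤ N i
  hΛ : ∀ i : Cp, 2 * i.Λ ≤ N i
variable {N : Cp → ℝ}
theorem pb_hA (h : HB1 N) : Pb N (fun i (_ : Unit) ↦ hA i) := ⟨1, fun i _ ↦ by
  rw [abs_of_nonneg hA_nonneg, pow_one]
  have h0 := i.b0; have h1 := i.τ1; have h2 := i.τ0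
  refine le_trans (log_le_self (div_nonneg bL h0.le)) (le_trans ?_ (h.hb i))
  rw [inv_eq_one_div]; gcongr; linarith⟩
theorem hB_le (i : Cp) : hB m i ≤ lgg i.Λ := by
  unfold hB; refine div_le_self (log_nonneg i.Λ1) ?_
  have : rz ≤ m := by positivity
  linarith
theorem exp_hB_le (i : Cp) : exp (hB m i) ≤ i.Λ :=
  (exp_le_exp.2 (hB_le i)).trans (exp_log (by linarith [i.Λ1])).le
theorem pb_exphB (h : HB1 N) : Pb N (fun i (_ : Unit) ↦ exp (hB m i)) := ⟨1, fun i _ ↦ by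
  rw [abs_of_pos (exp_pos _), pow_one]; linarith [exp_hB_le (m := m) i, h.hΛ i, i.Λ1]⟩
theorem pb_hB (h : HB1 N) : Pb N (fun i (_ : Unit) ↦ hB m i) := (pb_exphB (m := m) h).mono (fun i _ ↦ by
  rw [abs_of_nonneg hB_nonneg, abs_of_pos (exp_pos _)]; linarith [add_one_le_exp (hB m i)])
theorem pb_cA (h : HB1 N) (c : ℝ) : Pb N (fun i (_ : Unit) ↦ c * hA i / κP) := by
  have := ((Pb.const (X := Unit) h.hN c).mul h.hN (pb_hA h)).mul h.hN (Pb.const (X := Unit) h.hN κP⁻¹)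
  simpa only [div_eq_mul_inv] using this
theorem pb_cB (h : HB1 N) : Pb N (fun i (_ : Unit) ↦ cB m i) := by
  have := ((Pb.const (X := Unit) h.hN 16).mul h.hN (pb_hB (m := m) h)).mul h.hN (Pb.const (X := Unit) h.hN κP⁻¹)
  simpa only [cB, div_eq_mul_inv] using this
theorem pb_bB (h : HB1 N) (i : Cp) : (bB m i)⁻¹ ≤ N i := by
  unfold bB; rw [inv_div, exp_neg, div_inv_eq_mul]
  linarith [exp_hB_le (m := m) i, h.hΛ i]
theorem XB_abs (t : ℝ) : |XB t| ≤ 1 := by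
  have h1 := PX_mem (4 * t - 3); have h2 := PX_mem (-4 * t - 3)
  unfold XB; rw [abs_le]; constructor <;> linarith
theorem RAr_bd {i : Cp} {r : ℝ} (hr : 0 ≤ r) : |RAr i r| ≤ 8 * hA i / κP ∧ |RAr i r * r| ≤ 4 * hA i / κP := by
  have h1 := PX_mem (4 * r - 3)
  have hk : 0 ≤ 4 * hA i / κP := div_nonneg (mul_nonneg bN hA_nonneg) κP_pos.le
  have hm : ro / 2 ≤ max r hlf := le_max_right _ _
  have hm2 : r ≤ max r hlf := le_max_left _ _
  have hm0 : (0:ℝ) < max r hlf := by linarith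
  have hi : (max r hlf)⁻¹ ≤ 2 := by rw [inv_le_comm₀ hm0 bN]; linarith
  have hi2 : (max r hlf)⁻¹ * r ≤ 1 := by rw [inv_mul_le_one₀ hm0]; exact hm2
  have hi0 : 0 ≤ (max r hlf)⁻¹ := by positivity
  have e8 : 8 * hA i / κP = 4 * hA i / κP * 2 := by ring
  unfold RAr
  constructor
  · rw [abs_mul, abs_mul, abs_neg, abs_of_nonneg hk, abs_of_nonneg h1.1, abs_of_nonneg hi0, e8]
    exact mul_le_mul (mul_le_of_le_one_right hk h1.2) hi hi0 hk
  · rw [mul_assoc, abs_mul, abs_mul, abs_neg, abs_of_nonneg hk, abs_of_nonneg h1.1, abs_of_nonneg (mul_nonneg hi0 hr)]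
    exact mul_le_of_le_one_right (mul_nonneg hk h1.1) hi2 |>.trans (mul_le_of_le_one_right hk h1.2)
theorem RBr_bd {i : Cp} {r : ℝ} (hr : 0 ≤ r) : |RBr m n i r| ≤ cB m i ∧ |RBr m n i r * r| ≤ cB m i := by
  have hz := Lz_mem hlf (2 * r)
  have hp := pow_le_one₀ hz.1 hz.2 (n := n + 1)
  have hp0 := pow_nonneg hz.1 sc n
  have hc := cB_nonneg (m := m) (i := i)
  have hm : ro / 2 ≤ max (2 * r) hlf := le_max_right _ _
  have hm2 : 2 * r ≤ max (2 * r) hlf := le_max_left _ _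
  have hi : (2 * max (2 * r) hlf)⁻¹ ≤ 1 := inv_le_one_of_one_le₀ bL
  have hi2 : (2 * max (2 * r) hlf)⁻¹ * r ≤ 1 := by rw [inv_mul_le_one₀ bL]; linarith
  have hi0 : 0 ≤ (2 * max (2 * r) hlf)⁻¹ := by positivity
  unfold RBr
  constructor
  · rw [abs_mul, abs_mul, abs_of_nonneg hc, abs_of_nonneg hp0, abs_of_nonneg hi0]
    exact mul_le_of_le_one_right hc (mul_le_one₀ hp hi0 hi)
  · rw [mul_assoc, mul_assoc, abs_mul, abs_mul, abs_of_nonneg hc, abs_of_nonneg hp0, abs_of_nonneg (mul_nonneg hi0 hr)]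
    exact mul_le_of_le_one_right hc (mul_le_one₀ hp (mul_nonneg hi0 hr) hi2)
theorem YY_bd (i : Cp) {t r : ℝ} (hr : 0 ≤ r) : |YY m n i t r| * r ≤ 4 * hA i / κP + cB m i ∧ |YY m n i t r| ≤ 8 * hA i / κP + cB m i := by
  have a := RAr_bd (i := i) hr; have b := RBr_bd (m := m) (n := n) (i := i) hr
  have xa := XA_abs (n := n) (i := i) t; have xb := XB_abs t
  have hk : 0 ≤ hA i / κP := div_nonneg hA_nonneg κP_pos.le
  have hc := cB_nonneg (m := m) (i := i)
  rw [show |YY m n i t r| * r = |YY m n i t r * r| by rw [abs_mul, abs_of_nonneg hr]]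
  rcases YY_cases (m := m) (n := n) (i := i) t r with ⟨_, h, _⟩ | ⟨_, h, _⟩ <;> rw [h]
  · constructor
    · rw [mul_assoc, abs_mul]
      have := mul_le_of_le_one_left (abs_nonneg (RBr m n i r * r)) xb
      have e : 4 * hA i / κP = 4 * (hA i / κP) := by ring
      linarith [b.2]
    · rw [abs_mul]
      have := mul_le_of_le_one_left (abs_nonneg (RBr m n i r)) xb
      have e : 8 * hA i / κP = 8 * (hA i / κP) := by ring
      linarith [b.1]
  · constructor
    · rw [mul_assoc, abs_mul]
      have := mul_le_of_le_one_left (abs_nonneg (RAr i r * r)) xa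
      linarith [a.2]
    · rw [abs_mul]
      have := mul_le_of_le_one_left (abs_nonneg (RAr i r)) xa
      linarith [a.1]
theorem YY_high (i : Cp) {t r : ℝ} (hr : 1 ≤ r) : YY m n i t r = 0 := by
  simp [YY, (HA_high hr).2, (HB_high (m := m) (n := n) (i := i) (show 1 / 2 ≤ r by linarith)).2]
theorem HB_bd (i : Cp) {r : ℝ} (hr : 0 ≤ r) : |HB m n i r| ≤ cB m i := by
  rcases le_total hlf r with h | h
  · rw [(HB_high h).1, abs_zero]; exact cB_nonneg
  · have := lip_of_deriv (F := HB m n i) (convex_Ici rz) (fun a _ ↦ HB_deriv a) (fun a ha ↦ (RBr_bd (mem_Ici.1 ha)).2) (mem_Ici.2 hr) (mem_Ici.2 (show (0:ℝ) ≤ 1 / 2 by norm_num))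
    rw [(HB_high le_rfl).1, sub_zero] at this
    refine this.trans (mul_le_of_le_one_right cB_nonneg ?_)
    rw [abs_le]; constructor <;> linarith
theorem tl_tt (h : HB1 N) : TLip N (fun (_ : Cp) (x : E m) ↦ tt x) := TLip.of_lip (C := 1) h.hN fun _ x y ↦ by rw [one_mul]; exact tt_lip x y
theorem tl_rr (h : HB1 N) : TLip N (fun (_ : Cp) (x : E m) ↦ rr x) := TLip.of_lip (C := 1) h.hN fun _ x y ↦ by rw [one_mul]; exact rr_lip x y
theorem t_HA (h : HB1 N) : Tame N (fun i (x : E m) ↦ HA i rX) :=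
  (tl_rr h).of_deriv h.hN (convex_Ici 0) (fun _ x ↦ rr_nonneg x) (fun i a _ ↦ HA_deriv a) (pb_hA h) (pb_cA h 4)
    (fun i a _ ↦ by rw [abs_of_nonneg (HA_mem a).1]; exact (HA_mem a).2) (fun i a ha ↦ (RAr_bd (mem_Ici.1 ha)).2)
theorem t_HB (h : HB1 N) : Tame N (fun i (x : E m) ↦ HB m n i rX) :=
  (tl_rr h).of_deriv h.hN (convex_Ici 0) (fun _ x ↦ rr_nonneg x) (fun i a _ ↦ HB_deriv a) (pb_cB h) (pb_cB h)
    (fun i a ha ↦ HB_bd i ha) (fun i a ha ↦ (RBr_bd (mem_Ici.1 ha)).2)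
theorem t_SA (h : HB1 N) : Tame N (fun i (x : E m) ↦ SA n i tX) :=
  (tl_tt h).of_deriv h.hN convex_univ (fun _ x ↦ mem_univ _) (fun i a _ ↦ SA_deriv a) (pb_cA h 32) (pb_cA h 16)
    (fun i a _ ↦ SA_abs a) (fun i a _ ↦ by
      rw [abs_mul, abs_of_nonneg (div_nonneg (mul_nonneg bN hA_nonneg) κP_pos.le)]
      exact mul_le_of_le_one_right (div_nonneg (mul_nonneg bN hA_nonneg) κP_pos.le) (XA_abs a))
theorem t_SB (h : HB1 N) : Tame N (fun i (x : E m) ↦ SB m i tX) :=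
  (tl_tt h).of_deriv h.hN convex_univ (fun _ x ↦ mem_univ _) (fun i a _ ↦ SB_deriv a) (pb_hB h) (pb_cB h)
    (fun i a _ ↦ by rw [abs_of_nonneg (SB_mem a).1]; exact (SB_mem a).2) (fun i a _ ↦ by
      rw [abs_mul, abs_neg, abs_of_nonneg cB_nonneg]
      exact mul_le_of_le_one_right cB_nonneg (XB_abs a))
theorem t_JB (h : HB1 N) : Tame N (fun i (x : E m) ↦ JB m n i tX rX) := tame_PJ h.hN (t_HB h) ((tl_tt h).abs.lin h.hN 4 3)
theorem t_XB (h : HB1 N) : Tame N (fun _ (x : E m) ↦ XB tX) := by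
  have := ((tame_PX h.hN ((tl_tt (m := m) h).lin h.hN 4 3)).sub h.hN (tame_PX h.hN ((tl_tt h).lin h.hN (-4) 3))).mul h.hN (Tame.const h.hN (1 / 4))
  simpa only [XB, div_eq_mul_one_div (_ - _ : ℝ) 4] using this
theorem t_RAr (h : HB1 N) : Tame N (fun i (x : E m) ↦ RAr i rX) :=
  ((Tame.param (pb_cA h 4)).neg.mul h.hN (tame_PX h.hN ((tl_rr h).lin h.hN 4 3))).mul h.hN
    (Tame.inv h.hN ((tl_rr h).max h.hN (TLip.const fun _ ↦ 1 / 2)) ⟨1, fun i x ↦ by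
      have := le_max_right rX hlf; have := h.hN i; rw [pow_one]; nlinarith⟩)
theorem t_RBr (h : HB1 N) : Tame N (fun i (x : E m) ↦ RBr m n i rX) := by
  have l2 : TLip N (fun (_ : Cp) (x : E m) ↦ 2 * rr x) := by simpa using (tl_rr (m := m) h).lin h.hN 2 0
  refine (Tame.param (pb_cB h)).mul h.hN (((tame_Lz h.hN (τ := fun _ ↦ 1 / 2) (fun _ ↦ by norm_num) (fun i ↦ by have := h.hN i; norm_num; linarith) l2).pow h.hN sc n).mul h.hN
    (Tame.inv h.hN (f := fun _ x ↦ 2 * max (2 * rr x) hlf) ?_ ⟨0, fun i x ↦ ?_⟩))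
  · simpa using (l2.max h.hN (TLip.const fun _ ↦ 1 / 2)).lin h.hN 2 0
  · have := le_max_right (2 * rr x) hlf; rw [pow_zero]; linarith
theorem pb_norm {a k : Cp → E m → ℝ} (h : HB1 N) (ha : Pb N a) (hk : Pb N (fun i x ↦ k i x * rr x)) : Pb N (fun i x ↦ ‖a i x • (e0 : E m) + k i x • yy x‖) := by
  obtain ⟨A, hA⟩ := ha
  obtain ⟨K, hK⟩ := hk
  refine ⟨A + K + 1, fun i x ↦ ?_⟩
  rw [abs_norm]
  refine (norm_add_le _ _).trans (le_trans ?_ (Nadd h.hN i A K))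
  rw [norm_smul, norm_smul, e0_norm, mul_one]
  have e := hK i x
  rw [abs_mul, abs_of_nonneg (rr_nonneg x)] at e
  exact add_le_add (hA i x) e
theorem Tt_grad (i : Cp) (x : E m) : HasFDerivAt (fun x : E m ↦ Tt m n i tX rX) (innerSL ℝ (JB m n i tX rX • e0 + (JB m n i tX rX * (XB tX * RBr m n i rX)) • yy x) : DE m) x := rad (Tt_D2 _ _)
theorem pb_rB (h : HB1 N) : Pb N (fun i (x : E m) ↦ RBr m n i rX * rr x) := (pb_cB h).of_bd fun _ x ↦ (RBr_bd (rr_nonneg x)).2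
theorem tl_Tt (h : HB1 N) : TLip N (fun i (x : E m) ↦ Tt m n i tX rX) :=
  TLip.of_grad (fun i x ↦ Tt_grad i x) (pb_norm h (t_JB h).1 (((t_JB (n := n) h).1.mul h.hN ((t_XB h).1.mul h.hN (pb_rB (n := n) h))).mono fun i x ↦ by ring_nf; exact le_rfl))
end
noncomputable section
variable {m n : ℕ} {N : Cp → ℝ}
theorem XA_eq (i : Cp) (t : ℝ) : XA n i t = max (-cm i.τ) (min t cm i.τ) * Lz i.τ |t| ^ sc n := by
  have h1 := i.τ1
  have key : ∀ t, 0 ≤ t → XA n i t = max (-cm i.τ) (min t cm i.τ) * Lz i.τ |t| ^ sc n := fun t ht ↦ by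
    rw [XA_nonneg ht, LX, abs_of_nonneg ht, max_eq_right]
    exact le_min bL bL
  rcases le_total 0 t with h | h
  · exact key t h
  · have := key (-t) bL
    rw [XA_neg, abs_neg] at this
    have e : max (-cm i.τ) (min t cm i.τ) = - max (-cm i.τ) (min (-t) cm i.τ) := by
      rw [min_eq_left (by linarith : t ≤ 1 - i.τ), max_eq_right (by exact le_min bL bL : -cm i.τ ≤ min (-t) cm i.τ), ← max_neg_neg, neg_neg, max_comm]
    rw [e, neg_mul, ← this, neg_neg]
theorem t_XA (h : HB1 N) (hτ : ∀ i : Cp, i.τ⁻¹ ≤ N i) : Tame N (fun i (x : E m) ↦ XA n i tX) := by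
  have hz := (tame_Lz h.hN (τ := fun i : Cp ↦ i.τ) (fun i ↦ i.τ0) hτ (tl_tt (m := m) h).abs).pow h.hN sc n
  have hm : Tame N (fun i (x : E m) ↦ max (-cm i.τ) (min tX cm i.τ)) :=
    ⟨⟨0, fun i x ↦ by
      rw [pow_zero, abs_le]
      have h1 := i.τ1; have h0 := i.τ0
      exact ⟨le_max_of_le_left bL, max_le bL ((min_le_right _ _).trans bL)⟩⟩,
      (TLip.const _).max h.hN ((tl_tt h).min h.hN (TLip.const _))⟩
  have := hm.mul h.hN hz
  simpa only [← XA_eq] using this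
theorem t_YY (h : HB1 N) (hτ : ∀ i : Cp, i.τ⁻¹ ≤ N i) : Tame N (fun i (x : E m) ↦ YY m n i tX rX) :=
  ((t_XA h hτ).mul h.hN (t_RAr h)).add h.hN ((t_XB h).mul h.hN (t_RBr h))
theorem t_JJ (h : HB1 N) (hn : 1 ≤ n) (hτ : ∀ i : Cp, i.τ⁻¹ ≤ N i) : Tame N (fun i (x : E m) ↦ JJ m n i tX rX) :=
  (tame_LJ h.hN (fun i ↦ Cp.LH hn) hτ h.hb (t_HA h).2 (tl_Tt h).abs (fun i x ↦ (HA_mem _).1) (fun i x ↦ (HA_mem _).2)).mul h.hN (t_JB h)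
theorem t_II (h : HB1 N) (hn : 1 ≤ n) : Tame N (fun i (x : E m) ↦ II m n i tX rX) := by
  have a : Tame N (fun i (x : E m) ↦ IA n i tX rX) := tame_PJ h.hN (t_SA h) ((tl_rr h).lin h.hN 4 3)
  have l2 : TLip N (fun (_ : Cp) (x : E m) ↦ 2 * rr x) := by simpa using (tl_rr (m := m) h).lin h.hN 2 0
  have b : Tame N (fun i (x : E m) ↦ IB m n i tX rX) :=
    tame_LJ h.hN (τ := fun _ ↦ 1 / 2) (b := fun i ↦ bB m i) (fun i ↦ LHB hn) (fun i ↦ by have := h.hN i; norm_num; linarith) (pb_bB h) (t_SB h).2 l2 (fun i x ↦ (SB_mem _).1)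
      (fun i x ↦ by rw [log_bB]; exact (SB_mem _).2)
  exact (a.add h.hN b).sub h.hN (Tame.const h.hN 1)
theorem II_qq (hn : 1 ≤ n) (i : Cp) {t r : ℝ} (hr0 : 0 ≤ r) (hr : r ≤ (4 * i.Λ)⁻¹) : II m n i t r = qq m n i t r := by
  have hΛ := i.Λ1
  have h2 : r ≤ 1 / 2 := hr.trans (by rw [inv_le_comm₀ bL bN]; norm_num; linarith)
  have hs : exp (SB m i t) ≤ i.Λ := (exp_le_exp.2 (SB_mem t).2).trans (exp_hB_le i)
  have h3 : r * exp (SB m i t) ≤ (4 * i.Λ)⁻¹ * i.Λ := mul_le_mul hr hs (exp_pos _).le bP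
  have h4 : (4 * i.Λ)⁻¹ * i.Λ = 1 / 4 := by field_simp
  have h5 := qB_low (m := m) (n := n) (i := i) hn (t := t) (r := r) bL
  have h6 := qA_low (n := n) (i := i) (t := t) h2
  unfold II qq
  rw [h6.1, h6.2, h5.1, h5.2]
theorem qq_bd (h : HB1 N) (hn : 1 ≤ n) : Pb N (fun i (x : E m) ↦ qq m n i tX rX) :=
  ((Pb.const (X := Unit) h.hN 2).mul h.hN (pb_exphB (m := m) h)).of_bd fun i x ↦ by
    have := qq_mem (m := m) (i := i) hn tX rX
    rw [abs_of_nonneg bL]; exact this.2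
def kq (m n : ℕ) (i : Cp) (x : E m) : ℝ := (II m n i tX rX - qq m n i tX rX) * ((max rX (4 * i.Λ)⁻¹) ^ 2)⁻¹
theorem kq_eq (hn : 1 ≤ n) (i : Cp) (x : E m) : kq m n i x * rr x = (II m n i tX rX - qq m n i tX rX) / rr x := by
  unfold kq
  rcases le_total rX (4 * i.Λ)⁻¹ with h | h
  · rw [II_qq hn i (rr_nonneg x) h]; simp
  · have hΛ := i.Λ1
    rw [max_eq_left h]
    have : 0 < rr x := lt_of_lt_of_le bP h
    field_simp
theorem qq_grad (hn : 1 ≤ n) (i : Cp) (x : E m) : HasFDerivAt (fun x : E m ↦ qq m n i tX rX) (innerSL ℝ ((-(II m n i tX rX * YY m n i tX rX)) • e0 + kq m n i x • yy x) : DE m) x :=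
  rad (by rw [kq_eq hn]; exact qq_D2 hn _ _)
theorem pb_YYr (h : HB1 N) : Pb N (fun i (x : E m) ↦ YY m n i tX rX * rr x) :=
  ((pb_cA h 4).add h.hN (pb_cB (m := m) h)).of_bd fun i x ↦ by
    rw [abs_mul, abs_of_nonneg (rr_nonneg x)]; exact (YY_bd i (rr_nonneg x)).1
theorem pb_YY (h : HB1 N) : Pb N (fun i (x : E m) ↦ YY m n i tX rX) :=
  ((pb_cA h 8).add h.hN (pb_cB (m := m) h)).of_bd fun i x ↦ (YY_bd i (rr_nonneg x)).2
theorem t_qq (h : HB1 N) (hn : 1 ≤ n) : Tame N (fun i (x : E m) ↦ qq m n i tX rX) := by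
  refine ⟨qq_bd h hn, TLip.of_grad (fun i x ↦ qq_grad hn i x) (pb_norm h ((t_II h hn).1.mul h.hN (pb_YY h)).neg ?_)⟩
  have pl : Pb N (fun i (_ : Unit) ↦ i.Λ) := ⟨1, fun i _ ↦ by rw [abs_of_nonneg (by linarith [i.Λ1]), pow_one]; linarith [h.hΛ i, i.Λ1]⟩
  have pL : Pb N (fun i (_ : E m) ↦ 4 * i.Λ) := ((Pb.const (X := Unit) h.hN 4).mul h.hN pl).of_bd fun i x ↦ by
    rw [abs_of_nonneg (by linarith [i.Λ1])]
  refine ((((t_II (m := m) h hn).1.add h.hN (qq_bd h hn).neg).mul h.hN pL)).mono fun i x ↦ ?_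
  rw [kq_eq hn]
  rcases le_total rX (4 * i.Λ)⁻¹ with hh | hh
  · rw [II_qq hn i (rr_nonneg x) hh]; simp
  · have hΛ := i.Λ1
    have : rX⁻¹ ≤ 4 * i.Λ := by rw [inv_le_comm₀ (lt_of_lt_of_le bP hh) bP]; exact hh
    rw [div_eq_mul_inv, abs_mul, abs_mul, ← sub_eq_add_neg, abs_of_nonneg (inv_nonneg.2 (rr_nonneg x)), abs_of_nonneg (by linarith : 0 ≤ 4 * i.Λ)]
    gcongr
theorem smul_y {k : E m → ℝ} {K : ℝ} (h1 : ∀ x, |k x| ≤ K) (h2 : ∀ x z, |k x - k z| ≤ K * dist x z) (h3 : ∀ x, 1 ≤ rr x → k x = 0) (x z : E m) :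
    ‖k x • yy x - k z • yy z‖ ≤ 2 * K * dist x z := by
  have hK : 0 ≤ K := (abs_nonneg _).trans (h1 x)
  have key : ∀ x z : E m, rr x ≤ 1 → ‖k x • yy x - k z • yy z‖ ≤ 2 * K * dist x z := fun x z hx ↦ by
    have e : k x • yy x - k z • yy z = (k x - k z) • yy x + k z • yy (x - z) := by rw [yy_sub]; module
    rw [e]
    refine (norm_add_le _ _).trans ?_
    rw [norm_smul, norm_smul, norm_eq_abs, norm_eq_abs]
    have a := mul_le_mul (h2 x z) hx (rr_nonneg x) (mul_nonneg hK dist_nonneg)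
    have b := mul_le_mul (h1 z) (rr_le (x - z)) (rr_nonneg _) hK
    rw [← dist_eq_norm] at b
    unfold rr at a b
    linarith
  rcases le_total rX 1 with hx | hx
  · exact key x z hx
  · rcases le_total (rr z) 1 with hz | hz
    · rw [norm_sub_rev, dist_comm]; exact key z x hz
    · rw [h3 x hx, h3 z hz]; simp; positivity
theorem tv {a k : Cp → E m → ℝ} (hN : ∀ i, 2 ≤ N i) (ha : TLip N a) (hk : Tame N k) (h3 : ∀ i x, 1 ≤ rr x → k i x = 0) :
    ∃ M : ℕ, ∀ i x z, ‖(a i x • (e0 : E m) + k i x • yy x) - (a i z • e0 + k i z • yy z)‖ ≤ N i ^ M * dist x z := by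
  obtain ⟨A, hA⟩ := ha
  obtain ⟨⟨K, hK⟩, L, hL⟩ := hk
  refine ⟨A + (K + L + 1) + 1, fun i x z ↦ ?_⟩
  have e : (a i x • (e0 : E m) + k i x • yy x) - (a i z • e0 + k i z • yy z) = (a i x - a i z) • e0 + (k i x • yy x - k i z • yy z) := by module
  rw [e]
  refine (norm_add_le _ _).trans ?_
  rw [norm_smul, e0_norm, mul_one, norm_eq_abs]
  have s := smul_y (k := k i) (K := N i ^ (K + L)) (fun x ↦ (hK i x).trans (Nmono hN i bO))
    (fun x z ↦ (hL i x z).trans (mul_le_mul_of_nonneg_right (Nmono hN i bO) dist_nonneg)) (h3 i) x z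
  have t1 : 2 * N i ^ (K + L) ≤ N i ^ (K + L + 1) := by
    rw [pow_succ, mul_comm]; exact mul_le_mul_of_nonneg_left (hN i) (Npos hN i _).le
  have := Nadd hN i A (K + L + 1)
  have d := dist_nonneg (x := x) (y := z)
  nlinarith [hA i x z]
end
noncomputable section
variable {m n : ℕ} {N : Cp → ℝ}
def BB (i : Cp) : ℝ := 2 + i.b⁻¹ + 2 * i.Λ
def NN (i : Cp) : ℝ := BB i + i.τ⁻¹
structure Cell (n M : ℕ) (i : Cp) (cu : E m → ℝ) (cg cs : E m → E m) : Prop where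
  du : ∀ x, HasFDerivAt cu (innerSL ℝ (cg x) : DE m) x
  lg : ∀ x z, ‖cg x - cg z‖ ≤ NN i ^ M * dist x z
  ls : ∀ x z, ‖cs x - cs z‖ ≤ NN i ^ M * dist x z
  s1 : ∀ x, 1 ≤ BB i ^ M * ‖cs x‖
  s2 : ∀ x, ‖cs x‖ ≤ BB i ^ M
  g1 : ∀ x, i.τ ^ nI n ≤ BB i ^ M * ‖cg x‖
  g2 : ∀ x, ‖cg x‖ ≤ BB i ^ M
  out : ∀ x, 1 ≤ |tt x| ∨ 1 ≤ rr x → cu x = tt x ∧ cg x = e0 ∧ cs x = e0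
  inn : ∀ x, |tt x| ≤ i.b → rr x ≤ exp (-(lgg i.Λ / sc m)) / 4 →
    cu x = cm i.τ / i.b * tt x ∧ cg x = (cm i.τ / i.b) • e0 ∧ cs x = i.Λ • e0
  dv : ∀ φ : E m → ℝ, ContDiff ℝ tI φ → HasCompactSupport φ → ∫ x, fD φ x (cs x) = 0
  par : ∀ x, ‖cg x‖ • cs x = ‖cs x‖ • cg x
  le1 : ∀ x, |tt x| ≤ 1 → |cu x| ≤ 1
  top : ∀ x, rr x ≤ 1 / 2 → i.b ≤ tt x → tt x ≤ 1 → 1 - i.τ ≤ cu x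
  bot : ∀ x, rr x ≤ 1 / 2 → tt x ≤ -i.b → -1 ≤ tt x → cu x ≤ -cm i.τ
theorem hb1B : HB1 BB := ⟨fun i ↦ by have := i.Λ1; unfold BB; have := inv_pos.2 i.b0; linarith,
  fun i ↦ by have := i.Λ1; unfold BB; linarith, fun i ↦ by have := inv_pos.2 i.b0; unfold BB; linarith⟩
theorem BB_le (i : Cp) : BB i ≤ NN i := by have := inv_pos.2 i.τ0; unfold NN; linarith
theorem hb1N : HB1 NN := ⟨fun i ↦ (hb1B.hN i).trans (BB_le i), fun i ↦ (hb1B.hb i).trans (BB_le i), fun i ↦ (hb1B.hΛ i).trans (BB_le i)⟩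
theorem NN_τ (i : Cp) : i.τ⁻¹ ≤ NN i := by have := hb1B.hN i; unfold NN; linarith
theorem II_low (hn : 1 ≤ n) (i : Cp) (t r : ℝ) : 1 ≤ (32 * hA i / κP + 8 + n * (bB m i)⁻¹ * 4 + 4) ^ 4 * II m n i t r ∧ 0 < II m n i t r := by
  have hk : 0 ≤ 32 * hA i / κP := div_nonneg (mul_nonneg bN hA_nonneg) κP_pos.le
  have hb : 0 ≤ n * (bB m i)⁻¹ := mul_nonneg bP (inv_nonneg.2 (LHB (m := m) (i := i) hn).b0.le)
  unfold II
  set K := 32 * hA i / κP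
  set Q := n * (bB m i)⁻¹
  rcases le_total r hlf with h | h
  · rw [(qA_low (n := n) (i := i) (t := t) h).2]
    have hb2 := LJ_bounds (LHB (m := m) (i := i) hn) (SB_mem (m := m) (i := i) t).1 (by rw [log_bB]; exact (SB_mem t).2) (t := 2 * r)
    have e : ro + IB m n i t r - 1 = IB m n i t r := by ring
    rw [e]; unfold IB
    set L := LJ hlf (bB m i) n (SB m i t) (2 * r)
    refine ⟨?_, hb2.1⟩
    have h3 : ro / 4 ≤ hlf ^ nI n := by
      have : (ro / 2) ^ (2 : ℝ) ≤ hlf ^ nI n := by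
        refine rpow_le_rpow_of_exponent_ge bN bN ?_
        have : ro / n ≤ 1 := by rw [div_le_one bP]; exact_mod_cast hn
        linarith
      norm_num at this ⊢; linarith
    have h4 := h3.trans hb2.2.2
    have h5 : 4 * (1 + Q) ^ 2 ≤ (K + 8 + Q * 4 + 4) ^ 2 := by nlinarith
    have h6 : ro ≤ (K + 8 + Q * 4 + 4) ^ 2 := by nlinarith
    calc ro ≤ 4 * ((1 + Q) ^ 2 * L) := by linarith
      _ = (4 * (1 + Q) ^ 2) * 1 * L := by ring
      _ ≤ (K + 8 + Q * 4 + 4) ^ 2 * (K + 8 + Q * 4 + 4) ^ 2 * L := by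
        have := hb2.1
        gcongr
      _ = _ := by ring
  · rw [(qB_high (m := m) (i := i) (t := t) hn h).2]
    have hb2 := PJ_bounds (c := 4 * r - 3) (SA_abs (n := n) (i := i) t)
    have e : IA n i t r + 1 - 1 = IA n i t r := by ring
    rw [e]; unfold IA
    refine ⟨hb2.2.2.trans ?_, hb2.1⟩
    have h5 : (K + 8) ^ 2 ≤ (K + 8 + Q * 4 + 4) ^ 2 := pow_le_pow_left₀ bL bL 2
    have h6 : ro ≤ (K + 8 + Q * 4 + 4) ^ 2 := by nlinarith
    have := hb2.1
    refine mul_le_mul_of_nonneg_right ?_ this.le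
    calc (K + 8) ^ 2 ≤ (K + 8 + Q * 4 + 4) ^ 2 * 1 := by linarith
      _ ≤ (K + 8 + Q * 4 + 4) ^ 2 * (K + 8 + Q * 4 + 4) ^ 2 := by gcongr
      _ = _ := by ring
theorem TLip.cont {X : Type*} [PseudoMetricSpace X] {f : Cp → X → ℝ} (h : TLip N f) (i : Cp) : Continuous (f i) := by
  obtain ⟨M, hM⟩ := h
  refine (LipschitzWith.of_dist_le_mul (K := (N i ^ M).toNNReal) fun x y ↦ ?_).continuous
  rw [dist_eq]
  exact (hM i x y).trans (mul_le_mul_of_nonneg_right (le_coe_toNNReal _) dist_nonneg)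
theorem cs_div (hn : 1 ≤ n) (i : Cp) {φ : E m → ℝ} (hφ : ContDiff ℝ tI φ) (hc : HasCompactSupport φ) :
    ∫ x : E m, fD φ x ((qq m n i tX rX ^ m * II m n i tX rX) • e0 + (qq m n i tX rX ^ m * II m n i tX rX * YY m n i tX rX) • yy x) = 0 := by
  set q : E m → ℝ := fun x ↦ qq m n i tX rX with hq
  set I : E m → ℝ := fun x ↦ II m n i tX rX with hI
  set Y : E m → ℝ := fun x ↦ YY m n i tX rX with hY
  have cq : Continuous q := (t_qq hb1N hn).2.cont i
  have cI : Continuous I := (t_II hb1N hn).2.cont i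
  have cY : Continuous Y := (t_YY hb1N NN_τ).2.cont i
  have hd : ∀ x, HasFDerivAt (fun x ↦ q x ^ sc m) ((((m : ℝ) + 1) * q x ^ m) • (innerSL ℝ ((-(I x * Y x)) • e0 + kq m n i x • yy x) : DE m)) x := fun x ↦ by
    have := (qq_grad hn i x).pow sc m
    simpa using this
  have ck : Continuous (kq m n i) := by
    unfold kq
    refine (cI.sub cq).mul (((rr_cont.max continuous_const).pow 2).inv₀ fun x ↦ ?_)
    have hΛ := i.Λ1
    have : 0 < max rX (4 * i.Λ)⁻¹ := lt_of_lt_of_le bP (le_max_right _ _)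
    exact (pow_pos this 2).ne'
  have hf : ∀ x, fD (fun x ↦ q x ^ sc m) x = _ := fun x ↦ (hd x).fderiv
  have hQ : ContDiff ℝ 1 (fun x ↦ q x ^ sc m) := by
    rw [contDiff_one_iff_fderiv]
    refine ⟨fun x ↦ (hd x).differentiableAt, ?_⟩
    rw [funext hf]
    have cyy : Continuous (yy : E m → E m) := yyL.continuous
    have : Continuous fun x : E m ↦ ((-(I x * Y x)) • (e0 : E m) + kq m n i x • yy x) :=
      ((cI.mul cY).neg.smul continuous_const).add (ck.smul cyy)
    exact (continuous_const.mul (cq.pow m)).smul ((innerSL ℝ).continuous.comp this)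
  refine divfree hQ hφ hc fun x ↦ ?_
  rw [hf]
  have e1 : kq m n i x * rr x ^ 2 = I x - q x := by
    rw [pow_two, ← mul_assoc, kq_eq hn]
    by_cases h : rr x = 0
    · have := II_qq (m := m) hn i (t := tt x) (rr_nonneg x) (by rw [h]; have := i.Λ1; positivity)
      simp [hI, hq, this]
    · simp only [hI, hq]; field_simp
  have e2 : (innerSL ℝ ((-(I x * Y x)) • e0 + kq m n i x • yy x) : DE m) (yy x) = I x - q x := by
    rw [innerSL_apply_apply, inner_add_left, inner_smul_left, inner_smul_left, inner_e0, yy_zero, real_inner_self_eq_norm_sq, ← e1]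
    simp [rr]
  have e3 : (innerSL ℝ ((-(I x * Y x)) • e0 + kq m n i x • yy x) : DE m) e0 = -(I x * Y x) := by
    rw [innerSL_apply_apply, inner_add_left, inner_smul_left, inner_smul_left, inner_e0', inner_e0', yy_zero, e0_zero]; simp
  rw [smul_apply, smul_apply, e2, e3, smul_eq_mul, smul_eq_mul]
  have e4 : ((m : ℝ) + 1) * q x ^ sc m + sc m * q x ^ m * (I x - q x) = sc m * (q x ^ m * I x) := by ring
  rw [e4]; module
theorem log_exp_hA (i : Cp) : exp (hA i) = cm i.τ / i.b :=
  exp_log (div_pos (by linarith [i.τ1]) i.b0)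
theorem exp_hB_pow (i : Cp) : exp (hB m i) ^ sc m = i.Λ := by
  rw [← exp_nat_mul, hB]
  push_cast
  rw [mul_div_cancel₀ _ bP]; exact exp_log (by linarith [i.Λ1])
theorem Pb.le {X : Type*} {f : Cp → X → ℝ} (hN : ∀ i, 2 ≤ N i) {M : ℕ} (hM : ∀ i x, |f i x| ≤ N i ^ M) {M' : ℕ} (h : M ≤ M') (i : Cp) (x : X) : f i x ≤ N i ^ M' :=
  (le_abs_self _).trans ((hM i x).trans (Nmono hN i h))
theorem cell_ex (m : ℕ) {n : ℕ} (hn : 1 ≤ n) : ∃ M : ℕ, ∀ i : Cp, ∃ (cu : E m → ℝ) (cg cs : E m → E m), Cell n M i cu cg cs := by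
  set J : Cp → E m → ℝ := fun i x ↦ JJ m n i tX rX with hJ
  set Y : Cp → E m → ℝ := fun i x ↦ YY m n i tX rX with hY
  set q : Cp → E m → ℝ := fun i x ↦ qq m n i tX rX with hq
  set I : Cp → E m → ℝ := fun i x ↦ II m n i tX rX with hI
  have h := hb1N
  have hB := hb1B
  have Yz : ∀ i x, 1 ≤ rr x → Y i x = 0 := fun i x hx ↦ YY_high i hx
  obtain ⟨M1, h1⟩ := tv h.hN (t_JJ (m := m) h hn NN_τ).2 ((t_JJ h hn NN_τ).mul h.hN (t_YY (n := n) h NN_τ)) (fun i x hx ↦ by simp [YY_high (m := m) i hx])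
  obtain ⟨M2, h2⟩ := tv h.hN (((t_qq (m := m) h hn).pow h.hN m).mul h.hN (t_II h hn)).2 ((((t_qq h hn).pow h.hN m).mul h.hN (t_II h hn)).mul h.hN (t_YY (n := n) h NN_τ)) (fun i x hx ↦ by simp [YY_high (m := m) i hx])
  have JBp : ∀ (i : Cp) (x : E m), 0 < JB m n i tX rX ∧ JB m n i tX rX ≤ 16 * (cB m i + 1) ^ 2 ∧ 1 ≤ (cB m i + 8) ^ 2 * JB m n i tX rX := fun i x ↦ PJ_bounds (HB_bd i (rr_nonneg x))
  have LJp : ∀ i x, _ := fun (i : Cp) (x : E m) ↦ LJ_bounds (t := |Tt m n i tX rX|) (Cp.LH (i := i) hn) (HA_mem (i := i) rX).1 (HA_mem rX).2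
  have Jp : ∀ i x, 0 < J i x := fun i x ↦ mul_pos (LJp i x).1 (JBp i x).1
  have pJ : Pb BB J := by
    have p1 : Pb BB (fun i (_ : Unit) ↦ i.b⁻¹) := ⟨1, fun i _ ↦ by rw [abs_of_pos (inv_pos.2 i.b0), pow_one]; exact hB.hb i⟩
    refine (p1.mul hB.hN ((Pb.const hB.hN 16).mul hB.hN (((pb_cB (m := m) hB).add hB.hN (Pb.const hB.hN 1)).pow hB.hN 2))).of_bd fun i x ↦ ?_
    rw [abs_of_pos (Jp i x)]
    exact mul_le_mul (LJp i x).2.1 (JBp i x).2.1 (JBp i x).1.le (inv_pos.2 i.b0).le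
  obtain ⟨M3, h3⟩ := pb_norm hB pJ (k := fun i x ↦ J i x * Y i x) ((pJ.mul hB.hN (pb_YYr (n := n) hB)).mono fun i x ↦ by rw [mul_assoc])
  have pq : Pb BB (fun i x ↦ q i x ^ m * I i x) := ((qq_bd hB hn).pow hB.hN m).mul hB.hN (t_II hB hn).1
  obtain ⟨M4, h4⟩ := pb_norm hB pq (k := fun i x ↦ q i x ^ m * I i x * Y i x) ((pq.mul hB.hN (pb_YYr (n := n) hB)).mono fun i x ↦ by rw [mul_assoc])
  have p5 : Pb BB (fun (i : Cp) (_ : Unit) ↦ (1 + n * i.b⁻¹) ^ 2 * (cB m i + 8) ^ 2) := by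
    have p1 : Pb BB (fun i (_ : Unit) ↦ i.b⁻¹) := ⟨1, fun i _ ↦ by rw [abs_of_pos (inv_pos.2 i.b0), pow_one]; exact hB.hb i⟩
    exact (((Pb.const hB.hN 1).add hB.hN ((Pb.const hB.hN n).mul hB.hN p1)).pow hB.hN 2).mul hB.hN (((pb_cB (m := m) hB).add hB.hN (Pb.const hB.hN 8)).pow hB.hN 2)
  obtain ⟨M5, h5⟩ := p5
  have p6 : Pb BB (fun (i : Cp) (_ : Unit) ↦ 2 ^ m * (32 * hA i / κP + 8 + n * (bB m i)⁻¹ * 4 + 4) ^ 4) := by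
    have p1 : Pb BB (fun i (_ : Unit) ↦ (bB m i)⁻¹) := ⟨1, fun i _ ↦ by rw [abs_of_pos (inv_pos.2 (LHB (m := m) (i := i) hn).b0), pow_one]; exact pb_bB hB i⟩
    exact (Pb.const hB.hN (2 ^ m)).mul hB.hN (((((pb_cA hB 32).add hB.hN (Pb.const hB.hN 8)).add hB.hN (((Pb.const hB.hN n).mul hB.hN p1).mul hB.hN (Pb.const hB.hN 4))).add hB.hN (Pb.const hB.hN 4)).pow hB.hN 4)
  obtain ⟨M6, h6⟩ := p6
  refine ⟨M1 + M2 + M3 + M4 + M5 + M6, fun i ↦ ⟨fun x ↦ uu m n i tX rX, fun x ↦ J i x • e0 + (J i x * Y i x) • yy x, fun x ↦ (q i x ^ m * I i x) • e0 + (q i x ^ m * I i x * Y i x) • yy x, ?_⟩⟩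
  have qp : ∀ x, 0 < q i x := fun x ↦ lt_of_lt_of_le bN (qq_mem hn _ _).1
  have Ip : ∀ x, 0 < I i x := fun x ↦ (II_low hn i _ _).2
  have nrm : ∀ (c : ℝ) x, 0 < c → c ≤ ‖c • (e0 : E m) + (c * Y i x) • yy x‖ := fun c x hc ↦ by
    rw [mul_smul, ← smul_add, norm_smul, norm_of_nonneg hc.le]
    exact le_mul_of_one_le_right hc.le (norm_add_y _ _).1
  constructor
  · exact fun x ↦ rad (uu_D2 hn _ _)
  · exact fun x z ↦ (h1 i x z).trans (mul_le_mul_of_nonneg_right (Nmono h.hN i bO) dist_nonneg)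
  · exact fun x z ↦ (h2 i x z).trans (mul_le_mul_of_nonneg_right (Nmono h.hN i bO) dist_nonneg)
  · intro x
    have a1 := nrm (q i x ^ m * I i x) x (mul_pos (pow_pos (qp x) m) (Ip x))
    have a2 := (II_low (m := m) hn i tX rX).1
    have a3 := Pb.le hB.hN h6 (show M6 ≤ M1 + M2 + M3 + M4 + M5 + M6 by omega) i ()
    have a4 : ro ≤ 2 ^ m * q i x ^ m := by
      rw [← mul_pow]; refine one_le_pow₀ ?_
      linarith [(qq_mem (m := m) (i := i) hn tX rX).1]
    refine le_trans ?_ (mul_le_mul a3 a1 (mul_pos (pow_pos (qp x) m) (Ip x)).le (Npos hB.hN i _).le)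
    calc ro ≤ (2 ^ m * q i x ^ m) * ((32 * hA i / κP + 8 + n * (bB m i)⁻¹ * 4 + 4) ^ 4 * I i x) := one_le_mul_of_one_le_of_one_le a4 a2
      _ = _ := by ring
  · exact fun x ↦ Pb.le hB.hN h4 bO i x
  · intro x
    have a1 := nrm (J i x) x (Jp i x)
    have a3 := Pb.le hB.hN h5 (show M5 ≤ M1 + M2 + M3 + M4 + M5 + M6 by omega) i ()
    refine le_trans ?_ (mul_le_mul a3 a1 (Jp i x).le (Npos hB.hN i _).le)
    calc i.τ ^ nI n ≤ _ := (LJp i x).2.2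
      _ ≤ (1 + n * i.b⁻¹) ^ 2 * LJ i.τ i.b n (HA i rX) |Tt m n i tX rX| * ((cB m i + 8) ^ 2 * JB m n i tX rX) :=
        le_mul_of_one_le_right (mul_nonneg (sq_nonneg _) (LJp i x).1.le) (JBp i x).2.2
      _ = _ := by simp only [hJ, JJ]; ring
  · exact fun x ↦ Pb.le hB.hN h3 bO i x
  · intro x hx
    have key : uu m n i tX rX = tt x ∧ J i x = 1 ∧ Y i x = 0 ∧ q i x = 1 ∧ I i x = 1 := by
      by_cases hr : 1 ≤ rr x
      · have z := HA_high (i := i) hr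
        have z2 := HB_high (m := m) (n := n) (i := i) (show 1 / 2 ≤ rr x by linarith)
        have z3 := qA_high (n := n) (i := i) (t := tt x) hr
        have z4 := qB_high (m := m) (i := i) (t := tt x) hn (show 1 / 2 ≤ rr x by linarith)
        refine ⟨?_, ?_, YY_high i hr, ?_, ?_⟩
        · simp [uu, Tt, z.1, z2.1, TT_zero, LO, Lf_zero n i.τ0]
        · simp [hJ, JJ, z.1, z2.1, LJ_zero (Cp.LH (i := i) hn), JB, PJ_zero]
        · simp [hq, qq, z3.1, z4.1]
        · simp [hI, II, z3.2, z4.2]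
      · have ht : 1 ≤ |tt x| := hx.resolve_right hr
        have z := SA_high (n := n) (i := i) ht
        have z2 := SB_high (m := m) (i := i) ht
        have z3 : Tt m n i tX rX = tt x := TT_high _ ht
        have z4 := (HA_mem (i := i) rX).1
        refine ⟨?_, ?_, ?_, ?_, ?_⟩
        · have key : ∀ t : ℝ, 1 ≤ t → LO n i (HA i rX) t = t := fun t ht ↦ by
            rw [LO_nonneg bL]; simp [Lf, ht]
          simp only [uu, z3]
          rcases le_abs.1 ht with h | h
          · exact key _ h
          · have := key _ h
            rw [LO_neg] at this; linarith
        · simp only [hJ, JJ, z3, JB]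
          rw [LJ_ge1 (Cp.LH (i := i) hn) z4 ht, (PJ_end _ _ _).1]; · norm_num
          rw [abs_of_nonneg] <;> linarith
        · simp [hY, YY, z2.2, XA_ge1 ht]
        · simp only [hq, qq, qA, z, Pd_zero, qB, z2.1]
          rw [Lf_zero n (by norm_num : rz < 1 / 2)]
          simp
          intro hh h0; rw [h0] at hh; norm_num at hh
        · simp only [hI, II, IA, IB, z, z2.1, PJ_zero, LJ_zero (LHB (m := m) (i := i) hn)]; norm_num
    obtain ⟨k1, k2, k3, k4, k5⟩ := key
    refine ⟨k1, ?_, ?_⟩ <;> simp [k2, k3, k4, k5]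
  · intro x ht hr
    have hb := i.b1
    have ht2 : |tt x| ≤ 1 / 2 := ht.trans hb
    have hh : rz ≤ BDP.hB m i := hB_nonneg
    have hr2 : rr x ≤ 1 / 2 := hr.trans (by
      have : exp (-(lgg i.Λ / sc m)) ≤ 1 := exp_le_one_iff.2 (by have : (0:ℝ) ≤ BDP.hB m i := hh; unfold BDP.hB at this; linarith)
      linarith)
    have z := HA_low (i := i) hr2
    have z3 : Tt m n i tX rX = tt x := TT_low _ ht2
    have z2 := SB_low (m := m) (i := i) ht2
    have z5 := qA_low (n := n) (i := i) (t := tt x) hr2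
    have z6 := qB_low (m := m) (n := n) (i := i) hn (t := tt x) (r := rr x) (by
      rw [z2.1]
      have : rr x * exp (BDP.hB m i) ≤ exp (-(BDP.hB m i)) / 4 * exp (BDP.hB m i) := mul_le_mul_of_nonneg_right hr (exp_pos _).le
      have e : exp (-(BDP.hB m i)) / 4 * exp (BDP.hB m i) = 1 / 4 := by rw [exp_neg]; field_simp
      linarith)
    have hτ := i.τ1
    have hl : |tt x| * exp (hA i) ≤ 1 - i.τ := by
      rw [log_exp_hA, ← mul_div_assoc, div_le_iff₀ i.b0, mul_comm]
      exact mul_le_mul_of_nonneg_left ht bL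
    have k1 : uu m n i tX rX = cm i.τ / i.b * tt x := by
      have key : ∀ t : ℝ, 0 ≤ t → t * exp (hA i) ≤ 1 - i.τ → LO n i (hA i) t = cm i.τ / i.b * t := fun t h0 h1 ↦ by
        rw [LO_nonneg h0, Lf_low n i.τ0 i.τ1 hA_nonneg h1, log_exp_hA, mul_comm]
      simp only [uu, z3, z.1]
      rcases le_total 0 tX with h | h
      · exact key _ h (by rwa [abs_of_nonneg h] at hl)
      · have := key (-tt x) bL (by rwa [abs_of_nonpos h] at hl)
        rw [LO_neg] at this; linarith
    have k2 : J i x = cm i.τ / i.b := by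
      simp only [hJ, JJ, z3, z.1, JB]
      rw [LJ_low (s := hA i) (Cp.LH (i := i) hn) le_rfl hl, (PJ_end _ _ _).1, log_exp_hA, mul_one]
      rw [abs_of_nonpos] <;> linarith
    have k3 : Y i x = 0 := by simp [hY, YY, z.2, z2.2]
    have k4 : q i x ^ m * I i x = i.Λ := by
      simp only [hq, hI, qq, II, z5.1, z5.2, z6.1, z6.2, z2.1]
      rw [← exp_hB_pow (m := m) i]; ring
    refine ⟨k1, ?_, ?_⟩
    · simp [k2, k3]
    · simp only [k4, k3]; simp
  · exact fun φ hφ hc ↦ cs_div hn i hφ hc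
  · intro x
    have e : ∀ c : ℝ, c • (e0 : E m) + (c * Y i x) • yy x = c • (e0 + Y i x • yy x) := fun c ↦ by module
    rw [e, e, norm_smul, norm_smul, norm_of_nonneg (Jp i x).le, norm_of_nonneg (mul_pos (pow_pos (qp x) m) (Ip x)).le]
    module
  · intro x hx
    have key : ∀ t r : ℝ, 0 ≤ t → t ≤ 1 → |uu m n i t r| ≤ 1 := fun t r h0 h1 ↦ by
      have hT : 0 ≤ Tt m n i t r ∧ Tt m n i t r ≤ 1 := by
        unfold Tt
        rcases le_total t hlf with h | h
        · rw [TT_low _ (by rwa [abs_of_nonneg h0])]; exact ⟨h0, h1⟩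
        · have := TT_mid (HB m n i r) h h1; exact ⟨by linarith, this.2⟩
      have b := Lf_bounds (Cp.LH (i := i) hn) (HA_mem (i := i) r).1 hT.2
      unfold uu
      rw [LO_nonneg hT.1, abs_of_nonneg (b.2.1 hT.1)]; exact b.1
    rcases le_total 0 tX with h | h
    · exact key _ _ h ((le_abs_self _).trans hx)
    · have := key (-tt x) rX bL ((neg_le_abs _).trans hx)
      simp only [uu, Tt, TT_neg, LO_neg, abs_neg] at this
      exact this
  all_goals
    have key : ∀ t r : ℝ, r ≤ 1 / 2 → i.b ≤ t → t ≤ 1 → 1 - i.τ ≤ uu m n i t r := fun t r hr h0 h1 ↦ by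
      have hb := i.b0
      have hT : i.b ≤ Tt m n i t r ∧ Tt m n i t r ≤ 1 := by
        unfold Tt
        rcases le_total t hlf with h | h
        · rw [TT_low _ (by rwa [abs_of_nonneg bL])]; exact ⟨h0, h1⟩
        · have := TT_mid (HB m n i r) h h1; exact ⟨by linarith [i.b1], this.2⟩
      have b := Lf_bounds (Cp.LH (i := i) hn) (HA_mem (i := i) r).1 hT.2
      unfold uu
      rw [LO_nonneg bL]
      refine b.2.2 ?_
      rw [(HA_low hr).1, log_exp_hA, ← mul_div_assoc, le_div_iff₀ hb, mul_comm]
      exact mul_le_mul_of_nonneg_right hT.1 (by linarith [i.τ1])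
  · exact fun x ↦ key _ _
  · intro x hr h0 h1
    have := key (-tt x) rX hr bL bL
    simp only [uu, Tt, TT_neg, LO_neg] at this ⊢
    linarith
end
noncomputable section
variable {m : ℕ}
def nC (x : E m) : ℝ := max |tt x| rX
theorem tt_add (x y : E m) : tt (x + y) = tt x + tt y := rfl
theorem tt_sub (x y : E m) : tt (x - y) = tt x - tt y := rfl
theorem tt_smul (a : ℝ) (y : E m) : tt (a • y) = a * tt y := rfl
theorem rr_smul (a : ℝ) (y : E m) : rr (a • y) = |a| * rr y := by unfold rr; rw [yy_smul, norm_smul]; rfl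
theorem rr_add (x y : E m) : rr (x + y) ≤ rr x + rr y := by unfold rr; rw [yy_add]; exact norm_add_le _ _
theorem nC_add (x y : E m) : nC (x + y) ≤ nC x + nC y := by
  refine max_le ?_ ?_
  · rw [tt_add]; exact (abs_add_le _ _).trans (add_le_add (le_max_left _ _) (le_max_left _ _))
  · exact (rr_add x y).trans (add_le_add (le_max_right _ _) (le_max_right _ _))
theorem nC_smul (a : ℝ) (y : E m) : nC (a • y) = |a| * nC y := by
  unfold nC; rw [tt_smul, rr_smul, abs_mul, mul_max_of_nonneg _ _ (abs_nonneg a)]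
theorem nC_neg (y : E m) : nC (-y) = nC y := by
  have := nC_smul (-1) y; simpa using this
theorem nC_le (x : E m) : nC x ≤ ‖x‖ := max_le (tt_le x) (rr_le x)
theorem le_nC (x : E m) : ‖x‖ ≤ 2 * nC x := by
  have := le_ty x; have h1 := le_max_left |tt x| rX; have h2 := le_max_right |tt x| rX
  unfold nC; linarith
theorem nC_cont : Continuous (nC : E m → ℝ) := (continuous_abs.comp tt_cont).max rr_cont
theorem nC_tri (x y z : E m) : nC (x - z) ≤ nC (x - y) + nC (y - z) := by
  have := nC_add (x - y) (y - z); simpa using this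
theorem nC_comm (x y : E m) : nC (x - y) = nC (y - x) := by rw [← nC_neg, neg_sub]
theorem coord_le_rr (x : E m) (k : Fin sc m) : |x k.succ| ≤ rr x := by
  have := PiLp.norm_apply_le (yy x) k.succ
  rwa [yy_succ] at this
theorem rr_le_sum (x : E m) : rr x ≤ ∑ k : Fin sc m, |x k.succ| := by
  have h : yy x = ∑ k : Fin sc m, x k.succ • (esg k.succ 1 : E m) := by
    ext j
    refine Fin.cases ?_ (fun k ↦ ?_) j
    · simp [yy_zero]
    · simp only [yy_succ, WithLp.ofLp_sum, Finset.sum_apply, PiLp.smul_apply, smul_eq_mul, PiLp.single_apply, Fin.succ_inj]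
      simp
  unfold rr; rw [h]
  refine (norm_sum_le _ _).trans (Finset.sum_le_sum fun k _ ↦ ?_)
  rw [norm_smul]; simp
def Cyl (c : E m) (R : ℝ) : Set (E m) := {x | nC (x - c) ≤ R}
theorem Cyl_closed (c : E m) (R : ℝ) : IsClosed (Cyl c R) :=
  isClosed_le (nC_cont.comp (continuous_id.sub continuous_const)) continuous_const
theorem grid (ε b ρ : ℝ) (mv mh : ℕ) (hε : 0 < ε) (hv : 1 ≤ mv) (hh : 1 ≤ mh) (h1 : 4 * ε * pd mv + ε ≤ b) (h2 : 4 * ε * sc m * mh ≤ ρ) :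
    ∃ z : ℕ → E m, (∀ k < mv * mh ^ sc m, |tt (z k)| + ε ≤ b ∧ rr (z k) + ε ≤ ρ) ∧
      ∀ k < mv * mh ^ sc m, ∀ l < mv * mh ^ sc m, k ≠ l → 4 * ε ≤ nC (z k - z l) := by
  have hc : Fintype.card (Fin mv × (Fin sc m → Fin mh)) = mv * mh ^ sc m := by simp
  set eq := (Fintype.equivFinOfCardEq hc).symm
  set Z : Fin mv × (Fin sc m → Fin mh) → E m := fun p ↦ WithLp.toLp 2 (Fin.cons (4 * ε * (p.1 : ℕ)) fun k ↦ 4 * ε * (p.2 k : ℕ)) with hZ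
  have Z0 : ∀ p, tt (Z p) = 4 * ε * (p.1 : ℕ) := fun p ↦ rfl
  have Zs : ∀ p k, Z p (Fin.succ k) = 4 * ε * (p.2 k : ℕ) := fun p k ↦ rfl
  have sep : ∀ a b : ℕ, a ≠ b → 4 * ε ≤ |4 * ε * (a : ℝ) - 4 * ε * b| := fun a b hab ↦ by
    rw [← mul_sub, abs_mul, abs_of_pos bL]
    refine le_mul_of_one_le_right bL ?_
    have : (1 : ℤ) ≤ |(a : ℤ) - b| := Int.one_le_abs bO
    exact_mod_cast this
  refine ⟨fun k ↦ if h : k < mv * mh ^ sc m then Z (eq ⟨k, h⟩) else 0, fun k hk ↦ ?_, fun k hk l hl hkl ↦ ?_⟩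
  · beta_reduce
    rw [dif_pos hk]
    set p := eq ⟨k, hk⟩
    constructor
    · rw [Z0, abs_of_nonneg bP]
      have : ((p.1 : ℕ) : ℝ) ≤ mv - 1 := by
        have := p.1.2
        rw [le_sub_iff_add_le]; exact_mod_cast this
      nlinarith
    · refine le_trans (add_le_add_left (rr_le_sum _) _) ?_
      have : ∑ k : Fin sc m, |Z p k.succ| ≤ ∑ k : Fin sc m, 4 * ε * ((mh : ℝ) - 1) := Finset.sum_le_sum fun k _ ↦ by
        rw [Zs, abs_of_nonneg bP]
        have : ((p.2 k : ℕ) : ℝ) ≤ mh - 1 := by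
          have := (p.2 k).2
          rw [le_sub_iff_add_le]; exact_mod_cast this
        exact mul_le_mul_of_nonneg_left this bL
      rw [Finset.sum_const, Finset.card_univ, Fintype.card_fin, nsmul_eq_mul] at this
      push_cast at this
      have hm : rz ≤ m := by positivity
      nlinarith [mul_nonneg hm hε.le]
  · beta_reduce
    rw [dif_pos hk, dif_pos hl]
    have hne : eq ⟨k, hk⟩ ≠ eq ⟨l, hl⟩ := fun h ↦ hkl (by simpa using eq.injective h)
    set p := eq ⟨k, hk⟩
    set q := eq ⟨l, hl⟩
    by_cases h : p.1 = q.1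
    · have : p.2 ≠ q.2 := fun h' ↦ hne (Prod.ext h h')
      obtain ⟨j, hj⟩ := Function.ne_iff.1 this
      refine le_max_of_le_right (le_trans ?_ (coord_le_rr _ j))
      exact sep _ _ fun h ↦ hj (Fin.ext h)
    · refine le_max_of_le_left ?_
      rw [tt_sub, Z0, Z0]
      exact sep _ _ fun h' ↦ h (Fin.ext h')
structure Hier (m n M : ℕ) where
  i : ℕ → Cp
  cu : ℕ → E m → ℝ
  cg : ℕ → E m → E m
  cs : ℕ → E m → E m
  cell : ∀ j, Cell n M (i j) (cu j) (cg j) (cs j)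
  ε : ℕ → ℝ
  ε0 : ∀ j, 0 < ε j
  ε1 : ∀ j, ε j ≤ (i j).b
  N : ℕ → ℕ
  N1 : ∀ j, 1 ≤ N j
  z : ℕ → ℕ → E m
  zt : ∀ j, ∀ k < N j, |tt (z j k)| + ε j ≤ (i j).b
  zr : ∀ j, ∀ k < N j, rr (z j k) + ε j ≤ exp (-(lgg (i j).Λ / sc m)) / 4
  zs : ∀ j, ∀ k < N j, ∀ l < N j, k ≠ l → 4 * ε j ≤ nC (z j k - z j l)
  m0 : ℝ
  s0 : ℝ
  m0p : 0 < m0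
  s0p : 0 < s0
namespace Hier
variable {n M : ℕ} (H : Hier m n M)
def R : ℕ → ℝ | 0 => 1 / 2 | j + 1 => H.ε j * R j
def P : ℕ → ℕ | 0 => 1 | j + 1 => P j * H.N j
def mm : ℕ → ℝ | 0 => H.m0 | j + 1 => mm j * ((1 - (H.i j).τ) / (H.i j).b)
def ss : ℕ → ℝ | 0 => H.s0 | j + 1 => ss j * (H.i j).Λ
def c : ℕ → ℕ → E m | 0, _ => 0 | j + 1, a => c j (a / H.N j) + H.R j • H.z j (a % H.N j)
def y (j a : ℕ) (x : E m) : E m := (H.R j)⁻¹ • (x - H.c j a)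
def u : ℕ → E m → ℝ | 0, x => H.m0 * tt x | j + 1, x => u j x + ∑ a ∈ Finset.range (H.P j), H.mm j * H.R j * (H.cu j (H.y j a x) - tt (H.y j a x))
def G : ℕ → E m → E m | 0, _ => H.m0 • e0 | j + 1, x => G j x + ∑ a ∈ Finset.range (H.P j), H.mm j • (H.cg j (H.y j a x) - e0)
def σ : ℕ → E m → E m | 0, _ => H.s0 • e0 | j + 1, x => σ j x + ∑ a ∈ Finset.range (H.P j), H.ss j • (H.cs j (H.y j a x) - e0)
def EE (j : ℕ) : Set (E m) := ⋃ a ∈ Finset.range (H.P j), Cyl (H.c j a) (H.R j)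
variable {H}
theorem R_pos (j : ℕ) : 0 < HR j := by
  induction j with
  | zero => norm_num [R]
  | succ j ih => exact mul_pos (H.ε0 j) ih
theorem ε_half (j : ℕ) : Hε j ≤ 1 / 2 := (H.ε1 j).trans (Hi j).b1
theorem R_half (j : ℕ) : HR sc j ≤ HR j / 2 := by
  have := mul_le_mul_of_nonneg_right (ε_half (H := H) j) (R_pos (H := H) j).le
  rw [R]; linarith
theorem R_le (j : ℕ) : HR j ≤ hlf ^ sc j := by
  induction j with
  | zero => norm_num [R]
  | succ j ih => rw [pow_succ]; linarith [R_half (H := H) j]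
theorem P_pos (j : ℕ) : 1 ≤ HP j := by
  induction j with
  | zero => exact le_rfl
  | succ j ih => exact Nat.mul_pos ih (H.N1 j)
theorem mm_pos (j : ℕ) : 0 < Hmm j := by
  induction j with
  | zero => exact H.m0p
  | succ j ih => exact mul_pos ih (div_pos (by linarith [(Hi j).τ1]) (Hi j).b0)
theorem mm_mono (j : ℕ) : Hmm j ≤ Hmm sc j := by
  rw [mm]; refine le_mul_of_one_le_right (mm_pos j).le ?_
  rw [one_le_div (Hi j).b0]; linarith [(Hi j).τ1, (Hi j).b1]
theorem ss_pos (j : ℕ) : 0 < Hss j := by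
  induction j with
  | zero => exact H.s0p
  | succ j ih => exact mul_pos ih (by linarith [(Hi j).Λ1])
theorem par_lt {j a : ℕ} (ha : a < HP sc j) : a / HN j < HP j ∧ a % HN j < HN j :=
  ⟨Nat.div_lt_of_lt_mul (by rw [mul_comm]; exact ha), Nat.mod_lt _ (H.N1 j)⟩
theorem mem_EE {j : ℕ} {x : E m} : x ∈ HEE j ↔ ∃ a < HP j, nC (x - Hc j a) ≤ HR j := by
  simp [EE, Cyl]
theorem EE_closed (j : ℕ) : IsClosed (HEE j) := by
  unfold EE
  exact (Finset.range (HP j)).finite_toSet.isClosed_biUnion fun a _ ↦ Cyl_closed _ _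
theorem y_nC (j a : ℕ) (x : E m) : nC (Hy j a x) = nC (x - Hc j a) / HR j := by
  rw [y, nC_smul, abs_of_pos (inv_pos.2 (R_pos j)), inv_mul_eq_div]
theorem child_y {j a : ℕ} {x : E m} : Hy j (a / HN j) x = H.z j (a % HN j) + Hε j • Hy sc j a x := by
  have h1 := (R_pos (H := H) j).ne'
  have h2 := (H.ε0 j).ne'
  simp only [y, c, R, smul_smul]
  rw [show Hε j * (Hε j * HR j)⁻¹ = (HR j)⁻¹ by field_simp, ← sub_sub, smul_sub _ _ (HR j • _), smul_smul, inv_mul_cancel₀ h1, one_smul]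
  abel
theorem child_in {j a : ℕ} (ha : a < HP sc j) {x : E m} (hx : nC (x - Hc sc j a) ≤ HR sc j) :
    |tt (Hy j (a / HN j) x)| ≤ (Hi j).b ∧ rr (Hy j (a / HN j) x) ≤ exp (-(lgg (Hi j).Λ / sc m)) / 4 := by
  have hy : nC (Hy sc j a x) ≤ 1 := by rw [y_nC, div_le_one (R_pos _)]; exact hx
  have h1 := (le_max_left _ _).trans hy
  have h2 := (le_max_right _ _).trans hy
  have h0 := H.ε0 j
  rw [child_y]
  constructor
  · rw [tt_add, tt_smul]
    refine (abs_add_le _ _).trans (le_trans ?_ (H.zt j _ (par_lt ha).2))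
    rw [abs_mul, abs_of_pos h0]
    exact add_le_add le_rfl (mul_le_of_le_one_right h0.le h1)
  · refine (rr_add _ _).trans (le_trans ?_ (H.zr j _ (par_lt ha).2))
    rw [rr_smul, abs_of_pos h0]
    exact add_le_add le_rfl (mul_le_of_le_one_right h0.le h2)
theorem expΛ (i : Cp) : exp (-(lgg i.Λ / sc m)) ≤ 1 :=
  exp_le_one_iff.2 (neg_nonpos.2 (div_nonneg (log_nonneg i.Λ1) bP))
theorem child_cyl {j a : ℕ} (ha : a < HP sc j) {x : E m} (hx : nC (x - Hc sc j a) ≤ HR sc j) :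
    nC (x - Hc j (a / HN j)) ≤ HR j / 2 := by
  have h := child_in ha hx
  have : nC (Hy j (a / HN j) x) ≤ 1 / 2 := max_le (h.1.trans (Hi j).b1) (h.2.trans (by linarith [expΛ (m := m) Hij]))
  rw [y_nC, div_le_iff₀ (R_pos _)] at this; linarith
theorem EE_anti (j : ℕ) : HEE sc j ⊆ HEE j := fun x hx ↦ by
  obtain ⟨a, ha, h⟩ := mem_EE.1 hx
  exact mem_EE.2 ⟨_, (par_lt ha).1, (child_cyl ha h).trans (by linarith [R_pos (H := H) j])⟩
theorem nC_zero : nC (0 : E m) = 0 := by have := nC_smul 0 (0 : E m); simpa using this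
theorem sep {j a b : ℕ} (ha : a < HP j) (hb : b < HP j) (hab : a ≠ b) : 4 * HR j ≤ nC (Hc j a - Hc j b) := by
  induction j generalizing a b with
  | zero => simp [P] at ha hb; omega
  | succ j ih =>
    by_cases h : a / HN j = b / HN j
    · have hm : a % HN j ≠ b % HN j := fun h' ↦ hab (by rw [← Nat.div_add_mod a (HN j), ← Nat.div_add_mod b (HN j), h, h'])
      simp only [c, h, add_sub_add_left_eq_sub, ← smul_sub]
      rw [nC_smul, abs_of_pos (R_pos j), R]
      have := H.zs j _ (par_lt ha).2 _ (par_lt hb).2 hm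
      nlinarith [R_pos (H := H) j]
    · have h1 := ih (par_lt ha).1 (par_lt hb).1 h
      have h2 := child_cyl ha (x := Hc sc j a) (by rw [sub_self, nC_zero]; exact (R_pos _).le)
      have h3 := child_cyl hb (x := Hc sc j b) (by rw [sub_self, nC_zero]; exact (R_pos _).le)
      have t1 := nC_tri (Hc j (a / HN j)) (Hc sc j a) (Hc j (b / HN j))
      have t2 := nC_tri (Hc sc j a) (Hc sc j b) (Hc j (b / HN j))
      rw [nC_comm] at h2
      have := R_half (H := H) j
      have := R_pos (H := H) j
      linarith
theorem uniq {j a b : ℕ} (ha : a < HP j) (hb : b < HP j) {x : E m} (hx : nC (x - Hc j a) ≤ HR j) (hy : nC (x - Hc j b) ≤ HR j) : a = b := by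
  by_contra h
  have h1 := sep ha hb h
  have t1 := nC_tri (Hc j a) x (Hc j b)
  rw [nC_comm] at hx
  linarith [R_pos (H := H) j]
theorem far {j a : ℕ} {x : E m} (h : ¬ nC (x - Hc j a) ≤ HR j) : 1 ≤ |tt (Hy j a x)| ∨ 1 ≤ rr (Hy j a x) := by
  have : 1 ≤ nC (Hy j a x) := by rw [y_nC, one_le_div (R_pos _)]; exact (not_le.1 h).le
  exact le_max_iff.1 this
theorem sum_one {V : Type*} [AddCommGroup V] {j a : ℕ} (ha : a < HP j) {x : E m} (hx : nC (x - Hc j a) ≤ HR j) {f : ℕ → V}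
    (hf : ∀ b, 1 ≤ |tt (Hy j b x)| ∨ 1 ≤ rr (Hy j b x) → f b = 0) : ∑ b ∈ Finset.range (HP j), f b = f a :=
  Finset.sum_eq_single_of_mem a (Finset.mem_range.2 ha) fun b hb hne ↦ hf b (far fun h ↦ hne (uniq (Finset.mem_range.1 hb) ha h hx))
theorem sum_none {V : Type*} [AddCommGroup V] {j : ℕ} {x : E m} (hx : x ∉ HEE j) {f : ℕ → V}
    (hf : ∀ b, 1 ≤ |tt (Hy j b x)| ∨ 1 ≤ rr (Hy j b x) → f b = 0) : ∑ b ∈ Finset.range (HP j), f b = 0 :=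
  Finset.sum_eq_zero fun b hb ↦ hf b (far fun h ↦ hx (mem_EE.2 ⟨b, Finset.mem_range.1 hb, h⟩))
theorem off {j : ℕ} {x : E m} (hx : x ∉ HEE j) : Hu sc j x = Hu j x ∧ HG sc j x = HG j x ∧ Hσ sc j x = Hσ j x := by
  refine ⟨?_, ?_, ?_⟩
  · rw [u, sum_none hx, add_zero]; intro b hb; rw [((Hcell j).out _ hb).1]; simp
  · rw [G, sum_none hx, add_zero]; intro b hb; rw [((Hcell j).out _ hb).2.1]; simp
  · rw [σ, sum_none hx, add_zero]; intro b hb; rw [((Hcell j).out _ hb).2.2]; simp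
theorem on {j a : ℕ} (ha : a < HP j) {x : E m} (hx : nC (x - Hc j a) ≤ HR j) :
    Hu sc j x = Hu j x + Hmm j * HR j * (H.cu j (Hy j a x) - tt (Hy j a x)) ∧ HG sc j x = HG j x + Hmm j • (H.cg j (Hy j a x) - e0) ∧
      Hσ sc j x = Hσ j x + Hss j • (Hcs j (Hy j a x) - e0) := by
  refine ⟨?_, ?_, ?_⟩
  · rw [u, sum_one ha hx]; intro b hb; rw [((Hcell j).out _ hb).1]; simp
  · rw [G, sum_one ha hx]; intro b hb; rw [((Hcell j).out _ hb).2.1]; simp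
  · rw [σ, sum_one ha hx]; intro b hb; rw [((Hcell j).out _ hb).2.2]; simp
theorem aff (j : ℕ) : ∀ a < HP j, ∃ o : ℝ, ∀ x, nC (x - Hc j a) ≤ HR j →
    Hu j x = o + Hmm j * HR j * tt (Hy j a x) ∧ HG j x = Hmm j • e0 ∧ Hσ j x = Hss j • e0 := by
  induction j with
  | zero => exact fun a _ ↦ ⟨0, fun x _ ↦ ⟨by simp [u, mm, R, y, c, tt_smul]; ring, rfl, rfl⟩⟩
  | succ j ih =>
    intro a ha
    obtain ⟨o, ho⟩ := ih _ (par_lt ha).1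
    refine ⟨o + Hmm sc j * HR j * tt (H.z j (a % HN j)), fun x hx ↦ ?_⟩
    have hx2 : nC (x - Hc j (a / HN j)) ≤ HR j := (child_cyl ha hx).trans (by linarith [R_pos (H := H) j])
    obtain ⟨k1, k2, k3⟩ := on (par_lt ha).1 hx2
    obtain ⟨l1, l2, l3⟩ := ho x hx2
    have hin := child_in ha hx
    obtain ⟨i1, i2, i3⟩ := (Hcell j).inn _ hin.1 hin.2
    refine ⟨?_, ?_, ?_⟩
    · rw [k1, l1, i1, child_y, tt_add, tt_smul, mm, R]; ring
    · rw [k2, l2, i2, mm]; module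
    · rw [k3, l3, i3, ss]; module
theorem gen {j a : ℕ} (ha : a < HP j) : ∃ o : ℝ, ∀ x, nC (x - Hc j a) ≤ HR j → Hu sc j x = o + Hmm j * HR j * H.cu j (Hy j a x) ∧
    HG sc j x = Hmm j • H.cg j (Hy j a x) ∧ Hσ sc j x = Hss j • Hcs j (Hy j a x) := by
  obtain ⟨o, ho⟩ := aff j a ha
  refine ⟨o, fun x hx ↦ ?_⟩
  obtain ⟨k1, k2, k3⟩ := on ha hx
  obtain ⟨l1, l2, l3⟩ := ho x hx
  refine ⟨?_, ?_, ?_⟩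
  · rw [k1, l1]; ring
  · rw [k2, l2]; module
  · rw [k3, l3]; module
end Hier
end
noncomputable section
variable {m : ℕ}
namespace Hier
variable {n M : ℕ} {H : Hier m n M}
theorem y_deriv (j a : ℕ) (x : E m) : HasFDerivAt (Hy j a) ((HR j)⁻¹ • ContinuousLinearMap.id ℝ (E m)) x :=
  HasFDerivAt.fun_const_smul ((hasFDerivAt_id x).sub_const (Hc j a)) (HR j)⁻¹
theorem y_dist (j a : ℕ) (x z : E m) : dist (Hy j a x) (Hy j a z) = (HR j)⁻¹ * dist x z := by
  rw [y, y, dist_smul₀, dist_sub_right, norm_of_nonneg (inv_pos.2 (R_pos j)).le]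
theorem du (J : ℕ) (x : E m) : HasFDerivAt (Hu J) (innerSL ℝ (HG J x) : DE m) x := by
  induction J with
  | zero => exact ((tt_deriv x).const_mul Hm0).congr_fderiv (by simp [G])
  | succ j ih =>
    have h := ih.add (HasFDerivAt.fun_sum (u := Finset.range (HP j)) fun a _ ↦
      ((((Hcell j).du (Hy j a x)).comp x (y_deriv j a x)).sub ((tt_deriv (Hy j a x)).comp x (y_deriv j a x))).const_mul (Hmm j * HR j))
    refine h.congr_fderiv ?_
    simp only [G, map_add, map_sum, map_smul, map_sub]
    congr 1
    refine Finset.sum_congr rfl fun a _ ↦ ?_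
    ext v
    have := (R_pos (H := H) j).ne'
    simp
    field_simp
def Lg : ℕ → ℝ | 0 => 0 | j + 1 => Lg j + HP j * ((Hmm j + Hss j) * (NN Hij ^ M * (HR j)⁻¹))
theorem NN_pos (i : Cp) : 0 < NN i := by have := hb1N.hN i; linarith
theorem BB_pos (i : Cp) : 0 < BB i := by have := hb1B.hN i; linarith
theorem lip (J : ℕ) (x z : E m) : ‖HG J x - HG J z‖ ≤ Lg (H := H) J * dist x z ∧ ‖Hσ J x - Hσ J z‖ ≤ Lg (H := H) J * dist x z := by
  induction J with
  | zero => simp [G, σ, Lg]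
  | succ j ih =>
    have key : ∀ (f g : E m → E m) (c : E m → E m) (q : ℝ), 0 ≤ q → q ≤ Hmm j + Hss j → (∀ x z, ‖c x - c z‖ ≤ NN Hij ^ M * dist x z) →
        ‖f x - f z‖ ≤ Lg (H := H) j * dist x z → ‖(f x + ∑ a ∈ Finset.range (HP j), q • (c (Hy j a x) - e0)) - (f z + ∑ a ∈ Finset.range (HP j), q • (c (Hy j a z) - e0))‖ ≤ Lg (H := H) sc j * dist x z := by
      intro f g c q hq hq2 hc hf
      rw [add_sub_add_comm, ← Finset.sum_sub_distrib, Lg, add_mul]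
      refine (norm_add_le _ _).trans (add_le_add hf ((norm_sum_le _ _).trans ?_))
      refine (Finset.sum_le_card_nsmul _ _ ((Hmm j + Hss j) * (NN Hij ^ M * (HR j)⁻¹) * dist x z) fun a _ ↦ ?_).trans ?_
      · rw [← smul_sub, sub_sub_sub_cancel_right, norm_smul, norm_of_nonneg hq, mul_assoc]
        refine mul_le_mul hq2 ((hc _ _).trans_eq ?_) (norm_nonneg _) (hq.trans hq2)
        rw [y_dist, mul_assoc]
      · rw [Finset.card_range, nsmul_eq_mul]; exact le_of_eq (by ring)
    have := mm_pos (H := H) j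
    have := ss_pos (H := H) j
    exact ⟨key (HG j) (HG j) (H.cg j) (Hmm j) bL bL (Hcell j).lg ih.1, key (Hσ j) (Hσ j) (Hcs j) (Hss j) bL bL (Hcell j).ls ih.2⟩
theorem lip_cont {f : E m → E m} {L : ℝ} (h : ∀ x z, ‖f x - f z‖ ≤ L * dist x z) : Continuous f := by
  refine LipschitzWith.continuous (K := L.toNNReal) (LipschitzWith.of_dist_le_mul fun x z ↦ ?_)
  rw [dist_eq_norm]; exact (h x z).trans (mul_le_mul_of_nonneg_right (le_coe_toNNReal L) dist_nonneg)
theorem G_cont (J : ℕ) : Continuous (HG J) := lip_cont fun x z ↦ (lip J x z).1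
theorem σ_cont (J : ℕ) : Continuous (Hσ J) := lip_cont fun x z ↦ (lip J x z).2
theorem u_cont (J : ℕ) : Continuous (Hu J) := continuous_iff_continuousAt.2 fun x ↦ (du J x).continuousAt
theorem int_dv {φ : E m → ℝ} (hφ : ContDiff ℝ tI φ) (hc : HasCompactSupport φ) {f : E m → E m} (hf : Continuous f) :
    Integrable fun x ↦ fD φ x (f x) := by
  refine Continuous.integrable_of_hasCompactSupport ((hφ.continuous_fderiv bS).clm_apply hf) ?_
  refine (hc.fderiv ℝ).mono fun x hx ↦ ?_
  rw [Function.mem_support] at hx ⊢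
  intro h; rw [h] at hx; simp at hx
theorem dv_const {φ : E m → ℝ} (hφ : ContDiff ℝ tI φ) (hc : HasCompactSupport φ) (v : E m) : ∫ x, fD φ x v = 0 := by
  have := integral_mul_fderiv_eq_neg_fderiv_mul_of_integrable (μ := (volume : Measure (E m))) (f := fun _ : E m ↦ ro) (g := φ) (v := v) bS (by simpa using int_dv hφ hc continuous_const)
    (by simpa using hφ.continuous.integrable_of_hasCompactSupport hc) (fun x _ ↦ by fun_prop) (fun x _ ↦ hφ.differentiable bS x)
  simpa using this
theorem dv (J : ℕ) {φ : E m → ℝ} (hφ : ContDiff ℝ tI φ) (hc : HasCompactSupport φ) : ∫ x, fD φ x (Hσ J x) = 0 := by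
  induction J with
  | zero => exact dv_const hφ hc _
  | succ j ih =>
    have hyc : ∀ a, Continuous (Hy j a) := fun a ↦ continuous_iff_continuousAt.2 fun x ↦ (y_deriv j a x).continuousAt
    have hcs : ∀ a, Continuous fun x ↦ Hcs j (Hy j a x) := fun a ↦ (lip_cont (Hcell j).ls).comp (hyc a)
    have hR := R_pos (H := H) j
    have hI : ∀ a, Integrable fun x ↦ Hss j • (fD φ x (Hcs j (Hy j a x)) - fD φ x e0) := fun a ↦
      Integrable.smul (Hss j) ((int_dv hφ hc (hcs a)).sub (int_dv hφ hc continuous_const))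
    simp only [σ, map_add, map_sum, map_smul, map_sub]
    rw [integral_add (int_dv hφ hc (σ_cont j)), ih, zero_add, integral_finsetSum]
    · refine Finset.sum_eq_zero fun a _ ↦ ?_
      rw [integral_smul, integral_sub (int_dv hφ hc (hcs a)) (int_dv hφ hc continuous_const), dv_const hφ hc, sub_zero]
      have h2 : ∀ w : E m, HasFDerivAt (fun w : E m ↦ φ (HR j • w + Hc j a)) (fD φ (HR j • w + Hc j a) ∘L (HR j • ContinuousLinearMap.id ℝ (E m))) w := fun w ↦
        (hφ.differentiable bS _).hasFDerivAt.comp w ((HasFDerivAt.fun_const_smul (hasFDerivAt_id w) (HR j)).add_const _)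
      have h1 := (Hcell j).dv (fun w ↦ φ (HR j • w + Hc j a)) (hφ.comp (by fun_prop)) (by
        let e : E m ≃ₜ E m := (Homeomorph.smulOfNeZero (HR j) hR.ne').trans (Homeomorph.addRight (Hc j a))
        exact hc.comp_homeomorph e)
      have e1 : ∫ x, fD φ x (Hcs j (Hy j a x)) = ∫ x, (fun w ↦ fD φ (HR j • w + Hc j a) (Hcs j w)) ((HR j)⁻¹ • (x - Hc j a)) := by
        congr 1; ext x; simp only [smul_smul, mul_inv_cancel₀ hR.ne', one_smul, sub_add_cancel]; rfl
      rw [e1, integral_sub_right_eq_self (fun x : E m ↦ (fun w ↦ fD φ (HR j • w + Hc j a) (Hcs j w)) ((HR j)⁻¹ • x)) (Hc j a),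
        Measure.integral_comp_smul volume (fun w ↦ fD φ (HR j • w + Hc j a) (Hcs j w)) (HR j)⁻¹]
      have e2 : ∀ w : E m, fD φ (HR j • w + Hc j a) (Hcs j w) = (HR j)⁻¹ * fD (fun w ↦ φ (HR j • w + Hc j a)) w (Hcs j w) := fun w ↦ by
        rw [(h2 w).fderiv]; simp [hR.ne']
      simp only [e2]
      rw [integral_const_mul, h1]; simp
    · exact fun a _ ↦ hI a
    · exact integrable_finsetSum _ fun a _ ↦ hI a
end Hier
end
noncomputable section
variable {m : ℕ}
theorem BB1 (i : Cp) (M : ℕ) : 1 ≤ BB i ^ M := one_le_pow₀ (by linarith [hb1B.hN i])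
theorem box_coord {x : E m} (h1 : |tt x| < 1) (h2 : rr x < 1) : x ∈ BX m := fun i ↦
  Fin.cases h1 (fun k ↦ (coord_le_rr x k).trans_lt h2) i
theorem box_norm {x : E m} (h : x ∈ BX m) : ‖x‖ ≤ m + 2 := by
  have h1 := rr_le_sum x
  have h2 : ∑ k : Fin sc m, |x k.succ| ≤ ∑ k : Fin sc m, 1 := Finset.sum_le_sum fun k _ ↦ (h _).le
  have h3 := le_ty x
  have h4 : |tt x| < 1 := h 0
  simp at h2; linarith
theorem box_open : IsOpen BX m := by
  have : BX m = ⋂ i : Fin (m + 2), {x : E m | |x i| < 1} := by ext; simp [Box]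
  rw [this]; exact isOpen_iInter_of_finite fun i ↦ isOpen_lt (by fun_prop) continuous_const
theorem box_fin : volume BX m < ⊤ :=
  (measure_mono fun _ hx ↦ mem_closedBall_zero_iff.2 (box_norm hx)).trans_lt (measure_closedBall_lt_top (x := (0 : E m)) (r := m + 2))
instance : IsFiniteMeasure VX m := ⟨by simpa using box_fin⟩
def om (m : ℕ) : ℝ≥0∞ := volume (Cyl (0 : E m) 1)
theorem om_top : om m ≠ ⊤ :=
  ((measure_mono fun x (hx : nC (x - 0) ≤ 1) ↦ mem_closedBall_zero_iff.2 (by have := le_nC x; rw [sub_zero] at hx; linarith)).trans_lt (measure_closedBall_lt_top (x := (0 : E m)) (r := 2))).ne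
theorem om_pos : om m ≠ 0 :=
  ((measure_ball_pos volume (0 : E m) one_pos).trans_le (measure_mono fun x hx ↦ by
    have h1 := nC_le x; have h2 := mem_ball_zero_iff.1 hx
    show nC (x - 0) ≤ 1; rw [sub_zero]; linarith)).ne'
theorem vol_aff (c : E m) {R : ℝ} (hR : 0 < R) (S : Set (E m)) : volume {x | R⁻¹ • (x - c) ∈ S} = oR (R ^ (m + 2)) * volume S := by
  have h1 : {x | R⁻¹ • (x - c) ∈ S} = (fun x ↦ x - c) ⁻¹' ((fun x ↦ R⁻¹ • x) ⁻¹' S) := rfl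
  simp only [sub_eq_add_neg] at h1
  simp only [sub_eq_add_neg]
  rw [h1, measure_preimage_add_right, Measure.addHaar_preimage_smul volume (inv_ne_zero hR.ne')]
  simp [abs_of_pos hR]
theorem vol_cyl (c : E m) {R : ℝ} (hR : 0 < R) : volume (Cyl c R) = oR (R ^ (m + 2)) * om m := by
  rw [om, ← vol_aff c hR]; congr 1; ext x
  show nC (x - c) ≤ R ↔ nC (R⁻¹ • (x - c) - 0) ≤ 1
  rw [sub_zero, nC_smul, abs_of_pos (inv_pos.2 hR), inv_mul_le_iff₀ hR, mul_one]
namespace Hier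
variable {n M : ℕ} (H : Hier m n M)
def gl (j : ℕ) : ℝ := H.mm j * (H.i j).τ ^ nI n * (BB (H.i j) ^ M)⁻¹
def gu (j : ℕ) : ℝ := H.mm j * BB (H.i j) ^ M
def sl (j : ℕ) : ℝ := H.ss j * (BB (H.i j) ^ M)⁻¹
def su (j : ℕ) : ℝ := H.ss j * BB (H.i j) ^ M
def D (j : ℕ) : Set (E m) := if j = 0 then univ else H.EE j
structure Bd (j : ℕ) (g s : E m) : Prop where
  g1 : H.gl j ≤ ‖g‖
  g2 : ‖g‖ ≤ H.gu j
  s1 : H.sl j ≤ ‖s‖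
  s2 : ‖s‖ ≤ H.su j
  par : ‖g‖ • s = ‖s‖ • g
def Sg : Set (E m) := ⋂ j, H.EE j
def lev (x : E m) : ℕ := sInf {j | x ∉ H.EE j}
def uL (x : E m) : ℝ := H.u (H.lev x) x
def gL (x : E m) : E m := H.G (H.lev x) x
def σL (x : E m) : E m := H.σ (H.lev x) x
def V (j : ℕ) : ℝ := H.P j * H.R j ^ (m + 2)
variable {H}
theorem EE_sub {i j : ℕ} (h : i ≤ j) : HEE j ⊆ HEE i := antitone_nat_of_succ_le (f := HEE) EE_anti h
theorem EE_D (j : ℕ) : HEE j ⊆ HD j := by unfold D; split_ifs <;> simp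
theorem EE_box (j : ℕ) : HEE j ⊆ BX m := (EE_sub (Nat.zero_le j)).trans fun x hx ↦ by
  obtain ⟨a, _, h⟩ := mem_EE.1 hx
  simp only [c, R, sub_zero] at h
  exact box_coord ((le_max_left _ _).trans_lt (h.trans_lt bN)) ((le_max_right _ _).trans_lt (h.trans_lt bN))
theorem stab {x : E m} {i j : ℕ} (hx : x ∉ HEE i) (h : i ≤ j) : Hu j x = Hu i x ∧ HG j x = HG i x ∧ Hσ j x = Hσ i x := by
  induction j, h using Nat.le_induction with
  | base => exact ⟨rfl, rfl, rfl⟩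
  | succ j h ih =>
    have := off (H := H) (j := j) (x := x) fun h' ↦ hx (EE_sub h h')
    exact ⟨this.1.trans ih.1, this.2.1.trans ih.2.1, this.2.2.trans ih.2.2⟩
theorem lim {x : E m} {J : ℕ} (hx : x ∉ HEE J) : HuL x = Hu J x ∧ HgL x = HG J x ∧ HσL x = Hσ J x := by
  have h1 : x ∉ HEE (H.lev x) := Nat.sInf_mem (s := {j | x ∉ HEE j}) ⟨J, hx⟩
  have h2 : H.lev x ≤ J := Nat.sInf_le hx
  have := stab h1 h2
  exact ⟨this.1.symm, this.2.1.symm, this.2.2.symm⟩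
theorem τpow (i : Cp) : i.τ ^ nI n ≤ 1 := rpow_le_one i.τ0.le (by linarith [i.τ1]) bP
theorem bd_triv (j : ℕ) : H.Bd j (Hmm j • e0) (Hss j • e0) := by
  have h1 := mm_pos (H := H) j; have h2 := ss_pos (H := H) j
  have h3 := BB1 Hij M
  have h4 := inv_le_one_of_one_le₀ h3
  have h5 := τpow (n := n) Hij
  have h6 : 0 ≤ (Hi j).τ ^ nI n := (rpow_pos_of_pos (Hi j).τ0 _).le
  have e1 : ‖Hmm j • (e0 : E m)‖ = Hmm j := by rw [norm_smul, e0_norm, norm_of_nonneg h1.le, mul_one]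
  have e2 : ‖Hss j • (e0 : E m)‖ = Hss j := by rw [norm_smul, e0_norm, norm_of_nonneg h2.le, mul_one]
  have h7 : 0 < (BB Hij ^ M)⁻¹ := by positivity
  constructor <;> simp only [e1, e2, gl, gu, sl, su]
  · rw [mul_assoc]; exact mul_le_of_le_one_right h1.le (mul_le_one₀ h5 h7.le h4)
  · exact le_mul_of_one_le_right h1.le h3
  · exact mul_le_of_le_one_right h2.le h4
  · exact le_mul_of_one_le_right h2.le h3
  · module
theorem bdE {j : ℕ} {x : E m} (hx : x ∈ HEE j) : H.Bd j (HG j x) (Hσ j x) ∧ HG j x = Hmm j • e0 ∧ Hσ j x = Hss j • e0 := by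
  obtain ⟨a, ha, h⟩ := mem_EE.1 hx
  obtain ⟨o, ho⟩ := aff j a ha
  obtain ⟨-, h2, h3⟩ := ho x h
  rw [h2, h3]; exact ⟨bd_triv j, rfl, rfl⟩
theorem bd1 {j : ℕ} {x : E m} (hx : x ∈ HD j) : H.Bd j (HG sc j x) (Hσ sc j x) := by
  by_cases h : x ∈ HEE j
  · obtain ⟨a, ha, h⟩ := mem_EE.1 h
    obtain ⟨o, ho⟩ := gen ha
    obtain ⟨-, h2, h3⟩ := ho x h
    have c := Hcell j
    set y := Hy j a x
    have h1 := mm_pos (H := H) j; have h5 := ss_pos (H := H) j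
    have hB := BB1 Hij M
    have hB0 : 0 < BB Hij ^ M := by linarith
    have n1 : ‖HG sc j x‖ = Hmm j * ‖H.cg j y‖ := by rw [h2, norm_smul, norm_of_nonneg h1.le]
    have n2 : ‖Hσ sc j x‖ = Hss j * ‖Hcs j y‖ := by rw [h3, norm_smul, norm_of_nonneg h5.le]
    constructor
    · rw [n1, gl, mul_assoc]; refine mul_le_mul_of_nonneg_left ?_ h1.le
      rw [← div_eq_mul_inv, div_le_iff₀ hB0, mul_comm]; exact c.g1 y
    · rw [n1]; exact mul_le_mul_of_nonneg_left (c.g2 y) h1.le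
    · rw [n2, sl]; refine mul_le_mul_of_nonneg_left ?_ h5.le
      rw [inv_le_iff_one_le_mul₀ hB0, mul_comm]; exact c.s1 y
    · rw [n2]; exact mul_le_mul_of_nonneg_left (c.s2 y) h5.le
    · rw [n1, n2, h2, h3, smul_smul, smul_smul, mul_right_comm, mul_comm (_ * _) (‖_‖), ← smul_smul (‖H.cg j y‖), smul_comm, c.par y, smul_smul]
      congr 1; ring
  · have hj : j = 0 := by
      by_contra hj; exact h (by simpa [D, hj] using hx)
    subst hj
    obtain ⟨-, h2, h3⟩ := off h
    rw [h2, h3]; exact bd_triv 0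
theorem bdJ (J : ℕ) (x : E m) : ∃ j ≤ J, x ∈ HD j ∧ H.Bd j (HG J x) (Hσ J x) ∧ (x ∈ HEE J → j = J) := by
  by_cases h : x ∈ HEE J
  · exact ⟨J, le_rfl, EE_D J h, (bdE h).1, fun _ ↦ rfl⟩
  induction J with
  | zero => exact ⟨0, le_rfl, by simp [D], bd_triv 0, fun _ ↦ rfl⟩
  | succ J ih =>
    by_cases h' : x ∈ HD J
    · exact ⟨J, J.le_succ, h', bd1 h', fun q ↦ absurd q h⟩
    · have hE : x ∉ HEE J := fun q ↦ h' (EE_D J q)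
      obtain ⟨j, h1, h2, h3, -⟩ := ih hE
      obtain ⟨-, k2, k3⟩ := off hE
      exact ⟨j, by omega, h2, by rw [k2, k3]; exact h3, fun q ↦ absurd q h⟩
theorem bdL {x : E m} (hx : x ∉ HSg) : ∃ j, x ∈ HD j ∧ x ∉ HEE sc j ∧ H.Bd j (HgL x) (HσL x) ∧ HuL x = Hu sc j x ∧ ∀ J, x ∈ HEE J → J ≤ j := by
  have hne : ∃ j, x ∉ HEE j := by simpa [Sg] using hx
  have key : ∀ j, x ∈ HD j → x ∉ HEE sc j → ∃ j, x ∈ HD j ∧ x ∉ HEE sc j ∧ H.Bd j (HgL x) (HσL x) ∧ HuL x = Hu sc j x ∧ ∀ J, x ∈ HEE J → J ≤ j := fun j h1 h2 ↦ by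
    obtain ⟨k1, k2, k3⟩ := lim h2
    refine ⟨j, h1, h2, by rw [k2, k3]; exact bd1 h1, k1, fun J hJ ↦ ?_⟩
    by_contra h; exact h2 (EE_sub bO hJ)
  classical
  rcases hk : Nat.find hne with _ | j
  · refine key 0 (by simp [D]) fun h ↦ ?_
    have := Nat.find_spec hne
    rw [hk] at this; exact this (EE_anti 0 h)
  · refine key j (EE_D j ?_) (by have := Nat.find_spec hne; rwa [hk] at this)
    by_contra h; have := Nat.find_min' hne h; omega
theorem mR_le (j : ℕ) : Hmm j * HR j ≤ Hm0 / 2 := by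
  induction j with
  | zero => simp [mm, R]; linarith
  | succ j ih =>
    refine le_trans ?_ ih
    have hb := (Hi j).b0
    have : Hmm sc j * HR sc j = Hmm j * HR j * ((1 - (Hi j).τ) * (Hε j / (Hi j).b)) := by rw [mm, R]; field_simp
    rw [this]
    refine mul_le_of_le_one_right (mul_nonneg (mm_pos j).le (R_pos j).le) (mul_le_one₀ (by linarith [(Hi j).τ0]) (div_nonneg (H.ε0 j).le hb.le) ((div_le_one hb).2 (H.ε1 j)))
theorem u_bd (J : ℕ) (x : E m) : |Hu J x| ≤ Hm0 * (|tt x| + J) := by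
  have h0 := H.m0p
  induction J with
  | zero => simp [u, abs_mul, abs_of_pos h0]
  | succ j ih =>
    push_cast
    by_cases h : x ∈ HEE j
    · obtain ⟨a, ha, h⟩ := mem_EE.1 h
      rw [(on ha h).1]
      have hy : |tt (Hy j a x)| ≤ 1 := (le_max_left _ _).trans (show nC (Hy j a x) ≤ 1 by rw [y_nC, div_le_one (R_pos _)]; exact h)
      have h1 := (Hcell j).le1 _ hy
      have h2 : |Hmm j * HR j * (H.cu j (Hy j a x) - tt (Hy j a x))| ≤ Hm0 / 2 * 2 := by
        rw [abs_mul, abs_of_pos (mul_pos (mm_pos j) (R_pos j))]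
        refine mul_le_mul (mR_le j) ((abs_sub _ _).trans bL) (abs_nonneg _) bL
      refine (abs_add_le _ _).trans ?_; linarith
    · rw [(off h).1]; linarith
theorem vol_EE (j : ℕ) : volume (HEE j) = oR (HV j) * om m := by
  unfold EE
  rw [measure_biUnion_finset]
  · simp only [vol_cyl _ (R_pos j)]
    rw [Finset.sum_const, Finset.card_range, nsmul_eq_mul, V, ofReal_mul bP, ofReal_natCast, mul_assoc]
  · intro a ha b hb hab
    refine Set.disjoint_left.2 fun x hx hy ↦ hab (uniq (by simpa using ha) (by simpa using hb) hx hy)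
  · exact fun a _ ↦ (Cyl_closed _ _).measurableSet
theorem V_pos (j : ℕ) : 0 < HV j := mul_pos (by exact_mod_cast P_pos j) (pow_pos (R_pos j) _)
theorem D_meas (j : ℕ) : MeasurableSet (HD j) := by
  unfold D; split_ifs
  · exact .univ
  · exact (EE_closed j).measurableSet
variable (H) in
def Wf (c : ℕ → ℝ) (x : E m) : ℝ≥0∞ := ∑' j, (HD j).indicator (fun _ ↦ oR (c j)) x
theorem le_Wf (c : ℕ → ℝ) {j : ℕ} {x : E m} (h : x ∈ HD j) : oR (c j) ≤ H.Wf c x := by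
  refine le_trans ?_ (ENNReal.le_tsum j); rw [indicator_of_mem h]
theorem Wf_fin {c : ℕ → ℝ} (hc : ∀ j, 0 ≤ c j) (hs : Summable fun j ↦ c j * HV j) : ∫⁻ x in BX m, H.Wf c x < ⊤ := by
  unfold Wf
  rw [lintegral_tsum fun j ↦ (measurable_const.indicator (D_meas j)).aemeasurable]
  have h1 : ∀ j, ∫⁻ x in BX m, (HD j).indicator (fun _ ↦ oR (c j)) x ≤
      oR (c j * HV j) * (om m + volume BX m / oR (HV 0)) := fun j ↦ by
    rw [lintegral_indicator_const (D_meas j), Measure.restrict_apply (D_meas j), ofReal_mul (hc j), mul_assoc]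
    refine mul_le_mul_right ?_ _
    rcases j with _ | j
    · rw [mul_add, ENNReal.mul_div_cancel (by simpa using V_pos (H := H) 0) bS]
      exact le_add_left (measure_mono inter_subset_right)
    · rw [mul_add]; refine le_add_right ((measure_mono inter_subset_left).trans ?_)
      simp [D, vol_EE]
  refine (ENNReal.tsum_le_tsum h1).trans_lt ?_
  rw [ENNReal.tsum_mul_right, ← ofReal_tsum_of_nonneg (fun j ↦ mul_nonneg (hc j) (V_pos j).le) hs]
  refine mul_lt_top bS (add_lt_top.2 ⟨om_top.lt_top, div_lt_top box_fin.ne (by simpa using V_pos (H := H) 0)⟩)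
theorem Sg_null (hV : Tendsto HV atTop (𝓝 0)) : volume HSg = 0 := by
  have h1 : ∀ j, volume HSg ≤ oR (HV j) * om m := fun j ↦ vol_EE (H := H) j ▸ measure_mono (iInter_subset _ j)
  have h2 : Tendsto (fun j ↦ oR (HV j) * om m) atTop (𝓝 0) := by
    have := ENNReal.Tendsto.mul_const (b := om m) (tendsto_ofReal hV) (.inr om_top)
    simpa using this
  exact le_antisymm (ge_of_tendsto' h2 h1) zero_le
theorem E_tend (hV : Tendsto HV atTop (𝓝 0)) : Tendsto (fun j ↦ volume (HEE j)) atTop (𝓝 0) := by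
  simp only [vol_EE]
  have := ENNReal.Tendsto.mul_const (b := om m) (tendsto_ofReal hV) (.inr om_top)
  simpa using this
end Hier
end
noncomputable section
def LL (t : ℝ) : ℝ := lgg (exp 1 + t)
def ff (q γ t : ℝ) : ℝ := t ^ q * LL t ^ γ
def hf (q γ t : ℝ) : ℝ := q + γ * (t / (exp 1 + t)) / LL t
def hh (q γ t : ℝ) : ℝ := ff pd q γ t * hf q γ t
theorem LL1 {t : ℝ} (ht : 0 ≤ t) : 1 ≤ LL t := by
  rw [LL, le_log_iff_exp_le bP]; linarith
theorem LL_mono {s t : ℝ} (hs : 0 ≤ s) (h : s ≤ t) : LL s ≤ LL t := log_le_log bP bL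
theorem LL_le {t : ℝ} (ht : 0 ≤ t) : LL t ≤ 1 + t := by
  have h1 : rz < exp 1 := exp_pos 1
  rw [LL, log_le_iff_le_exp bP, exp_add]
  have := add_one_le_exp t
  have h2 : ro ≤ exp 1 := one_le_exp bN
  nlinarith
theorem ff_pos (q γ : ℝ) {t : ℝ} (ht : 0 < t) : 0 < ff q γ t :=
  mul_pos (rpow_pos_of_pos ht _) (rpow_pos_of_pos (by linarith [LL1 ht.le]) _)
theorem ff_nonneg (q γ : ℝ) {t : ℝ} (ht : 0 ≤ t) : 0 ≤ ff q γ t :=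
  mul_nonneg (rpow_nonneg ht _) (rpow_nonneg (by linarith [LL1 ht]) _)
theorem rE {t : ℝ} (ht : 0 < t) : 0 ≤ t / (exp 1 + t) ∧ t / (exp 1 + t) ≤ 1 := by
  have h1 : rz < exp 1 := exp_pos 1
  exact ⟨by positivity, (div_le_one bP).2 bL⟩
theorem LL_d {t : ℝ} (ht : 0 < t) : HasDerivAt LL (1 / (exp 1 + t)) t :=
  ((hasDerivAt_id t).const_add (exp 1)).log (by simp only [id]; positivity)
theorem ff_succ (q γ : ℝ) {t : ℝ} (ht : 0 < t) : ff q γ t = ff pd q γ t * t := by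
  rw [ff, ff, mul_right_comm, ← rpow_add_one ht.ne', sub_add_cancel]
theorem ff_d (q γ : ℝ) {t : ℝ} (ht : 0 < t) : HasDerivAt (ff q γ) (hh q γ t) t := by
  have hL : 0 < LL t := by linarith [LL1 ht.le]
  refine ((hasDerivAt_rpow_const (.inl ht.ne')).mul ((LL_d ht).rpow_const (p := γ) (.inl hL.ne'))).congr_deriv ?_
  rw [hh, hf, ff, rpow_sub_one hL.ne', rpow_sub_one ht.ne']
  have h1 : rz < exp 1 + t := by positivity
  field_simp
theorem hf_bd {q γ t k : ℝ} (ht : 0 < t) (hk : |γ| ≤ k * LL t) : q - k ≤ hf q γ t ∧ hf q γ t ≤ q + k := by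
  have hL : 0 < LL t := by linarith [LL1 ht.le]
  obtain ⟨h1, h2⟩ := rE ht
  have : |γ * (t / (exp 1 + t)) / LL t| ≤ k := by
    rw [abs_div, abs_of_pos hL, div_le_iff₀ hL, abs_mul, abs_of_nonneg h1]
    exact (mul_le_of_le_one_right (abs_nonneg _) h2).trans hk
  have := abs_le.1 this
  unfold hf; constructor <;> linarith
theorem hf_d (q γ : ℝ) {t : ℝ} (ht : 0 < t) {k : ℝ} (hk : |γ| ≤ k * LL t) : ∃ w, HasDerivAt (hf q γ) w t ∧ |w| * t ≤ 2 * k := by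
  have hL := LL1 ht.le
  have hL' : 0 < LL t := by linarith
  have h1 : rz < exp 1 := exp_pos 1
  have h2 : rz < exp 1 + t := by positivity
  refine ⟨_, (((((hasDerivAt_id t).div ((hasDerivAt_id t).const_add (exp 1)) (by simp only [id]; positivity)).const_mul γ).div (LL_d ht) hL'.ne').const_add q), ?_⟩
  simp only [id, Pi.div_apply]
  have e : (γ * ((1 * (exp 1 + t) - t * 1) / (exp 1 + t) ^ 2) * LL t - γ * (t / (exp 1 + t)) * (1 / (exp 1 + t))) / LL t ^ 2 =
      γ / LL t * ((exp 1 * LL t - t) / ((exp 1 + t) ^ 2 * LL t)) := by field_simp; ring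
  rw [e, abs_mul, mul_assoc]
  have h3 : |γ / LL t| ≤ k := by rw [abs_div, abs_of_pos hL', div_le_iff₀ hL']; exact hk
  have hk0 : 0 ≤ k := (abs_nonneg _).trans h3
  rw [mul_comm 2 k]
  refine mul_le_mul h3 ?_ bP hk0
  rw [abs_div, abs_of_pos (show 0 < (exp 1 + t) ^ 2 * LL t by positivity), div_mul_eq_mul_div, div_le_iff₀ bP]
  have h4 : |exp 1 * LL t - t| ≤ exp 1 * LL t + t := (abs_sub _ _).trans (by rw [abs_of_pos bP, abs_of_pos ht])
  refine (mul_le_mul_of_nonneg_right h4 ht.le).trans ?_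
  have : t * t ≤ t * t * LL t := le_mul_of_one_le_right bP hL
  nlinarith [mul_pos (mul_pos h1 ht) hL', mul_pos (mul_pos h1 h1) hL', mul_pos (mul_pos ht ht) hL']
structure Sc (p γ T0 : ℝ) (Q : ℕ) : Prop where
  T1 : 1 ≤ T0
  lo : ∀ t, T0 ≤ t → p / 2 * ff pd p γ t ≤ hh p γ t
  hi : ∀ t, T0 ≤ t → hh p γ t ≤ 2 * p * ff pd p γ t
  tan : ∀ t0, T0 ≤ t0 → ∀ t, 0 ≤ t → ff p γ t0 + hh p γ t0 * (t - t0) ≤ ff p γ t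
  mono : ∀ s, T0 ≤ s → ∀ t, s ≤ t → ff pd p γ s ≤ ff pd p γ t
  lip : ∀ X, 2 ≤ X → ∀ s, T0 ≤ s → s ≤ X → ∀ t, T0 ≤ t → t ≤ X → |hh p γ s - hh p γ t| ≤ X ^ Q * |s - t|
theorem Sc.mono' {p γ T0 T : ℝ} {Q : ℕ} (h : Sc p γ T0 Q) (hT : T0 ≤ T) : Sc p γ T Q :=
  ⟨h.T1.trans hT, fun t ht ↦ h.lo t (hT.trans ht), fun t ht ↦ h.hi t (hT.trans ht), fun t ht ↦ h.tan t (hT.trans ht), fun t ht ↦ h.mono t (hT.trans ht),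
    fun X hX s hs hs2 t ht ↦ h.lip X hX s (hT.trans hs) hs2 t (hT.trans ht)⟩
theorem pow_abs {C X : ℝ} (hX : 2 ≤ X) : ∃ k : ℕ, C ≤ 2 ^ k ∧ C ≤ X ^ k := by
  obtain ⟨k, hk⟩ := pow_unbounded_of_one_lt C (one_lt_two)
  exact ⟨k, hk.le, hk.le.trans (pow_le_pow_left₀ bN hX k)⟩
theorem scal {p : ℝ} (hp : 1 < p) (γ : ℝ) : ∃ (T0 : ℝ) (Q : ℕ), Sc p γ T0 Q := by
  have hp1 : 0 < p - 1 := by linarith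
  set k : ℝ := pd p / (8 * p) with hk
  have hk0 : 0 < k := by positivity
  have hkp : k * (8 * p) = p - 1 := by rw [hk]; field_simp
  have hk8 : k ≤ 1 / 8 := by nlinarith
  set c : ℝ := 2 * k with hc
  set S : ℝ := exp (|γ| / k) with hS
  have hS1 : 1 ≤ S := one_le_exp bP
  have hg : ∀ t, S ≤ t → |γ| ≤ k * LL t := fun t ht ↦ by
    rw [← div_le_iff₀' hk0, LL, le_log_iff_exp_le (by have := exp_pos 1; linarith)]
    have := exp_pos 1; linarith
  have hfp : ∀ t, S ≤ t → p - k ≤ hf p γ t ∧ hf p γ t ≤ p + k := fun t ht ↦ hf_bd bL (hg t ht)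
  have hfq : ∀ t, S ≤ t → p - 1 - k ≤ hf pd p γ t ∧ hf pd p γ t ≤ p - 1 + k := fun t ht ↦ hf_bd bL (hg t ht)
  have kp : k < pd p / 4 := by nlinarith
  have hd : ∀ t, S ≤ t → ∃ w, HasDerivAt (hh p γ) w t ∧ 0 ≤ w ∧ w ≤ ff (p - 1 - 1) γ t * (4 * p * p + 1) := fun t ht ↦ by
    have ht0 : 0 < t := by linarith
    obtain ⟨w, hw, hw2⟩ := hf_d p γ ht0 (hg t ht)
    obtain ⟨a1, a2⟩ := hfp t ht
    obtain ⟨b1, b2⟩ := hfq t ht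
    refine ⟨_, (ff_d pd p γ ht0).mul hw, ?_⟩
    have e : hh pd p γ t * hf p γ t + ff pd p γ t * w = ff (p - 1 - 1) γ t * (hf pd p γ t * hf p γ t + t * w) := by
      rw [ff_succ pd p γ ht0, hh]; ring
    rw [e]
    have hf0 := ff_pos (p - 1 - 1) γ ht0
    have hw3 : |t * w| ≤ 2 * k := by rw [abs_mul, abs_of_pos ht0, mul_comm]; exact hw2
    have hw4 := abs_le.1 hw3
    constructor
    · refine mul_nonneg hf0.le ?_
      have : pd p * (3 / 4) * 1 ≤ hf pd p γ t * hf p γ t := mul_le_mul bL bL bN bL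
      nlinarith
    · refine mul_le_mul_of_nonneg_left ?_ hf0.le
      have : hf pd p γ t * hf p γ t ≤ (2 * p) * (2 * p) := mul_le_mul bL bL bL bL
      nlinarith
  have hm : ∀ s, S ≤ s → ∀ t, s ≤ t → hh p γ s ≤ hh p γ t := fun s hs t hst ↦ by
    rcases hst.eq_or_lt with rfl | hlt
    · rfl
    obtain ⟨ξ, hξ, e⟩ := exists_deriv_eq_slope (hh p γ) hlt (fun x hx ↦ by obtain ⟨w, hw, -⟩ := hd x (hs.trans hx.1); exact hw.continuousAt.continuousWithinAt)
      (fun x hx ↦ by obtain ⟨w, hw, -⟩ := hd x (hs.trans hx.1.le); exact hw.differentiableAt.differentiableWithinAt)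
    obtain ⟨w, hw, hw2, -⟩ := hd ξ (hs.trans hξ.1.le)
    rw [hw.deriv] at e
    rw [e, div_nonneg_iff] at hw2
    rcases hw2 with h | h <;> linarith [h.1, h.2]
  have hc0 : 0 < c := by positivity
  have hc1 : c ≤ 1 / 4 := by linarith
  have hT : S ≤ S / c := by rw [le_div_iff₀ hc0]; nlinarith
  obtain ⟨k1, hk1, -⟩ := pow_abs (C := 4 * p * p + 1) (X := 2) le_rfl
  obtain ⟨k2, hk2⟩ := exists_nat_ge p
  obtain ⟨k3, hk3⟩ := exists_nat_ge |γ|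
  refine ⟨S / c, k1 + k2 + 2 * k3, hS1.trans hT, fun t ht ↦ ?_, fun t ht ↦ ?_, fun t0 ht0 t ht ↦ ?_, fun s hs t hst ↦ ?_, fun X hX s hs hsX t ht htX ↦ ?_⟩
  · have h0 := (ff_pos pd p γ (show 0 < t by linarith)).le
    rw [hh, mul_comm]; exact mul_le_mul_of_nonneg_left (by linarith [(hfp t (hT.trans ht)).1]) h0
  · have h0 := (ff_pos pd p γ (show 0 < t by linarith)).le
    rw [hh, mul_comm]; exact mul_le_mul_of_nonneg_right (by linarith [(hfp t (hT.trans ht)).2]) h0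
  · have hct : S ≤ c * t0 := by rwa [div_le_iff₀' hc0] at ht0
    have hSt : S ≤ t0 := hT.trans ht0
    have h0 : 0 < t0 := by linarith
    rcases lt_or_ge t (c * t0) with hlt | hge
    · refine le_trans ?_ (ff_nonneg p γ ht)
      obtain ⟨a1, a2⟩ := hfp t0 hSt
      have hf1 := ff_pos pd p γ h0
      rw [ff_succ p γ h0, hh]
      have h3 : t0 + hf p γ t0 * (t - t0) ≤ 0 := by
        have h5 : hf p γ t0 * (t - t0) ≤ hf p γ t0 * (c * t0 - t0) := mul_le_mul_of_nonneg_left bL bL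
        have h6 : 1 ≤ hf p γ t0 * cm c := by
          have : hf p γ t0 * c ≤ 2 * p * c := mul_le_mul_of_nonneg_right bL hc0.le
          nlinarith
        nlinarith
      nlinarith
    · rcases lt_trichotomy t t0 with h | h | h
      · obtain ⟨ξ, hξ, e⟩ := exists_hasDerivAt_eq_slope (ff p γ) (hh p γ) h (fun x hx ↦ (ff_d p γ (by linarith [hx.1])).continuousAt.continuousWithinAt) (fun x hx ↦ ff_d p γ (by linarith [hx.1]))
        have := hm ξ (by linarith [hξ.1]) t0 hξ.2.le
        rw [e, div_le_iff₀ bL] at this; linarith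
      · rw [h]; simp
      · obtain ⟨ξ, hξ, e⟩ := exists_hasDerivAt_eq_slope (ff p γ) (hh p γ) h (fun x hx ↦ (ff_d p γ (by linarith [hx.1])).continuousAt.continuousWithinAt) (fun x hx ↦ ff_d p γ (by linarith [hx.1]))
        have := hm t0 (by linarith [hξ.1]) ξ hξ.1.le
        rw [e, le_div_iff₀ bL] at this; linarith
  · rcases hst.eq_or_lt with rfl | hlt
    · rfl
    have hs' : S ≤ s := hT.trans hs
    obtain ⟨ξ, hξ, e⟩ := exists_hasDerivAt_eq_slope (ff pd p γ) (hh pd p γ) hlt (fun x hx ↦ (ff_d _ γ (by linarith [hx.1])).continuousAt.continuousWithinAt) (fun x hx ↦ ff_d _ γ (by linarith [hx.1]))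
    have hξ0 : 0 < ξ := by linarith [hξ.1]
    have : 0 ≤ hh pd p γ ξ := mul_nonneg (ff_pos _ γ hξ0).le (by linarith [(hfq ξ (by linarith [hξ.1])).1])
    rw [e, div_nonneg_iff] at this
    rcases this with h | h <;> linarith [h.1, h.2]
  · have hb : ∀ x ∈ Icc S X, ‖deriv (hh p γ) x‖ ≤ X ^ (k1 + k2 + 2 * k3) := fun x hx ↦ by
      obtain ⟨w, hw, hw1, hw2⟩ := hd x hx.1
      rw [hw.deriv, norm_of_nonneg hw1]
      refine hw2.trans ?_
      have hx1 : 1 ≤ x := hS1.trans hx.1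
      have hX1 : 1 ≤ X := by linarith
      have hL := LL1 (show 0 ≤ x by linarith)
      have e1 : x ^ (p - 1 - 1) ≤ X ^ k2 := by
        refine (rpow_le_rpow_of_exponent_le hx1 (show p - 1 - 1 ≤ (k2 : ℝ) by linarith)).trans ?_
        rw [rpow_natCast]; exact pow_le_pow_left₀ bL hx.2 _
      have e2 : LL x ^ γ ≤ (X ^ 2) ^ k3 := by
        refine (rpow_le_rpow_of_exponent_le hL ((le_abs_self γ).trans hk3)).trans ?_
        rw [rpow_natCast]
        refine pow_le_pow_left₀ bL ((LL_le bL).trans ?_) _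
        nlinarith [hx.2]
      have e3 : 4 * p * p + 1 ≤ X ^ k1 := hk1.trans (pow_le_pow_left₀ bN hX _)
      rw [pow_add, pow_add, pow_mul]
      calc ff (p - 1 - 1) γ x * (4 * p * p + 1) ≤ (X ^ k2 * (X ^ 2) ^ k3) * X ^ k1 := by
            refine mul_le_mul (mul_le_mul e1 e2 (rpow_nonneg bL _) bP) e3 bP bP
        _ = _ := by ring
    have := Convex.norm_image_sub_le_of_norm_deriv_le (f := hh p γ) (fun x hx ↦ by obtain ⟨w, hw, -⟩ := hd x hx.1; exact hw.differentiableAt) hb (convex_Icc S X) ⟨hT.trans ht, htX⟩ ⟨hT.trans hs, hsX⟩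
    simpa [norm_eq_abs] using this
end
noncomputable section
variable {m : ℕ}
def Psi (p α β t s : ℝ) : ℝ := (s - hh p (-β) t) / hh p α t
namespace Hier
variable {n M : ℕ}
structure Good (H : Hier m n M) (p α β T0 : ℝ) (Q : ℕ) : Prop where
  hp : 1 < p
  s0 : Sc p (-β) T0 Q
  s1 : Sc p α T0 Q
  glT : ∀ j, T0 ≤ H.gl j
  sg : ∀ j t, H.gl j ≤ t → t ≤ H.gu j → hh p (-β) t ≤ H.sl j
  c1 : Summable fun j ↦ H.gu j * H.su j * H.V j
  c2 : Summable fun j ↦ H.gu j ^ p * H.V j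
  Vh : ∀ j, H.V sc j ≤ H.V j / 2
  lam : ∃ l : ℕ → ℝ, (∀ j t, 0 ≤ t → H.ss j * t ≤ l j + ff p (-β) t) ∧ Tendsto (fun j ↦ l j * H.V j) atTop (𝓝 0)
  ns : ∀ s, p < s → Tendsto (fun j ↦ H.gl j ^ s * H.V j) atTop atTop
open Classical in
def aw (H : Hier m n M) (p α β : ℝ) (x : E m) : ℝ := if x ∈ H.Sg then 0 else Psi p α β ‖H.gL x‖ ‖H.σL x‖
def aJ (H : Hier m n M) (p α β : ℝ) (J : ℕ) (x : E m) : ℝ := Psi p α β ‖H.G J x‖ ‖H.σ J x‖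
variable {H : Hier m n M} {p α β T0 : ℝ} {Q : ℕ}
theorem gu_pos (j : ℕ) : 0 < Hgu j := mul_pos (mm_pos j) (by linarith [BB1 Hij M])
theorem su_pos (j : ℕ) : 0 < Hsu j := mul_pos (ss_pos j) (by linarith [BB1 Hij M])
theorem mm_le (j : ℕ) : Hmm j ≤ Hgu j := le_mul_of_one_le_right (mm_pos j).le (BB1 _ _)
theorem Good.gT (g : GD) {j : ℕ} {v s : E m} (h : H.Bd j v s) : T0 ≤ ‖v‖ := (g.glT j).trans h.g1
theorem Sc.pos {p γ T0 : ℝ} {Q : ℕ} (h : Sc p γ T0 Q) (hp : 1 < p) {t : ℝ} (ht : T0 ≤ t) : 0 < hh p γ t :=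
  lt_of_lt_of_le (mul_pos bL (ff_pos _ _ (by linarith [h.T1]))) (h.lo t ht)
theorem Good.psi (g : GD) {j : ℕ} {v s : E m} (h : H.Bd j v s) : 0 ≤ Psi p α β ‖v‖ ‖s‖ ∧ 0 ≤ ‖s‖ - hh p (-β) ‖v‖ ∧
    hh p (-β) ‖v‖ + Psi p α β ‖v‖ ‖s‖ * hh p α ‖v‖ = ‖s‖ ∧ Psi p α β ‖v‖ ‖s‖ ≤ Hsu j / (p / 2 * ff pd p α (Hgl j)) := by
  have hp := g.hp
  have h1 := Sc.pos g.s1 hp (g.gT h)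
  have h0 := Sc.pos g.s0 hp (g.gT h)
  have h2 : 0 ≤ ‖s‖ - hh p (-β) ‖v‖ := by linarith [g.sg j _ h.g1 h.g2, h.s1]
  have h3 : 0 < ff pd p α (Hgl j) := ff_pos _ _ (by linarith [g.s1.T1, g.glT j])
  refine ⟨div_nonneg h2 h1.le, h2, by rw [Psi, div_mul_cancel₀ _ h1.ne']; ring, ?_⟩
  refine div_le_div₀ (su_pos j).le (by linarith [h.s2]) bP (le_trans ?_ (g.s1.lo _ (g.gT h)))
  exact mul_le_mul_of_nonneg_left (g.s1.mono _ (g.glT j) _ h.g1) bL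
theorem aw_off {J : ℕ} {x : E m} (hx : x ∉ HEE J) : H.aw p α β x = H.aJ p α β J x := by
  have h : x ∉ HSg := fun h ↦ hx (mem_iInter.1 h J)
  obtain ⟨-, h2, h3⟩ := lim hx
  rw [aw, if_neg h, h2, h3, aJ]
theorem Good.aw0 (g : GD) (x : E m) : 0 ≤ H.aw p α β x := by
  unfold aw; split_ifs with h
  · rfl
  · obtain ⟨j, -, -, hb, -⟩ := bdL h
    exact (g.psi hb).1
theorem Good.V0 (g : GD) (j : ℕ) : HV j ≤ HV 0 * hlf ^ j := by
  induction j with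
  | zero => simp
  | succ j ih => have := g.Vh j; rw [pow_succ]; linarith
theorem Good.c3 (g : GD) (k : ℕ) (C : ℝ) : Summable fun j : ℕ ↦ (C * (j + k : ℝ)) * HV j := by
  have h1 : Summable fun j : ℕ ↦ (j : ℝ) * (1 / 2 : ℝ) ^ j := by simpa using summable_pow_mul_geometric_of_norm_lt_one 1 (r := (1 / 2 : ℝ)) bN
  have h2 : Summable fun j : ℕ ↦ (1 / 2 : ℝ) ^ j := summable_geometric_of_norm_lt_one bN
  have h3 : Summable fun j : ℕ ↦ (j + k : ℝ) * HV j := by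
    refine Summable.of_nonneg_of_le (fun j ↦ mul_nonneg bP (V_pos j).le) (fun j ↦ mul_le_mul_of_nonneg_left (g.V0 j) bP) ?_
    refine ((h1.add (h2.mul_left (k : ℝ))).mul_left (HV 0)).congr fun j ↦ ?_
    ring
  simpa [mul_assoc] using h3.mul_left C
theorem Good.Vt (g : GD) : Tendsto HV atTop (𝓝 0) := by
  refine squeeze_zero (fun j ↦ (V_pos j).le) g.V0 ?_
  simpa using (tendsto_pow_atTop_nhds_zero_of_lt_one (by norm_num : rz ≤ 1 / 2) bN).const_mul (HV 0)
theorem Good.ae (g : GD) : ∀ᵐ x ∂VX m, x ∉ HSg :=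
  ae_restrict_of_ae (measure_eq_zero_iff_ae_notMem.1 (Sg_null g.Vt))
theorem Good.meas (g : GD) {F : Type*} [TopologicalSpace F] [TopologicalSpace.PseudoMetrizableSpace F] {fJ : ℕ → E m → F} {f : E m → F} (hc : ∀ J, AEStronglyMeasurable (fJ J) VX m)
    (ho : ∀ J x, x ∉ HEE J → f x = fJ J x) : AEStronglyMeasurable f VX m := by
  refine aestronglyMeasurable_of_tendsto_ae atTop hc ?_
  filter_upwards [g.ae] with x hx
  obtain ⟨j, hj⟩ : ∃ j, x ∉ HEE j := by simpa [Sg] using hx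
  refine tendsto_const_nhds.congr' ?_
  filter_upwards [eventually_ge_atTop j] with J hJ
  exact ho J x fun h ↦ hj (EE_sub hJ h)
theorem Good.lim_int (g : GD) {F : Type*} [NormedAddCommGroup F] [NormedSpace ℝ F] {fJ : ℕ → E m → F} {f : E m → F} (hc : ∀ J, AEStronglyMeasurable (fJ J) VX m)
    (ho : ∀ J x, x ∉ HEE J → f x = fJ J x) {c : ℕ → ℝ} (hc0 : ∀ j, 0 ≤ c j) (hcs : Summable fun j ↦ c j * HV j)
    (hd : ∀ j x, x ∈ BX m → x ∈ HD j → x ∉ HEE sc j → ‖f x‖ ≤ c j) :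
    IntegrableOn f BX m ∧ ∀ d : ℕ → ℝ, Tendsto (fun j ↦ d j * HV j) atTop (𝓝 0) → (∀ J, ∀ x ∈ HEE J, ‖fJ J x‖ ≤ d J) →
      Tendsto (fun J ↦ ∫ x in BX m, fJ J x) atTop (𝓝 (∫ x in BX m, f x)) := by
  have hm := g.meas hc ho
  have hfin : ∫⁻ x in BX m, ‖f x‖ₑ < ⊤ := by
    refine (lintegral_mono_ae ?_).trans_lt (Wf_fin hc0 hcs)
    filter_upwards [g.ae, ae_restrict_mem box_open.measurableSet] with x hx hxB
    obtain ⟨j, h1, h2, -⟩ := bdL hx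
    refine le_trans ?_ (le_Wf c h1)
    rw [← ofReal_norm]; exact ofReal_le_ofReal (hd j x hxB h1 h2)
  refine ⟨⟨hm, hfin⟩, fun d hdt hdb ↦ ?_⟩
  have hle : ∀ J, ∫⁻ x in BX m, ‖fJ J x - f x‖ₑ ≤ (∫⁻ x in HEE J, ‖f x‖ₑ ∂VX m) + oR (d J * HV J) * om m := fun J ↦ by
    have hE := (EE_closed (H := H) J).measurableSet
    have h1 : ∀ x, ‖fJ J x - f x‖ₑ ≤ (HEE J).indicator (fun x ↦ ‖f x‖ₑ + oR (d J)) x := fun x ↦ by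
      by_cases hx : x ∈ HEE J
      · rw [indicator_of_mem hx, add_comm]
        refine enorm_sub_le.trans (add_le_add_left ?_ _)
        rw [← ofReal_norm]; exact ofReal_le_ofReal (hdb J x hx)
      · rw [ho J x hx]; simp
    refine (lintegral_mono h1).trans ?_
    rw [lintegral_indicator hE, lintegral_add_right _ measurable_const, setLIntegral_const, Measure.restrict_apply hE, inter_eq_left.2 (EE_box J), vol_EE,
      ofReal_mul' (V_pos J).le, mul_assoc]
  have ht : Tendsto (fun J ↦ (∫⁻ x in HEE J, ‖f x‖ₑ ∂VX m) + oR (d J * HV J) * om m) atTop (𝓝 0) := by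
    have t1 : Tendsto (fun J ↦ ∫⁻ x in HEE J, ‖f x‖ₑ ∂VX m) atTop (𝓝 0) := by
      refine tendsto_setLIntegral_zero hfin.ne (tendsto_of_tendsto_of_tendsto_of_le_of_le tendsto_const_nhds (E_tend g.Vt) (fun _ ↦ zero_le) fun J ↦ ?_)
      exact Measure.restrict_apply_le _ _
    have t2 := ENNReal.Tendsto.mul_const (b := om m) (tendsto_ofReal hdt) (.inr om_top)
    simpa using t1.add t2
  have h0 := tendsto_of_tendsto_of_tendsto_of_le_of_le tendsto_const_nhds ht (fun _ ↦ zero_le) hle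
  refine tendsto_integral_of_L1 f hm ?_ h0
  filter_upwards [h0.eventually (gt_mem_nhds zero_lt_top)] with J hJ
  have : Integrable (fun x ↦ fJ J x - f x) VX m := ⟨(hc J).sub hm, hJ⟩
  exact (this.add (⟨hm, hfin⟩ : Integrable f VX m)).congr (.of_forall fun x ↦ by simp)
end Hier
end
noncomputable section
variable {m : ℕ}
namespace Hier
variable {n M : ℕ} {H : Hier m n M} {p α β T0 : ℝ} {Q : ℕ}
theorem D_le {j J : ℕ} {x : E m} (h1 : x ∈ HD j) (h2 : x ∉ HEE sc J) : j ≤ J := by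
  by_contra h
  have h3 : j ≠ 0 := by omega
  rw [D, if_neg h3] at h1
  exact h2 (EE_sub bO h1)
theorem levB {j : ℕ} {x : E m} (h1 : x ∈ HD j) (h2 : x ∉ HEE sc j) : H.Bd j (HgL x) (HσL x) := by
  obtain ⟨k, a1, a2, a3, -⟩ := bdL (x := x) (H := H) fun h ↦ h2 (mem_iInter.1 h _)
  rwa [le_antisymm (D_le h1 a2) (D_le a1 h2)]
theorem Good.gu1 (g : GD) (j : ℕ) : 1 ≤ Hgu j := by
  have a := bdE (H := H) (j := j) (x := Hc j 0) (mem_EE.2 ⟨0, P_pos j, by simpa [nC_zero] using (R_pos j).le⟩)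
  linarith [g.gT a.1, g.s0.T1, a.1.g2]
theorem ubox {J : ℕ} {x : E m} (hx : x ∈ BX m) : |Hu J x| ≤ Hm0 * (J + (m + 2 : ℕ)) :=
  (u_bd J x).trans (mul_le_mul_of_nonneg_left (by push_cast; linarith [tt_le x, box_norm hx]) H.m0p.le)
theorem Good.c4 (g : GD) : Summable fun j ↦ Hgu j * HV j :=
  g.c2.of_nonneg_of_le (fun j ↦ mul_nonneg (gu_pos j).le (V_pos j).le) fun j ↦
    mul_le_mul_of_nonneg_right (by simpa using rpow_le_rpow_of_exponent_le (g.gu1 j) g.hp.le) (V_pos j).le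
theorem ibp (J : ℕ) {φ : E m → ℝ} (hφ : ContDiff ℝ tI φ) (hc : HasCompactSupport φ) :
    ∫ x, Hu J x • fD φ x = -∫ x, φ x • (innerSL ℝ (HG J x) : DE m) := by
  have c0 := u_cont (H := H) J
  have c1 := G_cont (H := H) J
  have c2 := hφ.continuous_fderiv bS
  have c3 := hφ.continuous
  have c4 := (innerSL ℝ (E := E m)).continuous.comp c1
  have i1 : Integrable fun x ↦ Hu J x • fD φ x := (c0.smul c2).integrable_of_hasCompactSupport (hc.fderiv ℝ).smul_left
  have i2 : Integrable fun x ↦ φ x • (innerSL ℝ (HG J x) : DE m) := (c3.smul c4).integrable_of_hasCompactSupport hc.smul_right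
  ext v
  rw [neg_apply, ContinuousLinearMap.integral_apply i1, ContinuousLinearMap.integral_apply i2]
  have e : ∀ x, fD (Hu J) x = innerSL ℝ (HG J x) := fun x ↦ (du J x).fderiv
  have := integral_mul_fderiv_eq_neg_fderiv_mul_of_integrable (μ := (volume : Measure (E m))) (f := Hu J) (g := φ) (v := v)
    (((i2.apply_continuousLinearMap v).congr (.of_forall fun x ↦ by simp [e, mul_comm]))) (i1.apply_continuousLinearMap v)
    ((c0.mul c3).integrable_of_hasCompactSupport hc.mul_left) (fun x _ ↦ (du J x).differentiableAt) (fun x _ ↦ hφ.differentiable bS x)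
  simpa [e, mul_comm] using this
theorem Good.w11 (g : GD) : W11On BX m HuL (fun x ↦ (innerSL ℝ (HgL x) : DE m)) := by
  have h0 := H.m0p
  have sM : ∀ J, AEStronglyMeasurable (Hu J) VX m := fun J ↦ (u_cont J).aestronglyMeasurable
  have sG : ∀ J, AEStronglyMeasurable (fun x ↦ (innerSL ℝ (HG J x) : DE m)) VX m := fun J ↦
    ((innerSL ℝ (E := E m)).continuous.comp (G_cont J)).aestronglyMeasurable
  have bu : ∀ j x, x ∈ BX m → x ∈ HD j → x ∉ HEE sc j → |HuL x| ≤ Hm0 * (j + (m + 3 : ℕ)) := fun j x h1 _ h3 ↦ by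
    rw [(lim h3).1]; refine (ubox h1).trans (le_of_eq ?_); push_cast; ring
  have bg : ∀ j x, x ∈ BX m → x ∈ HD j → x ∉ HEE sc j → ‖HgL x‖ ≤ Hgu j := fun j x _ h2 h3 ↦ (levB h2 h3).g2
  have ou : ∀ J x, x ∉ HEE J → HuL x = Hu J x := fun J x h ↦ (lim h).1
  have og : ∀ J x, x ∉ HEE J → HgL x = HG J x := fun J x h ↦ (lim h).2.1
  refine ⟨(g.lim_int sM ou (fun j ↦ by positivity) (g.c3 (m + 3) Hm0) bu).1,
    (g.lim_int sG (fun J x h ↦ by rw [og J x h]) (fun j ↦ (gu_pos j).le) g.c4 (fun j x a b c ↦ by simpa using bg j x a b c)).1, fun φ hφ hc hs ↦ ?_⟩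
  have c2 := hφ.continuous_fderiv bS
  obtain ⟨B1, hB1⟩ := c2.bounded_above_of_compact_support (hc.fderiv ℝ)
  obtain ⟨B2, hB2⟩ := hφ.continuous.bounded_above_of_compact_support hc
  have n1 : 0 ≤ B1 := (norm_nonneg _).trans (hB1 0)
  have n2 : 0 ≤ B2 := (norm_nonneg _).trans (hB2 0)
  have k1 := (g.c3 (m + 3) Hm0).mul_left B1
  have k2 := g.c4.mul_left B2
  have t1 := (g.lim_int (fJ := fun J x ↦ Hu J x • fD φ x) (f := fun x ↦ HuL x • fD φ x) (c := fun j ↦ B1 * (Hm0 * (j + (m + 3 : ℕ)))) (fun J ↦ (sM J).smul c2.aestronglyMeasurable)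
    (fun J x h ↦ by simp only [ou J x h]) (fun j ↦ by positivity) (k1.congr fun j ↦ by ring)
    (fun j x a b c ↦ by rw [norm_smul, mul_comm]; exact mul_le_mul (hB1 x) (bu j x a b c) (norm_nonneg _) n1)).2 (fun j ↦ B1 * (Hm0 * (j + (m + 3 : ℕ)))) ((k1.congr fun j ↦ by ring).tendsto_atTop_zero)
    (fun J x hx ↦ by
      rw [norm_smul, mul_comm]; refine mul_le_mul (hB1 x) ((ubox (EE_box J hx)).trans (mul_le_mul_of_nonneg_left ?_ h0.le)) (norm_nonneg _) n1
      push_cast; linarith)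
  have t2 := (g.lim_int (fJ := fun J x ↦ φ x • (innerSL ℝ (HG J x) : DE m)) (f := fun x ↦ φ x • (innerSL ℝ (HgL x) : DE m)) (c := fun j ↦ B2 * Hgu j) (fun J ↦ hφ.continuous.aestronglyMeasurable.smul (sG J))
    (fun J x h ↦ by simp only [og J x h]) (fun j ↦ mul_nonneg n2 (gu_pos j).le) (k2.congr fun j ↦ by ring)
    (fun j x a b c ↦ by rw [norm_smul, innerSL_apply_norm]; exact mul_le_mul (hB2 x) (bg j x a b c) (norm_nonneg _) n2)).2 (fun j ↦ B2 * Hgu j) ((k2.congr fun j ↦ by ring).tendsto_atTop_zero)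
    (fun J x hx ↦ by rw [norm_smul, innerSL_apply_norm]; exact mul_le_mul (hB2 x) (bdE hx).1.g2 (norm_nonneg _) n2)
  refine tendsto_nhds_unique t1 (t2.neg.congr fun J ↦ ?_)
  rw [setIntegral_eq_integral_of_forall_compl_eq_zero fun x hx ↦ ?_, setIntegral_eq_integral_of_forall_compl_eq_zero fun x hx ↦ ?_, ← ibp J hφ hc]
  · rw [image_eq_zero_of_notMem_tsupport (f := fD φ) fun h ↦ hx (hs (tsupport_fderiv_subset ℝ h)), smul_zero]
  · rw [image_eq_zero_of_notMem_tsupport fun h ↦ hx (hs h), zero_smul]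
theorem Good.gLm (g : GD) : AEStronglyMeasurable HgL VX m :=
  g.meas (fun J ↦ (G_cont J).aestronglyMeasurable) fun J x h ↦ (lim h).2.1
theorem Good.memLp (g : GD) : MemLp (fun x ↦ ‖HgL x‖) (oR p) VX m := by
  have hp := g.hp
  refine ⟨g.gLm.norm, ?_⟩
  rw [eLpNorm_lt_top_iff_lintegral_rpow_enorm_lt_top (by simp; linarith) ofReal_ne_top, toReal_ofReal bL]
  refine (lintegral_mono_ae ?_).trans_lt (Wf_fin (H := H) (fun j ↦ rpow_nonneg (gu_pos j).le _) g.c2)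
  filter_upwards [g.ae] with x hx
  obtain ⟨j, h1, h2, h3, -⟩ := bdL hx
  refine le_trans ?_ (le_Wf _ h1)
  rw [← ofReal_norm, ofReal_rpow_of_nonneg (norm_nonneg _) bL, norm_norm]
  exact ofReal_le_ofReal (rpow_le_rpow (norm_nonneg _) h3.g2 bL)
theorem Good.notLp (g : GD) {s : ℝ} (hs : p < s) : ¬ MemLp (fun x ↦ ‖HgL x‖) (oR s) VX m := fun h ↦ by
  have hp := g.hp
  have h1 := h.2
  rw [eLpNorm_lt_top_iff_lintegral_rpow_enorm_lt_top (by simp; linarith) ofReal_ne_top, toReal_ofReal bL] at h1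
  set I := ∫⁻ x in BX m, ‖‖HgL x‖‖ₑ ^ s
  have hl : ∀ j, oR (Hgl j ^ s * HV j) * om m ≤ 2 * I := fun j ↦ by
    have g0 : 0 ≤ Hgl j := by linarith [g.glT j, g.s0.T1]
    have hE := fun j ↦ (EE_closed (H := H) j).measurableSet
    have v1 : oR (HV j) * om m ≤ 2 * volume (HEE j \ HEE sc j) := by
      rw [measure_sdiff (EE_anti j) (hE _).nullMeasurableSet (by rw [vol_EE]; exact mul_ne_top ofReal_ne_top om_top), vol_EE, vol_EE, ENNReal.mul_sub (fun _ _ ↦ by simp)]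
      refine le_sub_of_add_le_left (mul_ne_top bS (mul_ne_top ofReal_ne_top om_top)) ?_
      have : 2 * (oR (HV sc j) * om m) ≤ oR (HV j) * om m := by
        rw [← mul_assoc]; gcongr
        rw [← ofReal_ofNat, ← ofReal_mul bN]
        exact ofReal_le_ofReal (by linarith [g.Vh j])
      rw [two_mul (oR (HV j) * om m)]; gcongr
    have v2 : oR (Hgl j ^ s) * volume (HEE j \ HEE sc j) ≤ I := by
      have hsub : HEE j \ HEE sc j ⊆ BX m := sdiff_subset.trans (EE_box j)
      rw [← setLIntegral_const]
      refine le_trans (setLIntegral_mono' ((hE j).diff (hE _)) fun x hx ↦ ?_) (lintegral_mono_set hsub)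
      rw [← ofReal_norm, ofReal_rpow_of_nonneg (norm_nonneg _) bL, norm_norm]
      exact ofReal_le_ofReal (rpow_le_rpow g0 (levB (EE_D j hx.1) hx.2).g1 bL)
    rw [ofReal_mul (rpow_nonneg g0 _), mul_assoc]
    calc _ ≤ oR (Hgl j ^ s) * (2 * volume (HEE j \ HEE sc j)) := by gcongr
      _ = 2 * (oR (Hgl j ^ s) * volume (HEE j \ HEE sc j)) := by ring
      _ ≤ _ := by gcongr
  have ht : Tendsto (fun j ↦ oR (Hgl j ^ s * HV j) * om m) atTop (𝓝 (⊤ * om m)) :=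
    ENNReal.Tendsto.mul_const (tendsto_ofReal_atTop.comp (g.ns s hs)) (.inr om_top)
  rw [top_mul om_pos] at ht
  exact absurd (le_of_tendsto' ht hl) (not_le.2 (mul_lt_top bS h1))
end Hier
end
noncomputable section
variable {m : ℕ}
theorem vsum (v : E m) : v = ∑ i, v i • esg i ro := by
  ext k; simp [Finset.sum_apply, Pi.single_apply]
open Convolution ContinuousLinearMap in
theorem moll {σ : E m → E m} {L : ℝ} (hL : ∀ x z, ‖σ x - σ z‖ ≤ L * dist x z) (hσ : Continuous σ)
    (hd : ∀ φ : E m → ℝ, ContDiff ℝ tI φ → HasCompactSupport φ → ∫ x, fD φ x (σ x) = 0) {ε : ℝ} (hε : 0 < ε) :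
    ∃ s : E m → E m, ContDiff ℝ tI s ∧ (∀ x, ‖s x - σ x‖ ≤ |L| * ε) ∧ ∀ x, ∑ i, (fD s x (esg i 1)) i = 0 := by
  let ρ : ContDiffBump (0 : E m) := ⟨ε / 2, ε, by positivity, by linarith⟩
  have r1 : ContDiff ℝ tI (ρ.normed volume) := ρ.contDiff_normed
  have r2 := ρ.hasCompactSupport_normed (μ := volume)
  refine ⟨ρ.normed volume ⋆[lsmul ℝ ℝ, volume] σ, r2.contDiff_convolution_left _ r1 hσ.locallyIntegrable, fun x ↦ ?_, fun x ↦ ?_⟩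
  · rw [← dist_eq_norm]
    refine ρ.dist_normed_convolution_le hσ.aestronglyMeasurable fun z hz ↦ ?_
    rw [dist_eq_norm]
    exact (hL z x).trans (mul_le_mul (le_abs_self L) (mem_ball.1 hz).le dist_nonneg (abs_nonneg L))
  · have hd' := (r2.hasFDerivAt_convolution_left (lsmul ℝ ℝ) (r1.of_le bS) (hσ.locallyIntegrable (μ := volume)) x).fderiv
    have hc : Continuous (fD (ρ.normed volume)) := r1.continuous_fderiv bS
    have hi : Integrable fun t ↦ (precompL (E m) (lsmul ℝ ℝ)) (fD (ρ.normed volume) t) (σ (x - t)) :=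
      HasCompactSupport.convolutionExists_left (precompL (E m) (lsmul ℝ ℝ : ℝ →L[ℝ] E m →L[ℝ] E m)) (r2.fderiv ℝ) hc (hσ.locallyIntegrable (μ := volume)) x
    have hz := hd (fun y ↦ ρ.normed volume (x - y)) (r1.comp (contDiff_const.sub contDiff_id)) (r2.comp_homeomorph (Homeomorph.subLeft x))
    have hf : ∀ y, fD (fun y ↦ ρ.normed volume (x - y)) y = -fD (ρ.normed volume) (x - y) := fun y ↦ by
      have := ((r1.differentiable bS) (x - y)).hasFDerivAt.comp y ((hasFDerivAt_id y).const_sub x)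
      exact (this.congr_fderiv (by ext; simp)).fderiv
    rw [hd', convolution]
    have e1 : ∀ i, (((∫ t, (precompL (E m) (lsmul ℝ ℝ)) (fD (ρ.normed volume) t) (σ (x - t))) : E m →L[ℝ] E m) (esg i 1)) i =
        ∫ t, fD (ρ.normed volume) t (esg i 1) * σ (x - t) i := fun i ↦ by
      rw [ContinuousLinearMap.integral_apply hi]
      exact ((EuclideanSpace.proj i : DE m).integral_comp_comm (hi.apply_continuousLinearMap _)).symm
    simp only [e1]
    rw [← integral_finsetSum]
    · rw [← integral_sub_left_eq_self _ volume x]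
      simp only [hf, neg_apply, integral_neg, neg_eq_zero] at hz
      rw [← hz]; congr 1; ext y
      have := vsum (σ y)
      conv_rhs => rw [this, map_sum]
      simp [mul_comm]
    · exact fun i _ ↦ (EuclideanSpace.proj i : DE m).integrable_comp (hi.apply_continuousLinearMap (esg i 1))
theorem int_bil {F1 F2 F3 : Type*} [NormedAddCommGroup F1] [NormedSpace ℝ F1] [NormedAddCommGroup F2] [NormedSpace ℝ F2] [NormedAddCommGroup F3] [NormedSpace ℝ F3]
    [SecondCountableTopology F2] (B : F1 →L[ℝ] F2 →L[ℝ] F3) {f : E m → F1} (hG : IntegrableOn f BX m) {v : E m → F2} (hv : Continuous v) : IntegrableOn (fun x ↦ B (f x) (v x)) BX m := by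
  obtain ⟨C, hC⟩ := (isCompact_closedBall (0 : E m) (m + 2)).exists_bound_of_continuousOn hv.continuousOn
  refine ((hG.norm.const_mul ‖B‖).mul_const C).mono' (B.isBoundedBilinearMap.continuous.comp_aestronglyMeasurable (hG.1.prodMk hv.aestronglyMeasurable)) ?_
  filter_upwards [ae_restrict_mem box_open.measurableSet] with x hx
  exact (B.le_opNorm₂ _ _).trans (mul_le_mul_of_nonneg_left (hC x (mem_closedBall_zero_iff.2 (box_norm hx))) bP)
theorem int_app {Gw : E m → DE m} (hG : IntegrableOn Gw BX m) {v : E m → E m} (hv : Continuous v) : IntegrableOn (fun x ↦ Gw x (v x)) BX m :=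
  int_bil (ContinuousLinearMap.id ℝ DE m) hG hv
open Manifold in
theorem test0 {σ : E m → E m} {L : ℝ} (hL : ∀ x z, ‖σ x - σ z‖ ≤ L * dist x z) (hσ : Continuous σ)
    (hd : ∀ φ : E m → ℝ, ContDiff ℝ tI φ → HasCompactSupport φ → ∫ x, fD φ x (σ x) = 0)
    {w : E m → ℝ} {Gw : E m → DE m} (hw : W11On BX m w Gw) {K : Set (E m)} (hK : IsCompact K) (hKB : K ⊆ BX m)
    (h0 : ∀ᵐ x ∂VX m, x ∉ K → w x = 0) : ∫ x in BX m, Gw x (σ x) = 0 := by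
  obtain ⟨hwi, hG, hwk⟩ := hw
  have z1 : ∀ᵐ x ∂(volume : Measure (E m)), x ∈ BX m \ K → Gw x = 0 := by
    refine (box_open.sdiff hK.isClosed).ae_eq_zero_of_integral_contDiff_smul_eq_zero (hG.mono_set sdiff_subset).locallyIntegrableOn fun g g1 g2 g3 ↦ ?_
    have e := hwk g g1 g2 (g3.trans sdiff_subset)
    rw [setIntegral_eq_integral_of_forall_compl_eq_zero (f := fun x ↦ g x • Gw x) fun x hx ↦ by
      rw [image_eq_zero_of_notMem_tsupport fun h ↦ hx (g3 h).1, zero_smul]] at e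
    rw [← neg_eq_zero, ← e]
    refine integral_eq_zero_of_ae ?_
    filter_upwards [h0] with x hx
    by_cases hxK : x ∈ K
    · rw [image_eq_zero_of_notMem_tsupport (f := fD g) fun h ↦ (g3 (tsupport_fderiv_subset ℝ h)).2 hxK, smul_zero]; rfl
    · rw [hx hxK, zero_smul]; rfl
  obtain ⟨K', k1, k2, k3⟩ := exists_compact_between hK box_open hKB
  obtain ⟨f, f1, f2, f3⟩ := exists_contMDiffMap_one_nhds_of_subset_interior 𝓘(ℝ, E m) (n := tI) hK.isClosed k2
  obtain ⟨χ, x0, x1, x2, x3⟩ : ∃ χ : E m → ℝ, ContDiff ℝ tI χ ∧ (∀ᶠ x in 𝓝ˢ K, χ x = 1) ∧ (∀ x ∉ K', χ x = 0) ∧ ∀ x, |χ x| ≤ 1 :=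
    ⟨f, f.contMDiff.contDiff, f1, f2, fun x ↦ by rw [abs_of_nonneg (f3 x).1]; exact (f3 x).2⟩
  have ts : tsupport χ ⊆ K' := closure_minimal (fun x hx ↦ by by_contra h; exact hx (x2 x h)) k1.isClosed
  have cs : HasCompactSupport χ := HasCompactSupport.of_support_subset_isCompact k1 ((subset_tsupport _).trans ts)
  have d0 : ∀ x ∈ K, fD χ x = 0 := fun x hx ↦ by
    have : χ =ᶠ[𝓝 x] fun _ ↦ 1 := x1.filter_mono (nhds_le_nhdsSet hx)
    rw [this.fderiv_eq]; simp
  have key : ∀ ε > 0, |∫ x in BX m, Gw x (σ x)| ≤ (|L| * ∫ x in BX m, ‖Gw x‖) * ε := fun ε hε ↦ by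
    obtain ⟨s, s1, s2, s3⟩ := moll hL hσ hd hε
    have sd := s1.differentiable bS
    have xd := x0.differentiable bS
    let φ : Fin (m + 2) → E m → ℝ := fun i x ↦ χ x * s x i
    have si : ∀ i x, HasFDerivAt (fun x ↦ s x i) ((EuclideanSpace.proj i : DE m).comp (fD s x)) x := fun i x ↦
      (EuclideanSpace.proj i : DE m).hasFDerivAt.comp x (sd x).hasFDerivAt
    have p1 : ∀ i, ContDiff ℝ tI (φ i) := fun i ↦ x0.mul ((EuclideanSpace.proj i : DE m).contDiff.comp s1)
    have p2 : ∀ i, HasCompactSupport (φ i) := fun i ↦ cs.mul_right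
    have p3 : ∀ i, tsupport (φ i) ⊆ BX m := fun i ↦ (tsupport_mul_subset_left).trans (ts.trans k3)
    have p4 : ∀ i x v, fD (φ i) x v = χ x * (fD s x v) i + s x i * fD χ x v := fun i x v ↦ by
      have : HasFDerivAt (φ i) _ x := (xd x).hasFDerivAt.mul (si i x)
      rw [this.fderiv]; simp
    have j1 : ∀ i, IntegrableOn (fun x ↦ w x • fD (φ i) x) BX m := fun i ↦ int_bil (ContinuousLinearMap.lsmul ℝ ℝ) hwi ((p1 i).continuous_fderiv bS)
    have j2 : ∀ i, IntegrableOn (fun x ↦ φ i x • Gw x) BX m := fun i ↦ int_bil (ContinuousLinearMap.lsmul ℝ ℝ).flip hG (p1 i).continuous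
    have j3 : ∀ i, IntegrableOn (fun x ↦ w x * fD (φ i) x (esg i 1)) BX m := fun i ↦ (j1 i).apply_continuousLinearMap _
    have j4 : ∀ i, IntegrableOn (fun x ↦ φ i x * Gw x (esg i 1)) BX m := fun i ↦ (j2 i).apply_continuousLinearMap _
    have e1 : ∀ i, ∫ x in BX m, w x * fD (φ i) x (esg i 1) = -∫ x in BX m, φ i x * Gw x (esg i 1) := fun i ↦ by
      have e := congrArg (fun T : E m →L[ℝ] ℝ ↦ T (esg i 1)) (hwk (φ i) (p1 i) (p2 i) (p3 i))
      simp only [neg_apply] at e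
      rwa [ContinuousLinearMap.integral_apply (j1 i), ContinuousLinearMap.integral_apply (j2 i)] at e
    have e2 : ∫ x in BX m, Gw x (χ x • s x) = 0 := by
      have a1 : ∑ i, ∫ x in BX m, φ i x * Gw x (esg i 1) = ∫ x in BX m, Gw x (χ x • s x) := by
        rw [← integral_finsetSum _ fun i _ ↦ j4 i]
        congr 1; ext x
        have := vsum (s x)
        conv_rhs => rw [this, map_smul, map_sum, Finset.smul_sum]
        simp [φ, mul_assoc]
      rw [← a1, ← neg_eq_zero, ← Finset.sum_neg_distrib]
      simp only [← e1]
      rw [← integral_finsetSum _ fun i _ ↦ j3 i]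
      refine integral_eq_zero_of_ae ?_
      filter_upwards [h0] with x hx
      by_cases hxK : x ∈ K
      · simp only [p4, d0 x hxK, zero_apply, mul_zero, add_zero, ← Finset.mul_sum, s3]; simp
      · simp [hx hxK]
    have xs : Continuous fun x ↦ χ x • s x := x0.continuous.smul s1.continuous
    rw [← sub_zero (∫ x in BX m, Gw x (σ x)), ← e2, ← integral_sub (int_app hG hσ) (int_app hG xs), mul_assoc, mul_comm, mul_assoc, ← integral_mul_const]
    rw [← norm_eq_abs]
    refine norm_integral_le_of_norm_le (hG.norm.mul_const _) ?_
    filter_upwards [ae_restrict_of_ae z1, ae_restrict_mem box_open.measurableSet] with x hx hxB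
    by_cases hxK : x ∈ K
    · have : χ x = 1 := x1.self_of_nhdsSet x hxK
      rw [this, one_smul, ← map_sub]
      refine ((Gw x).le_opNorm _).trans ?_
      rw [norm_sub_rev]; nlinarith [mul_le_mul_of_nonneg_left (s2 x) (norm_nonneg (Gw x))]
    · rw [hx ⟨hxB, hxK⟩]; simp
  refine abs_eq_zero.1 (le_antisymm (le_of_forall_pos_le_add fun η hη ↦ ?_) (abs_nonneg _))
  set A := |L| * ∫ x in BX m, ‖Gw x‖
  have hA : 0 ≤ A := by positivity
  refine (key (η / sc A) bP).trans ?_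
  rw [zero_add, mul_div_assoc', div_le_iff₀ bP]; nlinarith
end
noncomputable section
variable {m : ℕ}
theorem ff_meas (q γ : ℝ) : Measurable (ff q γ) := by unfold ff LL; fun_prop
theorem hh_meas (q γ : ℝ) : Measurable (hh q γ) := by
  have := ff_meas pd q γ
  unfold hh hf LL; fun_prop
def ph (p α β a t : ℝ) : ℝ := t ^ p * (lgg (exp 1 + t) ^ (-β) + a * lgg (exp 1 + t) ^ α)
theorem ph_eq (p α β a t : ℝ) : ph p α β a t = ff p (-β) t + a * ff p α t := by unfold ph ff LL; ring
theorem W_sub {u v : E m → ℝ} {G F : E m → DE m} (h1 : W11On BX m u G) (h2 : W11On BX m v F) :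
    W11On BX m (fun x ↦ u x - v x) (fun x ↦ G x - F x) := by
  refine ⟨h1.1.sub h2.1, h1.2.1.sub h2.2.1, fun φ a b c ↦ ?_⟩
  have k1 : ∀ {w : E m → ℝ}, IntegrableOn w BX m → IntegrableOn (fun x ↦ w x • fD φ x) BX m := fun hw ↦
    int_bil (ContinuousLinearMap.lsmul ℝ ℝ) hw (a.continuous_fderiv bS)
  have k2 : ∀ {w : E m → DE m}, IntegrableOn w BX m → IntegrableOn (fun x ↦ φ x • w x) BX m := fun hw ↦
    int_bil (ContinuousLinearMap.lsmul ℝ ℝ).flip hw a.continuous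
  simp only [sub_smul, smul_sub]
  rw [integral_sub (k1 h1.1) (k1 h2.1), integral_sub (k2 h1.2.1) (k2 h2.2.1), h1.2.2 φ a b c, h2.2.2 φ a b c]; abel
namespace Hier
variable {n M : ℕ} {H : Hier m n M} {p α β T0 : ℝ} {Q : ℕ}
theorem Good.awm (g : GD) : AEStronglyMeasurable (Haw p α β) VX m := by
  refine g.meas (fJ := H.aJ p α β) (fun J ↦ ?_) fun J x h ↦ aw_off h
  have h1 : Measurable fun x ↦ ‖HG J x‖ := (G_cont J).measurable.norm
  have h2 : Measurable fun x ↦ ‖Hσ J x‖ := (σ_cont J).measurable.norm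
  exact ((h2.sub ((hh_meas _ _).comp h1)).div ((hh_meas _ _).comp h1)).aestronglyMeasurable
theorem Good.phm (g : GD) {v : E m → ℝ} (hv : AEStronglyMeasurable v VX m) :
    AEStronglyMeasurable (fun x ↦ ph p α β awx (v x)) VX m := by
  simp only [ph_eq]
  have k := fun γ ↦ ((ff_meas p γ).comp_aemeasurable hv.aemeasurable).aestronglyMeasurable
  exact (k _).add (g.awm.mul (k _))
theorem Good.ph0 (g : GD) (x : E m) {t : ℝ} (ht : 0 ≤ t) : ff p (-β) t ≤ ph p α β awx t := by
  rw [ph_eq]; linarith [mul_nonneg (g.aw0 x) (ff_nonneg p α ht)]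
theorem Good.tan (g : GD) {x : E m} (hx : x ∉ HSg) {t : ℝ} (ht : 0 ≤ t) :
    ph p α β awx ‖HgL x‖ + ‖HσL x‖ * (t - ‖HgL x‖) ≤ ph p α β awx t := by
  obtain ⟨j, -, -, hb, -⟩ := bdL hx
  obtain ⟨h1, -, h3, -⟩ := g.psi hb
  have e : Haw p α β x = Psi p α β ‖HgL x‖ ‖HσL x‖ := by rw [aw, if_neg hx]
  rw [ph_eq, ph_eq, e]
  have a1 := g.s0.tan _ (g.gT hb) t ht
  have a2 := mul_le_mul_of_nonneg_left (g.s1.tan _ (g.gT hb) t ht) h1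
  nlinarith [congrArg (fun y ↦ y * (t - ‖HgL x‖)) h3]
theorem Good.phi (g : GD) : IntegrableOn (fun x ↦ ph p α β awx ‖HgL x‖) BX m := by
  refine ⟨g.phm g.gLm.norm, (lintegral_mono_ae ?_).trans_lt (Wf_fin (H := H) (fun j ↦ mul_nonneg (gu_pos j).le (su_pos j).le) g.c1)⟩
  filter_upwards [g.ae] with x hx
  obtain ⟨j, h1, h2, h3, -⟩ := bdL hx
  refine le_trans ?_ (le_Wf _ h1)
  have hp := g.hp
  have a := g.tan hx le_rfl
  have z : ph p α β awx 0 = 0 := by rw [ph, zero_rpow bL, zero_mul]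
  rw [← ofReal_norm, norm_of_nonneg ((ff_nonneg _ _ (norm_nonneg _)).trans (g.ph0 x (norm_nonneg _)))]
  refine ofReal_le_ofReal ?_
  have := mul_le_mul h3.g2 h3.s2 (norm_nonneg _) (gu_pos j).le
  linarith
theorem Good.minim (g : GD) : IsLocalMinimizer BX m (fun x t ↦ t ^ p * (lgg (exp 1 + t) ^ (-β) +
          Haw p α β x * lgg (exp 1 + t) ^ α)) HuL (fun x ↦ (innerSL ℝ (HgL x) : DE m)) := by
  change IsLocalMinimizer BX m (fun x t ↦ ph p α β awx t) _ _
  have nn : ∀ x {t : ℝ}, 0 ≤ t → 0 ≤ ph p α β awx t := fun x t ht ↦ (ff_nonneg _ _ ht).trans (g.ph0 x ht)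
  have hf := g.phi
  refine ⟨g.w11, ?_, fun v Gv hv ⟨K, hK, hKB, hvK⟩ ↦ ?_⟩
  · simp only [energyOf, innerSL_apply_norm]
    exact (hasFiniteIntegral_iff_ofReal (.of_forall fun x ↦ nn x (norm_nonneg _))).1 hf.2
  by_cases htop : energyOf BX m (fun x t ↦ ph p α β awx t) (fun x ↦ ‖Gv x‖) = ⊤
  · rw [htop]; exact le_top
  have hfv : IntegrableOn (fun x ↦ ph p α β awx ‖Gv x‖) BX m :=
    ⟨g.phm hv.2.1.1.norm, (hasFiniteIntegral_iff_ofReal (.of_forall fun x ↦ nn x (norm_nonneg _))).2 (lt_top_iff_ne_top.2 htop)⟩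
  simp only [energyOf, innerSL_apply_norm]
  rw [← ofReal_integral_eq_lintegral_ofReal hf (.of_forall fun x ↦ nn x (norm_nonneg _)),
    ← ofReal_integral_eq_lintegral_ofReal hfv (.of_forall fun x ↦ nn x (norm_nonneg _))]
  refine ofReal_le_ofReal ?_
  obtain ⟨l, hl1, hl2⟩ := g.lam
  have W := W_sub hv g.w11
  have hE := fun J ↦ (EE_closed (H := H) J).measurableSet
  have key : ∀ J, ∫ x in BX m, ph p α β awx ‖HgL x‖ ≤
      (∫ x in BX m, ph p α β awx ‖Gv x‖) + (2 * (∫ x in HEE J, ph p α β awx ‖HgL x‖ ∂VX m) + 2 * (l J * HV J) * (om m).toReal) := fun J ↦ by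
    have h0 := test0 (fun x z ↦ (lip (H := H) J x z).2) (σ_cont J) (fun φ a b ↦ dv J a b) W hK hKB
      (hvK.mono fun x hx hxK ↦ sub_eq_zero.2 (hx hxK))
    have hi := int_app W.2.1 (σ_cont (H := H) J)
    have fi : Integrable (fun x ↦ (HEE J).indicator (fun x ↦ 2 * ph p α β awx ‖HgL x‖ + 2 * l J) x) VX m :=
      ((hf.const_mul 2).add (integrable_const _)).indicator (hE J)
    have e1 : ∫ x in BX m, (HEE J).indicator (fun x ↦ 2 * ph p α β awx ‖HgL x‖ + 2 * l J) x =
        2 * (∫ x in HEE J, ph p α β awx ‖HgL x‖ ∂VX m) + 2 * (l J * HV J) * (om m).toReal := by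
      rw [integral_indicator (hE J), integral_add (hf.integrableOn.const_mul 2) (integrable_const _), integral_const_mul, setIntegral_const, measureReal_restrict_apply (hE J),
        inter_eq_left.2 (EE_box J), measureReal_def, vol_EE, toReal_mul, toReal_ofReal (V_pos J).le, smul_eq_mul]
      ring
    rw [← e1, ← add_zero (∫ x in BX m, ph p α β awx ‖HgL x‖), ← h0, ← integral_add hf hi, ← integral_add hfv fi]
    refine integral_mono_ae (hf.add hi) (hfv.add fi) ?_
    filter_upwards [g.ae] with x hx
    simp only [sub_apply, innerSL_apply_apply]
    have q1 := (Gv x).le_opNorm (Hσ J x)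
    have q2 := le_abs_self (Gv x (Hσ J x))
    rw [← norm_eq_abs] at q2
    by_cases hxE : x ∈ HEE J
    · rw [indicator_of_mem hxE]
      have q3 : ‖Hσ J x‖ = Hss J := by rw [(bdE hxE).2.2, norm_smul, e0_norm, mul_one, norm_of_nonneg (ss_pos J).le]
      have q4 := abs_le.1 (abs_real_inner_le_norm (HgL x) (Hσ J x))
      rw [q3] at q1 q4
      linarith [hl1 J _ (norm_nonneg (Gv x)), hl1 J _ (norm_nonneg (HgL x)), g.ph0 x (norm_nonneg (Gv x)), g.ph0 x (norm_nonneg (HgL x))]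
    · rw [indicator_of_notMem hxE, ← (lim hxE).2.2]
      rw [← (lim hxE).2.2] at q1 q2
      obtain ⟨j, -, -, hb, -⟩ := bdL hx
      have q5 : inner ℝ (HgL x) (HσL x) = ‖HgL x‖ * ‖HσL x‖ := inner_eq_norm_mul_iff_real.2 hb.par.symm
      rw [q5]; linarith [g.tan hx (norm_nonneg (Gv x))]
  have t1 : Tendsto (fun J ↦ ∫ x in HEE J, ph p α β awx ‖HgL x‖ ∂VX m) atTop (𝓝 0) := by
    refine hf.tendsto_setIntegral_nhds_zero ?_
    exact tendsto_of_tendsto_of_tendsto_of_le_of_le tendsto_const_nhds (E_tend g.Vt) (fun _ ↦ zero_le) fun J ↦ Measure.restrict_apply_le _ _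
  have t2 := ((t1.const_mul 2).add ((hl2.const_mul 2).mul_const (om m).toReal)).const_add (∫ x in BX m, ph p α β awx ‖Gv x‖)
  simp only [mul_zero, zero_mul, add_zero] at t2
  exact ge_of_tendsto' t2 key
end Hier
end
noncomputable section
variable {m : ℕ}
theorem modl {F : Type*} [PseudoMetricSpace F] {a : F → ℝ} {aJ : ℕ → F → ℝ} {A C κ q ϰ : ℝ} (hA : 0 ≤ A) (hC : 1 ≤ C) (hq : 0 < q) (hϰ : 0 ≤ ϰ) (hκ : ϰ * q ≤ κ)
    (h1 : ∀ J x y, |aJ J x - aJ J y| ≤ exp (C * rS J ^ q) * dist x y) (h2 : ∀ J x, |a x - aJ J x| ≤ A * rS J ^ (-κ)) (h3 : ∀ x y, |a x - a y| ≤ A) :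
    ∃ K, 0 < K ∧ ∀ x y, |a x - a y| ≤ K * lgg (exp 1 + (dist x y)⁻¹) ^ (-ϰ) := by
  have hκ0 : 0 ≤ κ := (mul_nonneg hϰ hq.le).trans hκ
  let k := ⌈ϰ⌉₊
  let K1 : ℝ := A * (2 * C) ^ ϰ
  let K2 : ℝ := 4 * (k.factorial * 2 ^ k)
  let K3 : ℝ := 2 * A * 2 ^ κ * (2 * C) ^ ϰ
  have n1 : 0 ≤ K1 := by positivity
  have n3 : 0 ≤ K3 := by positivity
  have n2 : 0 < K2 := by positivity
  refine ⟨K1 + K2 + K3, by positivity, fun x y ↦ ?_⟩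
  set r := dist x y
  have hr : 0 ≤ r := dist_nonneg
  set L := lgg (exp 1 + r⁻¹)
  have hL : 1 ≤ L := LL1 (inv_nonneg.2 hr)
  have hL0 : 0 < L := by linarith
  have hP : 0 < L ^ (-ϰ) := rpow_pos_of_pos hL0 _
  by_cases hsm : L ≤ 2 * C
  · refine (h3 x y).trans ?_
    have : 1 ≤ (2 * C) ^ ϰ * L ^ (-ϰ) := by
      rw [rpow_neg hL0.le, ← div_eq_mul_inv, one_le_div bP]
      exact rpow_le_rpow hL0.le hsm hϰ
    calc A ≤ A * ((2 * C) ^ ϰ * L ^ (-ϰ)) := le_mul_of_one_le_right hA this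
      _ = K1 * L ^ (-ϰ) := by ring
      _ ≤ _ := by gcongr; linarith
  push Not at hsm
  have hr1 : r ≤ 4 * exp (-L) := by
    rw [exp_neg, exp_log bP, ← div_eq_mul_inv, le_div_iff₀ bP, mul_add]
    have e3 : exp 1 < 3 := by linarith [exp_one_lt_d9]
    rcases hr.eq_or_lt with h | h
    · rw [← h]; norm_num
    rw [mul_inv_cancel₀ h.ne']
    by_contra hc
    have : 1 ≤ r := by nlinarith
    have : L ≤ 2 := by
      rw [log_le_iff_le_exp bP]
      have e2 := add_one_le_exp ro
      have : exp 2 = exp 1 * exp 1 := by rw [← exp_add]; norm_num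
      have : r⁻¹ ≤ 1 := inv_le_one_of_one_le₀ ‹_›
      nlinarith
    linarith
  set z := L / (2 * C) with hz
  have hz1 : 1 ≤ z := by rw [hz, le_div_iff₀ bL]; linarith
  set w := z ^ (1 / q)
  have hw : 1 ≤ w := one_le_rpow hz1 bP
  have hwz : w ^ q = z := by rw [← rpow_mul bL, one_div_mul_cancel hq.ne', rpow_one]
  have hfl : 1 ≤ ⌊w⌋₊ := Nat.le_floor (by simpa using hw)
  obtain ⟨J, hJ⟩ : ∃ J : ℕ, ⌊w⌋₊ = J + 1 := ⟨⌊w⌋₊ - 1, by omega⟩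
  have hJ1 : rS J ≤ w := by have := Nat.floor_le (show 0 ≤ w by linarith); rw [hJ] at this; exact_mod_cast this
  have hJ2 : w / 2 ≤ rS J := by have := Nat.lt_floor_add_one w; rw [hJ] at this; push_cast at this; linarith [(Nat.cast_nonneg J : rz ≤ J)]
  have b1 : exp (C * rS J ^ q) * r ≤ K2 * L ^ (-ϰ) := by
    have a1 : C * rS J ^ q ≤ L / 2 := by
      have : rS J ^ q ≤ z := hwz ▸ rpow_le_rpow bP hJ1 hq.le
      calc _ ≤ C * z := by gcongr
        _ = _ := by rw [hz]; field_simp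
    have a2 : exp (-(L / 2)) ≤ k.factorial * 2 ^ k * L ^ (-ϰ) := by
      have f1 := pow_div_factorial_le_exp (L / 2) bP k
      have f2 : L ^ ϰ ≤ L ^ k := by rw [← rpow_natCast]; exact rpow_le_rpow_of_exponent_le hL (Nat.le_ceil _)
      rw [exp_neg, rpow_neg hL0.le, ← div_eq_mul_inv, le_div_iff₀ bP, inv_mul_le_iff₀ (exp_pos _)]
      rw [div_pow, div_div, div_le_iff₀ bP] at f1
      linarith
    calc _ ≤ exp (L / 2) * (4 * exp (-L)) := by gcongr
      _ = 4 * exp (-(L / 2)) := by rw [mul_left_comm, ← exp_add]; congr 2; ring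
      _ ≤ 4 * (k.factorial * 2 ^ k * L ^ (-ϰ)) := by gcongr
      _ = _ := by ring
  have b2 : A * rS J ^ (-κ) * 2 ≤ K3 * L ^ (-ϰ) := by
    have a1 : rS J ^ (-κ) ≤ (w / 2) ^ (-κ) := rpow_le_rpow_of_nonpos bP hJ2 bL
    have a2 : (w / 2) ^ (-κ) = 2 ^ κ * w ^ (-κ) := by
      rw [div_rpow bL bN, rpow_neg (by norm_num : rz ≤ 2)]; field_simp
    have a3 : w ^ (-κ) ≤ z ^ (-ϰ) := by
      rw [← rpow_mul bL]
      refine rpow_le_rpow_of_exponent_le hz1 ?_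
      rw [mul_neg, neg_le_neg_iff, one_div, ← div_eq_inv_mul, le_div_iff₀ hq]; exact hκ
    have a4 : z ^ (-ϰ) = (2 * C) ^ ϰ * L ^ (-ϰ) := by
      rw [hz, div_rpow hL0.le bL, rpow_neg (by linarith : 0 ≤ 2 * C), div_inv_eq_mul, mul_comm]
    calc _ ≤ A * (2 ^ κ * ((2 * C) ^ ϰ * L ^ (-ϰ))) * 2 := by rw [← a4]; refine mul_le_mul_of_nonneg_right (mul_le_mul_of_nonneg_left ((a1.trans a2.le).trans ?_) hA) bN; gcongr
      _ = _ := by ring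
  have t1 := h1 J x y
  have t2 := h2 J x
  have t3 := h2 J y
  have : |a x - a y| ≤ |a x - aJ J x| + |aJ J x - aJ J y| + |a y - aJ J y| := by
    rw [abs_sub_comm (a y)]
    have e : a x - a y = (a x - aJ J x) + (aJ J x - aJ J y) + (aJ J y - a y) := by ring
    rw [e]; exact abs_add_three _ _ _
  have := mul_nonneg n1 hP.le
  linarith
namespace Hier
variable {n M : ℕ} {H : Hier m n M} {p α β T0 : ℝ} {Q : ℕ}
theorem Good.modulus (g : GD) {A C κ q ϰ : ℝ} (hC : 1 ≤ C) (hq : 0 < q) (hϰ : 0 ≤ ϰ) (hκ : ϰ * q ≤ κ)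
    (hX : ∀ j : ℕ, Hgu j ≤ exp (C * rS j ^ q) ∧ Hsu j ≤ exp (C * rS j ^ q) ∧ Lg (H := H) j ≤ exp (C * rS j ^ q))
    (hA : ∀ j : ℕ, Hsu j / (p / 2 * ff pd p α (Hgl j)) ≤ A * rS j ^ (-κ)) :
    ∃ K, 0 < K ∧ ∀ x y, |Haw p α β x - Haw p α β y| ≤ K * lgg (exp 1 + (dist x y)⁻¹) ^ (-ϰ) := by
  have hp := g.hp
  have hT1 := g.s1.T1
  have hκ0 : 0 ≤ κ := (mul_nonneg hϰ hq.le).trans hκ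
  have fp : ∀ j, 0 < ff pd p α (Hgl j) := fun j ↦ ff_pos _ _ (by linarith [g.glT j])
  have hA0 : 0 ≤ A := by
    have := (div_pos (su_pos 0) (mul_pos bL (fp 0))).le.trans (hA 0); simpa using this
  have dec : ∀ {j J : ℕ}, J ≤ j → A * rS j ^ (-κ) ≤ A * rS J ^ (-κ) := fun {j J} h ↦ by
    refine mul_le_mul_of_nonneg_left (rpow_le_rpow_of_nonpos bP ?_ bL) hA0
    have : (J : ℝ) ≤ j := by exact_mod_cast h
    linarith
  have aE : ∀ J x, x ∈ HEE J ∨ J = 0 → Haw p α β x ≤ A * rS J ^ (-κ) := fun J x hx ↦ by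
    by_cases hs : x ∈ HSg
    · rw [aw, if_pos hs]; positivity
    obtain ⟨j, -, -, hb, -, hJ⟩ := bdL hs
    rw [aw, if_neg hs]
    exact (g.psi hb).2.2.2.trans ((hA j).trans (dec (hx.elim (hJ J) fun h ↦ h ▸ Nat.zero_le j)))
  set D0 := p / 2 * ff pd p α T0
  have hD0 : 0 < D0 := mul_pos bL (ff_pos _ _ bL)
  set B := 2 / D0 + 1 / D0 ^ 2
  have hB : 0 < B := by positivity
  have lipA : ∀ J x y, |H.aJ p α β J x - H.aJ p α β J y| ≤ exp ((C * (Q + 2) + B) * rS J ^ q) * dist x y := fun J x y ↦ by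
    have hJ : ro ≤ rS J ^ q := one_le_rpow (by linarith [(Nat.cast_nonneg J : rz ≤ J)]) hq.le
    set X := exp (C * rS J ^ q)
    have hX2 : 2 ≤ X := by
      have : ro ≤ C * rS J ^ q := by nlinarith
      linarith [add_one_le_exp (C * rS J ^ q)]
    have bd : ∀ x, T0 ≤ ‖HG J x‖ ∧ ‖HG J x‖ ≤ X ∧ ‖Hσ J x‖ ≤ X ∧ 0 ≤ ‖Hσ J x‖ - hh p (-β) ‖HG J x‖ ∧ D0 ≤ hh p α ‖HG J x‖ ∧ 0 < hh p (-β) ‖HG J x‖ := fun x ↦ by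
      obtain ⟨j, hj, -, hb, -⟩ := bdJ (H := H) J x
      have : exp (C * rS j ^ q) ≤ X := by
        have : (j : ℝ) ≤ J := by exact_mod_cast hj
        exact exp_le_exp.2 (mul_le_mul_of_nonneg_left (rpow_le_rpow bP bL hq.le) bL)
      refine ⟨g.gT hb, hb.g2.trans ((hX j).1.trans this), hb.s2.trans ((hX j).2.1.trans this), (g.psi hb).2.1, le_trans ?_ (g.s1.lo _ (g.gT hb)), Sc.pos g.s0 hp (g.gT hb)⟩
      exact mul_le_mul_of_nonneg_left (g.s1.mono _ le_rfl _ (g.gT hb)) bL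
    obtain ⟨x1, x2, x3, x4, x5, x6⟩ := bd x
    obtain ⟨y1, y2, y3, y4, y5, y6⟩ := bd y
    have l1 := (abs_norm_sub_norm_le (HG J x) (HG J y)).trans (lip J x y).1
    have l2 := (abs_norm_sub_norm_le (Hσ J x) (Hσ J y)).trans (lip J x y).2
    have l3 : Lg (H := H) J * dist x y ≤ X * dist x y := mul_le_mul_of_nonneg_right (hX J).2.2 dist_nonneg
    have m0 := g.s0.lip X hX2 _ x1 x2 _ y1 y2
    have m1 := g.s1.lip X hX2 _ x1 x2 _ y1 y2
    unfold aJ Psi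
    set N := ‖Hσ J x‖ - hh p (-β) ‖HG J x‖ with hN
    set N' := ‖Hσ J y‖ - hh p (-β) ‖HG J y‖ with hN'
    set D := hh p α ‖HG J x‖
    set D' := hh p α ‖HG J y‖
    set Δ := X * dist x y
    have hΔ : 0 ≤ Δ := by positivity
    have XQ : 1 ≤ X ^ Q := one_le_pow₀ bL
    have nD : |D - D'| ≤ X ^ Q * Δ := m1.trans (by gcongr; linarith)
    have nN : |N - N'| ≤ 2 * X ^ Q * Δ := by
      have e : N - N' = (‖Hσ J x‖ - ‖Hσ J y‖) - (hh p (-β) ‖HG J x‖ - hh p (-β) ‖HG J y‖) := by rw [hN, hN']; ring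
      have : |hh p (-β) ‖HG J x‖ - hh p (-β) ‖HG J y‖| ≤ X ^ Q * Δ := m0.trans (by gcongr; linarith)
      rw [e]; refine (abs_sub _ _).trans ?_
      nlinarith
    have hN'X : N' ≤ X := by linarith
    have p1 : 0 < D := by linarith
    have p2 : 0 < D' := by linarith
    have e : N / D - N' / D' = (N - N') / D + N' * (D' - D) / (D * D') := by field_simp; ring
    rw [e]
    refine (abs_add_le _ _).trans ?_
    rw [abs_div, abs_div, abs_mul, abs_of_pos p1, abs_of_nonneg y4, abs_of_pos (mul_pos p1 p2), abs_sub_comm D' D]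
    have q1 : |N - N'| / D ≤ 2 * X ^ Q * Δ / D0 := div_le_div₀ bP nN hD0 x5
    have q2 : N' * |D - D'| / (D * D') ≤ X * (X ^ Q * Δ) / D0 ^ 2 := by
      rw [sq]; exact div_le_div₀ bP (mul_le_mul hN'X nD (abs_nonneg _) bL) bP (mul_le_mul x5 y5 hD0.le p1.le)
    have q3 : 2 * X ^ Q * Δ / D0 + X * (X ^ Q * Δ) / D0 ^ 2 ≤ B * (X ^ (Q + 2) * dist x y) := by
      have : 2 * X ^ Q * Δ / D0 ≤ 2 * X ^ Q * Δ * X / D0 := div_le_div_of_nonneg_right (le_mul_of_one_le_right bP bL) hD0.le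
      refine (add_le_add this le_rfl).trans (le_of_eq ?_)
      simp only [B, Δ]; field_simp; ring
    refine (add_le_add q1 q2).trans (q3.trans ?_)
    rw [← mul_assoc]
    refine mul_le_mul_of_nonneg_right ?_ dist_nonneg
    have r0 : exp ((C * (Q + 2) + B) * rS J ^ q) = exp (C * (Q + 2) * rS J ^ q) * exp (B * rS J ^ q) := by
      rw [← exp_add]; congr 1; exact add_mul _ _ _
    rw [r0, mul_comm B]
    have r1 : X ^ (Q + 2) = exp (C * (Q + 2) * rS J ^ q) := by
      rw [← exp_nat_mul]; push_cast; congr 1; ring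
    rw [r1]
    refine mul_le_mul_of_nonneg_left ?_ (exp_pos _).le
    have : B ≤ B * rS J ^ q := le_mul_of_one_le_right hB.le hJ
    linarith [add_one_le_exp (B * rS J ^ q)]
  refine modl (aJ := H.aJ p α β) hA0 ?_ hq hϰ hκ lipA (fun J x ↦ ?_) fun x y ↦ ?_
  · nlinarith [(Nat.cast_nonneg Q : rz ≤ Q)]
  · by_cases hx : x ∈ HEE J
    · have a1 := aE J x (.inl hx)
      have a2 := g.aw0 x
      have hb := (bdE hx).1
      have a3 := (g.psi hb).1
      have a4 := (g.psi hb).2.2.2.trans (hA J)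
      exact abs_sub_le_of_nonneg_of_le a2 a1 a3 a4
    · rw [aw_off hx, sub_self, abs_zero]; positivity
  · have k := fun x ↦ aE 0 x (.inr rfl)
    simp only [Nat.cast_zero, zero_add, one_rpow, mul_one] at k
    exact abs_sub_le_of_nonneg_of_le (g.aw0 x) (k x) (g.aw0 y) (k y)
end Hier
end
noncomputable section
variable {m : ℕ}
def Th (s : ℝ) : Set (E m) := {x | rr x < 1 / 2 ∧ 1 / 2 < s * tt x ∧ s * tt x < 1}
theorem Th_open (s : ℝ) : IsOpen (Th s : Set (E m)) :=
  (isOpen_lt rr_cont continuous_const).inter ((isOpen_lt continuous_const (continuous_const.mul tt_cont)).inter (isOpen_lt (continuous_const.mul tt_cont) continuous_const))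
theorem Th_nC {s : ℝ} (hs : |s| = 1) {x : E m} (hx : x ∈ Th s) : nC x ≤ 1 := by
  refine max_le ?_ (by linarith [hx.1])
  rw [← one_mul |tt x|, ← hs, ← abs_mul, abs_le]
  constructor <;> linarith [hx.2.1, hx.2.2]
theorem Th_vol {s : ℝ} (hs : |s| = 1) : 0 < volume.real (Th s : Set (E m)) := by
  have h0 : rr (e0 : E m) = 0 := by
    have := rr_le_sum (e0 : E m)
    simp only [e0_succ, abs_zero, Finset.sum_const_zero] at this
    exact le_antisymm this (norm_nonneg _)
  have h1 : s * s = 1 := by rw [← abs_mul_abs_self, hs, one_mul]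
  refine toReal_pos ((Th_open s).measure_pos _ ⟨(s * (3 / 4)) • e0, ?_⟩).ne' (ne_top_of_le_ne_top om_top (measure_mono fun x hx ↦ ?_))
  · refine ⟨?_, ?_⟩
    · rw [rr_smul, h0]; norm_num
    · rw [tt_smul, show tt (e0 : E m) = 1 from e0_zero, show s * (s * (3 / 4) * 1) = s * s * (3 / 4) by ring, h1]; norm_num
  · simpa [Cyl] using Th_nC hs hx
namespace Hier
variable {n M : ℕ} {H : Hier m n M}
theorem R_tend : Tendsto HR atTop (𝓝 0) :=
  squeeze_zero (fun j ↦ (R_pos _).le) (fun j ↦ R_le _) ((_root_.tendsto_pow_atTop_nhds_zero_of_lt_one (r := (1 / 2 : ℝ)) bN bN).comp (tendsto_add_atTop_nat 1))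
theorem nonLeb (hI : IntegrableOn HuL BX m) {η : ℝ} (hη : 0 < η) (h : ∀ j, η ≤ Hmm j * HR j) {x : E m} (hx : x ∈ HSg) :
    IsNonLebesguePoint HuL x := by
  rintro ⟨c, hc⟩
  have hxE : ∀ j, x ∈ HEE j := fun j ↦ mem_iInter.1 hx j
  have R0 : Tendsto (fun j ↦ 8 * HR j) atTop (𝓝 0) := by simpa using (R_tend (H := H)).const_mul 8
  have R1 : Tendsto (fun j ↦ 8 * HR j) atTop (𝓝[>] 0) :=
    tendsto_nhdsWithin_iff.2 ⟨R0, .of_forall fun j ↦ by have := R_pos (H := H) j; simp only [mem_Ioi]; linarith⟩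
  have hcj := hc.comp R1
  obtain ⟨ρ, hρ, hB⟩ := Metric.isOpen_iff.1 (box_open (m := m)) x (EE_box 0 (hxE 0))
  set v := min (volume.real (Th 1 : Set (E m))) (volume.real (Th (-1) : Set (E m)))
  have hv : 0 < v := lt_min (Th_vol bS) (Th_vol bS)
  have om0 : 0 < (om m).toReal := toReal_pos om_pos om_top
  set δ := η / 2 * v / (8 ^ (m + 2) * (om m).toReal)
  have hδ : 0 < δ := by positivity
  obtain ⟨j, hj1, hj2⟩ := ((hcj.eventually (gt_mem_nhds hδ)).and (R0.eventually (gt_mem_nhds hρ))).exists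
  refine absurd hj1 (not_lt.2 ?_)
  have hR := R_pos (H := H) j
  obtain ⟨a, ha, hxa⟩ := mem_EE.1 (hxE j)
  obtain ⟨o, ho⟩ := gen ha
  have hIc : IntegrableOn (fun z ↦ |HuL z - c|) (ball x (8 * HR j)) :=
    ((hI.mono_set ((ball_subset_ball hj2.le).trans hB)).sub (integrableOn_const measure_ball_lt_top.ne)).abs
  have key : ∀ s : ℝ, |s| = 1 → v ≤ volume.real (Th s : Set (E m)) → (∀ z, Hy j a z ∈ Th s → η / 2 ≤ |HuL z - c|) → δ ≤ ⨍ z in ball x (8 * HR j), |HuL z - c| := fun s hs hvs hz ↦ by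
    have hS : MeasurableSet {z | Hy j a z ∈ Th s} := by
      refine ((Th_open s).preimage ?_).measurableSet
      unfold y; fun_prop
    have sub : {z | Hy j a z ∈ Th s} ⊆ ball x (8 * HR j) := fun z hz ↦ by
      have h1 := Th_nC hs hz
      rw [y_nC, div_le_one hR] at h1
      have h2 := nC_tri z (Hc j a) x
      rw [nC_comm (Hc j a)] at h2
      rw [mem_ball, dist_eq_norm]
      linarith [le_nC (z - x)]
    have vS : volume.real {z | Hy j a z ∈ Th s} = HR j ^ (m + 2) * volume.real (Th s : Set (E m)) := by
      rw [Measure.real, show {z | Hy j a z ∈ Th s} = {x | (HR j)⁻¹ • (x - Hc j a) ∈ Th s} from rfl, vol_aff _ hR, toReal_mul, toReal_ofReal bP]; rfl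
    have vB : volume.real (ball x (8 * HR j)) ≤ (8 * HR j) ^ (m + 2) * (om m).toReal := by
      have e := vol_cyl x (R := 8 * HR j) bP
      have : (8 * HR j) ^ (m + 2) * (om m).toReal = (volume (Cyl x (8 * HR j))).toReal := by
        rw [e, toReal_mul, toReal_ofReal bP]
      rw [this]
      refine toReal_mono (by rw [e]; exact mul_ne_top ofReal_ne_top om_top) (measure_mono fun z hz ↦ ?_)
      rw [mem_ball, dist_eq_norm] at hz
      exact (nC_le _).trans hz.le
    have vB0 : 0 < volume.real (ball x (8 * HR j)) := toReal_pos (measure_ball_pos _ _ bP).ne' measure_ball_lt_top.ne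
    have i1 : η / 2 * volume.real {z | Hy j a z ∈ Th s} ≤ ∫ z in {z | Hy j a z ∈ Th s}, |HuL z - c| :=
      setIntegral_ge_of_const_le_real hS (ne_top_of_le_ne_top measure_ball_lt_top.ne (measure_mono sub)) (fun z h ↦ hz z h) (hIc.mono_set sub)
    have i2 : ∫ z in {z | Hy j a z ∈ Th s}, |HuL z - c| ≤ ∫ z in ball x (8 * HR j), |HuL z - c| :=
      setIntegral_mono_set hIc (.of_forall fun z ↦ abs_nonneg _) sub.eventuallyLE
    rw [setAverage_eq, smul_eq_mul, inv_mul_eq_div, le_div_iff₀ vB0]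
    have i3 : HR j ^ (m + 2) * v ≤ volume.real {z | Hy j a z ∈ Th s} := by rw [vS]; exact mul_le_mul_of_nonneg_left hvs bP
    refine (mul_le_mul_of_nonneg_left vB hδ.le).trans (le_trans (le_of_eq ?_) ((mul_le_mul_of_nonneg_left i3 (by positivity : rz ≤ η / 2)).trans (i1.trans i2)))
    simp only [δ]; field_simp; exact mul_pow _ _ _
  have nE : ∀ z, Hy j a z ∈ Th 1 ∨ Hy j a z ∈ Th (-1) → HuL z = o + Hmm j * HR j * H.cu j (Hy j a z) := fun z hz ↦ by
    have h1 : nC (z - Hc j a) ≤ HR j := by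
      have : nC (Hy j a z) ≤ 1 := hz.elim (Th_nC bS) (Th_nC bS)
      rwa [y_nC, div_le_one hR] at this
    rw [← (ho z h1).1]
    refine (lim fun hE ↦ ?_).1
    obtain ⟨a', ha', hz'⟩ := mem_EE.1 hE
    have e := uniq (par_lt ha').1 ha ((child_cyl ha' hz').trans bL) h1
    have := (child_in ha' hz').1
    rw [e] at this
    have := abs_le.1 (this.trans (Hi j).b1)
    rcases hz with hz | hz <;> linarith [hz.2.1, hz.2.2]
  have hη' := h j
  have hb := (Hi j).b1
  have hτ := (Hi j).τ1
  rcases le_total c o with hco | hco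
  · refine key 1 bS (min_le_left _ _) fun z hz ↦ ?_
    have := (Hcell j).top _ hz.1.le (by linarith [hz.2.1]) (by linarith [hz.2.2])
    rw [nE z (.inl hz)]
    refine le_trans ?_ (le_abs_self _)
    have : Hmm j * HR j * hlf ≤ Hmm j * HR j * H.cu j (Hy j a z) := mul_le_mul_of_nonneg_left bL bL
    linarith
  · refine key (-1) bS (min_le_right _ _) fun z hz ↦ ?_
    have := (Hcell j).bot _ hz.1.le (by linarith [hz.2.1]) (by linarith [hz.2.2])
    rw [nE z (.inr hz)]
    refine le_trans ?_ (neg_le_abs _)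
    have : Hmm j * HR j * H.cu j (Hy j a z) ≤ Hmm j * HR j * (-hlf) := mul_le_mul_of_nonneg_left bL bL
    linarith
theorem Sg_closed : IsClosed HSg := isClosed_iInter fun j ↦ EE_closed j
theorem Sg_box : HSg ⊆ BX m := (iInter_subset _ 0).trans (EE_box 0)
theorem dim_le {s K : ℝ} (hs : 0 < s) (hK : ∀ j, HP j * HR j ^ s ≤ K) : dimH HSg ≤ oR s := by
  have R0 : Tendsto (fun j ↦ oR (4 * HR j)) atTop (𝓝 0) := by simpa using tendsto_ofReal ((R_tend (H := H)).const_mul 4)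
  have dm : ∀ j a, ediam (Cyl (Hc j a) (HR j)) ≤ oR (4 * HR j) := fun j a ↦ by
    refine ediam_le fun x hx z hz ↦ ?_
    rw [edist_dist]
    refine ofReal_le_ofReal ?_
    have h1 : nC (x - Hc j a) ≤ HR j := hx
    have h2 : nC (z - Hc j a) ≤ HR j := hz
    have h3 := nC_tri x (Hc j a) z
    rw [nC_comm (Hc j a)] at h3
    rw [dist_eq_norm]; linarith [le_nC (x - z)]
  have := Measure.hausdorffMeasure_le_liminf_sum (X := E m) s HSg (l := atTop) (fun j ↦ oR (4 * HR j)) R0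
    (ι := fun j ↦ Fin (HP j)) (fun j a ↦ Cyl (Hc j a) (HR j)) (.of_forall fun j a ↦ dm j a)
    (.of_forall fun j x hx ↦ by
      obtain ⟨a, ha, h⟩ := mem_EE.1 (mem_iInter.1 hx j)
      exact mem_iUnion.2 ⟨⟨a, ha⟩, h⟩)
  refine dimH_le_of_hausdorffMeasure_ne_top (d := s.toNNReal) ?_
  rw [coe_toNNReal _ hs.le]
  refine ne_top_of_le_ne_top (b := oR (4 ^ s * K)) ofReal_ne_top (this.trans ?_)
  refine liminf_le_of_frequently_le' (Frequently.of_forall fun j ↦ ?_)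
  refine (Finset.sum_le_sum fun (a : Fin (HP j)) _ ↦ ENNReal.rpow_le_rpow (dm j a) hs.le).trans ?_
  have hR := R_pos (H := H) j
  rw [Finset.sum_const, Finset.card_univ, Fintype.card_fin, nsmul_eq_mul, ofReal_rpow_of_pos bP, ← ofReal_natCast, ← ofReal_mul bP]
  refine ofReal_le_ofReal ?_
  rw [mul_rpow bN hR.le]
  have := mul_le_mul_of_nonneg_left (hK j) (by positivity : rz ≤ 4 ^ s)
  linarith
theorem le_dim {s C : ℝ} (hs : 0 < s) (hC : ∀ j, (HP j : ℝ)⁻¹ ≤ C * HR sc j ^ s) : oR s ≤ dimH HSg := by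
  set A : ℕ → ℝ → ℕ := fun j t ↦ ⌊t * HP j⌋₊ with hA
  have Pp : ∀ j, rz < HP j := fun j ↦ by exact_mod_cast P_pos j
  have A1 : ∀ j, ∀ t ∈ Ico rz 1, A j t < HP j := fun j t ht ↦ by
    rw [hA, Nat.floor_lt (mul_nonneg ht.1 (Pp j).le)]
    have := mul_lt_mul_of_pos_right ht.2 (Pp j); linarith
  have A2 : ∀ j t, A sc j t / HN j = A j t := fun j t ↦ by
    simp only [hA]
    rw [← Nat.floor_div_natCast, P]
    have : rz < HN j := by exact_mod_cast H.N1 j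
    congr 1; push_cast; field_simp
  have ex : ∀ t : ℝ, ∃ x : E m, t ∈ Ico rz 1 → ∀ j, nC (x - Hc j (A j t)) ≤ HR j := fun t ↦ by
    by_cases ht : t ∈ Ico rz 1
    · obtain ⟨x, hx⟩ := IsCompact.nonempty_iInter_of_sequence_nonempty_isCompact_isClosed (fun j ↦ Cyl (Hc j (A j t)) (HR j))
        (fun j x hx ↦ by
          have := child_cyl (A1 sc j t ht) hx
          rw [A2] at this
          exact this.trans (by linarith [R_pos (H := H) j]))
        (fun j ↦ ⟨Hc j (A j t), by simp only [Cyl, mem_ofPred_eq, sub_self, nC_zero]; exact (R_pos j).le⟩)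
        (Metric.isCompact_of_isClosed_isBounded (Cyl_closed _ _) ((Metric.isBounded_closedBall (x := Hc 0 (A 0 t)) (r := 2 * HR 0)).subset fun x hx ↦ by
          rw [mem_closedBall, dist_eq_norm]
          have : nC (x - Hc 0 (A 0 t)) ≤ HR 0 := hx
          linarith [le_nC (x - Hc 0 (A 0 t))]))
        (fun j ↦ Cyl_closed _ _)
      exact ⟨x, fun _ j ↦ mem_iInter.1 hx j⟩
    · exact ⟨0, fun h ↦ absurd h ht⟩
  choose gg hg using ex
  have C0 : 0 ≤ C := by
    by_contra! h
    have := hC 0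
    have h1 := inv_pos.2 (Pp 0)
    have := mul_neg_of_neg_of_pos h (rpow_pos_of_pos (R_pos (H := H) (0 + 1)) s)
    linarith
  have P0 : Tendsto (fun j ↦ (HP j : ℝ)⁻¹) atTop (𝓝 0) := by
    have h1 : Tendsto (fun j ↦ HR sc j) atTop (𝓝 0) := R_tend.comp (tendsto_add_atTop_nat 1)
    have h2 := (h1.rpow_const (p := s) (.inr hs.le)).const_mul C
    rw [zero_rpow hs.ne', mul_zero] at h2
    exact squeeze_zero (fun j ↦ (inv_pos.2 (Pp j)).le) hC h2
  have fl : ∀ j, ∀ t ∈ Ico rz 1, ∀ t' ∈ Ico rz 1, A j t = A j t' → |t - t'| ≤ (HP j : ℝ)⁻¹ := fun j t ht t' ht' h ↦ by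
    have a1 := Nat.floor_le (mul_nonneg ht.1 (Pp j).le)
    have a2 := Nat.lt_floor_add_one (t * HP j)
    have b1 := Nat.floor_le (mul_nonneg ht'.1 (Pp j).le)
    have b2 := Nat.lt_floor_add_one (t' * HP j)
    simp only [hA] at h
    rw [h] at a1 a2
    rw [← one_div, le_div_iff₀ (Pp j)]
    rw [show |t - t'| * (HP j : ℝ) = |(t - t') * HP j| by rw [abs_mul, abs_of_pos (Pp j)], abs_le]
    constructor <;> linarith
  have hol : ∀ t ∈ Ico rz 1, ∀ t' ∈ Ico rz 1, |t - t'| ≤ C * dist (gg t) (gg t') ^ s := fun t ht t' ht' ↦ by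
    by_cases hne : ∃ j, A j t ≠ A j t'
    · classical
      have hm := fun {i} ↦ Nat.find_min hne (m := i)
      have hf := Nat.find_spec hne
      set k := Nat.find hne
      cases hk : k with
      | zero =>
        rw [hk] at hf
        have h1 := A1 0 t ht; have h2 := A1 0 t' ht'
        simp only [P] at h1 h2; omega
      | succ j =>
        rw [hk] at hf
        have he : A j t = A j t' := not_not.1 (hm bO)
        refine (fl j t ht t' ht' he).trans ((hC j).trans ?_)
        have h1 := sep (A1 _ t ht) (A1 _ t' ht') hf
        have h2 := hg t ht sc j
        have h3 := hg t' ht' sc j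
        have t1 := nC_tri (Hc sc j (A sc j t)) (gg t) (Hc sc j (A sc j t'))
        have t2 := nC_tri (gg t) (gg t') (Hc sc j (A sc j t'))
        rw [nC_comm] at h2
        have hR := R_pos (H := H) sc j
        refine mul_le_mul_of_nonneg_left (rpow_le_rpow hR.le ?_ hs.le) C0
        rw [dist_eq_norm]; linarith [nC_le (gg t - gg t')]
    · push Not at hne
      have : |t - t'| ≤ 0 := ge_of_tendsto' P0 fun j ↦ fl j t ht t' ht' (hne j)
      exact this.trans bP
  have inj : InjOn gg (Ico rz 1) := fun t ht t' ht' h ↦ by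
    have := hol t ht t' ht'
    rw [h, dist_self, zero_rpow hs.ne', mul_zero] at this
    linarith [abs_nonpos_iff.1 this]
  set f := Function.invFunOn gg (Ico rz 1)
  have fl' : ∀ t ∈ Ico rz 1, f (gg t) = t := fun t ht ↦ inj.leftInvOn_invFunOn ht
  have hH : HolderOnWith C.toNNReal s.toNNReal f (gg '' Ico rz 1) := by
    rintro _ ⟨t, ht, rfl⟩ _ ⟨t', ht', rfl⟩
    rw [fl' t ht, fl' t' ht', edist_dist, edist_dist, coe_toNNReal _ hs.le]
    by_cases h0 : dist (gg t) (gg t') = 0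
    · rw [inj ht ht' (dist_eq_zero.1 h0)]; simp
    rw [ofReal_rpow_of_pos (lt_of_le_of_ne dist_nonneg (Ne.symm h0)), show ((C.toNNReal : ℝ≥0) : ℝ≥0∞) = oR C from rfl, ← ofReal_mul C0]
    exact ofReal_le_ofReal (hol t ht t' ht')
  have hd := hH.dimH_image_le (toNNReal_pos.2 hs)
  have e : f '' (gg '' Ico rz 1) = Ico 0 1 := by
    rw [image_image]; exact (image_congr fl').trans (image_id _)
  rw [e, dimH_of_nonempty_interior (by rw [interior_Ico]; exact nonempty_Ioo.2 one_pos)] at hd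
  have hd2 : dimH (gg '' Ico rz 1) ≤ dimH HSg := dimH_mono fun _ ⟨t, ht, e⟩ ↦ by
    rw [← e]; exact mem_iInter.2 fun j ↦ mem_EE.2 ⟨_, A1 j t ht, hg t ht j⟩
  simp only [Module.finrank_self, Nat.cast_one] at hd
  have hs' : ((s.toNNReal : ℝ≥0) : ℝ≥0∞) ≠ 0 := by simpa using hs
  rw [ENNReal.le_div_iff_mul_le (.inl hs') (.inl coe_ne_top), one_mul] at hd
  exact hd.trans hd2
end Hier
end
noncomputable section
theorem k1 (j : ℕ) : ro ≤ j + 1 := by linarith [(Nat.cast_nonneg j : rz ≤ j)]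
theorem k0 (j : ℕ) : rz < j + 1 := by linarith [k1 j]
theorem poly (r : ℝ) : ∃ C, 0 < C ∧ ∀ j : ℕ, rS j ^ r ≤ C * (3 / 2) ^ j := by
  obtain ⟨N, hN⟩ := exists_nat_ge r
  have hs : Summable fun j : ℕ ↦ ((j : ℝ) ^ N * (2 / 3 : ℝ) ^ j) := summable_pow_mul_geometric_of_norm_lt_one N bN
  have h1 := hs.tendsto_atTop_zero.comp (tendsto_add_atTop_nat 1)
  obtain ⟨C, hC⟩ := h1.bddAbove_range
  refine ⟨max 1 (C * (3 / 2)), by positivity, fun j ↦ ?_⟩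
  have h2 : ((j + 1 : ℕ) : ℝ) ^ N * (2 / 3 : ℝ) ^ sc j ≤ C := hC ⟨j, rfl⟩
  have h3 : rS j ^ r ≤ rS j ^ N := by
    rw [← rpow_natCast]; exact rpow_le_rpow_of_exponent_le (k1 j) hN
  refine h3.trans (le_trans ?_ (mul_le_mul_of_nonneg_right (le_max_right _ _) bP))
  have e : (2 / 3 : ℝ) ^ sc j * (3 / 2) ^ sc j = 1 := by rw [← mul_pow]; norm_num
  have := mul_le_mul_of_nonneg_right h2 (by positivity : rz ≤ (3 / 2) ^ sc j)
  rw [mul_assoc, e, mul_one, pow_succ] at this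
  push_cast at this
  linarith
theorem sfac {B c : ℝ} (hB : 0 < B) (hc : 0 < c) : Tendsto (fun j : ℕ ↦ B ^ j * ((j.factorial : ℝ) ^ c)⁻¹) atTop (𝓝 0) := by
  have h := (FloorSemiring.tendsto_pow_div_factorial_atTop (B ^ (1 / c))).rpow_const (p := c) (.inr hc.le)
  rw [zero_rpow hc.ne'] at h
  refine h.congr fun j ↦ ?_
  rw [div_rpow bP bP, ← rpow_natCast, ← rpow_mul hB.le, ← rpow_mul hB.le, ← rpow_natCast, div_eq_mul_inv]
  congr 2; field_simp
def Sub (q : ℝ) (x : ℕ → ℝ) : Prop := ∃ C, 0 ≤ C ∧ ∀ j : ℕ, x j ≤ exp (C * rS j ^ q)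
variable {q : ℝ} {x y : ℕ → ℝ}
theorem Sub.le (h : Sub q y) (hx : ∀ j, x j ≤ y j) : Sub q x := by
  obtain ⟨C, h0, h⟩ := h; exact ⟨C, h0, fun j ↦ (hx j).trans (h j)⟩
theorem Sub.mul (h : Sub q x) (h' : Sub q y) (hy : ∀ j, 0 ≤ y j) : Sub q fun j ↦ x j * y j := by
  obtain ⟨C, h0, h⟩ := h; obtain ⟨D, d0, h'⟩ := h'
  refine ⟨C + D, by positivity, fun j ↦ ?_⟩
  rw [add_mul, exp_add]
  exact mul_le_mul (h j) (h' j) (hy j) (exp_pos _).le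
theorem Sub.cst (hq : 0 ≤ q) (c : ℝ) : Sub q fun _ ↦ c := by
  refine ⟨|c|, abs_nonneg _, fun j ↦ ?_⟩
  have h1 : |c| ≤ |c| * rS j ^ q := le_mul_of_one_le_right (abs_nonneg _) (one_le_rpow (k1 j) hq)
  linarith [add_one_le_exp (|c| * rS j ^ q), le_abs_self c]
theorem Sub.add (hq : 0 ≤ q) (h : Sub q x) (h' : Sub q y) : Sub q fun j ↦ x j + y j := by
  obtain ⟨C, h0, h⟩ := h; obtain ⟨D, d0, h'⟩ := h'
  refine Sub.le (y := fun j ↦ exp (C * rS j ^ q) * (2 * exp (D * rS j ^ q))) (Sub.mul ⟨C, h0, fun j ↦ le_rfl⟩ (Sub.mul (Sub.cst hq 2) ⟨D, d0, fun j ↦ le_rfl⟩ fun j ↦ by positivity) fun j ↦ by positivity) fun j ↦ ?_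
  have h1 : 1 ≤ exp (C * rS j ^ q) := one_le_exp (mul_nonneg h0 (rpow_nonneg (k0 j).le _))
  have h2 : 1 ≤ exp (D * rS j ^ q) := one_le_exp (mul_nonneg d0 (rpow_nonneg (k0 j).le _))
  nlinarith [h j, h' j]
theorem Sub.pow (hq : 0 ≤ q) (h : Sub q x) (hx : ∀ j, 0 ≤ x j) (n : ℕ) : Sub q fun j ↦ x j ^ n := by
  induction n with
  | zero => simpa using Sub.cst hq 1
  | succ n ih => simp only [pow_succ]; exact ih.mul h hx
theorem Sub.rpow (h : Sub q x) (hx : ∀ j, 0 ≤ x j) {r : ℝ} (hr : 0 ≤ r) : Sub q fun j ↦ x j ^ r := by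
  obtain ⟨C, h0, h⟩ := h
  refine ⟨C * r, by positivity, fun j ↦ (rpow_le_rpow (hx j) (h j) hr).trans (le_of_eq ?_)⟩
  rw [← exp_mul]; congr 1; ring
theorem logk {c : ℝ} (hc : 0 < c) (j : ℕ) : lgg sc j ≤ rS j ^ c / c := log_le_rpow_div (k0 j).le hc
theorem Sub.grow (hq : 1 < q) (hx : ∀ j, 0 < x j) {C r : ℝ} (h : ∀ j : ℕ, x sc j ≤ x j * (C * rS j ^ r)) : Sub q x := by
  have hC : 0 < C := by
    have := (hx 1).trans_le (h 0)
    simpa using pos_of_mul_pos_right this (hx 0).le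
  set D := |lgg (x 0)| + |lgg C| + |r| / pd q
  have hq1 : 0 < q - 1 := by linarith
  have hD : 0 ≤ D := by positivity
  refine ⟨D, hD, fun j ↦ ?_⟩
  have key : ∀ j : ℕ, x j ≤ exp (D * (sc j * rS j ^ pd q)) := fun j ↦ by
    induction j with
    | zero =>
      have : lgg (x 0) ≤ D := by
        have := abs_nonneg (lgg C); have : 0 ≤ |r| / pd q := by positivity
        simp only [D]; linarith [le_abs_self (lgg (x 0))]
      rw [← exp_log (hx 0)]; simpa using this
    | succ j ih =>
      have k := k0 j
      have p1 : 1 ≤ rS j ^ pd q := one_le_rpow (k1 j) hq1.le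
      have s1 : C * rS j ^ r ≤ exp (D * rS j ^ pd q) := by
        rw [← exp_log (mul_pos hC (rpow_pos_of_pos k r)), log_mul hC.ne' (rpow_pos_of_pos k r).ne', log_rpow k]
        refine exp_le_exp.2 ?_
        have a1 := logk hq1 j
        have a2 : r * lgg sc j ≤ |r| * (rS j ^ pd q / pd q) :=
          mul_le_mul (le_abs_self r) a1 (log_nonneg (k1 j)) (abs_nonneg r)
        have a3 : lgg C ≤ |lgg C| * rS j ^ pd q := (le_abs_self _).trans (le_mul_of_one_le_right (abs_nonneg _) p1)
        have a4 : 0 ≤ |lgg (x 0)| * rS j ^ pd q := by positivity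
        have : D * rS j ^ pd q = |lgg (x 0)| * rS j ^ pd q + |lgg C| * rS j ^ pd q + |r| * (rS j ^ pd q / pd q) := by
          simp only [D]; ring
        linarith
      refine (h j).trans ((mul_le_mul ih s1 bP (exp_pos _).le).trans ?_)
      rw [← exp_add]
      refine exp_le_exp.2 ?_
      rw [← mul_add]
      refine mul_le_mul_of_nonneg_left ?_ hD
      have m1 : rS j ^ pd q ≤ ((j + 1 : ℕ) + 1 : ℝ) ^ pd q := rpow_le_rpow k.le (by push_cast; linarith) hq1.le
      push_cast at m1 ⊢
      nlinarith
  refine (key j).trans (le_of_eq ?_)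
  congr 2
  nth_rewrite 1 [← rpow_one rS j]
  rw [← rpow_add (k0 j)]; congr 1; ring
theorem Sub.poly (hq : 1 < q) (C r : ℝ) (hC : 0 < C) : Sub q fun j : ℕ ↦ C * rS j ^ r := by
  have h1 : Sub q fun j : ℕ ↦ C * rS j ^ |r| := by
    refine Sub.grow (C := 2 ^ |r|) (r := 0) hq (fun j ↦ mul_pos hC (rpow_pos_of_pos (k0 j) _)) fun j ↦ ?_
    rw [rpow_zero, mul_one, mul_assoc, ← mul_rpow (k0 j).le bN]
    refine mul_le_mul_of_nonneg_left (rpow_le_rpow bP ?_ (abs_nonneg r)) hC.le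
    push_cast; linarith [k1 j]
  exact h1.le fun j ↦ mul_le_mul_of_nonneg_left (rpow_le_rpow_of_exponent_le (k1 j) (le_abs_self r)) hC.le
theorem Sub.LL (hq : 0 ≤ q) (h : Sub q x) : ∃ C, 0 < C ∧ ∀ j : ℕ, LL (x j) ≤ C * rS j ^ q ∨ x j < 0 := by
  obtain ⟨C, h0, h⟩ := h
  refine ⟨C + 2, by positivity, fun j ↦ ?_⟩
  rcases lt_or_ge (x j) 0 with hx | hx
  · exact .inr hx
  left
  have p1 : 1 ≤ rS j ^ q := one_le_rpow (k1 j) hq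
  have e1 : 1 ≤ exp (C * rS j ^ q) := one_le_exp bP
  have e2 : ro + 1 ≤ exp 1 := add_one_le_exp 1
  rw [BDP.LL, log_le_iff_le_exp bP]
  have : exp 1 + x j ≤ exp 1 * exp 1 * exp (C * rS j ^ q) := by
    have := h j
    have h3 : exp 1 + 1 ≤ exp 1 * exp 1 := by nlinarith
    nlinarith
  refine this.trans ?_
  rw [← exp_add, ← exp_add]
  exact exp_le_exp.2 (by nlinarith)
theorem rp_bd {L c C k q γ : ℝ} (hk : 1 ≤ k) (hc : 0 < c) (h1 : c * k ≤ L) (h2 : L ≤ C * k ^ q) (hq : 1 ≤ q) :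
    L ^ γ ≤ (c ^ γ + C ^ γ) * k ^ (γ + pd q * |γ|) := by
  have k0 : 0 < k := by linarith
  have L0 : 0 < L := (mul_pos hc k0).trans_le h1
  have C0 : 0 < C := pos_of_mul_pos_left (L0.trans_le h2) bP
  rcases le_total 0 γ with h | h
  · have : L ^ γ ≤ C ^ γ * k ^ (γ + pd q * |γ|) := by
      refine (rpow_le_rpow L0.le h2 h).trans (le_of_eq ?_)
      rw [mul_rpow C0.le bP, ← rpow_mul k0.le, abs_of_nonneg h]; congr 2; ring
    rw [add_mul]; have : 0 ≤ c ^ γ * k ^ (γ + pd q * |γ|) := by positivity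
    linarith
  · have : L ^ γ ≤ c ^ γ * k ^ (γ + pd q * |γ|) := by
      refine (rpow_le_rpow_of_nonpos (mul_pos hc k0) h1 h).trans ?_
      rw [mul_rpow hc.le k0.le]
      refine mul_le_mul_of_nonneg_left (rpow_le_rpow_of_exponent_le hk ?_) bP
      have := mul_nonneg (by linarith : 0 ≤ q - 1) (abs_nonneg γ); linarith
    rw [add_mul]; have : 0 ≤ C ^ γ * k ^ (γ + pd q * |γ|) := by positivity
    linarith
end
noncomputable section
variable {m : ℕ}
theorem step (i : Cp) {A : ℝ} (hA : 16 * rS m ≤ A) : ∃ (ε : ℝ) (N : ℕ) (z : ℕ → E m), 0 < ε ∧ ε ≤ i.b ∧ 1 ≤ N ∧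
    (∀ k < N, |tt (z k)| + ε ≤ i.b ∧ rr (z k) + ε ≤ exp (-(lgg i.Λ / sc m)) / 4) ∧
    (∀ k < N, ∀ l < N, k ≠ l → 4 * ε ≤ nC (z k - z l)) ∧ ε⁻¹ ≤ A * BB i ∧
    N * ε ^ (m + 2) * i.Λ ≤ i.b / A ^ sc m ∧ i.b / (8 * (2 * A) ^ sc m) ≤ N * ε ^ (m + 2) * i.Λ ∧ (A ^ sc m * i.b ^ sc m * i.Λ ≤ 1 → ε = i.b) := by
  have hm : rz ≤ m := by positivity
  have hA0 : 0 < A := by linarith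
  have hb := i.b0
  have hΛ := i.Λ1
  have hΛ0 : 0 < i.Λ := by linarith
  set ρ := exp (-(lgg i.Λ / sc m)) with hρ
  have ρ0 : 0 < ρ := exp_pos _
  have ρp : ρ ^ sc m * i.Λ = 1 := by
    rw [hρ, ← exp_nat_mul]
    nth_rewrite 2 [← exp_log hΛ0]
    rw [← exp_add, exp_eq_one_iff]; push_cast; field_simp; ring
  have ρi : ρ⁻¹ ≤ i.Λ := by
    rw [hρ, exp_neg, inv_inv]
    nth_rewrite 2 [← exp_log hΛ0]
    exact exp_le_exp.2 (div_le_self (log_nonneg hΛ) bL)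
  set ε := min i.b (ρ / A) with hε
  have ε0 : 0 < ε := lt_min hb bP
  have εb : ε ≤ i.b := min_le_left _ _
  have ερ : ε * A ≤ ρ := by rw [← le_div_iff₀ hA0]; exact min_le_right _ _
  have q1 : 1 ≤ i.b / ε := (one_le_div ε0).2 εb
  have q2 : 1 ≤ ρ / (A * ε) := (one_le_div bP).2 bL
  set mv := ⌊(i.b / ε + 3) / 4⌋₊
  set mh := ⌊ρ / (A * ε)⌋₊
  have v1 : 1 ≤ mv := Nat.le_floor (by push_cast; linarith)
  have h1 : 1 ≤ mh := Nat.le_floor (by push_cast; linarith)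
  have v2 : (mv : ℝ) ≤ (i.b / ε + 3) / 4 := Nat.floor_le bL
  have h2 : (mh : ℝ) ≤ ρ / (A * ε) := Nat.floor_le bL
  have v3 : i.b / ε ≤ 8 * mv := by
    have := Nat.lt_floor_add_one ((i.b / ε + 3) / 4)
    have h : ro ≤ mv := by exact_mod_cast v1
    have h' : (i.b / ε + 3) / 4 < (mv : ℝ) + 1 := this
    linarith
  have h3 : ρ / (A * ε) ≤ 2 * mh := by
    have h' : ρ / (A * ε) < (mh : ℝ) + 1 := Nat.lt_floor_add_one _
    have h : ro ≤ mh := by exact_mod_cast h1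
    linarith
  have eb : i.b / ε * ε = i.b := by field_simp
  have eρ : ρ / (A * ε) * ε = ρ / A := by field_simp
  have g1 : 4 * ε * ((mv : ℝ) - 1) + ε ≤ i.b := by nlinarith
  have h2' : (mh : ℝ) * ε ≤ ρ / A := by rw [← eρ]; exact mul_le_mul_of_nonneg_right h2 ε0.le
  have g2 : 4 * ε * sc m * mh ≤ ρ / 4 := by
    have : ρ / A * (16 * sc m) ≤ ρ := by rw [div_mul_eq_mul_div, div_le_iff₀ hA0]; exact mul_le_mul_of_nonneg_left hA ρ0.le
    have := mul_le_mul_of_nonneg_right h2' (by positivity : rz ≤ 16 * sc m)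
    linarith
  obtain ⟨z, z1, z2⟩ := grid (m := m) ε i.b (ρ / 4) mv mh ε0 v1 h1 g1 g2
  have eN : ((mv * mh ^ sc m : ℕ) : ℝ) * ε ^ (m + 2) * i.Λ = (mv * ε) * ((mh * ε) ^ sc m * i.Λ) := by push_cast; rw [mul_pow, pow_succ ε sc m]; ring
  refine ⟨ε, mv * mh ^ sc m, z, ε0, εb, Nat.mul_pos v1 (pow_pos h1 _), z1, z2, ?_, ?_, ?_, fun h ↦ ?_⟩
  · have B1 : i.b⁻¹ ≤ BB i := by unfold BB; linarith
    have B2 : i.Λ ≤ BB i := by unfold BB; have := inv_pos.2 hb; linarith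
    rcases min_choice i.b (ρ / A) with h | h
    · rw [hε, h]; exact B1.trans (le_mul_of_one_le_left (by linarith [inv_pos.2 hb]) bL)
    · rw [hε, h, inv_div, div_eq_mul_inv]; exact mul_le_mul_of_nonneg_left (ρi.trans B2) hA0.le
  · rw [eN]
    have a1 : mv * ε ≤ i.b := by rw [← eb]; exact mul_le_mul_of_nonneg_right bL ε0.le
    have a2 : (mh * ε) ^ sc m * i.Λ ≤ 1 / A ^ sc m := by
      refine (mul_le_mul_of_nonneg_right (pow_le_pow_left₀ bP h2' _) hΛ0.le).trans (le_of_eq ?_)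
      rw [div_pow, div_mul_eq_mul_div, ρp]
    refine (mul_le_mul a1 a2 bP hb.le).trans (le_of_eq ?_); ring
  · rw [eN]
    have a1 : i.b / 8 ≤ mv * ε := by rw [← eb]; have := mul_le_mul_of_nonneg_right v3 ε0.le; linarith
    have a2 : 1 / (2 * A) ^ sc m ≤ (mh * ε) ^ sc m * i.Λ := by
      have : ρ / (2 * A) ≤ mh * ε := by
        have e : ρ / (2 * A) = ρ / A / 2 := by field_simp
        rw [e, ← eρ]; have := mul_le_mul_of_nonneg_right h3 ε0.le; linarith
      refine le_trans (le_of_eq ?_) (mul_le_mul_of_nonneg_right (pow_le_pow_left₀ bP this sc m) hΛ0.le)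
      rw [div_pow, div_mul_eq_mul_div, ρp]
    refine le_trans (le_of_eq ?_) (mul_le_mul a1 a2 bP bP); field_simp
  · refine min_eq_left ((le_div_iff₀ hA0).2 ?_)
    refine le_of_pow_le_pow_left₀ (Nat.succ_ne_zero m) ρ0.le (le_of_mul_le_mul_right ?_ hΛ0)
    rw [ρp]; refine le_trans (le_of_eq ?_) h; rw [Nat.succ_eq_add_one]; ring
structure Par {n M : ℕ} (H : Hier m n M) (p γ μ ν bs A c0 : ℝ) : Prop where
  b : ∀ j : ℕ, (H.i j).b = bs * rS j ^ (-ν)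
  τ : ∀ j : ℕ, (H.i j).τ = 1 / 2 * rS j ^ (-(1 + μ))
  Λ : ∀ j : ℕ, (H.i j).Λ = ((1 - (H.i j).τ) / (H.i j).b) ^ pd p * jR ^ γ
  ε : ∀ j : ℕ, (H.ε j)⁻¹ ≤ A * BB (H.i j)
  t1 : ∀ j : ℕ, c0 ≤ H.N j * H.ε j ^ (m + 2) * ((1 - (H.i j).τ) / (H.i j).b) ^ p
  t2 : ∀ j : ℕ, H.N j * H.ε j ^ (m + 2) * ((1 - (H.i j).τ) / (H.i j).b) ^ p ≤ 1 / 2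
  eb : p < m + 2 → ∀ j, H.ε j = (H.i j).b
theorem kap (γ : ℝ) (j : ℕ) : 2 ^ (-|γ|) ≤ jR ^ γ ∧ jR ^ γ ≤ 2 ^ |γ| := by
  have h1 : 1 ≤ jR := by rw [one_le_div (k0 j)]; push_cast; linarith
  have h2 : jR ≤ 2 := by rw [div_le_iff₀ (k0 j)]; push_cast; linarith [k1 j]
  constructor
  · refine le_trans ?_ (rpow_le_rpow_of_exponent_le h1 (neg_abs_le γ))
    exact rpow_le_rpow_of_nonpos bL h2 bS
  · exact (rpow_le_rpow_of_exponent_le h1 (le_abs_self γ)).trans (rpow_le_rpow bL h2 (abs_nonneg γ))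
theorem pars {n M : ℕ} (cell : ∀ i : Cp, ∃ (cu : E m → ℝ) (cg cs : E m → E m), Cell n M i cu cg cs) {p : ℝ} (hp : 1 < p) (γ : ℝ) {μ ν : ℝ} (hμ : 0 < μ) (hν : 0 < ν) :
    ∃ bs A c0, 0 < bs ∧ bs ≤ 1 / 4 ∧ 0 < A ∧ 0 < c0 ∧ ∀ m0, 0 < m0 → ∀ s0, 0 < s0 → ∃ H : Hier m n M, PA ∧ H.m0 = m0 ∧ H.s0 = s0 := by
  set g : ℝ := 2 ^ |γ| with hg
  have g1 : 1 ≤ g := one_le_rpow bN (abs_nonneg γ)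
  have hm : rz ≤ m := by positivity
  set A : ℝ := 16 * sc m + 2 * g with hA
  have A0 : 0 < A := by linarith
  have ev : ∀ {c : ℝ}, 0 < c → ∀ K, ∀ᶠ t : ℝ in 𝓝[>] 0, K * t ^ c ≤ 1 := fun {c} hc K ↦ by
    have h : Tendsto (fun t : ℝ ↦ K * t ^ c) (𝓝[>] 0) (𝓝 (K * 0 ^ c)) := ((continuousAt_id.rpow_const (.inr hc.le)).tendsto.mono_left nhdsWithin_le_nhds).const_mul K
    rw [zero_rpow hc.ne', mul_zero] at h
    exact (h.eventually (gt_mem_nhds one_pos)).mono fun t ht ↦ ht.le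
  have e2 : ∀ᶠ t : ℝ in 𝓝[>] 0, p < m + 2 → A ^ sc m * g * t ^ mP ≤ 1 := by
    by_cases h : p < m + 2
    · exact (ev bL _).mono fun t ht _ ↦ ht
    · exact .of_forall fun t ht ↦ absurd ht h
  obtain ⟨bs, ⟨⟨hb1, hb2⟩, hb3⟩, hb4⟩ := ((((ev (by linarith : 0 < p - 1) (2 ^ pd p * g)).and e2).and (ev one_pos 4)).and self_mem_nhdsWithin).exists
  rw [rpow_one] at hb3
  have b0 : 0 < bs := hb4
  have b4 : bs ≤ 1 / 4 := by linarith
  set c0 : ℝ := 1 / (16 * (2 * A) ^ sc m * g)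
  refine ⟨bs, A, c0, b0, b4, A0, by positivity, fun m0 hm0 s0 hs0 ↦ ?_⟩
  have kν : ∀ j : ℕ, 0 < rS j ^ (-ν) ∧ rS j ^ (-ν) ≤ 1 := fun j ↦ ⟨rpow_pos_of_pos (k0 j) _, rpow_le_one_of_one_le_of_nonpos (k1 j) bL⟩
  have kμ : ∀ j : ℕ, 0 < rS j ^ (-(1 + μ)) ∧ rS j ^ (-(1 + μ)) ≤ 1 := fun j ↦ ⟨rpow_pos_of_pos (k0 j) _, rpow_le_one_of_one_le_of_nonpos (k1 j) bL⟩
  have ex : ∀ j : ℕ, ∃ i : Cp, i.b = bs * rS j ^ (-ν) ∧ i.τ = 1 / 2 * rS j ^ (-(1 + μ)) ∧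
      i.Λ = (cm i.τ / i.b) ^ pd p * jR ^ γ := fun j ↦ by
    have hbp : 0 < bs * rS j ^ (-ν) := mul_pos b0 (kν j).1
    have hbl : bs * rS j ^ (-ν) ≤ bs := mul_le_of_le_one_right b0.le (kν j).2
    refine ⟨⟨bs * rS j ^ (-ν), 1 / 2 * rS j ^ (-(1 + μ)), ((1 - 1 / 2 * rS j ^ (-(1 + μ))) / (bs * rS j ^ (-ν))) ^ pd p * jR ^ γ,
      hbp, by linarith, by linarith [(kμ j).1], by linarith [(kμ j).2], ?_⟩, rfl, rfl, rfl⟩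
    have x1 : 1 / (2 * bs) ≤ (1 - 1 / 2 * rS j ^ (-(1 + μ))) / (bs * rS j ^ (-ν)) := by
      rw [div_le_div_iff₀ bP hbp]; nlinarith [(kμ j).2]
    have x2 : g ≤ (1 / (2 * bs)) ^ pd p := by
      rw [div_rpow zero_le_one bP, one_rpow, le_div_iff₀ bP, mul_rpow bN b0.le]; linarith
    have x3 := x2.trans (rpow_le_rpow bP x1 (by linarith : 0 ≤ p - 1))
    refine le_trans ?_ (mul_le_mul x3 (kap γ j).1 bP bL)
    rw [hg, ← rpow_add bN]; simp
  choose i ib iτ iΛ using ex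
  choose cu cg cs hcell using fun j ↦ cell (i j)
  choose ε N z ε0 ε1 N1 z1 z2 εA t1 t2 te using fun j ↦ step (m := m) (i j) (A := A) bL
  have Xp : ∀ j, 0 < (1 - (i j).τ) / (i j).b := fun j ↦ div_pos (by linarith [(i j).τ1]) (i j).b0
  have rat : ∀ j, N j * ε j ^ (m + 2) * ij1 ^ p = N j * ε j ^ (m + 2) * (i j).Λ * ij1 / jR ^ γ := fun j ↦ by
    have hk : 0 < jR ^ γ := by have := k0 j; positivity
    rw [eq_div_iff hk.ne', iΛ j]
    have : ij1 ^ p = ij1 ^ pd p * ij1 := by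
      rw [← rpow_add_one (Xp j).ne']; congr 1; ring
    rw [this]; ring
  refine ⟨⟨i, cu, cg, cs, hcell, ε, ε0, ε1, N, N1, z, fun j k hk ↦ (z1 j k hk).1, fun j k hk ↦ (z1 j k hk).2, z2, m0, s0, hm0, hs0⟩,
    ⟨ib, iτ, iΛ, εA, fun j ↦ ?_, fun j ↦ ?_, fun hpm j ↦ te j ?_⟩, rfl, rfl⟩
  · change c0 ≤ N j * ε j ^ (m + 2) * ij1 ^ p
    have hk : 0 < jR ^ γ := by have := k0 j; positivity
    rw [rat, le_div_iff₀ hk]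
    have h1 := mul_le_mul_of_nonneg_right (t2 j) (Xp j).le
    have hb := (i j).b0
    have e : (i j).b / (8 * (2 * A) ^ sc m) * ij1 = (1 - (i j).τ) * (1 / (8 * (2 * A) ^ sc m)) := by field_simp
    have h2 : c0 * jR ^ γ ≤ c0 * g := mul_le_mul_of_nonneg_left (kap γ j).2 bP
    have e2 : c0 * g = 1 / 2 * (1 / (8 * (2 * A) ^ sc m)) := by simp only [c0]; field_simp; norm_num
    have h3 : 1 / 2 * (1 / (8 * (2 * A) ^ sc m)) ≤ (1 - (i j).τ) * (1 / (8 * (2 * A) ^ sc m)) := mul_le_mul_of_nonneg_right (by linarith [(i j).τ1]) bP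
    linarith
  · change N j * ε j ^ (m + 2) * ij1 ^ p ≤ 1 / 2
    have hk : 0 < jR ^ γ := by have := k0 j; positivity
    rw [rat, div_le_iff₀ hk]
    refine (mul_le_mul_of_nonneg_right (t1 j) (Xp j).le).trans ?_
    have hb := (i j).b0
    have e : (i j).b / A ^ sc m * ij1 = (1 - (i j).τ) / A ^ sc m := by field_simp
    have hAm : A ≤ A ^ sc m := le_self_pow₀ bL (Nat.succ_ne_zero m)
    have h1 : (1 - (i j).τ) / A ^ sc m ≤ 1 / (2 * g) := div_le_div₀ zero_le_one (by linarith [(i j).τ0]) bP bL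
    have h2 : 1 / (2 * g) = 1 / 2 * 2 ^ (-|γ|) := by rw [hg, rpow_neg bN]; field_simp
    rw [e]; linarith [(kap γ j).1]
  · have hb := (i j).b0
    have hbl : (i j).b ≤ bs := by rw [ib]; exact mul_le_of_le_one_right b0.le (kν j).2
    have x1 : ij1 ^ pd p ≤ (1 / (i j).b) ^ pd p := rpow_le_rpow (Xp j).le (div_le_div_of_nonneg_right (by linarith [(i j).τ0]) hb.le) bL
    have x2 : (i j).Λ ≤ (1 / (i j).b) ^ pd p * g := by rw [iΛ]; exact mul_le_mul x1 (kap γ j).2 (by have := k0 j; positivity) bP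
    have x3 : (i j).b ^ sc m * (1 / (i j).b) ^ pd p = (i j).b ^ mP := by
      rw [one_div, inv_rpow hb.le, ← rpow_neg hb.le, ← rpow_natCast, ← rpow_add hb]; congr 1; push_cast; ring
    have x4 : (i j).b ^ mP ≤ bs ^ mP := rpow_le_rpow hb.le hbl bL
    calc A ^ sc m * (i j).b ^ sc m * (i j).Λ ≤ A ^ sc m * (i j).b ^ sc m * ((1 / (i j).b) ^ pd p * g) := mul_le_mul_of_nonneg_left x2 bP
      _ = A ^ sc m * g * (i j).b ^ mP := by rw [← x3]; ring
      _ ≤ A ^ sc m * g * bs ^ mP := mul_le_mul_of_nonneg_left x4 bP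
      _ ≤ 1 := hb2 hpm
end
noncomputable section
variable {m n M : ℕ} {H : Hier m n M} {p γ μ ν bs A c0 : ℝ}
namespace Par
open Hier
theorem kp (j : ℕ) (r : ℝ) : 0 < rS j ^ r := rpow_pos_of_pos (k0 j) r
theorem Xp (i : Cp) : 0 < cm i.τ / i.b := div_pos (by linarith [i.τ1]) i.b0
theorem ss_eq (h : PA) {S : ℝ} (hS : Hs0 = S * Hm0 ^ pd p) (j : ℕ) : Hss j = S * Hmm j ^ pd p * rS j ^ γ := by
  induction j with
  | zero => simp [ss, mm, hS]
  | succ j ih =>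
    rw [ss, mm, ih, h.Λ, mul_rpow (mm_pos j).le (Xp _).le, div_rpow bP (k0 j).le]
    have := kp j γ
    field_simp
theorem binv (h : PA) (j : ℕ) : (Hi j).b⁻¹ = bs⁻¹ * rS j ^ ν := by
  rw [h.b, mul_inv, rpow_neg (k0 j).le, inv_inv]
theorem X_le (h : PA) (j : ℕ) : (1 - (Hi j).τ) / (Hi j).b ≤ bs⁻¹ * rS j ^ ν := by
  rw [← h.binv, div_eq_mul_inv]; exact mul_le_of_le_one_left (inv_pos.2 (Hi j).b0).le (by linarith [(Hi j).τ0])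
theorem X_ge (h : PA) (hb : 0 < bs) (hb4 : bs ≤ 1 / 4) (j : ℕ) : 2 * rS j ^ ν ≤ (1 - (Hi j).τ) / (Hi j).b := by
  rw [div_eq_mul_inv, h.binv, ← mul_assoc]
  refine mul_le_mul_of_nonneg_right ?_ (kp j ν).le
  have : 4 ≤ bs⁻¹ := by rw [le_inv_comm₀ bN hb]; linarith
  nlinarith [(Hi j).τ1]
def C1 (p γ bs : ℝ) : ℝ := 2 + bs⁻¹ + 2 * (bs⁻¹ ^ pd p * 2 ^ |γ|)
theorem C1_ge (hb : 0 < bs) : 1 ≤ C1 p γ bs := by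
  have : 0 < bs⁻¹ ^ pd p * 2 ^ |γ| := by positivity
  have := inv_pos.2 hb
  unfold C1; linarith
theorem BB_le (h : PA) (hp : 1 < p) (hν : 0 ≤ ν) (hb : 0 < bs) (j : ℕ) : BB Hij ≤ C1 p γ bs * rS j ^ (ν * p) := by
  have e1 : rS j ^ ν ≤ rS j ^ (ν * p) := rpow_le_rpow_of_exponent_le (k1 j) (by nlinarith)
  have e2 : rS j ^ (ν * pd p) ≤ rS j ^ (ν * p) := rpow_le_rpow_of_exponent_le (k1 j) (by nlinarith)
  have e3 : 1 ≤ rS j ^ (ν * p) := one_le_rpow (k1 j) bP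
  have l1 : (Hi j).Λ ≤ bs⁻¹ ^ pd p * 2 ^ |γ| * rS j ^ (ν * pd p) := by
    rw [h.Λ]
    refine (mul_le_mul (rpow_le_rpow (Xp _).le (h.X_le j) bL) (kap γ j).2 (by have := k0 j; positivity) (by have := kp j ν; positivity)).trans (le_of_eq ?_)
    rw [mul_rpow (inv_pos.2 hb).le (kp j ν).le, ← rpow_mul (k0 j).le]; ring
  have l2 := mul_le_mul_of_nonneg_left e2 (by positivity : 0 ≤ bs⁻¹ ^ pd p * 2 ^ |γ|)
  have l3 := mul_le_mul_of_nonneg_left e1 (inv_pos.2 hb).le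
  unfold BB C1; rw [h.binv]; linarith
theorem W_le (h : PA) (hp : 1 < p) (hν : 0 ≤ ν) (hb : 0 < bs) (j : ℕ) : BB Hij ^ M ≤ C1 p γ bs ^ M * rS j ^ (ν * p * M) := by
  refine (pow_le_pow_left₀ (BB_pos _).le (h.BB_le hp hν hb j) M).trans (le_of_eq ?_)
  rw [mul_pow, rpow_mul (k0 j).le (ν * p), rpow_natCast]
theorem τ_eq (h : PA) (j : ℕ) (r : ℝ) : (Hi j).τ ^ r = hlf ^ r * rS j ^ (-((1 + μ) * r)) := by
  rw [h.τ, mul_rpow bN (kp j _).le, ← rpow_mul (k0 j).le]; ring_nf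
def th (H : Hier m n M) (p : ℝ) (j : ℕ) : ℝ := H.V j * H.mm j ^ p
theorem th_pos (j : ℕ) : 0 < th H p j := mul_pos (V_pos j) (rpow_pos_of_pos (mm_pos j) _)
theorem th_succ (j : ℕ) : th H p sc j = th H p j * (HN j * Hε j ^ (m + 2) * ((1 - (Hi j).τ) / (Hi j).b) ^ p) := by
  unfold th V
  rw [R, P, mm, mul_rpow (mm_pos j).le (Xp _).le]; push_cast; ring
theorem th_le (h : PA) (j : ℕ) : th H p j ≤ th H p 0 * hlf ^ j := by
  induction j with
  | zero => simp
  | succ j ih => rw [th_succ, pow_succ (1 / 2 : ℝ), ← mul_assoc (th H p 0)]; exact mul_le_mul ih (h.t2 j) (by have := H.ε0 j; have := Xp Hij; positivity) (by have := th_pos (H := H) (p := p) 0; positivity)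
theorem th_ge (h : PA) (hc : 0 < c0) (j : ℕ) : th H p 0 * c0 ^ j ≤ th H p j := by
  induction j with
  | zero => simp
  | succ j ih => rw [th_succ, pow_succ c0, ← mul_assoc (th H p 0)]; exact mul_le_mul ih (h.t1 j) hc.le (th_pos j).le
theorem Vh (h : PA) (hp : 1 < p) (j : ℕ) : HV sc j ≤ HV j / 2 := by
  have h1 : th H p sc j ≤ th H p j / 2 := by rw [th_succ]; nlinarith [h.t2 j, th_pos (H := H) (p := p) j]
  unfold th at h1
  have h2 : Hmm j ^ p ≤ Hmm sc j ^ p := rpow_le_rpow (mm_pos j).le (mm_mono j) bL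
  have h3 := rpow_pos_of_pos (mm_pos (H := H) j) p
  have h4 := mul_le_mul_of_nonneg_left h2 (V_pos (H := H) sc j).le
  refine le_of_mul_le_mul_right ?_ h3
  linarith
theorem m_ge (h : PA) (hb : 0 < bs) (hb4 : bs ≤ 1 / 4) (j : ℕ) : Hm0 * (2 ^ j * (j.factorial : ℝ) ^ ν) ≤ Hmm j := by
  induction j with
  | zero => simp [mm]
  | succ j ih =>
    rw [mm, Nat.factorial_succ, Nat.cast_mul, mul_rpow bP bP]
    refine le_trans (le_of_eq ?_) (mul_le_mul ih (h.X_ge hb hb4 j) (by have := kp j ν; positivity) (mm_pos j).le)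
    push_cast; ring
theorem fac1 (hν : 0 ≤ ν) (j : ℕ) : 1 ≤ (j.factorial : ℝ) ^ ν := one_le_rpow (by exact_mod_cast j.factorial_pos) hν
theorem gl_ge (h : PA) (hp : 1 < p) (hν : 0 ≤ ν) (hb : 0 < bs) (hn : 1 ≤ n) (hμ : 0 ≤ μ) (j : ℕ) :
    Hmm j * ((4 * C1 p γ bs ^ M)⁻¹ * rS j ^ (-(2 * (1 + μ) + ν * p * M))) ≤ Hgl j := by
  have n1 : ro + 1 / n ≤ 2 := by have : ro / n ≤ 1 := div_le_one_of_le₀ (by exact_mod_cast hn) bP; linarith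
  have t1 : 1 / 4 * rS j ^ (-(2 * (1 + μ))) ≤ (Hi j).τ ^ nI n := by
    refine le_trans (le_of_eq ?_) (rpow_le_rpow_of_exponent_ge (Hi j).τ0 (by linarith [(Hi j).τ1]) n1)
    rw [h.τ_eq, rpow_two]; norm_num; congr 1; ring
  have t2 : (C1 p γ bs ^ M * rS j ^ (ν * p * M))⁻¹ ≤ (BB Hij ^ M)⁻¹ := inv_anti₀ (pow_pos (BB_pos _) M) (h.W_le hp hν hb j)
  unfold gl; rw [mul_assoc (Hmm j)]
  have := C1_ge (p := p) (γ := γ) hb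
  refine mul_le_mul_of_nonneg_left (le_trans (le_of_eq ?_) (mul_le_mul t1 t2 (by have := kp j (ν * p * M); positivity) (rpow_nonneg (Hi j).τ0.le _))) (mm_pos j).le
  rw [mul_inv, mul_inv, ← rpow_neg (k0 j).le, neg_add, rpow_add (k0 j)]; ring
theorem gl_low (hp : 1 < p) (γ : ℝ) (hν : 0 ≤ ν) (hb : 0 < bs) (hb4 : bs ≤ 1 / 4) (hn : 1 ≤ n) (hμ : 0 ≤ μ) :
    ∃ c, 0 < c ∧ ∀ (H : Hier m n M), PA → ∀ j : ℕ, H.m0 * c * (4 / 3) ^ j ≤ H.gl j := by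
  obtain ⟨C, hC, hk⟩ := poly (2 * (1 + μ) + ν * p * M)
  have hc := C1_ge (p := p) (γ := γ) hb
  refine ⟨(4 * C1 p γ bs ^ M)⁻¹ * C⁻¹, by positivity, fun H h j ↦ le_trans ?_ (h.gl_ge hp hν hb hn hμ j)⟩
  have h1 : H.m0 * 2 ^ j ≤ H.mm j := le_trans (mul_le_mul_of_nonneg_left (le_mul_of_one_le_right bP (fac1 hν j)) H.m0p.le) (h.m_ge hb hb4 j)
  have h2 : (C * (3 / 2) ^ j)⁻¹ ≤ rS j ^ (-(2 * (1 + μ) + ν * p * M)) := by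
    rw [rpow_neg (k0 j).le]; exact inv_anti₀ (kp j _) (hk j)
  refine le_trans (le_of_eq ?_) (mul_le_mul h1 (mul_le_mul_of_nonneg_left h2 bP) bP (mm_pos j).le)
  have : (4 / 3 : ℝ) ^ j = 2 ^ j * ((3 / 2) ^ j)⁻¹ := by rw [← inv_pow, ← mul_pow]; norm_num
  rw [this, mul_inv C]; ring
theorem gu_up (hp : 1 < p) (γ : ℝ) (hν : 0 ≤ ν) (hb : 0 < bs) {m0 : ℝ} (hm : 0 < m0) {q : ℝ} (hq : 1 < q) :
    ∃ C, 0 ≤ C ∧ ∀ (H : Hier m n M), PA → H.m0 = m0 → ∀ j : ℕ, H.gu j ≤ exp (C * rS j ^ q) := by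
  let U : ℕ → ℝ := fun j ↦ Nat.rec m0 (fun j u ↦ u * (bs⁻¹ * rS j ^ ν)) j
  have U0 : ∀ j, 0 < U j := fun j ↦ by
    induction j with
    | zero => exact hm
    | succ j ih => exact mul_pos ih (mul_pos (inv_pos.2 hb) (kp j ν))
  have hU : Sub q U := Sub.grow hq U0 (C := bs⁻¹) (r := ν) fun j ↦ le_rfl
  have hc := C1_ge (p := p) (γ := γ) hb
  obtain ⟨C, hC, h1⟩ := hU.mul (Sub.poly hq (C1 p γ bs ^ M) (ν * p * M) bP) fun j ↦ by have := kp j (ν * p * M); positivity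
  refine ⟨C, hC, fun H h e j ↦ le_trans ?_ (h1 j)⟩
  have hm' : H.mm j ≤ U j := by
    induction j with
    | zero => exact e.le
    | succ j ih => exact mul_le_mul ih (h.X_le j) (Xp _).le (U0 j).le
  exact mul_le_mul hm' (h.W_le hp hν hb j) (pow_pos (BB_pos _) M).le (U0 j).le
end Par
end
noncomputable section
theorem LLb {C q : ℝ} (hC : 0 ≤ C) (hq : 0 ≤ q) : ∃ D, 0 < D ∧ ∀ (j : ℕ) (t : ℝ), 0 ≤ t → t ≤ exp (C * rS j ^ q) → LL t ≤ D * rS j ^ q := by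
  obtain ⟨D, hD, h⟩ := Sub.LL hq (x := fun j : ℕ ↦ exp (C * rS j ^ q)) ⟨C, hC, fun j ↦ le_rfl⟩
  exact ⟨D, hD, fun j t ht h1 ↦ (LL_mono ht h1).trans ((h j).resolve_right (exp_pos _).le.not_gt)⟩
theorem LLl {j : ℕ} {t : ℝ} (h : (4 / 3 : ℝ) ^ j ≤ t) : lgg (4 / 3) / 2 * sc j ≤ LL t := by
  have h0 : rz < (4 / 3) ^ j := by positivity
  have h1 := LL1 (h0.le.trans h)
  have h2 : j * lgg (4 / 3) ≤ LL t := by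
    rw [← log_pow]; exact log_le_log h0 (by linarith [exp_pos 1])
  have h3 : lgg (4 / 3) ≤ 1 := by have := log_le_sub_one_of_pos (by norm_num : rz < 4 / 3); linarith
  linarith
theorem lamlem {p : ℝ} (hp : 1 < p) (β : ℝ) : ∃ c, 0 < c ∧ ∀ l x : ℝ, 1 ≤ l → 0 ≤ x → c * l ^ (pd p / 2) * LL x ^ (-|β|) ≤ l ^ pd p * LL (l * x) ^ (-β) := by
  set η := pd p / (2 * (|β| + 1)) with hη
  have b0 := abs_nonneg β
  have η0 : 0 < η := div_pos bL bP
  set C := (exp 1 + 1) ^ η / η with hC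
  have C0 : 0 < C := by positivity
  refine ⟨(2 * C) ^ (-|β|), by positivity, fun l x hl hx ↦ ?_⟩
  have l0 : 0 < l := by linarith
  have L1 := LL1 l0.le
  have X1 := LL1 hx
  have Y1 := LL1 (mul_nonneg l0.le hx)
  have a1 : LL (l * x) ≤ 2 * (C * l ^ η) * LL x := by
    have e1 := exp_pos 1
    have : LL (l * x) ≤ LL l + LL x := by
      unfold LL; rw [← log_mul bP bP]
      have : ro ≤ exp 1 := one_le_exp zero_le_one
      refine log_le_log bP ?_
      nlinarith [mul_nonneg l0.le hx, mul_nonneg e1.le l0.le, mul_nonneg e1.le hx]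
    have h2 : LL l ≤ C * l ^ η := by
      refine (log_le_rpow_div bP η0).trans ?_
      rw [hC, div_mul_eq_mul_div, ← mul_rpow bP l0.le]
      exact div_le_div_of_nonneg_right (rpow_le_rpow bP (by nlinarith) η0.le) η0.le
    nlinarith
  have a2 : (2 * (C * l ^ η) * LL x) ^ (-|β|) ≤ LL (l * x) ^ (-β) :=
    (rpow_le_rpow_of_nonpos bL a1 bL).trans (rpow_le_rpow_of_exponent_le Y1 (by linarith [le_abs_self β]))
  refine le_trans ?_ (mul_le_mul_of_nonneg_left a2 bP)
  rw [← mul_assoc 2 C, mul_rpow (y := LL x) bP bL, mul_rpow (x := 2 * C) bP bP, ← rpow_mul l0.le]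
  have a3 : l ^ (pd p / 2) ≤ l ^ pd p * l ^ (η * -|β|) := by
    rw [← rpow_add l0]; refine rpow_le_rpow_of_exponent_le hl ?_
    have : η * |β| ≤ pd p / 2 := by rw [hη, div_mul_eq_mul_div, div_le_div_iff₀ bP bN]; nlinarith
    linarith
  have := mul_le_mul_of_nonneg_left a3 (by positivity : 0 ≤ (2 * C) ^ (-|β|) * LL x ^ (-|β|))
  linarith
variable {m n M : ℕ} {H : Hier m n M} {p γ μ ν bs A c0 α β T0 q S δ : ℝ} {Q : ℕ}
namespace Par
open Hier
theorem sumth (h : PA) {f : ℕ → ℝ} (f0 : ∀ j, 0 ≤ f j) (C r : ℝ) (hC : 0 ≤ C) (hf : ∀ j : ℕ, f j ≤ C * rS j ^ r * th H p j) : Summable f := by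
  obtain ⟨D, hD, hk⟩ := poly r
  have t0 := th_pos (H := H) (p := p) 0
  refine Summable.of_nonneg_of_le f0 (fun j ↦ (hf j).trans ?_) ((summable_geometric_of_lt_one bN (by norm_num : (3 / 4 : ℝ) < 1)).mul_left (C * D * th H p 0))
  refine (mul_le_mul (mul_le_mul_of_nonneg_left (hk j) hC) (h.th_le j) (th_pos j).le bP).trans (le_of_eq ?_)
  have : (3 / 4 : ℝ) ^ j = (3 / 2) ^ j * hlf ^ j := by rw [← mul_pow]; norm_num
  rw [this]; ring
theorem Wp (j : ℕ) : 0 < BB Hij ^ M := pow_pos (BB_pos _) M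
theorem guV (hp : 1 < p) (j : ℕ) : Hgu j ^ p * HV j = (BB Hij ^ M) ^ p * th H p j := by
  rw [gu, mul_rpow (mm_pos j).le (Wp j).le, th]; ring
theorem mp (j : ℕ) : Hmm j ^ p = Hmm j ^ pd p * Hmm j := by
  rw [← rpow_add_one (mm_pos j).ne']; congr 1; ring
theorem Wpp (h : PA) (hp : 1 < p) (hν : 0 ≤ ν) (hb : 0 < bs) {r : ℝ} (hr : 0 ≤ r) (j : ℕ) : (BB Hij ^ M) ^ r ≤ (C1 p γ bs ^ M) ^ r * rS j ^ (ν * p * M * r) := by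
  refine (rpow_le_rpow (Wp j).le (h.W_le hp hν hb j) hr).trans (le_of_eq ?_)
  have := C1_ge (p := p) (γ := γ) hb
  rw [mul_rpow bP (kp j _).le, ← rpow_mul (k0 j).le]
theorem c1c2 (h : PA) (hp : 1 < p) (hν : 0 ≤ ν) (hb : 0 < bs) (hS : Hs0 = S * Hm0 ^ pd p) (S0 : 0 < S) :
    (Summable fun j ↦ Hgu j * Hsu j * HV j) ∧ Summable fun j ↦ Hgu j ^ p * HV j := by
  have hc := C1_ge (p := p) (γ := γ) hb
  constructor
  · refine h.sumth (fun j ↦ mul_nonneg (mul_pos (gu_pos j) (su_pos j)).le (V_pos j).le) (S * (C1 p γ bs ^ M) ^ (2 : ℝ)) (γ + ν * p * M * 2) bP fun j ↦ ?_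
    have e : Hgu j * Hsu j * HV j = S * (BB Hij ^ M) ^ (2 : ℝ) * rS j ^ γ * th H p j := by
      rw [gu, su, h.ss_eq hS, th, mp (p := p), rpow_two]; ring
    rw [e, rpow_add (k0 j)]
    refine mul_le_mul_of_nonneg_right ?_ (th_pos j).le
    have := mul_le_mul_of_nonneg_left (h.Wpp hp hν hb zero_le_two j) (mul_pos S0 (kp j γ)).le
    linarith
  · refine h.sumth (fun j ↦ mul_nonneg (rpow_nonneg (gu_pos j).le _) (V_pos j).le) ((C1 p γ bs ^ M) ^ p) (ν * p * M * p) bP fun j ↦ ?_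
    rw [guV hp]; exact mul_le_mul_of_nonneg_right (h.Wpp hp hν hb bL j) (th_pos j).le
theorem gl_le_mm (j : ℕ) : Hgl j ≤ Hmm j := by
  unfold gl; rw [mul_assoc]
  exact mul_le_of_le_one_right (mm_pos j).le (mul_le_one₀ (τpow _) (inv_pos.2 (Wp j)).le (inv_le_one_of_one_le₀ (BB1 _ _)))
theorem lam (h : PA) (hp : 1 < p) (s0 : Sc p (-β) T0 Q) (hT : ∀ j, T0 ≤ Hgl j) {C : ℝ} (hC : 0 ≤ C) (hq : 0 ≤ q)
    (hg : ∀ j : ℕ, Hgu j ≤ exp (C * rS j ^ q)) (hS : Hs0 = S * Hm0 ^ pd p) (S0 : 0 < S) :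
    ∃ l : ℕ → ℝ, (∀ j t, 0 ≤ t → Hss j * t ≤ l j + ff p (-β) t) ∧ Tendsto (fun j ↦ l j * HV j) atTop (𝓝 0) := by
  obtain ⟨D, hD, hL⟩ := LLb hC hq
  obtain ⟨c, hc, hl⟩ := lamlem hp β
  obtain ⟨K, hK1, hK⟩ := ((eventually_ge_atTop ro).and ((_root_.tendsto_rpow_atTop (by linarith : 0 < pd p / 2)).eventually_ge_atTop (S / (c * D ^ (-|β|))))).exists
  rw [div_le_iff₀ bP] at hK
  set r := 2 * (q * |β| + |γ|) / pd p with hr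
  have hp1 : 0 < p - 1 := by linarith
  have r0 : 0 ≤ r := by positivity
  have rr' : r * (pd p / 2) = q * |β| + |γ| := by rw [hr]; field_simp
  have K0 : 0 < K := by linarith
  have l1 : ∀ j : ℕ, 1 ≤ K * rS j ^ r := fun j ↦ by nlinarith [one_le_rpow (k1 j) r0]
  refine ⟨fun j ↦ K * rS j ^ r * Hss j * Hmm j, fun j t ht ↦ ?_, ?_⟩
  · have ml := mm_pos (H := H) j
    have sl := ss_pos (H := H) j
    rcases le_total t (K * rS j ^ r * Hmm j) with h1 | h1
    · have := mul_le_mul_of_nonneg_left h1 sl.le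
      have := ff_nonneg p (-β) ht
      linarith
    · have hm : T0 ≤ Hmm j := (hT j).trans (gl_le_mm j)
      have hm' : Hmm j ≤ K * rS j ^ r * Hmm j := le_mul_of_one_le_left ml.le (l1 j)
      have t0 : 0 < t := by linarith
      have h2 := s0.mono _ (hm.trans hm') _ h1
      have h3 : Hss j ≤ ff pd p (-β) (K * rS j ^ r * Hmm j) := by
        rw [ff, mul_rpow (by linarith [l1 j]) ml.le, h.ss_eq hS]
        have h4 := hl _ _ (l1 j) ml.le
        have h5 : (D * rS j ^ q) ^ (-|β|) ≤ LL (Hmm j) ^ (-|β|) :=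
          rpow_le_rpow_of_nonpos (by linarith [LL1 ml.le]) (hL j _ ml.le ((mm_le j).trans (hg j))) bS
        have h6 : S * rS j ^ γ ≤ c * (K * rS j ^ r) ^ (pd p / 2) * (D * rS j ^ q) ^ (-|β|) := by
          rw [mul_rpow K0.le (kp j r).le, mul_rpow hD.le (kp j q).le, ← rpow_mul (k0 j).le, ← rpow_mul (k0 j).le, rr']
          have e : rS j ^ (q * |β| + |γ|) * rS j ^ (q * -|β|) = rS j ^ |γ| := by rw [← rpow_add (k0 j)]; congr 1; ring
          have := mul_le_mul hK (rpow_le_rpow_of_exponent_le (k1 j) (le_abs_self γ)) (kp j γ).le bP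
          rw [← e] at this; linarith
        have h7 := mul_le_mul_of_nonneg_left h5 (by have := l1 j; positivity : 0 ≤ c * (K * rS j ^ r) ^ (pd p / 2))
        have := mul_le_mul_of_nonneg_left (h6.trans (h7.trans h4)) (rpow_nonneg ml.le pd p)
        linarith
      have : Hss j * t ≤ ff p (-β) t := by rw [ff_succ _ _ t0]; exact mul_le_mul_of_nonneg_right (h3.trans h2) ht
      have : 0 ≤ K * rS j ^ r * Hss j * Hmm j := by have := l1 j; positivity
      linarith
  · refine (h.sumth (fun j ↦ ?_) (K * S) (r + γ) bP fun j ↦ le_of_eq ?_).tendsto_atTop_zero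
    · have := l1 j; have := ss_pos (H := H) j; have := mm_pos (H := H) j; have := V_pos (H := H) j; positivity
    · dsimp only; rw [h.ss_eq hS, th, mp (p := p), rpow_add (k0 j)]; ring
theorem ns (h : PA) (hp : 1 < p) (hν : 0 < ν) (hb : 0 < bs) (hb4 : bs ≤ 1 / 4) (hc : 0 < c0) (hn : 1 ≤ n) (hμ : 0 ≤ μ) {s : ℝ} (hs : p < s) :
    Tendsto (fun j ↦ Hgl j ^ s * HV j) atTop atTop := by
  have hC := C1_ge (p := p) (γ := γ) hb
  set e := 2 * (1 + μ) + ν * p * M with he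
  set κ := (4 * C1 p γ bs ^ M)⁻¹ with hκ
  have κ0 : 0 < κ := by positivity
  obtain ⟨D, hD, hk⟩ := poly (e * s)
  have t0 := th_pos (H := H) (p := p) 0
  have m0 := H.m0p
  have hsp : 0 < ν * (s - p) := mul_pos hν bL
  have h1 := sfac (B := 3 / 2 / c0) bP hsp
  have h2 : Tendsto (fun j : ℕ ↦ ((3 / 2 / c0) ^ j * ((j.factorial : ℝ) ^ (ν * (s - p)))⁻¹)⁻¹) atTop atTop :=
    Tendsto.inv_tendsto_nhdsGT_zero (tendsto_nhdsWithin_iff.2 ⟨h1, .of_forall fun j ↦ by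
      have := fac1 hsp.le j
      exact mem_Ioi.2 bP⟩)
  refine tendsto_atTop_mono (fun j ↦ ?_) (h2.const_mul_atTop (by positivity : 0 < κ ^ s * D⁻¹ * Hm0 ^ (s - p) * th H p 0))
  have g1 := rpow_le_rpow (by have := mm_pos (H := H) j; have := kp j (-e); positivity) (h.gl_ge hp hν.le hb hn hμ j) (by linarith : 0 ≤ s)
  rw [← he, ← hκ, mul_rpow (mm_pos j).le (by have := kp j (-e); positivity), mul_rpow κ0.le (kp j _).le, ← rpow_mul (k0 j).le] at g1
  have g2 : (D * (3 / 2) ^ j)⁻¹ ≤ rS j ^ (-e * s) := by rw [neg_mul, rpow_neg (k0 j).le]; exact inv_anti₀ (kp j _) (hk j)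
  have g3 : Hm0 ^ (s - p) * (j.factorial : ℝ) ^ (ν * (s - p)) ≤ Hmm j ^ (s - p) := by
    rw [rpow_mul bP, ← mul_rpow m0.le bP]
    refine rpow_le_rpow bP (le_trans ?_ (h.m_ge hb hb4 j)) bL
    refine mul_le_mul_of_nonneg_left (le_mul_of_one_le_left bP (one_le_pow₀ bN)) m0.le
  have g4 := h.th_ge hc j
  have mp := rpow_pos_of_pos (mm_pos (H := H) j) (s - p)
  have key : κ ^ s * ((D * (3 / 2) ^ j)⁻¹ * ((Hm0 ^ (s - p) * (j.factorial : ℝ) ^ (ν * (s - p))) * (th H p 0 * c0 ^ j))) ≤ κ ^ s * (rS j ^ (-e * s) * (Hmm j ^ (s - p) * th H p j)) :=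
    mul_le_mul_of_nonneg_left (mul_le_mul g2 (mul_le_mul g3 g4 bP mp.le) bP (kp j _).le) bP
  have e1 : Hmm j ^ s = Hmm j ^ (s - p) * Hmm j ^ p := by rw [← rpow_add (mm_pos j)]; congr 1; ring
  calc _ = κ ^ s * ((D * (3 / 2) ^ j)⁻¹ * ((Hm0 ^ (s - p) * (j.factorial : ℝ) ^ (ν * (s - p))) * (th H p 0 * c0 ^ j))) := by
        rw [div_pow]; have := fac1 hsp.le j; field_simp
    _ ≤ _ := key
    _ = Hmm j ^ s * (κ ^ s * rS j ^ (-e * s)) * HV j := by rw [e1, th]; ring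
    _ ≤ _ := mul_le_mul_of_nonneg_right g1 (V_pos j).le
end Par
end
noncomputable section
variable {m n M : ℕ} {H : Hier m n M} {p γ μ ν bs A c0 α β T0 q S δ D : ℝ} {Q : ℕ}
namespace Par
open Hier
theorem sg (h : PA) (hp : 1 < p) (hν : 0 ≤ ν) (hb : 0 < bs) (s0 : Sc p (-β) T0 Q) (hT : ∀ j, T0 ≤ Hgl j) (hg : ∀ j, (4 / 3 : ℝ) ^ j ≤ Hgl j)
    (hL : ∀ j : ℕ, LL (Hgu j) ≤ D * rS j ^ q) (hq : 1 ≤ q) (hγ : γ = -β + 2 * δ) (hδ : pd q * |β| ≤ δ) (hw : ν * p * M * p ≤ δ)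
    (hS : Hs0 = S * Hm0 ^ pd p) (hD : 0 < D) (hSl : 2 * p * ((C1 p γ bs ^ M) ^ p * ((lgg (4 / 3) / 2) ^ (-β) + D ^ (-β))) ≤ S) (j : ℕ) (t : ℝ) (h1 : Hgl j ≤ t) (h2 : t ≤ Hgu j) :
    hh p (-β) t ≤ Hsl j := by
  have hl : 0 < lgg (4 / 3) := log_pos bN
  have hC := C1_ge (p := p) (γ := γ) hb
  have glu : Hgl j ≤ Hgu j := h1.trans h2
  have ht := (hT j).trans h1
  refine (s0.hi t ht).trans ((mul_le_mul_of_nonneg_left (s0.mono _ ht _ h2) bL).trans ?_)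
  have r1 := rp_bd (γ := -β) (k1 j) bP (LLl ((hg j).trans glu)) (hL j) hq
  rw [abs_neg] at r1
  have r2 := r1.trans (mul_le_mul_of_nonneg_left (rpow_le_rpow_of_exponent_le (k1 j) (by linarith : -β + pd q * |β| ≤ -β + δ)) bP)
  have r3 := (h.Wpp hp hν hb (by linarith : 0 ≤ p) j).trans (mul_le_mul_of_nonneg_left (rpow_le_rpow_of_exponent_le (k1 j) hw) bP)
  have W0 := Wp (H := H) j
  have L0 : 0 < LL (Hgu j) := by linarith [LL1 (gu_pos (H := H) j).le]
  have e : rS j ^ γ = rS j ^ δ * rS j ^ (-β + δ) := by rw [← rpow_add (k0 j), hγ]; congr 1; ring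
  have r4 : 2 * p * ((BB Hij ^ M) ^ p * LL (Hgu j) ^ (-β)) ≤ S * rS j ^ γ := by
    have := mul_le_mul r3 r2 bP (by have := kp j δ; positivity)
    have := mul_le_mul_of_nonneg_left this (by linarith : 0 ≤ 2 * p)
    have := mul_le_mul_of_nonneg_right hSl (kp j γ).le
    rw [e] at this ⊢
    linarith
  have Wpe : (BB Hij ^ M) ^ p = (BB Hij ^ M) ^ pd p * BB Hij ^ M := by rw [← rpow_add_one W0.ne']; congr 1; ring
  rw [sl, ← div_eq_mul_inv, le_div_iff₀ W0, h.ss_eq hS, ff, gu, mul_rpow (mm_pos j).le W0.le]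
  rw [Wpe] at r4
  have := mul_le_mul_of_nonneg_left r4 (rpow_nonneg (mm_pos (H := H) j).le pd p)
  unfold gu at this
  linarith
theorem hA (h : PA) (hp : 1 < p) (hν : 0 ≤ ν) (hb : 0 < bs) (hg : ∀ j, (4 / 3 : ℝ) ^ j ≤ Hgl j) (hL : ∀ j : ℕ, LL (Hgu j) ≤ D * rS j ^ q) (hq : 1 ≤ q)
    (hδ : pd q * |α| ≤ δ) (hw : ν * p * M * p ≤ δ) (hμ : (1 + μ) * ((1 + 1 / n) * pd p) ≤ p) (hS : Hs0 = S * Hm0 ^ pd p) (hD : 0 < D) (S0 : 0 < S) :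
    ∃ K, ∀ j : ℕ, Hsu j / (p / 2 * ff pd p α (Hgl j)) ≤ K * rS j ^ (-(-(γ + 2 * δ + p - α))) := by
  have hl : 0 < lgg (4 / 3) := log_pos bN
  have hC := C1_ge (p := p) (γ := γ) hb
  set r : ℝ := (1 + 1 / n) * pd p with hr
  refine ⟨2 * S / p * ((C1 p γ bs ^ M) ^ p * (hlf ^ (-r) * ((lgg (4 / 3) / 2) ^ (-α) + D ^ (-α)))), fun j ↦ ?_⟩
  have g0 : 0 < Hgl j := lt_of_lt_of_le bP (hg j)
  have glu : Hgl j ≤ Hgu j := (gl_le_mm j).trans (mm_le j)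
  have r1 := rp_bd (γ := -α) (k1 j) bP (LLl (hg j)) ((LL_mono g0.le glu).trans (hL j)) hq
  rw [abs_neg] at r1
  have r2 := r1.trans (mul_le_mul_of_nonneg_left (rpow_le_rpow_of_exponent_le (k1 j) (by linarith : -α + pd q * |α| ≤ -α + δ)) bP)
  have r3 := (h.Wpp hp hν hb (by linarith : 0 ≤ p) j).trans (mul_le_mul_of_nonneg_left (rpow_le_rpow_of_exponent_le (k1 j) hw) bP)
  have τ0 := (Hi j).τ0
  have r4 : (Hi j).τ ^ (-r) ≤ hlf ^ (-r) * rS j ^ p := by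
    rw [h.τ_eq]; exact mul_le_mul_of_nonneg_left (rpow_le_rpow_of_exponent_le (k1 j) bL) bP
  have W0 := Wp (H := H) j
  have m0 := mm_pos (H := H) j
  have L0 : 0 < LL (Hgl j) := by linarith [LL1 g0.le]
  have Wpe : (BB Hij ^ M) ^ p = (BB Hij ^ M) ^ pd p * BB Hij ^ M := by rw [← rpow_add_one W0.ne']; congr 1; ring
  have e1 : Hsu j / (p / 2 * ff pd p α (Hgl j)) = 2 * S / p * (rS j ^ γ * ((BB Hij ^ M) ^ p * ((Hi j).τ ^ (-r) * LL (Hgl j) ^ (-α)))) := by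
    have eg : Hgl j ^ pd p = Hmm j ^ pd p * (Hi j).τ ^ r * ((BB Hij ^ M) ^ pd p)⁻¹ := by
      rw [gl, mul_rpow bP bP, mul_rpow bP bP, ← rpow_mul τ0.le, inv_rpow W0.le]
    rw [su, h.ss_eq hS, ff, eg, Wpe, rpow_neg τ0.le, rpow_neg L0.le]
    have a1 := rpow_pos_of_pos m0 pd p
    have a2 := rpow_pos_of_pos τ0 r
    have a3 := rpow_pos_of_pos W0 pd p
    have a4 := rpow_pos_of_pos L0 α
    generalize Hmm j ^ pd p = x1 at *
    generalize (Hi j).τ ^ r = x2 at *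
    generalize (BB Hij ^ M) ^ pd p = x3 at *
    generalize LL (Hgl j) ^ α = x4 at *
    field_simp
  have e2 : rS j ^ (-(-(γ + 2 * δ + p - α))) = rS j ^ γ * (rS j ^ δ * (rS j ^ p * rS j ^ (-α + δ))) := by
    rw [← rpow_add (k0 j), ← rpow_add (k0 j), ← rpow_add (k0 j)]; congr 1; ring
  rw [e1, e2, mul_assoc (2 * S / p)]
  refine mul_le_mul_of_nonneg_left ?_ bP
  have kδ := kp j δ
  have kpp := kp j p
  have := mul_le_mul r3 (mul_le_mul r4 r2 bP bP) bP bP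
  have := mul_le_mul_of_nonneg_left this (kp j γ).le
  linarith
theorem hX (h : PA) (hp : 1 < p) (hν : 0 ≤ ν) (hb : 0 < bs) (hb4 : bs ≤ 1 / 4) (hA : 0 < A) (hq : 1 < q) (hS : Hs0 = S * Hm0 ^ pd p) (S0 : 0 < S) :
    ∃ C, 1 ≤ C ∧ ∀ j : ℕ, Hgu j ≤ exp (C * rS j ^ q) ∧ Hsu j ≤ exp (C * rS j ^ q) ∧ Lg (H := H) j ≤ exp (C * rS j ^ q) := by
  have hq0 : 0 ≤ q := by linarith
  have hC := C1_ge (p := p) (γ := γ) hb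
  have mS : Sub q Hmm := Sub.grow hq mm_pos (C := bs⁻¹) (r := ν) fun j ↦ mul_le_mul_of_nonneg_left (h.X_le j) (mm_pos j).le
  have BS : Sub q fun j ↦ BB Hij := (Sub.poly hq _ _ bL).le fun j ↦ h.BB_le hp hν hb j
  have WS := BS.pow hq0 (fun j ↦ (BB_pos _).le) M
  have sS : Sub q Hss := ((((mS.rpow (fun j ↦ (mm_pos j).le) (by linarith : 0 ≤ p - 1)).mul (Sub.poly hq S γ S0)) fun j ↦ by have := kp j γ; positivity)).le fun j ↦ by rw [h.ss_eq hS]; apply le_of_eq; ring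
  have εle : ∀ j : ℕ, (Hε j)⁻¹ ≤ A * C1 p γ bs * rS j ^ (ν * p) := fun j ↦ (h.ε j).trans (by rw [mul_assoc]; exact mul_le_mul_of_nonneg_left (h.BB_le hp hν hb j) hA.le)
  have RS : Sub q fun j ↦ (HR j)⁻¹ := Sub.grow hq (fun j ↦ inv_pos.2 (R_pos j)) fun j ↦ by
    rw [R, mul_inv, mul_comm]; exact mul_le_mul_of_nonneg_left (εle j) (inv_pos.2 (R_pos j)).le
  have PS : Sub q fun j ↦ (HP j : ℝ) := by
    refine Sub.grow hq (fun j ↦ by exact_mod_cast P_pos j) (C := (A * C1 p γ bs) ^ (m + 2)) (r := ν * p * (m + 2 : ℕ)) fun j ↦ ?_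
    rw [P]; push_cast
    refine mul_le_mul_of_nonneg_left ?_ bP
    have ε0 := H.ε0 j
    have x1 : 1 ≤ ((1 - (Hi j).τ) / (Hi j).b) ^ p := one_le_rpow (by have := h.X_ge hb hb4 j; linarith [one_le_rpow (k1 j) hν]) bL
    have x2 : HN j * Hε j ^ (m + 2) ≤ 1 := by
      have := h.t2 j
      have := le_mul_of_one_le_right (by positivity : 0 ≤ HN j * Hε j ^ (m + 2)) x1
      linarith
    have x3 : (HN j : ℝ) ≤ (Hε j)⁻¹ ^ (m + 2) := by rw [inv_pow, ← one_div, le_div_iff₀ bP]; exact x2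
    refine x3.trans ((pow_le_pow_left₀ (inv_pos.2 ε0).le (εle j) _).trans (le_of_eq ?_))
    rw [mul_pow, ← rpow_natCast (rS j ^ (ν * p)), ← rpow_mul (k0 j).le]; push_cast; rfl
  have NS : Sub q fun j ↦ NN Hij := (BS.add hq0 (Sub.poly hq 2 (1 + μ) two_pos)).le fun j ↦ by
    unfold NN; rw [h.τ, mul_inv, ← rpow_neg (k0 j).le, neg_neg]; norm_num
  obtain ⟨C, C0, TS⟩ := PS.mul ((mS.add hq0 sS).mul ((NS.pow hq0 (fun j ↦ (NN_pos _).le) M).mul RS fun j ↦ (inv_pos.2 (R_pos j)).le)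
    fun j ↦ mul_nonneg (pow_pos (NN_pos _) M).le (inv_pos.2 (R_pos j)).le) fun j ↦ mul_nonneg (add_pos (mm_pos j) (ss_pos j)).le (mul_nonneg (pow_pos (NN_pos _) M).le (inv_pos.2 (R_pos j)).le)
  have LS : Sub q fun j ↦ Lg (H := H) j := by
    refine ((Sub.poly hq 1 1 one_pos).mul ⟨C, C0, fun j ↦ le_rfl⟩ fun j ↦ (exp_pos _).le).le fun j ↦ ?_
    rw [one_mul, rpow_one]
    induction j with
    | zero => simp only [Lg]; positivity
    | succ j ih =>
      have mono : exp (C * rS j ^ q) ≤ exp (C * ((j + 1 : ℕ) + 1 : ℝ) ^ q) :=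
        exp_le_exp.2 (mul_le_mul_of_nonneg_left (rpow_le_rpow (k0 j).le (by push_cast; linarith) hq0) C0)
      rw [Lg]
      have := TS j
      have := mul_le_mul_of_nonneg_left mono (k0 j).le
      push_cast at *
      linarith
  obtain ⟨a, a0, ha⟩ := mS.mul WS fun j ↦ (pow_pos (BB_pos _) M).le
  obtain ⟨b, b0, hb⟩ := sS.mul WS fun j ↦ (pow_pos (BB_pos _) M).le
  obtain ⟨c, c0, hc⟩ := LS
  refine ⟨1 + a + b + c, by linarith, fun j ↦ ⟨(ha j).trans ?_, (hb j).trans ?_, (hc j).trans ?_⟩⟩ <;>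
    exact exp_le_exp.2 (mul_le_mul_of_nonneg_right bL (kp j q).le)
theorem mR (h : PA) (hμ : 0 < μ) (hpd : p < m + 2) : ∃ η, 0 < η ∧ ∀ j, η ≤ Hmm j * HR j := by
  have sm : Summable fun j ↦ (Hi j).τ := by
    have := (summable_nat_add_iff (f := fun k : ℕ ↦ (k : ℝ) ^ (-(1 + μ))) 1).2 (summable_nat_rpow.2 (by linarith : -(1 + μ) < -1))
    refine (this.mul_left hlf).congr fun j ↦ ?_
    rw [h.τ]; push_cast; rfl
  have key : ∀ j, Hm0 / 2 * exp (-(2 * ∑ i ∈ Finset.range j, (Hi i).τ)) ≤ Hmm j * HR j := fun j ↦ by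
    induction j with
    | zero => simp [mm, R]; linarith
    | succ j ih =>
      have b0 := (Hi j).b0
      have e : Hmm sc j * HR sc j = Hmm j * HR j * (1 - (Hi j).τ) := by rw [mm, R, h.eb hpd]; field_simp
      have t1 := (Hi j).τ1
      have t0 := (Hi j).τ0
      have e2 : exp (-(2 * (Hi j).τ)) ≤ 1 - (Hi j).τ := by
        rw [exp_neg, inv_le_comm₀ (exp_pos _) bL]
        refine le_trans ?_ (add_one_le_exp _)
        rw [inv_le_iff_one_le_mul₀ bL]; nlinarith
      rw [e, Finset.sum_range_succ, mul_add, neg_add, exp_add, ← mul_assoc]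
      exact mul_le_mul ih e2 (exp_pos _).le (mul_pos (mm_pos j) (R_pos j)).le
  refine ⟨Hm0 / 2 * exp (-(2 * ∑' i, (Hi i).τ)), by have := H.m0p; positivity, fun j ↦ le_trans ?_ (key j)⟩
  have := sm.sum_le_tsum (Finset.range j) fun i _ ↦ (Hi i).τ0.le
  exact mul_le_mul_of_nonneg_left (exp_le_exp.2 bL) (by linarith [H.m0p])
theorem PR (j : ℕ) : HP j * HR j ^ mP * (Hmm j * HR j) ^ p = th H p j := by
  have e : HR j ^ (m + 2) = HR j ^ mP * HR j ^ p := by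
    rw [← rpow_add (R_pos j), ← rpow_natCast]; congr 1; push_cast; ring
  rw [th, V, e, mul_rpow (mm_pos j).le (R_pos j).le]; ring
theorem dim (h : PA) (hp : 1 < p) (hν : 0 < ν) (hb : 0 < bs) (hb4 : bs ≤ 1 / 4) (hc : 0 < c0) (hμ : 0 < μ) (hpd : p < m + 2) :
    dimH HSg = oR mP := by
  obtain ⟨η, η0, hη⟩ := h.mR hμ hpd
  have m0 := H.m0p
  have t0 := th_pos (H := H) (p := p) 0
  refine le_antisymm (dim_le bL (K := th H p 0 / η ^ p) fun j ↦ ?_) ?_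
  · rw [le_div_iff₀ bP]
    have h1 := h.th_le j
    rw [← PR] at h1
    have h2 := mul_le_mul_of_nonneg_left (rpow_le_rpow η0.le (hη j) (by linarith : 0 ≤ p)) (by have := R_pos (H := H) j; positivity : 0 ≤ HP j * HR j ^ mP)
    have h3 : th H p 0 * hlf ^ j ≤ th H p 0 := mul_le_of_le_one_right t0.le (pow_le_one₀ bN bN)
    linarith
  have key : ∀ s, 0 < s → s < (m : ℝ) + 2 - p → oR s ≤ dimH HSg := fun s s0 hs ↦ by
    have hsp : 0 < ν * ((m : ℝ) + 2 - p - s) := mul_pos hν bL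
    obtain ⟨K, hK, hk⟩ := poly (ν * s)
    obtain ⟨B, hB⟩ := (sfac (B := 3 / 2 / c0) bP hsp).bddAbove_range
    refine le_dim s0 (C := B * (K * (bs⁻¹ ^ s * ((Hm0 / 2) ^ p / th H p 0)))) fun j ↦ ?_
    have R0 := R_pos (H := H) j
    have P0 : rz < HP j := by exact_mod_cast P_pos j
    have f1 := fac1 hsp.le j
    have a1 : (3 / 2 : ℝ) ^ j ≤ B * (c0 ^ j * (j.factorial : ℝ) ^ (ν * ((m : ℝ) + 2 - p - s))) := by
      have : (3 / 2 / c0) ^ j * ((j.factorial : ℝ) ^ (ν * ((m : ℝ) + 2 - p - s)))⁻¹ ≤ B := hB ⟨j, rfl⟩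
      rw [div_pow, ← div_eq_mul_inv, div_div, div_le_iff₀ bP] at this; exact this
    have a2 : (j.factorial : ℝ) ^ (ν * ((m : ℝ) + 2 - p - s)) ≤ HR j ^ (s - mP) := by
      have : (j.factorial : ℝ) ^ ν ≤ (HR j)⁻¹ := by
        rw [← one_div, le_div_iff₀ R0]
        have h1 := h.m_ge hb hb4 j
        have h2 := mR_le (H := H) j
        have h3 : (j.factorial : ℝ) ^ ν ≤ 2 ^ j * (j.factorial : ℝ) ^ ν := le_mul_of_one_le_left bP (one_le_pow₀ bN)
        have h4 := mul_le_mul_of_nonneg_right ((mul_le_mul_of_nonneg_left h3 m0.le).trans h1) R0.le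
        nlinarith
      rw [rpow_mul bP]
      refine (rpow_le_rpow bP this bL).trans (le_of_eq ?_)
      rw [inv_rpow R0.le, ← rpow_neg R0.le]; congr 1; ring
    have a3 : th H p 0 * c0 ^ j ≤ HP j * HR j ^ mP * (Hm0 / 2) ^ p := by
      refine (h.th_ge hc j).trans ?_
      rw [← PR]
      exact mul_le_mul_of_nonneg_left (rpow_le_rpow (mul_pos (mm_pos j) R0).le (mR_le j) bL) bP
    have eR : HR j ^ (s - mP) * HR j ^ mP = HR j ^ s := by rw [← rpow_add R0]; congr 1; ring
    have B0 : 0 ≤ B := by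
      by_contra hB0; push Not at hB0
      have : B * (c0 ^ j * (j.factorial : ℝ) ^ (ν * ((m : ℝ) + 2 - p - s))) < 0 := mul_neg_of_neg_of_pos hB0 bP
      have : rz < (3 / 2) ^ j := by positivity
      linarith
    have b1 : HR sc j ^ s = (bs⁻¹ ^ s * rS j ^ (ν * s))⁻¹ * HR j ^ s := by
      rw [R, h.eb hpd, mul_rpow (Hi j).b0.le R0.le, ← inv_inv (Hi j).b, h.binv, inv_rpow (by have := kp j ν; positivity), mul_rpow bP (kp j ν).le, ← rpow_mul (k0 j).le]
    have kk := kp j (ν * s)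
    have bb : 0 < bs⁻¹ ^ s := by positivity
    have mm0 : 0 < (Hm0 / 2) ^ p := by positivity
    have fin : rS j ^ (ν * s) ≤ B * K * ((Hm0 / 2) ^ p / th H p 0) * (HP j * HR j ^ s) := by
      have c2 := mul_le_mul a3 a2 bP bP
      have c3 : c0 ^ j * (j.factorial : ℝ) ^ (ν * ((m : ℝ) + 2 - p - s)) ≤ (Hm0 / 2) ^ p / th H p 0 * (HP j * HR j ^ s) := by
        rw [div_mul_eq_mul_div, le_div_iff₀ t0, ← eR]; linarith
      have c4 := (hk j).trans (mul_le_mul_of_nonneg_left (a1.trans (mul_le_mul_of_nonneg_left c3 B0)) hK.le)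
      linarith
    rw [b1, inv_le_iff_one_le_mul₀ P0]
    have e3 : B * (K * (bs⁻¹ ^ s * ((Hm0 / 2) ^ p / th H p 0))) * ((bs⁻¹ ^ s * rS j ^ (ν * s))⁻¹ * HR j ^ s) * HP j = B * K * ((Hm0 / 2) ^ p / th H p 0) * (HP j * HR j ^ s) / rS j ^ (ν * s) := by
      generalize bs⁻¹ ^ s = y at *
      generalize rS j ^ (ν * s) = z at *
      field_simp
    rw [e3, le_div_iff₀ kk, one_mul]; exact fin
  refine le_of_tendsto (((continuous_ofReal.tendsto mP).mono_left (nhdsWithin_le_nhds (s := Iio mP)))) ?_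
  filter_upwards [Ioo_mem_nhdsLT (by linarith : rz < (m : ℝ) + 2 - p)] with s hs
  exact key s hs.1 hs.2
end Par
end
noncomputable section
theorem Sc.monoQ {p γ T0 : ℝ} {Q Q' : ℕ} (h : Sc p γ T0 Q) (hQ : Q ≤ Q') : Sc p γ T0 Q' :=
  ⟨h.T1, h.lo, h.hi, h.tan, h.mono, fun X hX s hs hs2 t ht ht2 ↦ (h.lip X hX s hs hs2 t ht ht2).trans (mul_le_mul_of_nonneg_right (pow_le_pow_right₀ bL hQ) (abs_nonneg _))⟩
theorem main (m : ℕ) (p α β ϰ : ℝ) (hp : 1 < p) (hϰ : 0 ≤ ϰ) (hαβ : p + ϰ < α + β) :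
    ∃ (n M : ℕ) (H : Hier m n M) (T0 : ℝ) (Q : ℕ), GD ∧
      (∃ K, 0 < K ∧ ∀ x y, |H.aw p α β x - H.aw p α β y| ≤ K * lgg (exp 1 + (dist x y)⁻¹) ^ (-ϰ)) ∧
      (p < m + 2 → (∃ η, 0 < η ∧ ∀ j, η ≤ H.mm j * H.R j) ∧ dimH H.Sg = oR mP) := by
  set δ := (α + β - p - ϰ) / 8 with hδ
  have δ0 : 0 < δ := by rw [hδ]; linarith
  set γ := -β + 2 * δ with hγ
  have p1 : 0 < p - 1 := by linarith
  set μ := min 1 (1 / (3 * pd p)) with hμ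
  have μ0 : 0 < μ := lt_min one_pos bP
  have μ1 : μ ≤ 1 := min_le_left _ _
  have μ2 : μ * (3 * pd p) ≤ 1 := by rw [← le_div_iff₀ bP]; exact min_le_right _ _
  obtain ⟨n, hn⟩ := exists_nat_gt (1 / μ)
  have n0 : rz < n := lt_trans bP hn
  have n1 : 1 ≤ n := by exact_mod_cast n0
  have nμ : ro / n ≤ μ := by rw [div_le_iff₀ n0]; rw [div_lt_iff₀ μ0] at hn; linarith
  have hμn : (1 + μ) * ((1 + 1 / n) * pd p) ≤ p := by
    have h1 : (1 + μ) * ((1 + 1 / n) * pd p) ≤ (1 + μ) * ((1 + μ) * pd p) := by gcongr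
    have h2 : μ * μ * pd p ≤ μ * pd p := mul_le_mul_of_nonneg_right (mul_le_of_le_one_left μ0.le μ1) p1.le
    nlinarith
  obtain ⟨M, cell⟩ := cell_ex m n1
  set ν := δ / (p ^ 2 * sc M) with hν
  have ν0 : 0 < ν := by positivity
  have hw : ν * p * M * p ≤ δ := by
    have : ν * (p ^ 2 * sc M) = δ := by rw [hν]; field_simp
    nlinarith [(by positivity : 0 ≤ ν * p ^ 2)]
  set δ' := δ / (1 + |α| + |β| + ϰ) with hδ'
  have den : 0 < 1 + |α| + |β| + ϰ := by positivity
  have δ'0 : 0 < δ' := by positivity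
  have δe : δ' * (1 + |α| + |β| + ϰ) = δ := by rw [hδ']; field_simp
  have dα : δ' * |α| ≤ δ := by rw [← δe]; exact mul_le_mul_of_nonneg_left (by linarith [abs_nonneg β]) δ'0.le
  have dβ : δ' * |β| ≤ δ := by rw [← δe]; exact mul_le_mul_of_nonneg_left (by linarith [abs_nonneg α]) δ'0.le
  have dϰ : δ' * ϰ ≤ δ := by rw [← δe]; exact mul_le_mul_of_nonneg_left (by linarith [abs_nonneg α, abs_nonneg β]) δ'0.le
  obtain ⟨Ta, Qa, ha⟩ := scal hp (-β)
  obtain ⟨Tb, Qb, hb⟩ := scal hp α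
  have s0 : Sc p (-β) (max Ta Tb) (max Qa Qb) := Sc.monoQ (ha.mono' (le_max_left _ _)) (le_max_left _ _)
  have s1 : Sc p α (max Ta Tb) (max Qa Qb) := Sc.monoQ (hb.mono' (le_max_right _ _)) (le_max_right _ _)
  set T0 := max Ta Tb
  have T1 := s0.T1
  obtain ⟨bs, A, c0, b0, b4, A0, c00, ex⟩ := pars cell hp γ μ0 ν0
  obtain ⟨c, c1, hlow⟩ := Par.gl_low (m := m) (n := n) (M := M) (A := A) (c0 := c0) hp γ ν0.le b0 b4 n1 μ0.le
  have m00 : 0 < T0 / c := by positivity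
  have q1 : 1 < 1 + δ' := by linarith
  obtain ⟨C, C0, hup⟩ := Par.gu_up (m := m) (n := n) (M := M) (μ := μ) (A := A) (c0 := c0) hp γ ν0.le b0 m00 q1
  obtain ⟨D, D0, hD⟩ := LLb C0 (by linarith : 0 ≤ 1 + δ')
  have hl : 0 < lgg (4 / 3) := log_pos bN
  have hC1 := Par.C1_ge (p := p) (γ := γ) b0
  set S := 2 * p * ((Par.C1 p γ bs ^ M) ^ p * ((lgg (4 / 3) / 2) ^ (-β) + D ^ (-β))) with hS
  have S0 : 0 < S := by positivity
  obtain ⟨H, h, em, es⟩ := ex (T0 / c) m00 (S * (T0 / c) ^ pd p) bP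
  have hSs : H.s0 = S * H.m0 ^ pd p := by rw [es, em]
  have g1 : ∀ j, T0 * (4 / 3) ^ j ≤ H.gl j := fun j ↦ by
    have := hlow H h j; rw [em, div_mul_cancel₀ _ c1.ne'] at this; exact this
  have gT : ∀ j, T0 ≤ H.gl j := fun j ↦ (le_mul_of_one_le_right bL (one_le_pow₀ bN)).trans (g1 j)
  have g4 : ∀ j, (4 / 3 : ℝ) ^ j ≤ H.gl j := fun j ↦ (le_mul_of_one_le_left bP T1).trans (g1 j)
  have hgu := hup H h em
  have hL : ∀ j : ℕ, LL (H.gu j) ≤ D * rS j ^ (1 + δ') := fun j ↦ hD j _ (Hier.gu_pos j).le (hgu j)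
  have dβ' : (1 + δ' - 1) * |β| ≤ δ := by rw [add_sub_cancel_left]; exact dβ
  have dα' : (1 + δ' - 1) * |α| ≤ δ := by rw [add_sub_cancel_left]; exact dα
  have cc := h.c1c2 hp ν0.le b0 hSs S0
  have g : H.Good p α β T0 (max Qa Qb) := ⟨hp, s0, s1, gT, h.sg hp ν0.le b0 s0 gT g4 hL q1.le hγ dβ' hw hSs D0 le_rfl, cc.1, cc.2, h.Vh hp,
    h.lam hp s0 gT C0 bL hgu hSs S0, fun s hs ↦ h.ns hp ν0 b0 b4 c00 n1 μ0.le hs⟩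
  obtain ⟨K, hK⟩ := h.hA hp ν0.le b0 g4 hL q1.le dα' hw hμn hSs D0 S0
  obtain ⟨C', C'1, hX⟩ := h.hX hp ν0.le b0 b4 A0 q1 hSs S0
  refine ⟨n, M, H, T0, _, g, g.modulus C'1 bL hϰ ?_ hX hK, fun hpd ↦ ⟨h.mR μ0 hpd, h.dim hp ν0 b0 b4 c00 μ0 hpd⟩⟩
  have : 8 * δ = α + β - p - ϰ := by rw [hδ]; ring
  rw [hγ]; nlinarith
end
end BDP
theorem borderline_double_phase_singular_minimizer
    {d : ℕ} (hd : 2 ≤ d) (p α β ϰ : ℝ) (hp : 1 < p) (hϰ : 0 ≤ ϰ)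
    (hαβ : p + ϰ < α + β) :
    ∃ (a : Euc d → ℝ) (u : Euc d → ℝ) (G : Euc d → Euc d →L[ℝ] ℝ),
      (∀ x, 0 ≤ a x) ∧
      (∃ C : ℝ, 0 < C ∧ ∀ x y : Euc d,
        |a x - a y| ≤ C * Real.log (Real.exp 1 + (dist x y)⁻¹) ^ (-ϰ)) ∧
      W11On (Box d) u G ∧
      MemLp (fun x => ‖G x‖) (ENNReal.ofReal p) (volume.restrict (Box d)) ∧
      IsLocalMinimizer (Box d)
        (fun x t => t ^ p * (Real.log (Real.exp 1 + t) ^ (-β) +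
          a x * Real.log (Real.exp 1 + t) ^ α)) u G ∧
      (∀ s : ℝ, p < s →
        ¬ MemLp (fun x => ‖G x‖) (ENNReal.ofReal s) (volume.restrict (Box d))) ∧
      (p < (d : ℝ) → ∃ Sig : Set (Euc d), IsClosed Sig ∧ Sig ⊆ Box d ∧
        (∀ x ∈ Sig, IsNonLebesguePoint u x) ∧
        dimH Sig = ENNReal.ofReal ((d : ℝ) - p)) := by
  obtain ⟨m, rfl⟩ : ∃ m, d = m + 2 := ⟨d - 2, by omega⟩
  obtain ⟨n, M, H, T0, Q, g, hK, hd'⟩ := BDP.main m p α β ϰ hp hϰ hαβ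
  have e : ∀ x, ‖(innerSL ℝ (H.gL x) : Euc (m+2) →L[ℝ] ℝ)‖ = ‖H.gL x‖ :=
    fun x => innerSL_apply_norm (𝕜 := ℝ) _
  refine ⟨H.aw p α β, H.uL, fun x => innerSL ℝ (H.gL x), g.aw0, hK, g.w11, ?_, g.minim, fun s hs => ?_, fun hpd => ?_⟩
  · simp only [e]; exact g.memLp
  · simp only [e]; exact g.notLp hs
  · obtain ⟨⟨η, η0, hη⟩, hdim⟩ := hd' (by push_cast at hpd; linarith)
    exact ⟨H.Sg, BDP.Hier.Sg_closed, BDP.Hier.Sg_box, fun x hx => BDP.Hier.nonLeb g.w11.1 η0 hη hx, by rw [hdim]; push_cast; rfl⟩
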